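/- Let N ∈ {2, 3, 5, 6, 7, 10, 13}. The weakly holomorphic modular form G₂^{(N*)}(τ) = Σ_{n≥-1} ( Σ_{r∈ℤ} t₂^{(N*)}(4n - r²) ) qⁿ of weight 2 on Γ₀(N) is holomorphic at every cusp of Γ₀(N) other than i∞; its only pole is the simple pole (coefficient -2, from n = -1) at the cusp i∞. -/

import Mathlib

open Complex Matrix

noncomputable section

/-- `SL(2, ℝ)`. -/
abbrev SL2R := Matrix.SpecialLinearGroup (Fin 2) ℝ

/-- `q = e^{2πiz}` (also used as `ζ = e^{2πiz}`). -/
def qc (z : ℂ) : ℂ := Complex.exp (2 * Real.pi * Complex.I * z)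

/-- The Dedekind eta function `η(z) = q^{1/24} ∏_{n ≥ 1} (1 - q^n)` (intended for `Im z > 0`). -/
def dedekindEta (z : ℂ) : ℂ :=
  Complex.exp (Real.pi * Complex.I * z / 12) *
    ∏' n : ℕ, (1 - Complex.exp (2 * Real.pi * Complex.I * ((n : ℂ) + 1) * z))

/-- The hauptmodul `j_N` of `Γ₀(N)` for `N ∈ {2, 3, 5, 7, 13, 6, 10}`. -/
def jn (N : ℕ) (z : ℂ) : ℂ :=
  if N = 6 then (dedekindEta (2 * z) * dedekindEta (3 * z) ^ 3 / (dedekindEta z * dedekindEta (6 * z) ^ 3)) ^ 3 - 3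
  else if N = 10 then dedekindEta (2 * z) * dedekindEta (5 * z) ^ 5 / (dedekindEta z * dedekindEta (10 * z) ^ 5) - 1
  else (dedekindEta z / dedekindEta ((N : ℂ) * z)) ^ (24 / (N - 1)) + 24 / ((N : ℂ) - 1)

/-- The hauptmodul `j_N^*` of the Fricke group `Γ₀^*(N)` for `N ∈ {2, 3, 5, 7, 13, 6, 10}`. -/
def jnStar (N : ℕ) (z : ℂ) : ℂ :=
  if N = 6 then
    (dedekindEta z * dedekindEta (3 * z) / (dedekindEta (2 * z) * dedekindEta (6 * z))) ^ 6 + 6 +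
      2 ^ 6 * (dedekindEta (2 * z) * dedekindEta (6 * z) / (dedekindEta z * dedekindEta (3 * z))) ^ 6
  else if N = 10 then
    (dedekindEta z * dedekindEta (5 * z) / (dedekindEta (2 * z) * dedekindEta (10 * z))) ^ 4 + 4 +
      2 ^ 4 * (dedekindEta (2 * z) * dedekindEta (10 * z) / (dedekindEta z * dedekindEta (5 * z))) ^ 4
  else
    (dedekindEta z / dedekindEta ((N : ℂ) * z)) ^ (24 / (N - 1)) + 24 / ((N : ℂ) - 1) +
      (N : ℂ) ^ (12 / (N - 1)) * (dedekindEta ((N : ℂ) * z) / dedekindEta z) ^ (24 / (N - 1))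

/-- `f` has the `q`-expansion `f(τ) = Σ_{n ≥ n₀} (a n) q^n` on the upper half-plane. -/
def HasQExp (f : ℂ → ℂ) (a : ℤ → ℂ) (n₀ : ℤ) : Prop :=
  (∀ n < n₀, a n = 0) ∧
    ∀ τ : ℂ, 0 < τ.im →
      HasSum (fun m : ℕ => a (n₀ + m) * qc τ ^ (n₀ + (m : ℤ))) (f τ)

/-- `Γ₀(N)` viewed as a subgroup of `SL(2, ℝ)`. -/
def Gamma0SL2R (N : ℕ) : Subgroup SL2R :=
  (CongruenceSubgroup.Gamma0 N).map
    (Matrix.SpecialLinearGroup.map (Int.castRingHom ℝ))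

/-- The set of Atkin–Lehner matrices `W_e` of level `N`:
`W_e = e^{-1/2} [[xe, y], [zN, we]]`, `x, y, z, w ∈ ℤ` (determinant `1` being automatic). -/
def atkinLehnerSet (N e : ℕ) : Set SL2R :=
  { g | ∃ x y z w : ℤ,
      g.1 = (Real.sqrt e)⁻¹ • !![(x : ℝ) * e, (y : ℝ); (z : ℝ) * N, (w : ℝ) * e] }

/-- The Fricke group `Γ₀^*(N)`, generated by `Γ₀(N)` and all Atkin–Lehner involutions `W_e`
for `e ∣ N` with `gcd(e, N/e) = 1`. -/
def FrickeGroup (N : ℕ) : Subgroup SL2R :=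
  Subgroup.closure
    ((Gamma0SL2R N : Set SL2R) ∪
      ⋃ e ∈ {e : ℕ | e ∣ N ∧ Nat.Coprime e (N / e)}, atkinLehnerSet N e)

/-- The Gram matrix of the integral binary quadratic form `[a, b, c]`. -/
def formMat (a b c : ℤ) : Matrix (Fin 2) (Fin 2) ℝ :=
  !![(a : ℝ), (b : ℝ) / 2; (b : ℝ) / 2, (c : ℝ)]

/-- `𝒬_{d,N}`: positive definite integral binary quadratic forms `[a, b, c]` of
discriminant `-d` with `N ∣ a`. -/
def QdN (d : ℤ) (N : ℕ) : Set (Matrix (Fin 2) (Fin 2) ℝ) :=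
  { M | ∃ a b c : ℤ, M = formMat a b c ∧ 0 < a ∧ b ^ 2 - 4 * a * c = -d ∧ (N : ℤ) ∣ a }

/-- `𝒬_{d,N,h}`: members of `𝒬_{d,N}` with `b ≡ h (mod 2N)`. -/
def QdNh (d : ℤ) (N : ℕ) (h : ℤ) : Set (Matrix (Fin 2) (Fin 2) ℝ) :=
  { M | ∃ a b c : ℤ, M = formMat a b c ∧ 0 < a ∧ b ^ 2 - 4 * a * c = -d ∧ (N : ℤ) ∣ a ∧
      (b : ZMod (2 * N)) = (h : ZMod (2 * N)) }

/-- Orbit relation of the (right) action `Q ↦ Q ∘ g`, i.e. `M ↦ gᵀ M g`, of `Γ ≤ SL(2, ℝ)`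
on a set `S` of Gram matrices of quadratic forms. -/
def formRel (Γ : Subgroup SL2R) (S : Set (Matrix (Fin 2) (Fin 2) ℝ)) (Q Q' : S) : Prop :=
  ∃ g ∈ Γ, Q'.1 = (g.1)ᵀ * Q.1 * g.1

/-- The CM point `α_Q` of a positive definite form (as a point of `ℂ`; it lies in the upper
half-plane): `α_Q = (-b + i √d) / (2a) = (-(b/2) + i √(det M)) / a`. -/
def cmPointC (M : Matrix (Fin 2) (Fin 2) ℝ) : ℂ :=
  ((-(M 0 1) : ℝ) + Complex.I * Real.sqrt M.det) / ((M 0 0 : ℝ) : ℂ)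

/-- The order of the stabilizer of the form `M` in `Γ/{±1}` (the stabilizer in `Γ` contains
`±1` and has twice the cardinality). -/
def stabOrder (Γ : Subgroup SL2R) (M : Matrix (Fin 2) (Fin 2) ℝ) : ℕ :=
  Nat.card { g : SL2R // g ∈ Γ ∧ (g.1)ᵀ * M * g.1 = M } / 2

/-- The modular trace `Σ_{Q ∈ S/Γ} f(α_Q) / |Γ̄_Q|`. -/
def classTrace (Γ : Subgroup SL2R) (f : ℂ → ℂ)
    (S : Set (Matrix (Fin 2) (Fin 2) ℝ)) : ℂ :=
  ∑ᶠ O : Quot (formRel Γ S),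
    f (cmPointC (Quot.out O).1) / (stabOrder Γ (Quot.out O).1 : ℂ)

/-- `t₂^{(N*)}(d)`, where `P` is the polynomial with `φ₂(j_N^*) = P(j_N^*)`;
includes the paper's conventions at nonpositive indices. -/
def t2Star (N : ℕ) (P : Polynomial ℂ) (d : ℤ) : ℂ :=
  if 0 < d then
    classTrace (FrickeGroup N) (fun z => Polynomial.eval (jnStar N z) P) (QdN d N)
  else if d = 0 then (if N = 2 then 5 else if N = 6 ∨ N = 10 then 5 / 2 else 3)
  else if d = -1 then -1
  else if d = -4 then -2
  else 0

/-- `σ₁^{(N)}(x) = Σ_{d ∣ x, N ∤ d} d` for `x ∈ ℤ_{>0}`, `(N-1)/24` at `x = 0`, and `0`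
off `ℤ_{≥0}`. -/
def sigmaN (N : ℕ) (x : ℚ) : ℂ :=
  if x = 0 then ((N : ℂ) - 1) / 24
  else if 0 < x ∧ x.den = 1 then
    ∑ d ∈ (Nat.divisors x.num.toNat).filter (fun d => ¬ N ∣ d), (d : ℂ)
  else 0

/-- `σ₁(x) = Σ_{d ∣ x} d` for `x ∈ ℤ_{>0}` and `0` otherwise. -/
def sigmaQ (x : ℚ) : ℂ :=
  if 0 < x ∧ x.den = 1 then ∑ d ∈ Nat.divisors x.num.toNat, (d : ℂ) else 0

/-- A weakly holomorphic Jacobi form of weight `k` and index `m`. -/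
structure WeakJacobiForm (k : ℤ) (m : ℕ) where
  toFun : ℂ → ℂ → ℂ
  holo : DifferentiableOn ℂ (fun p : ℂ × ℂ => toFun p.1 p.2)
      ({τ : ℂ | 0 < τ.im} ×ˢ (Set.univ : Set ℂ))
  slash_inv : ∀ a b c d : ℤ, a * d - b * c = 1 → ∀ τ z : ℂ, 0 < τ.im →
    ((c : ℂ) * τ + d) ^ (-k) *
        Complex.exp (-(2 * Real.pi * Complex.I * m * c * z ^ 2) / ((c : ℂ) * τ + d)) *
        toFun (((a : ℂ) * τ + b) / ((c : ℂ) * τ + d)) (z / ((c : ℂ) * τ + d)) =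
      toFun τ z
  elliptic : ∀ lm mu : ℤ, ∀ τ z : ℂ, 0 < τ.im →
    Complex.exp (2 * Real.pi * Complex.I * m * ((lm : ℂ) ^ 2 * τ + 2 * lm * z)) *
        toFun τ (z + lm * τ + mu) = toFun τ z
  coeff : ℤ → ℤ → ℂ
  coeff_neg_finite : {n : ℤ | n < 0 ∧ ∃ r : ℤ, coeff n r ≠ 0}.Finite
  expansion : ∀ τ z : ℂ, 0 < τ.im →
    HasSum (fun p : ℤ × ℤ => coeff p.1 p.2 * qc τ ^ p.1 * qc z ^ p.2) (toFun τ z)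

/-- Meromorphy of weight `k` at all cusps: at each cusp `γ∞`, the function `F|_k γ` has a
Fourier expansion in fractional powers of `q` with only finitely many negative terms. -/
def MeromAtCusps (k : ℤ) (F : ℂ → ℂ) : Prop :=
  ∀ a b c d : ℤ, a * d - b * c = 1 →
    ∃ (M : ℕ) (cs : ℤ → ℂ) (n₀ : ℤ), 0 < M ∧
      ∀ τ : ℂ, 0 < τ.im →
        HasSum
          (fun j : ℕ => cs (n₀ + j) *
            Complex.exp (2 * Real.pi * Complex.I * τ / M) ^ (n₀ + (j : ℤ)))
          (((c : ℂ) * τ + d) ^ (-k) * F (((a : ℂ) * τ + b) / ((c : ℂ) * τ + d)))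

/-- The Möbius action of an element of `SL(2, ℝ)` on `ℂ`. -/
def moebius (g : SL2R) (z : ℂ) : ℂ :=
  ((g.1 0 0 : ℝ) * z + ((g.1 0 1 : ℝ) : ℂ)) / ((g.1 1 0 : ℝ) * z + ((g.1 1 1 : ℝ) : ℂ))

/-- A weakly holomorphic modular function on `Γ`: holomorphic on the upper half-plane,
`Γ`-invariant, with poles only at the cusps. -/
def IsWeaklyHolModularFn (Γ : Subgroup SL2R) (f : ℂ → ℂ) : Prop :=
  DifferentiableOn ℂ f {z : ℂ | 0 < z.im} ∧
    (∀ g ∈ Γ, ∀ z : ℂ, 0 < z.im → f (moebius g z) = f z) ∧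
    MeromAtCusps 0 f

/-- The set `L_{h, d/4N}` of vectors
`X = [[b + h/2N, c/N], [-a, -(b + h/2N)]]`, `a, b, c ∈ ℤ`, of norm `q(X) = d/4N`. -/
def LhSet (N : ℕ) (h d : ℤ) : Set (Matrix (Fin 2) (Fin 2) ℝ) :=
  { X | ∃ a b c : ℤ,
      X = !![(b : ℝ) + (h : ℝ) / (2 * N), (c : ℝ) / N;
             -(a : ℝ), -((b : ℝ) + (h : ℝ) / (2 * N))] ∧
      (2 * b * N + h) ^ 2 - 4 * a * c * N = -d }

/-- The map `X ↦ N ⬝ [[0,-1],[1,0]] ⬝ X` from vectors to Gram matrices of quadratic forms. -/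
def vecToForm (N : ℕ) (X : Matrix (Fin 2) (Fin 2) ℝ) : Matrix (Fin 2) (Fin 2) ℝ :=
  (N : ℝ) • (!![(0 : ℝ), -1; 1, 0] * X)

/-- Orbit relation of `Γ` acting by conjugation `g.X = g X g⁻¹` on a set `S` of vectors. -/
def vecRel (Γ : Subgroup SL2R) (S : Set (Matrix (Fin 2) (Fin 2) ℝ)) (X X' : S) : Prop :=
  ∃ g ∈ Γ, X'.1 = g.1 * X.1 * (g⁻¹).1

/-- The Heegner point `D_X ∈ ℍ` of a vector `X` of positive norm. -/
def heegnerC (X : Matrix (Fin 2) (Fin 2) ℝ) : ℂ :=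
  ((X 0 0 / X 1 0 : ℝ) : ℂ) + Complex.I * Real.sqrt (X.det / (X 1 0) ^ 2)

/-- The order of the stabilizer of the vector `X` in `Γ/{±1}`. -/
def vecStabOrder (Γ : Subgroup SL2R) (X : Matrix (Fin 2) (Fin 2) ℝ) : ℕ :=
  Nat.card { g : SL2R // g ∈ Γ ∧ g.1 * X * (g⁻¹).1 = X } / 2

/-- The modular trace `t_f(h, m) = Σ_{X ∈ Γ\L_{h,m}} f(D_X) / |Γ̄_X|`. -/
def vecTrace (Γ : Subgroup SL2R) (f : ℂ → ℂ) (S : Set (Matrix (Fin 2) (Fin 2) ℝ)) : ℂ :=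
  ∑ᶠ O : Quot (vecRel Γ S), f (heegnerC (Quot.out O).1) / (vecStabOrder Γ (Quot.out O).1 : ℂ)

/-- The weight-2 Eisenstein series `E₂(z) = 1 - 24 Σ_{n ≥ 1} σ₁(n) qⁿ`. -/
def E2 (z : ℂ) : ℂ :=
  1 - 24 * ∑' n : ℕ, (∑ d ∈ Nat.divisors (n + 1), (d : ℂ)) * qc z ^ (n + 1)

/-- `E₂^{(N)}(z) = N E₂(Nz) - E₂(z)`. -/
def E2N (N : ℕ) (z : ℂ) : ℂ := (N : ℂ) * E2 ((N : ℂ) * z) - E2 z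

end

namespace FrickeTrace

/-- Integral two by two matrices. -/
abbrev IM := Matrix (Fin 2) (Fin 2) ℤ

/-- The automorphy factor. -/
def den (M : IM) (z : ℂ) : ℂ := M 1 0 * z + M 1 1

/-- The Möbius action of an integral matrix. -/
noncomputable def mb (M : IM) (z : ℂ) : ℂ := (M 0 0 * z + M 0 1) / den M z

lemma den_ne_zero {M : IM} (hM : 0 < M.det) {z : ℂ} (hz : 0 < z.im) : den M z ≠ 0 := by
  intro h
  have him : (den M z).im = 0 := by rw [h]; rfl
  have hre : (den M z).re = 0 := by rw [h]; rfl
  simp only [den, add_im, mul_im, intCast_re, intCast_im, zero_mul, add_zero, mul_eq_zero,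
    Int.cast_eq_zero, add_re, mul_re, sub_zero] at him hre
  rw [det_fin_two] at hM
  rcases him with h0 | h0
  · rw [h0] at hre hM
    simp only [Int.cast_zero, zero_mul, zero_add, Int.cast_eq_zero] at hre
    simp [hre] at hM
  · exact hz.ne' h0

lemma im_mb (M : IM) (z : ℂ) :
    (mb M z).im = M.det * z.im / normSq (den M z) := by
  rw [mb, div_im, det_fin_two]
  simp only [den, add_im, mul_im, intCast_re, intCast_im, zero_mul, add_zero, add_re, mul_re,
    sub_zero]
  push_cast
  ring

lemma im_mb_pos {M : IM} (hM : 0 < M.det) {z : ℂ} (hz : 0 < z.im) : 0 < (mb M z).im := by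
  rw [im_mb]
  have := normSq_pos.mpr (den_ne_zero hM hz)
  have h2 : (0 : ℝ) < M.det := by exact_mod_cast hM
  positivity

lemma den_mul (A : IM) {B : IM} {z : ℂ} (hB : den B z ≠ 0) :
    den (A * B) z = den A (mb B z) * den B z := by
  have : mb B z * den B z = B 0 0 * z + B 0 1 := div_mul_cancel₀ _ hB
  rw [den, den, add_mul, mul_assoc, this]
  simp only [Matrix.mul_apply, Fin.sum_univ_two, den]
  push_cast
  ring

lemma mb_mul (A : IM) {B : IM} {z : ℂ} (hB : den B z ≠ 0) :
    mb (A * B) z = mb A (mb B z) := by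
  have : mb B z * den B z = B 0 0 * z + B 0 1 := div_mul_cancel₀ _ hB
  have h2 : ((A * B) 0 0 : ℂ) * z + (A * B) 0 1 = (A 0 0 * mb B z + A 0 1) * den B z := by
    rw [add_mul, mul_assoc, this]
    simp only [Matrix.mul_apply, Fin.sum_univ_two, den]
    push_cast
    ring
  rw [mb, h2, den_mul A hB, mul_div_mul_right _ _ hB]
  rfl

lemma mb_smul {n : ℤ} (hn : n ≠ 0) (M : IM) (z : ℂ) : mb (n • M) z = mb M z := by
  have : (n : ℂ) ≠ 0 := by exact_mod_cast hn
  simp only [mb, den, Matrix.smul_apply, smul_eq_mul, Int.cast_mul]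
  rw [← mul_div_mul_left (c := (n : ℂ)) (M 0 0 * z + M 0 1 : ℂ) _ this]
  ring_nf

lemma den_smul (n : ℤ) (M : IM) (z : ℂ) : den (n • M) z = n * den M z := by
  simp only [den, Matrix.smul_apply, smul_eq_mul, Int.cast_mul]
  ring

@[simp] lemma mb_one (z : ℂ) : mb 1 z = z := by simp [mb, den]

@[simp] lemma den_one (z : ℂ) : den 1 z = 1 := by simp [den]

lemma mb_neg (M : IM) (z : ℂ) : mb (-M) z = mb M z := by
  simpa using mb_smul (n := -1) (by norm_num) M z

lemma hasDerivAt_mb {M : IM} {z : ℂ} (h : den M z ≠ 0) :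
    HasDerivAt (mb M) (M.det / den M z ^ 2) z := by
  have h1 : HasDerivAt (fun z : ℂ => (M 0 0 * z + M 0 1 : ℂ)) (M 0 0) z := by
    simpa using ((hasDerivAt_id z).const_mul (M 0 0 : ℂ)).add_const (M 0 1 : ℂ)
  have h2 : HasDerivAt (fun z : ℂ => (M 1 0 * z + M 1 1 : ℂ)) (M 1 0) z := by
    simpa using ((hasDerivAt_id z).const_mul (M 1 0 : ℂ)).add_const (M 1 1 : ℂ)
  have h3 := h1.div h2 h
  rw [show (M.det / den M z ^ 2 : ℂ) = (M 0 0 * (M 1 0 * z + M 1 1) - (M 0 0 * z + M 0 1) * M 1 0)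
    / (M 1 0 * z + M 1 1) ^ 2 by rw [det_fin_two]; simp only [den]; push_cast; ring]
  exact h3

lemma det_adj (M : IM) : M.adjugate.det = M.det := by
  rw [Matrix.det_adjugate]; simp

lemma mb_adj {M : IM} (hM : 0 < M.det) {z : ℂ} (hz : 0 < z.im) :
    mb M.adjugate (mb M z) = z := by
  rw [← mb_mul _ (den_ne_zero hM hz), adjugate_mul, mb_smul hM.ne', mb_one]

lemma mb_mb_adj {M : IM} (hM : 0 < M.det) {z : ℂ} (hz : 0 < z.im) :
    mb M (mb M.adjugate z) = z := by
  rw [← mb_mul _ (den_ne_zero (by rwa [det_adj]) hz), mul_adjugate, mb_smul hM.ne', mb_one]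

/-- The matrices in `Γ₀(N)`. -/
def G0 (N : ℕ) : Set IM := {M | M.det = 1 ∧ (N : ℤ) ∣ M 1 0}

/-- Boundedness near `i∞`. -/
def BddInf (F : ℂ → ℂ) : Prop := ∃ C A : ℝ, ∀ z : ℂ, A ≤ z.im → ‖F z‖ ≤ C

open UpperHalfPlane in
lemma coe_smul_eq_mb (g : SpecialLinearGroup (Fin 2) ℤ) (z : ℍ) :
    ((g • z : ℍ) : ℂ) = mb g.1 z := by
  rw [UpperHalfPlane.specialLinearGroup_apply]
  simp [mb, den]

open UpperHalfPlane ModularForm CongruenceSubgroup OnePoint in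
open scoped MatrixGroups in
theorem eq_const_of_bddInf {N : ℕ} (hN : N ≠ 0) {F : ℂ → ℂ}
    (hF : DifferentiableOn ℂ F upperHalfPlaneSet)
    (hinv : ∀ M ∈ G0 N, ∀ z : ℂ, 0 < z.im → F (mb M z) = F z)
    (hb : ∀ M : IM, M.det = 1 → BddInf (fun z => F (mb M z))) :
    ∃ c, ∀ z : ℂ, 0 < z.im → F z = c := by
  have : NeZero N := ⟨hN⟩
  let Γ : Subgroup (GL (Fin 2) ℝ) := (Gamma0 N : Subgroup (GL (Fin 2) ℝ))
  let f : ModularForm Γ 0 :=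
    { toFun := fun z => F z
      slash_action_eq' := by
        rintro _ ⟨g, hg, rfl⟩
        ext z
        have := hinv g.1 ⟨g.2, by
          have := (Gamma0_mem).1 hg
          exact (ZMod.intCast_zmod_eq_zero_iff_dvd _ _).1 this⟩ z z.im_pos
        rw [← coe_smul_eq_mb] at this
        rw [← this]
        change (( fun z : ℍ => F z) ∣[(0:ℤ)] g) z = _
        rw [ModularForm.SL_slash_apply]
        simp
      holo' := by
        rw [UpperHalfPlane.mdifferentiable_iff]
        refine hF.congr ?_
        intro z hz
        simp [Function.comp, ofComplex_apply_of_im_pos hz]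
      bdd_at_cusps' := by
        intro c hc
        have hc' : IsCusp c 𝒮ℒ := by
          refine hc.mono ?_
          rintro _ ⟨g, hg, rfl⟩
          exact ⟨g, rfl⟩
        rw [OnePoint.isBoundedAt_iff_forall_SL2Z hc']
        intro g _
        obtain ⟨C, A, h⟩ := hb g.1 g.2
        rw [UpperHalfPlane.isBoundedAtImInfty_iff]
        refine ⟨C, A, fun z hz => ?_⟩
        have : ‖F (mb g.1 z)‖ ≤ C := h z hz
        rw [← coe_smul_eq_mb] at this
        change ‖(( fun z : ℍ => F z) ∣[(0:ℤ)] g) z‖ ≤ C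
        rw [ModularForm.SL_slash_apply]
        simpa using this }
  obtain ⟨c, hc⟩ := ModularForm.eq_const_of_weight_zero f
  exact ⟨c, fun z hz => congrFun hc ⟨z, hz⟩⟩

end FrickeTrace

namespace FrickeTrace

/-- The square of the Dedekind eta function. -/
noncomputable def eta2 (z : ℂ) : ℂ := dedekindEta z ^ 2

lemma dedekindEta_eq_eta (z : ℂ) : dedekindEta z = ModularForm.eta z := by
  simp only [dedekindEta, ModularForm.eta, ModularForm.eta_q_eq_cexp, Function.Periodic.qParam]
  congr 2
  push_cast
  ring

lemma dedekindEta_ne_zero {z : ℂ} (hz : 0 < z.im) : dedekindEta z ≠ 0 := by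
  rw [dedekindEta_eq_eta]; exact ModularForm.eta_ne_zero hz

lemma eta2_ne_zero {z : ℂ} (hz : 0 < z.im) : eta2 z ≠ 0 := pow_ne_zero _ (dedekindEta_ne_zero hz)

lemma differentiableAt_eta2 {z : ℂ} (hz : 0 < z.im) : DifferentiableAt ℂ eta2 z := by
  have : eta2 = fun z => ModularForm.eta z ^ 2 := by ext z; rw [eta2, dedekindEta_eq_eta]
  rw [this]
  exact (ModularForm.differentiableAt_eta_of_mem_upperHalfPlaneSet hz).pow 2

/-- A primitive twelfth root of unity. -/
noncomputable def zt : ℂ := Complex.exp (Real.pi * I / 6)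

lemma zt_ne_zero : zt ≠ 0 := Complex.exp_ne_zero _

lemma zt_pow_three : zt ^ 3 = I := by
  rw [zt, ← Complex.exp_nat_mul, show ((3 : ℕ) : ℂ) * (Real.pi * I / 6) = Real.pi / 2 * I by
    push_cast; ring, exp_pi_div_two_mul_I]

lemma zt_pow_twelve : zt ^ 12 = 1 := by
  rw [show 12 = 3 * 4 by norm_num, pow_mul, zt_pow_three, I_pow_four]

lemma zt_zpow_congr {m n : ℤ} (h : (12 : ℤ) ∣ m - n) : zt ^ m = zt ^ n := by
  obtain ⟨k, hk⟩ := h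
  rw [show m = n + 12 * k by linarith, zpow_add₀ zt_ne_zero, _root_.zpow_mul]
  have : zt ^ (12 : ℤ) = 1 := by exact_mod_cast zt_pow_twelve
  rw [this, _root_.one_zpow, mul_one]

lemma twelve_dvd_of_zmod {x : ℤ} (h4 : (x : ZMod 4) = 0) (h3 : (x : ZMod 3) = 0) :
    (12 : ℤ) ∣ x := by
  have a := (ZMod.intCast_zmod_eq_zero_iff_dvd x 4).1 h4
  have b := (ZMod.intCast_zmod_eq_zero_iff_dvd x 3).1 h3
  push_cast at a b
  omega

lemma eta2_add_one (z : ℂ) : eta2 (z + 1) = zt * eta2 z := by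
  have h1 : ∀ n : ℕ, Complex.exp (2 * Real.pi * I * ((n : ℂ) + 1) * (z + 1)) =
      Complex.exp (2 * Real.pi * I * ((n : ℂ) + 1) * z) := by
    intro n
    rw [mul_add, Complex.exp_add, mul_one,
      show 2 * Real.pi * I * ((n : ℂ) + 1) = ((n + 1 : ℕ) : ℤ) * (2 * Real.pi * I) by
        push_cast; ring, Complex.exp_int_mul_two_pi_mul_I, mul_one]
  simp only [eta2, dedekindEta, h1, zt, mul_pow]
  rw [← mul_assoc]
  congr 1
  simp only [← Complex.exp_nat_mul, ← Complex.exp_add]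
  congr 1
  push_cast
  ring

lemma eta2_neg_inv {z : ℂ} (hz : 0 < z.im) : eta2 (-1 / z) = -I * z * eta2 z := by
  have h := ModularForm.eta_comp_eq_csqrt_I_inv (show z ∈ UpperHalfPlane.upperHalfPlaneSet from hz)
  simp only [Function.comp, Pi.smul_apply, Pi.mul_apply, smul_eq_mul] at h
  have hs : ∀ w : ℂ, Complex.sqrt w ^ 2 = w := by
    intro w
    exact cpow_nat_inv_pow w two_ne_zero
  rw [eta2, eta2, dedekindEta_eq_eta, dedekindEta_eq_eta, h, mul_pow, mul_pow, inv_pow, hs, hs,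
    inv_I]
  ring

/-- The exponent of the eta-squared multiplier system. -/
def psi (M : IM) : ℤ :=
  (1 - M 1 0 ^ 2) * (M 0 1 * M 1 1 + 3 * (M 1 0 - 1) * M 1 1 + M 1 0 + 3) +
    M 1 0 * (M 0 0 + M 1 1 - 3)

lemma psi_T_aux (a b c d : ℤ) (h : a * d - b * c = 1) :
    (12 : ℤ) ∣ psi !![a, a + b; c, c + d] - (psi !![a, b; c, d] + 1) := by
  have key4 : ∀ a b c d : ZMod 4, a * d - b * c = 1 →
      (1 - c ^ 2) * ((a + b) * (c + d) + 3 * (c - 1) * (c + d) + c + 3) + c * (a + (c + d) - 3)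
      - ((1 - c ^ 2) * (b * d + 3 * (c - 1) * d + c + 3) + c * (a + d - 3) + 1) = 0 := by decide
  have key3 : ∀ a b c d : ZMod 3, a * d - b * c = 1 →
      (1 - c ^ 2) * ((a + b) * (c + d) + 3 * (c - 1) * (c + d) + c + 3) + c * (a + (c + d) - 3)
      - ((1 - c ^ 2) * (b * d + 3 * (c - 1) * d + c + 3) + c * (a + d - 3) + 1) = 0 := by decide
  apply twelve_dvd_of_zmod
  · have := key4 a b c d (by exact_mod_cast congrArg (Int.cast : ℤ → ZMod 4) h)
    simpa [psi] using this
  · have := key3 a b c d (by exact_mod_cast congrArg (Int.cast : ℤ → ZMod 3) h)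
    simpa [psi] using this

lemma psi_S_aux (a b c d : ℤ) (h : a * d - b * c = 1) :
    (12 : ℤ) ∣ psi !![b, -a; d, -c] - (psi !![a, b; c, d] - 3) := by
  have key4 : ∀ a b c d : ZMod 4, a * d - b * c = 1 →
      (1 - d ^ 2) * (a * c + -(3 * (d - 1) * c) + d + 3) + d * (b + -c - 3)
      - ((1 - c ^ 2) * (b * d + 3 * (c - 1) * d + c + 3) + c * (a + d - 3) - 3) = 0 := by decide
  have key3 : ∀ a b c d : ZMod 3, a * d - b * c = 1 →
      (1 - d ^ 2) * (a * c + -(3 * (d - 1) * c) + d + 3) + d * (b + -c - 3)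
      - ((1 - c ^ 2) * (b * d + 3 * (c - 1) * d + c + 3) + c * (a + d - 3) - 3) = 0 := by decide
  apply twelve_dvd_of_zmod
  · have := key4 a b c d (by exact_mod_cast congrArg (Int.cast : ℤ → ZMod 4) h)
    simpa [psi] using this
  · have := key3 a b c d (by exact_mod_cast congrArg (Int.cast : ℤ → ZMod 3) h)
    simpa [psi] using this

lemma eta2_S {z : ℂ} (hz : 0 < z.im) : eta2 (mb !![0, -1; 1, 0] z) = zt ^ (-3 : ℤ) * z * eta2 z := by
  have := eta2_neg_inv hz
  have h3 : zt ^ (-3 : ℤ) = -I := by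
    rw [_root_.zpow_neg, show (3 : ℤ) = ((3 : ℕ) : ℤ) by rfl, zpow_natCast, zt_pow_three, inv_I]
  rw [h3, ← this]
  simp [mb, den]

lemma eta2_T (z : ℂ) : eta2 (mb !![1, 1; 0, 1] z) = zt * eta2 z := by
  rw [← eta2_add_one]; simp [mb, den]

/-- The transformation property of `eta2`. -/
def EtaLaw (M : IM) : Prop :=
  ∀ z : ℂ, 0 < z.im → eta2 (mb M z) = zt ^ psi M * den M z * eta2 z

lemma IM_eq (M : IM) : M = !![M 0 0, M 0 1; M 1 0, M 1 1] := Matrix.eta_fin_two M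

lemma etaLaw_mul_T {M : IM} (hM : M.det = 1) : EtaLaw M ↔ EtaLaw (M * !![1, 1; 0, 1]) := by
  have hdet : M 0 0 * M 1 1 - M 0 1 * M 1 0 = 1 := by rw [← hM, det_fin_two]
  have hmul : M * !![1, 1; 0, 1] = !![M 0 0, M 0 0 + M 0 1; M 1 0, M 1 0 + M 1 1] := by
    ext i j; fin_cases i <;> fin_cases j <;> simp [Matrix.mul_apply, Fin.sum_univ_two]
  have hpsi : zt ^ psi (M * !![1, 1; 0, 1]) = zt ^ psi M * zt := by
    rw [← zpow_add_one₀ zt_ne_zero]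
    apply zt_zpow_congr
    have := psi_T_aux _ _ _ _ hdet
    rwa [← hmul, ← IM_eq M] at this
  have hT : (0 : ℤ) < (!![1, 1; 0, 1] : IM).det := by simp
  have key : ∀ z : ℂ, 0 < z.im → (eta2 (mb (M * !![1, 1; 0, 1]) z) =
      zt ^ psi (M * !![1, 1; 0, 1]) * den (M * !![1, 1; 0, 1]) z * eta2 z ↔
      eta2 (mb M (mb !![1, 1; 0, 1] z)) = zt ^ psi M * den M (mb !![1, 1; 0, 1] z) *
        eta2 (mb !![1, 1; 0, 1] z)) := by
    intro z hz
    rw [mb_mul _ (den_ne_zero hT hz), den_mul _ (den_ne_zero hT hz), hpsi, eta2_T]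
    have : den !![1, 1; 0, 1] z = 1 := by simp [den]
    rw [this]
    ring_nf
  constructor
  · intro h z hz
    exact (key z hz).2 (h _ (im_mb_pos hT hz))
  · intro h z hz
    have hz' : 0 < (z - 1).im := by simpa using hz
    have := (key (z - 1) hz').1 (h _ hz')
    rwa [show mb !![1, 1; 0, 1] (z - 1) = z by simp [mb, den]] at this

lemma etaLaw_mul_S {M : IM} (hM : M.det = 1) : EtaLaw M ↔ EtaLaw (M * !![0, -1; 1, 0]) := by
  have hdet : M 0 0 * M 1 1 - M 0 1 * M 1 0 = 1 := by rw [← hM, det_fin_two]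
  have hmul : M * !![0, -1; 1, 0] = !![M 0 1, -M 0 0; M 1 1, -M 1 0] := by
    ext i j; fin_cases i <;> fin_cases j <;> simp [Matrix.mul_apply, Fin.sum_univ_two]
  have hpsi : zt ^ psi (M * !![0, -1; 1, 0]) = zt ^ psi M * zt ^ (-3 : ℤ) := by
    rw [← zpow_add₀ zt_ne_zero]
    apply zt_zpow_congr
    have := psi_S_aux _ _ _ _ hdet
    rwa [← hmul, ← IM_eq M] at this
  have hT : (0 : ℤ) < (!![0, -1; 1, 0] : IM).det := by simp
  have key : ∀ z : ℂ, 0 < z.im → (eta2 (mb (M * !![0, -1; 1, 0]) z) =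
      zt ^ psi (M * !![0, -1; 1, 0]) * den (M * !![0, -1; 1, 0]) z * eta2 z ↔
      eta2 (mb M (mb !![0, -1; 1, 0] z)) = zt ^ psi M * den M (mb !![0, -1; 1, 0] z) *
        eta2 (mb !![0, -1; 1, 0] z)) := by
    intro z hz
    rw [mb_mul _ (den_ne_zero hT hz), den_mul _ (den_ne_zero hT hz), hpsi, eta2_S hz]
    have : den !![0, -1; 1, 0] z = z := by simp [den]
    rw [this]
    ring_nf
  constructor
  · intro h z hz
    exact (key z hz).2 (h _ (im_mb_pos hT hz))
  · intro h z hz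
    have hz' := im_mb_pos hT hz
    have := (key _ hz').1 (h _ hz')
    rwa [← mb_mul _ (den_ne_zero hT hz), show (!![0, -1; 1, 0] * !![0, -1; 1, 0] : IM) = -1 by
      ext i j; fin_cases i <;> fin_cases j <;> simp [Matrix.mul_apply, Fin.sum_univ_two], mb_neg,
      mb_one] at this

/-- The underlying integral matrix of an element of `SL₂(ℤ)`. -/
def sv (g : SpecialLinearGroup (Fin 2) ℤ) : IM := g.1

lemma det_sv (g : SpecialLinearGroup (Fin 2) ℤ) : (sv g).det = 1 := g.2

theorem etaLaw_sv (g : SpecialLinearGroup (Fin 2) ℤ) : EtaLaw (sv g) := by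
  have hone : EtaLaw (sv 1) := by
    change EtaLaw 1
    intro z hz
    have h0 : psi 1 = 0 := by simp [psi]
    simp [h0]
  have hSS : ∀ x : SpecialLinearGroup (Fin 2) ℤ, EtaLaw (sv x) ↔
      EtaLaw (sv (x * ModularGroup.S)) := fun x => etaLaw_mul_S (det_sv x)
  have hTT : ∀ x : SpecialLinearGroup (Fin 2) ℤ, EtaLaw (sv x) ↔
      EtaLaw (sv (x * ModularGroup.T)) := fun x => etaLaw_mul_T (det_sv x)
  have hg : g ∈ Subgroup.closure {ModularGroup.S, ModularGroup.T} := by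
    rw [SpecialLinearGroup.SL2Z_generators]; exact Subgroup.mem_top g
  refine Subgroup.closure_induction_right (p := fun g _ => EtaLaw (sv g)) hone ?_ ?_ hg
  · intro x _ y hy h
    rcases hy with hy | hy
    · rw [hy]; exact (hSS x).1 h
    · rw [Set.mem_singleton_iff.1 hy]; exact (hTT x).1 h
  · intro x _ y hy h
    rcases hy with hy | hy
    · rw [hy, hSS, inv_mul_cancel_right]; exact h
    · rw [Set.mem_singleton_iff.1 hy, hTT, inv_mul_cancel_right]; exact h

theorem etaLaw {M : IM} (hM : M.det = 1) : EtaLaw M := etaLaw_sv ⟨M, hM⟩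

end FrickeTrace

namespace FrickeTrace

/-- The Atkin–Lehner matrices of level `N` and determinant `e`. -/
def AL (N e : ℕ) : Set IM :=
  {M | M.det = e ∧ (e : ℤ) ∣ M 0 0 ∧ (e : ℤ) ∣ M 1 1 ∧ (N : ℤ) ∣ M 1 0}

/-- The composition law of Atkin–Lehner operators. -/
def st (e f : ℕ) : ℕ := e * f / (e.gcd f * e.gcd f)

lemma AL_det_pos {N e : ℕ} (he : e ≠ 0) {A : IM} (hA : A ∈ AL N e) : 0 < A.det := by
  rw [hA.1]; exact_mod_cast Nat.pos_of_ne_zero he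

lemma G0_det_pos {N : ℕ} {A : IM} (hA : A ∈ G0 N) : 0 < A.det := by rw [hA.1]; norm_num

lemma AL_one {N : ℕ} : AL N 1 = G0 N := by
  ext M; simp [AL, G0]

lemma one_mem_G0 (N : ℕ) : (1 : IM) ∈ G0 N := by simp [G0]

lemma G0_mul {N : ℕ} {A B : IM} (hA : A ∈ G0 N) (hB : B ∈ G0 N) : A * B ∈ G0 N := by
  refine ⟨by rw [det_mul, hA.1, hB.1, one_mul], ?_⟩
  rw [Matrix.mul_apply, Fin.sum_univ_two]
  exact dvd_add (hA.2.mul_right _) (hB.2.mul_left _)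

lemma AL_adj {N e : ℕ} {A : IM} (hA : A ∈ AL N e) : A.adjugate ∈ AL N e := by
  obtain ⟨h1, h2, h3, h4⟩ := hA
  refine ⟨by rw [det_adj, h1], ?_, ?_, ?_⟩ <;> rw [adjugate_fin_two]
  · exact h3
  · exact h2
  · simpa using h4

lemma G0_adj {N : ℕ} {A : IM} (hA : A ∈ G0 N) : A.adjugate ∈ G0 N := by
  rw [← AL_one] at *; exact AL_adj hA

lemma G0_mul_adj {N : ℕ} {A : IM} (hA : A ∈ G0 N) : A * A.adjugate = 1 := by
  rw [mul_adjugate, hA.1, one_smul]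

lemma G0_adj_mul {N : ℕ} {A : IM} (hA : A ∈ G0 N) : A.adjugate * A = 1 := by
  rw [adjugate_mul, hA.1, one_smul]

lemma st_mul_gcd {e f : ℕ} (he : e ≠ 0) : st e f * e.gcd f = e.lcm f := by
  have hg : 0 < e.gcd f := Nat.gcd_pos_of_pos_left _ (Nat.pos_of_ne_zero he)
  obtain ⟨a, ha⟩ := Nat.gcd_dvd_left e f
  obtain ⟨b, hb⟩ := Nat.gcd_dvd_right e f
  have h1 : e * f = (e.gcd f * e.gcd f) * (a * b) := by
    nth_rewrite 1 [ha]; nth_rewrite 2 [hb]; ring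
  rw [st, Nat.lcm, h1, Nat.mul_div_cancel_left _ (Nat.mul_pos hg hg), mul_assoc (e.gcd f),
    Nat.mul_div_cancel_left _ hg]
  ring

lemma st_dvd {N e f : ℕ} (he : e ≠ 0) (heN : e ∣ N) (hfN : f ∣ N) : st e f ∣ N :=
  (Dvd.intro _ (st_mul_gcd he)).trans (Nat.lcm_dvd heN hfN)

lemma AL_mul {N e f : ℕ} (he : e ≠ 0) (heN : e ∣ N) (hfN : f ∣ N) {A B : IM} (hA : A ∈ AL N e)
    (hB : B ∈ AL N f) : ∃ C ∈ AL N (st e f), A * B = (e.gcd f : ℤ) • C := by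
  obtain ⟨a1, ⟨x1, a2⟩, ⟨w1, a3⟩, ⟨z1, a4⟩⟩ := hA
  obtain ⟨b1, ⟨x2, b2⟩, ⟨w2, b3⟩, ⟨z2, b4⟩⟩ := hB
  have hg : 0 < e.gcd f := Nat.gcd_pos_of_pos_left _ (Nat.pos_of_ne_zero he)
  have hst := st_mul_gcd (f := f) he
  have hlN : e.lcm f ∣ N := Nat.lcm_dvd heN hfN
  obtain ⟨k, hk⟩ := hlN
  obtain ⟨e', he'⟩ := Nat.gcd_dvd_left e f
  obtain ⟨f', hf'⟩ := Nat.gcd_dvd_right e f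
  have hlcm : e * f = e.gcd f * e.lcm f := (Nat.gcd_mul_lcm e f).symm
  set g := e.gcd f with hgdef
  set s := st e f with hs
  have hNz : (N : ℤ) = s * g * k := by rw [hk, ← hst]; push_cast; ring
  have hefz : (e : ℤ) * f = g * (s * g) := by
    have : e * f = g * (s * g) := by rw [hlcm, hst]
    exact_mod_cast this
  have hez : (e : ℤ) = g * e' := by exact_mod_cast he'
  have hfz : (f : ℤ) = g * f' := by exact_mod_cast hf'
  have hgz : (g : ℤ) ≠ 0 := by exact_mod_cast hg.ne'
  let C : IM := !![s * (g * x1 * x2 + A 0 1 * z2 * k), x1 * e' * B 0 1 + A 0 1 * w2 * f';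
    N * (z1 * x2 * f' + w1 * e' * z2), s * (z1 * k * B 0 1 + g * w1 * w2)]
  have hC : A * B = (g : ℤ) • C := by
    ext i j
    fin_cases i <;> fin_cases j
    · simp only [Fin.zero_eta, Matrix.mul_apply, Fin.sum_univ_two, a2, b2, b4, C]
      simp
      linear_combination (x1 * x2) * hefz + (A 0 1 * z2) * hNz
    · simp only [Fin.zero_eta, Fin.mk_one, Matrix.mul_apply, Fin.sum_univ_two, a2, b3, C]
      simp
      linear_combination (x1 * B 0 1) * hez + (A 0 1 * w2) * hfz
    · simp only [Fin.zero_eta, Fin.mk_one, Matrix.mul_apply, Fin.sum_univ_two, a3, a4, b2, b4, C]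
      simp
      linear_combination (w1 * N * z2) * hez + (N * z1 * x2) * hfz
    · simp only [Fin.mk_one, Matrix.mul_apply, Fin.sum_univ_two, a3, a4, b3, C]
      simp
      linear_combination (w1 * w2) * hefz + (z1 * B 0 1) * hNz
  refine ⟨C, ⟨?_, ?_, ?_, ?_⟩, hC⟩
  · have h1 : (A * B).det = e * f := by rw [det_mul, a1, b1]
    rw [hC, det_smul, Fintype.card_fin, hefz] at h1
    have : (g : ℤ) ^ 2 * C.det = (g : ℤ) ^ 2 * s := by rw [h1]; ring
    exact mul_left_cancel₀ (pow_ne_zero 2 hgz) this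
  · exact ⟨_, rfl⟩
  · exact ⟨_, rfl⟩
  · exact ⟨_, rfl⟩

lemma st_self {e : ℕ} (he : e ≠ 0) : st e e = 1 := by
  rw [st, Nat.gcd_self, Nat.div_self (Nat.mul_pos (Nat.pos_of_ne_zero he) (Nat.pos_of_ne_zero he))]

lemma st_one_left (e : ℕ) : st 1 e = e := by simp [st]

lemma st_one_right (e : ℕ) : st e 1 = e := by simp [st]

lemma G0_mul_AL {N e : ℕ} (heN : e ∣ N) {A B : IM} (hA : A ∈ G0 N)
    (hB : B ∈ AL N e) : A * B ∈ AL N e := by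
  rw [← AL_one] at hA
  obtain ⟨C, hC, h⟩ := AL_mul one_ne_zero (one_dvd N) heN hA hB
  rw [h]
  simpa [st_one_left] using hC

lemma AL_mul_G0 {N e : ℕ} (he : e ≠ 0) (heN : e ∣ N) {A B : IM} (hA : A ∈ AL N e)
    (hB : B ∈ G0 N) : A * B ∈ AL N e := by
  rw [← AL_one] at hB
  obtain ⟨C, hC, h⟩ := AL_mul he heN (one_dvd N) hA hB
  rw [h]
  simpa [st_one_right] using hC

lemma AL_eq_mul {N e : ℕ} (he : e ≠ 0) (heN : e ∣ N) {A B : IM} (hA : A ∈ AL N e)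
    (hB : B ∈ AL N e) : ∃ C ∈ G0 N, A = C * B := by
  obtain ⟨C, hC, h⟩ := AL_mul he heN heN hA (AL_adj hB)
  rw [st_self he, AL_one] at hC
  rw [Nat.gcd_self] at h
  refine ⟨C, hC, ?_⟩
  have h2 : (e : ℤ) • A = (e : ℤ) • (C * B) := by
    rw [← Matrix.smul_mul, ← h, Matrix.mul_assoc, adjugate_mul, hB.1, Matrix.mul_smul,
      Matrix.mul_one]
  have hez : (e : ℤ) ≠ 0 := by exact_mod_cast he
  exact smul_right_injective IM hez h2

lemma AL_nonempty {N e : ℕ} (hN : Squarefree N) (heN : e ∣ N) : ∃ A, A ∈ AL N e := by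
  obtain ⟨f, rfl⟩ := heN
  have hc : e.Coprime f := Nat.coprime_of_squarefree_mul hN
  have hb := Int.isCoprime_iff_gcd_eq_one.2 (show Int.gcd (e : ℤ) f = 1 from hc)
  obtain ⟨a, b, hab⟩ := hb
  refine ⟨!![a * e, -b; ((e * f : ℕ) : ℤ), e], ?_, ?_, ?_, ?_⟩
  · rw [det_fin_two]
    simp
    linear_combination (e : ℤ) * hab
  all_goals simp

lemma exists_AL_of_det_one {N : ℕ} (hN : Squarefree N) {g : IM} (hg : g.det = 1) :
    ∃ e, e ∣ N ∧ ∃ j : ℤ, g * !![(e : ℤ), j; 0, 1] ∈ AL N e ∧ ((N : ℤ) ∣ g 1 0 ↔ e = 1) := by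
  have hN0 : N ≠ 0 := hN.ne_zero
  set c := (g 1 0).natAbs with hc
  set h := N.gcd c with hh
  have hhpos : 0 < h := Nat.gcd_pos_of_pos_left _ (Nat.pos_of_ne_zero hN0)
  obtain ⟨e, he⟩ := Nat.gcd_dvd_left N c
  obtain ⟨k, hk⟩ := Nat.gcd_dvd_right N c
  rw [← hh] at he hk
  have hcop1 : Nat.Coprime e h := by
    apply Nat.coprime_of_squarefree_mul; rwa [mul_comm, ← he]
  have hcop2 : Nat.Coprime e k := by
    have := Nat.coprime_div_gcd_div_gcd (m := N) (n := c) hhpos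
    rwa [← hh, he, hk, Nat.mul_div_cancel_left _ hhpos, Nat.mul_div_cancel_left _ hhpos] at this
  have hcop : Nat.Coprime e c := by rw [hk]; exact Nat.Coprime.mul_right hcop1 hcop2
  have hb : IsCoprime (e : ℤ) (g 1 0) := by
    rw [Int.isCoprime_iff_gcd_eq_one]; exact hcop
  obtain ⟨a, b, hab⟩ := hb
  refine ⟨e, ⟨h, by rw [mul_comm]; exact he⟩, -b * g 1 1, ⟨?_, ?_, ?_, ?_⟩, ?_⟩
  · rw [det_mul, hg, det_fin_two]; simp
  · simp [Matrix.mul_apply, Fin.sum_univ_two]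
  · simp [Matrix.mul_apply, Fin.sum_univ_two]
    exact ⟨a * g 1 1, by linear_combination (-g 1 1) * hab⟩
  · simp [Matrix.mul_apply, Fin.sum_univ_two]
    have : (h : ℤ) ∣ g 1 0 := Int.natCast_dvd.2 ⟨k, hk⟩
    obtain ⟨m, hm⟩ := this
    exact ⟨m, by rw [hm, he]; push_cast; ring⟩
  · rw [Int.natCast_dvd, ← hc]
    constructor
    · intro hd
      have : h = N := Nat.gcd_eq_left hd
      rw [this] at he
      exact Nat.eq_of_mul_eq_mul_left (Nat.pos_of_ne_zero hN0) (by rw [← he, mul_one])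
    · rintro rfl
      rw [he, mul_one]; exact ⟨k, hk⟩

theorem eq_const_of_bddInf_AL {N : ℕ} (hN : Squarefree N) {F : ℂ → ℂ}
    (hF : DifferentiableOn ℂ F UpperHalfPlane.upperHalfPlaneSet)
    (hinv : ∀ M ∈ G0 N, ∀ z : ℂ, 0 < z.im → F (mb M z) = F z)
    (hb : ∀ e, e ∣ N → ∃ M ∈ AL N e, BddInf (fun z => F (mb M z))) :
    ∃ c, ∀ z : ℂ, 0 < z.im → F z = c := by
  refine eq_const_of_bddInf hN.ne_zero hF hinv fun g hg => ?_
  obtain ⟨e, heN, j, hA, -⟩ := exists_AL_of_det_one hN hg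
  have he : e ≠ 0 := fun h => hN.ne_zero (by rw [h] at heN; exact zero_dvd_iff.1 heN)
  have hepos : (0 : ℝ) < e := by exact_mod_cast Nat.pos_of_ne_zero he
  have hec : (e : ℂ) ≠ 0 := by exact_mod_cast he
  obtain ⟨M, hM, C, A, hbd⟩ := hb e heN
  obtain ⟨γ, hγ, hAγ⟩ := AL_eq_mul he heN hA hM
  refine ⟨C, e * max A 1, fun z hz => ?_⟩
  set w : ℂ := (z - j) / e with hw
  have hwim : w.im = z.im / e := by
    rw [hw, show (e : ℂ) = ((e : ℝ) : ℂ) by simp, div_ofReal_im]; simp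
  have hw1 : max A 1 ≤ w.im := by rw [hwim, le_div_iff₀ hepos]; linarith
  have hwpos : 0 < w.im := lt_of_lt_of_le one_pos ((le_max_right _ _).trans hw1)
  have hz' : mb !![(e : ℤ), j; 0, 1] w = z := by
    simp [mb, den, hw]; field_simp; ring
  have hdet : 0 < (!![(e : ℤ), j; 0, 1] : IM).det := by
    rw [det_fin_two]; simpa using Nat.pos_of_ne_zero he
  have : F (mb g z) = F (mb M w) := by
    rw [← hz', ← mb_mul _ (den_ne_zero hdet hwpos), hAγ,
      mb_mul _ (den_ne_zero (AL_det_pos he hM) hwpos),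
      hinv γ hγ _ (im_mb_pos (AL_det_pos he hM) hwpos)]
  show ‖F (mb g z)‖ ≤ C
  rw [this]
  exact hbd w ((le_max_left _ _).trans hw1)

end FrickeTrace

namespace FrickeTrace

/-- The unimodular part of `diag(d, 1) * A` for an Atkin–Lehner matrix `A` of determinant `e`. -/
def gp (A : IM) (d e : ℕ) : IM :=
  !![A 0 0 / e * (d.gcd e : ℤ), A 0 1 * ((d / d.gcd e : ℕ) : ℤ);
    A 1 0 / (d.lcm e : ℤ), A 1 1 / (d.gcd e : ℤ)]

lemma eta2_AL {N d e : ℕ} (hd : d ≠ 0) (he : e ≠ 0) (hdN : d ∣ N) (heN : e ∣ N) {A : IM}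
    (hA : A ∈ AL N e) {z : ℂ} (hz : 0 < z.im) :
    eta2 (d * mb A z) = zt ^ psi (gp A d e) * (den A z / (d.gcd e : ℕ)) * eta2 (st d e * z) := by
  have hdetA := AL_det_pos he hA
  obtain ⟨a1, ⟨x, a2⟩, ⟨w, a3⟩, ⟨zz, a4⟩⟩ := hA
  have hg : 0 < d.gcd e := Nat.gcd_pos_of_pos_left _ (Nat.pos_of_ne_zero hd)
  obtain ⟨k, hk⟩ := Nat.lcm_dvd hdN heN
  obtain ⟨d', hd'⟩ := Nat.gcd_dvd_left d e
  obtain ⟨e', he'⟩ := Nat.gcd_dvd_right d e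
  have hst : st d e = d' * e' := by
    rw [st]
    nth_rewrite 1 [hd']; nth_rewrite 2 [he']
    rw [show d.gcd e * d' * (d.gcd e * e') = (d.gcd e * d.gcd e) * (d' * e') by ring,
      Nat.mul_div_cancel_left _ (Nat.mul_pos hg hg)]
  have hlcm : d.lcm e = d.gcd e * (d' * e') := by
    rw [← st_mul_gcd hd, hst]; ring
  have hlpos : 0 < d.lcm e := Nat.lcm_pos (Nat.pos_of_ne_zero hd) (Nat.pos_of_ne_zero he)
  have hdd : d / d.gcd e = d' := by
    nth_rewrite 1 [hd']; exact Nat.mul_div_cancel_left _ hg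
  set g := d.gcd e with hgdef
  have hez : (e : ℤ) ≠ 0 := by exact_mod_cast he
  have hgz : (g : ℤ) ≠ 0 := by exact_mod_cast hg.ne'
  have hlz : (d.lcm e : ℤ) ≠ 0 := by exact_mod_cast hlpos.ne'
  have hgp : gp A d e = !![x * g, A 0 1 * d'; zz * k, w * e'] := by
    rw [gp, a2, a3, a4, hdd, Int.mul_ediv_cancel_left _ hez, ← hgdef, hk]
    push_cast
    have h1 : (d.lcm e : ℤ) * k * zz / (d.lcm e : ℤ) = zz * k := by
      rw [mul_assoc, Int.mul_ediv_cancel_left _ hlz, mul_comm]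
    have h2 : (e : ℤ) * w / (g : ℤ) = w * e' := by
      rw [show (e : ℤ) = g * e' by exact_mod_cast he', mul_assoc, Int.mul_ediv_cancel_left _ hgz,
        mul_comm]
    rw [h1, h2]
  have hNz : (N : ℤ) = g * (d' * e') * k := by rw [hk, hlcm]; push_cast; ring
  have hez2 : (e : ℤ) = g * e' := by exact_mod_cast he'
  have hdz2 : (d : ℤ) = g * d' := by exact_mod_cast hd'
  have hdet : (gp A d e).det = 1 := by
    rw [hgp, det_fin_two]
    simp
    have : A 0 0 * A 1 1 - A 0 1 * A 1 0 = e := by rw [← a1, det_fin_two]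
    rw [a2, a3, a4, hNz] at this
    apply mul_left_cancel₀ hez
    linear_combination this - (e * x * w + A 0 1 * d' * zz * k) * hez2
  have hst0 : 0 < st d e := by
    have := st_mul_gcd (f := e) hd
    rw [← this] at hlpos
    exact Nat.pos_of_mul_pos_right hlpos
  have hz' : 0 < ((st d e : ℂ) * z).im := by
    have : (0 : ℝ) < st d e := by exact_mod_cast hst0
    simpa using mul_pos this hz
  have hgc : (g : ℂ) ≠ 0 := by exact_mod_cast hg.ne'
  have hden : den (gp A d e) (st d e * z) = den A z / (g : ℕ) := by
    rw [eq_div_iff hgc, hgp, hst, den, den, a3, a4]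
    have h1 : (e : ℂ) = g * e' := by exact_mod_cast hez2
    have h2 : (N : ℂ) = g * (d' * e') * k := by exact_mod_cast hNz
    simp
    rw [h1, h2]
    ring
  have hmb : mb (gp A d e) (st d e * z) = d * mb A z := by
    have hA0 := den_ne_zero hdetA hz
    rw [mb, hden, mb, div_div_eq_mul_div, mul_div_assoc', hgp, hst, a2]
    congr 1
    have h1 : (e : ℂ) = g * e' := by exact_mod_cast hez2
    have h2 : (d : ℂ) = g * d' := by exact_mod_cast hdz2
    simp
    rw [h1, h2]
    ring
  have := etaLaw hdet _ hz'
  rw [hmb, hden] at this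
  exact this

/-- Products of powers of `eta2 (d z)`, `d ∣ N`. -/
noncomputable def etaQ (N : ℕ) (r : ℕ → ℤ) (z : ℂ) : ℂ :=
  ∏ d ∈ N.divisors, eta2 (d * z) ^ r d

/-- The multiplier of `etaQ N r` at the Atkin–Lehner matrix `A`. -/
noncomputable def mult (N e : ℕ) (r : ℕ → ℤ) (A : IM) : ℂ :=
  zt ^ (∑ d ∈ N.divisors, psi (gp A d e) * r d) *
    ∏ d ∈ N.divisors, (((d.gcd e : ℕ) : ℂ) ^ r d)⁻¹

lemma etaQ_AL {N e : ℕ} (hN : N ≠ 0) (heN : e ∣ N) {r : ℕ → ℤ}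
    (hr : ∑ d ∈ N.divisors, r d = 0) {A : IM}
    (hA : A ∈ AL N e) {z : ℂ} (hz : 0 < z.im) :
    etaQ N r (mb A z) = mult N e r A * ∏ d ∈ N.divisors, eta2 (st d e * z) ^ r d := by
  have he : e ≠ 0 := fun h => hN (by rw [h] at heN; exact zero_dvd_iff.1 heN)
  have hden := den_ne_zero (AL_det_pos he hA) hz
  have hprod : ∏ d ∈ N.divisors, den A z ^ r d = 1 := by
    have : ∀ (s : Finset ℕ), ∏ d ∈ s, den A z ^ r d = den A z ^ ∑ d ∈ s, r d := by
      intro s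
      induction s using Finset.induction_on with
      | empty => simp
      | insert a s ha ih => rw [Finset.prod_insert ha, Finset.sum_insert ha, ih, zpow_add₀ hden]
    rw [this, hr, zpow_zero]
  have hzt : zt ^ (∑ d ∈ N.divisors, psi (gp A d e) * r d) =
      ∏ d ∈ N.divisors, zt ^ (psi (gp A d e) * r d) := by
    have : ∀ (s : Finset ℕ), zt ^ (∑ d ∈ s, psi (gp A d e) * r d) =
      ∏ d ∈ s, zt ^ (psi (gp A d e) * r d) := by
      intro s
      induction s using Finset.induction_on with
      | empty => simp
      | insert a s ha ih => rw [Finset.prod_insert ha, Finset.sum_insert ha, ← ih,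
          zpow_add₀ zt_ne_zero]
    exact this _
  rw [← mul_one (mult N e r A * _), ← hprod, etaQ, mult, hzt, ← Finset.prod_mul_distrib,
    ← Finset.prod_mul_distrib, ← Finset.prod_mul_distrib]
  refine Finset.prod_congr rfl fun d hd => ?_
  have hdN := Nat.dvd_of_mem_divisors hd
  have hd0 : d ≠ 0 := (Nat.pos_of_mem_divisors hd).ne'
  rw [eta2_AL hd0 he hdN heN hA hz, mul_zpow, mul_zpow, div_zpow, _root_.zpow_mul]
  field_simp

/-- The Euler product. -/
noncomputable def eul (q : ℂ) : ℂ := ∏' n : ℕ, (1 - q ^ (n + 1))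

lemma differentiableOn_eul : DifferentiableOn ℂ eul (Metric.ball 0 1) :=
  ModularForm.differentiableOn_tprod_one_sub_pow

lemma eul_zero : eul 0 = 1 := by simp [eul]

lemma eul_ne_zero {q : ℂ} (hq : q ∈ Metric.ball (0 : ℂ) 1) : eul q ≠ 0 := by
  by_cases h : q = 0
  · rw [h, eul_zero]; exact one_ne_zero
  · have hq1 : ‖q‖ < 1 := by simpa using hq
    have hz : 0 < (Function.Periodic.invQParam 1 q).im :=
      Function.Periodic.im_invQParam_pos_of_norm_lt_one one_pos hq1 h
    have := ModularForm.eta_tprod_ne_zero (show _ ∈ UpperHalfPlane.upperHalfPlaneSet from hz)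
    simp only [ModularForm.eta_q_eq_pow] at this
    have h2 := Function.Periodic.qParam_right_inv (h := 1) one_ne_zero h
    rw [Function.Periodic.qParam] at h2
    simp only [ofReal_one, div_one] at h2
    rwa [h2] at this

lemma qc_mem_ball {z : ℂ} (hz : 0 < z.im) : qc z ∈ Metric.ball (0 : ℂ) 1 := by
  rw [mem_ball_zero_iff, qc, Complex.norm_exp]
  simp
  positivity

lemma qc_ne_zero (z : ℂ) : qc z ≠ 0 := Complex.exp_ne_zero _

lemma qc_nat_mul (d : ℕ) (z : ℂ) : qc (d * z) = qc z ^ d := by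
  rw [qc, qc, ← Complex.exp_nat_mul]; ring_nf

lemma eta2_eq (d : ℕ) (z : ℂ) :
    eta2 (d * z) = Complex.exp (Real.pi * I * z / 6) ^ d * eul (qc z ^ d) ^ 2 := by
  rw [eta2, dedekindEta, mul_pow, ← qc_nat_mul, ← Complex.exp_nat_mul, ← Complex.exp_nat_mul]
  congr 2
  · push_cast; ring
  · rw [eul]
    congr 1; ext n
    rw [qc, ← Complex.exp_nat_mul]
    push_cast
    ring_nf

/-- The unit part of the `q`-expansion of `∏ eta2 (δ d * z) ^ r d`. -/
noncomputable def unitQ (N : ℕ) (r : ℕ → ℤ) (δ : ℕ → ℕ) (q : ℂ) : ℂ :=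
  ∏ d ∈ N.divisors, (eul (q ^ δ d) ^ 2) ^ r d

lemma pow_mem_ball {q : ℂ} (hq : q ∈ Metric.ball (0 : ℂ) 1) {d : ℕ} (hd : d ≠ 0) :
    q ^ d ∈ Metric.ball (0 : ℂ) 1 := by
  rw [mem_ball_zero_iff] at *
  rw [norm_pow]
  exact pow_lt_one₀ (norm_nonneg _) hq hd

lemma differentiableOn_unitQ {N : ℕ} {r : ℕ → ℤ} {δ : ℕ → ℕ} (hδ : ∀ d ∈ N.divisors, δ d ≠ 0) :
    DifferentiableOn ℂ (unitQ N r δ) (Metric.ball 0 1) := by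
  unfold unitQ
  refine DifferentiableOn.fun_finsetProd fun d hd => ?_
  have h1 : DifferentiableOn ℂ (fun q : ℂ => eul (q ^ δ d)) (Metric.ball 0 1) :=
    differentiableOn_eul.comp (differentiable_pow (δ d)).differentiableOn
      fun q hq => pow_mem_ball hq (hδ d hd)
  refine (h1.pow 2).zpow (Or.inl fun q hq => ?_)
  exact pow_ne_zero _ (eul_ne_zero (pow_mem_ball hq (hδ d hd)))

lemma unitQ_zero {N : ℕ} {r : ℕ → ℤ} {δ : ℕ → ℕ} (hδ : ∀ d ∈ N.divisors, δ d ≠ 0) :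
    unitQ N r δ 0 = 1 := by
  refine Finset.prod_eq_one fun d hd => ?_
  rw [zero_pow (hδ d hd), eul_zero]; simp

lemma prod_eta2_eq {N : ℕ} {r : ℕ → ℤ} {δ : ℕ → ℕ} {m : ℤ}
    (hm : ∑ d ∈ N.divisors, (δ d : ℤ) * r d = 12 * m) (z : ℂ) :
    ∏ d ∈ N.divisors, eta2 (δ d * z) ^ r d = qc z ^ m * unitQ N r δ (qc z) := by
  have h0 : Complex.exp (Real.pi * I * z / 6) ≠ 0 := Complex.exp_ne_zero _
  have : ∀ (s : Finset ℕ), ∏ d ∈ s, Complex.exp (Real.pi * I * z / 6) ^ ((δ d : ℤ) * r d) =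
      Complex.exp (Real.pi * I * z / 6) ^ ∑ d ∈ s, (δ d : ℤ) * r d := by
    intro s
    induction s using Finset.induction_on with
    | empty => simp
    | insert a s ha ih => rw [Finset.prod_insert ha, Finset.sum_insert ha, ih, zpow_add₀ h0]
  have h12 : Complex.exp (Real.pi * I * z / 6) ^ (12 : ℤ) = qc z := by
    rw [show (12 : ℤ) = ((12 : ℕ) : ℤ) by rfl, zpow_natCast, ← Complex.exp_nat_mul, qc]
    congr 1; push_cast; ring
  rw [unitQ, ← h12, ← _root_.zpow_mul, ← hm, ← this, h12, ← Finset.prod_mul_distrib]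
  refine Finset.prod_congr rfl fun d _ => ?_
  rw [eta2_eq, mul_zpow, _root_.zpow_mul, zpow_natCast]

end FrickeTrace

namespace FrickeTrace

open Filter Topology
open UpperHalfPlane (upperHalfPlaneSet)

/-- A Hauptmodul `t = q⁻¹ + v(q)` for `Γ₀(N)` with its Atkin–Lehner transformation laws. -/
structure Haupt (N : ℕ) (t v : ℂ → ℂ) (γ κ : ℕ → ℂ) : Prop where
  sqf : Squarefree N
  diff : DifferentiableOn ℂ t upperHalfPlaneSet
  inv : ∀ M ∈ G0 N, ∀ z : ℂ, 0 < z.im → t (mb M z) = t z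
  vdiff : DifferentiableOn ℂ v (Metric.ball 0 1)
  eq : ∀ z : ℂ, 0 < z.im → t z = (qc z)⁻¹ + v (qc z)
  al : ∀ e, e ∣ N → e ≠ 1 → ∀ A ∈ AL N e, ∀ z : ℂ, 0 < z.im →
    (t (mb A z) - γ e) * (t z - γ e) = κ e
  kne : ∀ e, e ∣ N → e ≠ 1 → κ e ≠ 0

lemma norm_qc (z : ℂ) : ‖qc z‖ = Real.exp (-(2 * Real.pi * z.im)) := by
  rw [qc, Complex.norm_exp]
  congr 1
  simp

lemma exists_im_norm_qc_lt {ε : ℝ} (hε : 0 < ε) : ∃ A : ℝ, ∀ z : ℂ, A ≤ z.im → ‖qc z‖ < ε := by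
  refine ⟨-Real.log ε / (2 * Real.pi) + 1, fun z hz => ?_⟩
  rw [norm_qc, ← Real.lt_log_iff_exp_lt hε]
  have hpi := Real.pi_pos
  have h2 : -Real.log ε / (2 * Real.pi) < z.im := by linarith
  rw [div_lt_iff₀ (by positivity)] at h2
  linarith

lemma bddInf_comp_qc {H : ℂ → ℂ} (hH : ContinuousAt H 0) : BddInf (fun z => H (qc z)) := by
  have h1 : ∀ᶠ q in 𝓝 (0 : ℂ), ‖H q‖ < ‖H 0‖ + 1 :=
    hH.norm.eventually_lt_const (by linarith)
  obtain ⟨ε, hε, h2⟩ := Metric.eventually_nhds_iff.1 h1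
  obtain ⟨A, hA⟩ := exists_im_norm_qc_lt hε
  exact ⟨_, A, fun z hz => (h2 (by simpa using hA z hz)).le⟩

lemma BddInf.congr {F G : ℂ → ℂ} (hF : BddInf F) (h : ∀ z : ℂ, 0 < z.im → G z = F z) :
    BddInf G := by
  obtain ⟨C, A, hC⟩ := hF
  refine ⟨C, max A 1, fun z hz => ?_⟩
  rw [h z (lt_of_lt_of_le one_pos ((le_max_right _ _).trans hz))]
  exact hC z ((le_max_left _ _).trans hz)

lemma BddInf.mul {F G : ℂ → ℂ} (hF : BddInf F) (hG : BddInf G) : BddInf (fun z => F z * G z) := by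
  obtain ⟨C, A, hC⟩ := hF
  obtain ⟨D, B, hD⟩ := hG
  refine ⟨|C| * |D|, max A B, fun z hz => ?_⟩
  rw [norm_mul]
  exact mul_le_mul ((hC z ((le_max_left _ _).trans hz)).trans (le_abs_self _))
    ((hD z ((le_max_right _ _).trans hz)).trans (le_abs_self _)) (norm_nonneg _) (abs_nonneg _)

lemma BddInf.add {F G : ℂ → ℂ} (hF : BddInf F) (hG : BddInf G) : BddInf (fun z => F z + G z) := by
  obtain ⟨C, A, hC⟩ := hF
  obtain ⟨D, B, hD⟩ := hG
  refine ⟨C + D, max A B, fun z hz => ?_⟩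
  exact (norm_add_le _ _).trans (add_le_add (hC z ((le_max_left _ _).trans hz))
    (hD z ((le_max_right _ _).trans hz)))

lemma bddInf_const (c : ℂ) : BddInf (fun _ => c) := ⟨‖c‖, 0, fun _ _ => le_rfl⟩

lemma BddInf.sub_const {F : ℂ → ℂ} (hF : BddInf F) (c : ℂ) : BddInf (fun z => F z - c) := by
  simpa [sub_eq_add_neg] using hF.add (bddInf_const (-c))

lemma st_eq_one {e f : ℕ} (he : e ≠ 0) (h : st e f = 1) : e = f := by
  have h1 := st_mul_gcd (f := f) he
  rw [h, one_mul] at h1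
  have h2 : e ∣ e.gcd f := h1 ▸ Nat.dvd_lcm_left e f
  have h3 : f ∣ e.gcd f := h1 ▸ Nat.dvd_lcm_right e f
  exact Nat.dvd_antisymm (h2.trans (Nat.gcd_dvd_right e f)) (h3.trans (Nat.gcd_dvd_left e f))

lemma ball_mem : Metric.ball (0 : ℂ) 1 ∈ 𝓝 (0 : ℂ) := Metric.ball_mem_nhds _ one_pos

lemma differentiableOn_mb {M : IM} (hM : 0 < M.det) :
    DifferentiableOn ℂ (mb M) upperHalfPlaneSet :=
  fun _ hz => (hasDerivAt_mb (den_ne_zero hM hz)).differentiableAt.differentiableWithinAt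

lemma differentiableOn_comp_mb {t : ℂ → ℂ} (ht : DifferentiableOn ℂ t upperHalfPlaneSet)
    {M : IM} (hM : 0 < M.det) : DifferentiableOn ℂ (fun z => t (mb M z)) upperHalfPlaneSet :=
  ht.comp (differentiableOn_mb hM) fun _ hz => im_mb_pos hM hz

lemma exists_qc_eq {q : ℂ} (h0 : q ≠ 0) (h1 : ‖q‖ < 1) : ∃ z : ℂ, 0 < z.im ∧ qc z = q := by
  refine ⟨Function.Periodic.invQParam 1 q,
    Function.Periodic.im_invQParam_pos_of_norm_lt_one one_pos h1 h0, ?_⟩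
  have h2 := Function.Periodic.qParam_right_inv (h := 1) one_ne_zero h0
  rw [Function.Periodic.qParam] at h2
  simpa only [ofReal_one, div_one, qc] using h2

/-- Weak Hauptmodul data gives the Atkin–Lehner laws. -/
theorem Haupt.of_cusps {N : ℕ} (hN : Squarefree N) {t v : ℂ → ℂ} {γ : ℕ → ℂ}
    (diff : DifferentiableOn ℂ t upperHalfPlaneSet)
    (inv : ∀ M ∈ G0 N, ∀ z : ℂ, 0 < z.im → t (mb M z) = t z)
    (vdiff : DifferentiableOn ℂ v (Metric.ball 0 1))
    (eq : ∀ z : ℂ, 0 < z.im → t z = (qc z)⁻¹ + v (qc z))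
    (hcusp : ∀ e, e ∣ N → e ≠ 1 → ∃ A ∈ AL N e, ∃ H : ℂ → ℂ,
      DifferentiableOn ℂ H (Metric.ball 0 1) ∧ H 0 = γ e ∧
      ∀ z : ℂ, 0 < z.im → t (mb A z) = H (qc z)) :
    ∃ κ : ℕ → ℂ, Haupt N t v γ κ := by
  have hne : ∀ e, e ∣ N → e ≠ 0 := fun e he h =>
    hN.ne_zero (by rw [h] at he; exact zero_dvd_iff.1 he)
  have hAB : ∀ e, e ∣ N → ∀ A ∈ AL N e, ∀ B ∈ AL N e, ∀ z : ℂ, 0 < z.im →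
      t (mb A z) = t (mb B z) := by
    intro e he A hA B hB z hz
    obtain ⟨C, hC, rfl⟩ := AL_eq_mul (hne e he) he hA hB
    have hBd := AL_det_pos (hne e he) hB
    rw [mb_mul _ (den_ne_zero hBd hz), inv C hC _ (im_mb_pos hBd hz)]
  have hbdd : ∀ e, e ∣ N → e ≠ 1 → ∀ A ∈ AL N e, BddInf (fun z => t (mb A z)) := by
    intro e he he1 A hA
    obtain ⟨B, hB, H, hH, -, hH2⟩ := hcusp e he he1
    have : ContinuousAt H 0 := (hH.differentiableAt ball_mem).continuousAt
    refine (bddInf_comp_qc this).congr fun z hz => ?_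
    rw [hAB e he A hA B hB z hz, hH2 z hz]
  have hprod : ∀ e, e ∣ N → ∀ f, f ∣ N → ∀ A ∈ AL N e, ∀ B ∈ AL N f, ∀ C ∈ AL N (st e f),
      ∀ z : ℂ, 0 < z.im → t (mb A (mb B z)) = t (mb C z) := by
    intro e he f hf A hA B hB C hC z hz
    obtain ⟨D, hD, hABD⟩ := AL_mul (hne e he) he hf hA hB
    have hBd := AL_det_pos (hne f hf) hB
    have hg : ((e.gcd f : ℕ) : ℤ) ≠ 0 := by
      exact_mod_cast (Nat.gcd_pos_of_pos_left _ (Nat.pos_of_ne_zero (hne e he))).ne'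
    rw [← mb_mul _ (den_ne_zero hBd hz), hABD, mb_smul hg]
    exact hAB _ (st_dvd (hne e he) he hf) _ hD _ hC z hz
  have key : ∀ e, e ∣ N → e ≠ 1 → ∃ k : ℂ, k ≠ 0 ∧ ∀ A ∈ AL N e, ∀ z : ℂ, 0 < z.im →
      (t (mb A z) - γ e) * (t z - γ e) = k := by
    intro e he he1
    obtain ⟨A, hA, H, hH, hH0, hH2⟩ := hcusp e he he1
    have hAd := AL_det_pos (hne e he) hA
    have hqsub : ∀ q, H q - γ e = q * dslope H 0 q := by
      intro q
      have := sub_smul_dslope H 0 q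
      rw [sub_zero, smul_eq_mul, hH0] at this
      exact this.symm
    have hds : DifferentiableOn ℂ (dslope H 0) (Metric.ball 0 1) :=
      (differentiableOn_dslope ball_mem).2 hH
    set F : ℂ → ℂ := fun z => (t (mb A z) - γ e) * (t z - γ e) with hFdef
    have hFd : DifferentiableOn ℂ F upperHalfPlaneSet :=
      ((differentiableOn_comp_mb diff hAd).sub_const _).mul (diff.sub_const _)
    have hFinf : BddInf F := by
      have hc : ContinuousAt (fun q => dslope H 0 q * (1 + q * (v q - γ e))) 0 := by
        have h1 := (hds.differentiableAt ball_mem).continuousAt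
        have h2 := (vdiff.differentiableAt ball_mem).continuousAt
        fun_prop
      refine (bddInf_comp_qc hc).congr fun z hz => ?_
      rw [hFdef]
      simp only
      rw [hH2 z hz, hqsub, eq z hz]
      have := qc_ne_zero z
      field_simp
      try ring
    have hFinv : ∀ M ∈ G0 N, ∀ z : ℂ, 0 < z.im → F (mb M z) = F z := by
      intro M hM z hz
      have hMd := G0_det_pos hM
      simp only [hFdef]
      rw [inv M hM z hz, ← mb_mul _ (den_ne_zero hMd hz),
        hAB e he _ (AL_mul_G0 (hne e he) he hA hM) A hA z hz]
    obtain ⟨k, hk⟩ := eq_const_of_bddInf_AL hN hFd hFinv (by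
      intro f hf
      obtain ⟨B, hB⟩ := AL_nonempty hN hf
      refine ⟨B, hB, ?_⟩
      by_cases hf1 : f = 1
      · subst hf1
        rw [AL_one] at hB
        exact hFinf.congr fun z hz => hFinv B hB z hz
      obtain ⟨C, hC⟩ := AL_nonempty hN (st_dvd (hne e he) he hf)
      by_cases hef : e = f
      · subst hef
        refine hFinf.congr fun z hz => ?_
        simp only [hFdef]
        rw [hprod e he e he A hA B hB C hC z hz, hAB e he B hB A hA z hz]
        rw [st_self (hne e he), AL_one] at hC
        rw [inv C hC z hz, mul_comm]
      · have h1 := hbdd (st e f) (st_dvd (hne e he) he hf)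
          (fun h => hef (st_eq_one (hne e he) h)) C hC
        refine ((h1.sub_const (γ e)).mul ((hbdd f hf hf1 B hB).sub_const (γ e))).congr
          fun z hz => ?_
        simp only [hFdef]
        rw [hprod e he f hf A hA B hB C hC z hz])
    refine ⟨k, ?_, ?_⟩
    · rintro rfl
      have hcv : ContinuousAt (fun q => 1 + q * (v q - γ e)) 0 := by
        have h2 := (vdiff.differentiableAt ball_mem).continuousAt
        fun_prop
      have hne0 : ∀ᶠ q in 𝓝 (0 : ℂ), 1 + q * (v q - γ e) ≠ 0 :=
        hcv.eventually_ne (by simp)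
      have hHloc : ∀ᶠ q in 𝓝 (0 : ℂ), H q = γ e := by
        filter_upwards [hne0, ball_mem] with q hq hqb
        by_cases hq0 : q = 0
        · rw [hq0, hH0]
        obtain ⟨z, hz, rfl⟩ := exists_qc_eq hq0 (by simpa using hqb)
        have h1 := hk z hz
        simp only [hFdef] at h1
        rcases mul_eq_zero.1 h1 with h1 | h1
        · rw [← hH2 z hz]; exact sub_eq_zero.1 h1
        · exfalso
          apply hq
          have : 1 + qc z * (v (qc z) - γ e) = qc z * (t z - γ e) := by
            rw [eq z hz]; field_simp; try ring
          rw [this, h1, mul_zero]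
      have hHall : Set.EqOn H (fun _ => γ e) (Metric.ball 0 1) :=
        (hH.analyticOnNhd Metric.isOpen_ball).eqOn_of_preconnected_of_eventuallyEq
          analyticOnNhd_const (convex_ball _ _).isPreconnected (Metric.mem_ball_self one_pos) hHloc
      have htconst : ∀ z : ℂ, 0 < z.im → t z = γ e := by
        intro z hz
        have hz' : 0 < (mb A.adjugate z).im := im_mb_pos (by rwa [det_adj]) hz
        have := hH2 _ hz'
        rw [mb_mb_adj hAd hz] at this
        rw [this]
        exact hHall (qc_mem_ball hz')
      obtain ⟨ε, hε, h⟩ := Metric.eventually_nhds_iff.1 hne0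
      obtain ⟨B, hB⟩ := exists_im_norm_qc_lt hε
      let z : ℂ := ⟨0, max B 1⟩
      have hz : 0 < z.im := lt_of_lt_of_le one_pos (le_max_right _ _)
      have h1 := h (y := qc z) (by simpa using hB z (le_max_left _ _))
      apply h1
      have : 1 + qc z * (v (qc z) - γ e) = qc z * (t z - γ e) := by
        have := qc_ne_zero z
        rw [eq z hz]; field_simp; try ring
      rw [this, htconst z hz, sub_self, mul_zero]
    · intro B hB z hz
      rw [hAB e he B hB A hA z hz]
      exact hk z hz
  choose! κ hκ using key
  exact ⟨κ, hN, diff, inv, vdiff, eq, fun e he he1 => (hκ e he he1).2,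
    fun e he he1 => (hκ e he he1).1⟩

/-- The reduced part of the `q`-expansion of an eta quotient. -/
noncomputable def vQ (N : ℕ) (r : ℕ → ℤ) : ℂ → ℂ := dslope (unitQ N r id) 0

theorem haupt_etaQ {N : ℕ} (hN : Squarefree N) {r : ℕ → ℤ} {γ : ℕ → ℂ}
    (h0 : ∑ d ∈ N.divisors, r d = 0)
    (h1 : ∑ d ∈ N.divisors, (d : ℤ) * r d = 12 * (-1))
    (hcong : ∀ A ∈ G0 N, (12 : ℤ) ∣ ∑ d ∈ N.divisors, psi (gp A d 1) * r d)
    (hord : ∀ e, e ∣ N → e ≠ 1 → ∃ m : ℕ, ∑ d ∈ N.divisors, (st d e : ℤ) * r d = 12 * (m : ℤ) ∧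
      ∃ A ∈ AL N e, γ e = if m = 0 then mult N e r A else 0) :
    ∃ κ : ℕ → ℂ, Haupt N (etaQ N r) (vQ N r) γ κ := by
  have hid : ∀ d ∈ N.divisors, id d ≠ 0 := fun d hd => (Nat.pos_of_mem_divisors hd).ne'
  have hUd := differentiableOn_unitQ (r := r) hid
  refine Haupt.of_cusps hN ?_ ?_ ?_ ?_ ?_
  · unfold etaQ
    refine DifferentiableOn.fun_finsetProd fun d hd => ?_
    have hdpos : (0 : ℝ) < d := by exact_mod_cast Nat.pos_of_mem_divisors hd
    have him : ∀ z ∈ upperHalfPlaneSet, 0 < ((d : ℂ) * z).im := by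
      intro z hz
      simpa using mul_pos hdpos hz
    refine DifferentiableOn.zpow ?_ (Or.inl fun z hz => eta2_ne_zero (him z hz))
    intro z hz
    refine DifferentiableAt.differentiableWithinAt ?_
    exact (differentiableAt_eta2 (him z hz)).comp z (by fun_prop)
  · intro M hM z hz
    have hM1 := hM
    rw [← AL_one] at hM1
    rw [etaQ_AL hN.ne_zero (one_dvd N) h0 hM1 hz, mult,
      zt_zpow_congr (n := 0) (by simpa using hcong M hM)]
    simp [st_one_right, etaQ]
  · exact (differentiableOn_dslope ball_mem).2 hUd
  · intro z hz
    have h2 := prod_eta2_eq (δ := id) h1 z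
    simp only [id] at h2
    rw [etaQ, h2]
    have h3 := sub_smul_dslope (unitQ N r id) 0 (qc z)
    rw [unitQ_zero hid, sub_zero, smul_eq_mul] at h3
    have h4 := qc_ne_zero z
    have h5 : unitQ N r id (qc z) = 1 + qc z * vQ N r (qc z) := by
      rw [vQ, h3]; ring
    rw [_root_.zpow_neg_one, h5]
    field_simp
    try ring
  · intro e he he1
    have he0 : e ≠ 0 := fun h => hN.ne_zero (by rw [h] at he; exact zero_dvd_iff.1 he)
    obtain ⟨m, hm, A, hA, hγ⟩ := hord e he he1
    have hst : ∀ d ∈ N.divisors, st d e ≠ 0 := by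
      intro d hd h
      have hd0 := (Nat.pos_of_mem_divisors hd).ne'
      have := st_mul_gcd (f := e) hd0
      rw [h, zero_mul] at this
      exact (Nat.lcm_pos (Nat.pos_of_ne_zero hd0) (Nat.pos_of_ne_zero he0)).ne this
    refine ⟨A, hA, fun q => mult N e r A * (q ^ m * unitQ N r (fun d => st d e) q), ?_, ?_, ?_⟩
    · exact ((differentiable_pow m).differentiableOn.mul (differentiableOn_unitQ hst)).const_mul _
    · change mult N e r A * (0 ^ m * unitQ N r (fun d => st d e) 0) = γ e
      rw [unitQ_zero hst, hγ]
      split_ifs with hm0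
      · simp [hm0]
      · simp [hm0]
    · intro z hz
      rw [etaQ_AL hN.ne_zero he h0 hA hz, prod_eta2_eq (δ := fun d => st d e) hm, zpow_natCast]

end FrickeTrace

namespace FrickeTrace

open Filter Topology
open UpperHalfPlane (upperHalfPlaneSet)

lemma gp_one {N d : ℕ} (hd : d ∈ N.divisors) (x y k w : ℤ) :
    gp !![x, y; N * k, w] d 1 = !![x, y * d; ((N / d : ℕ) : ℤ) * k, w] := by
  have hd0 : (d : ℤ) ≠ 0 := by exact_mod_cast (Nat.pos_of_mem_divisors hd).ne'
  have h2 : ((N / d : ℕ) : ℤ) * (d : ℤ) = N := by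
    exact_mod_cast Nat.div_mul_cancel (Nat.dvd_of_mem_divisors hd)
  have h : (N : ℤ) * k / d = ((N / d : ℕ) : ℤ) * k := by
    rw [← h2]
    exact Int.ediv_eq_of_eq_mul_left hd0 (by ring)
  simp [gp, h]

/-- The character of an eta quotient on `Γ₀(N)` is trivial once it is so modulo `4` and `3`. -/
lemma etaQ_cong {N : ℕ} {r : ℕ → ℤ}
    (h4 : ∀ x y k w : ZMod 4, x * w - y * (N * k) = 1 →
      ∑ d ∈ N.divisors, ((1 - ((N / d : ℕ) * k) ^ 2) * (y * d * w + 3 * ((N / d : ℕ) * k - 1) * w +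
        (N / d : ℕ) * k + 3) + (N / d : ℕ) * k * (x + w - 3)) * (r d : ZMod 4) = 0)
    (h3 : ∀ x y k w : ZMod 3, x * w - y * (N * k) = 1 →
      ∑ d ∈ N.divisors, ((1 - ((N / d : ℕ) * k) ^ 2) * (y * d * w + 3 * ((N / d : ℕ) * k - 1) * w +
        (N / d : ℕ) * k + 3) + (N / d : ℕ) * k * (x + w - 3)) * (r d : ZMod 3) = 0) :
    ∀ A ∈ G0 N, (12 : ℤ) ∣ ∑ d ∈ N.divisors, psi (gp A d 1) * r d := by
  rintro A ⟨hA, k, hk⟩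
  have hA2 : A = !![A 0 0, A 0 1; N * k, A 1 1] := by
    rw [← hk]; exact (IM_eq A)
  rw [hA2] at hA ⊢
  rw [Matrix.det_fin_two_of] at hA
  have hs : ∑ d ∈ N.divisors, psi (gp !![A 0 0, A 0 1; N * k, A 1 1] d 1) * r d =
      ∑ d ∈ N.divisors, psi !![A 0 0, A 0 1 * d; ((N / d : ℕ) : ℤ) * k, A 1 1] * r d :=
    Finset.sum_congr rfl fun d hd => by rw [gp_one hd]
  rw [hs]
  apply twelve_dvd_of_zmod
  · have := h4 (A 0 0) (A 0 1) k (A 1 1) (by exact_mod_cast congrArg (Int.cast : ℤ → ZMod 4) hA)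
    rw [← this]
    rw [Int.cast_sum]
    refine Finset.sum_congr rfl fun d _ => ?_
    generalize N / d = m
    simp [psi]
  · have := h3 (A 0 0) (A 0 1) k (A 1 1) (by exact_mod_cast congrArg (Int.cast : ℤ → ZMod 3) hA)
    rw [← this]
    rw [Int.cast_sum]
    refine Finset.sum_congr rfl fun d _ => ?_
    generalize N / d = m
    simp [psi]

/-- Half the exponents of the eta quotient that is a Hauptmodul of `Γ₀(N)`. -/
def rt (N d : ℕ) : ℤ :=
  if N = 6 then if d = 1 then -2 else if d = 2 then 4 else if d = 3 then 2 else -4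
  else if N = 10 then if d = 1 then -1 else if d = 2 then 2 else if d = 5 then 1 else -2
  else if d = 1 then ((12 / (N - 1) : ℕ) : ℤ) else -((12 / (N - 1) : ℕ) : ℤ)

/-- Half the exponents of the eta quotient from which `jnStar N` is built. -/
def ru (N d : ℕ) : ℤ :=
  if N = 6 then if d = 1 ∨ d = 3 then 3 else -3
  else if N = 10 then if d = 1 ∨ d = 5 then 2 else -2
  else rt N d

lemma rt_cong {N : ℕ} (hN : N ∈ ({2, 3, 5, 6, 7, 10, 13} : Set ℕ)) :
    ∀ A ∈ G0 N, (12 : ℤ) ∣ ∑ d ∈ N.divisors, psi (gp A d 1) * rt N d := by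
  simp only [Set.mem_insert_iff, Set.mem_singleton_iff] at hN
  rcases hN with rfl | rfl | rfl | rfl | rfl | rfl | rfl <;> exact etaQ_cong (by decide) (by decide)

lemma ru_cong {N : ℕ} (hN : N ∈ ({2, 3, 5, 6, 7, 10, 13} : Set ℕ)) :
    ∀ A ∈ G0 N, (12 : ℤ) ∣ ∑ d ∈ N.divisors, psi (gp A d 1) * ru N d := by
  simp only [Set.mem_insert_iff, Set.mem_singleton_iff] at hN
  rcases hN with rfl | rfl | rfl | rfl | rfl | rfl | rfl <;> exact etaQ_cong (by decide) (by decide)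

/-- An explicit Atkin–Lehner matrix. -/
def wm (N e : ℕ) : IM :=
  if N = 6 ∧ e = 2 then !![4, 1; 6, 2]
  else if N = 6 ∧ e = 3 then !![3, 1; 6, 3]
  else if N = 10 ∧ e = 2 then !![6, 1; 10, 2]
  else if N = 10 ∧ e = 5 then !![5, 2; 10, 5]
  else if e = 1 then 1 else !![0, -1; (N : ℤ), 0]

lemma wm_mem {N : ℕ} (hN : N ∈ ({2, 3, 5, 6, 7, 10, 13} : Set ℕ)) {e : ℕ} (he : e ∈ N.divisors) :
    wm N e ∈ AL N e := by
  simp only [Set.mem_insert_iff, Set.mem_singleton_iff] at hN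
  revert e
  rcases hN with rfl | rfl | rfl | rfl | rfl | rfl | rfl <;> simp only [AL, Set.mem_ofPred_eq] <;> decide

/-- The values of the Hauptmodul at the cusps. -/
def gam (N e : ℕ) : ℂ :=
  if N = 6 ∧ e = 2 then 1 else if N = 6 ∧ e = 6 then 9
  else if N = 10 ∧ e = 2 then 1 else if N = 10 ∧ e = 10 then 5 else 0

lemma mult_of_dvd {N e : ℕ} {r : ℕ → ℤ} {A : IM}
    (h : (12 : ℤ) ∣ ∑ d ∈ N.divisors, psi (gp A d e) * r d) :
    mult N e r A = ∏ d ∈ N.divisors, (((d.gcd e : ℕ) : ℂ) ^ r d)⁻¹ := by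
  rw [mult, zt_zpow_congr (n := 0) (by simpa using h)]
  simp

lemma squarefree_level {N : ℕ} (hN : N ∈ ({2, 3, 5, 6, 7, 10, 13} : Set ℕ)) : Squarefree N := by
  simp only [Set.mem_insert_iff, Set.mem_singleton_iff] at hN
  have key : ∀ {p q : ℕ}, p.Prime → q.Prime → p ≠ q → Squarefree (p * q) := fun hp hq h =>
    (Nat.squarefree_mul ((Nat.coprime_primes hp hq).2 h)).2
      ⟨hp.prime.squarefree, hq.prime.squarefree⟩
  rcases hN with rfl | rfl | rfl | rfl | rfl | rfl | rfl
  · exact Nat.prime_two.prime.squarefree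
  · exact Nat.prime_three.prime.squarefree
  · exact Nat.prime_five.prime.squarefree
  · exact key Nat.prime_two Nat.prime_three (by norm_num)
  · exact (by norm_num : Nat.Prime 7).prime.squarefree
  · exact key Nat.prime_two Nat.prime_five (by norm_num)
  · exact (by norm_num : Nat.Prime 13).prime.squarefree

/-- The order of the Hauptmodul at the cusp belonging to `e`. -/
def mt (N e : ℕ) : ℕ :=
  if (N = 6 ∨ N = 10) ∧ (e = 2 ∨ e = N) then 0 else 1

lemma mult_rt {N : ℕ} (hN : N ∈ ({2, 3, 5, 6, 7, 10, 13} : Set ℕ)) {e : ℕ} (he : e ∈ N.divisors)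
    (he1 : e ≠ 1) : (12 : ℤ) ∣ ∑ d ∈ N.divisors, psi (gp (wm N e) d e) * rt N d := by
  simp only [Set.mem_insert_iff, Set.mem_singleton_iff] at hN
  revert e
  rcases hN with rfl | rfl | rfl | rfl | rfl | rfl | rfl <;> decide

lemma mult_ru {N : ℕ} (hN : N ∈ ({2, 3, 5, 6, 7, 10, 13} : Set ℕ)) {e : ℕ} (he : e ∈ N.divisors)
    (he1 : e ≠ 1) : (12 : ℤ) ∣ ∑ d ∈ N.divisors, psi (gp (wm N e) d e) * ru N d := by
  simp only [Set.mem_insert_iff, Set.mem_singleton_iff] at hN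
  revert e
  rcases hN with rfl | rfl | rfl | rfl | rfl | rfl | rfl <;> decide

lemma div2 : Nat.divisors 2 = {1, 2} := by decide
lemma div3 : Nat.divisors 3 = {1, 3} := by decide
lemma div5 : Nat.divisors 5 = {1, 5} := by decide
lemma div6 : Nat.divisors 6 = {1, 2, 3, 6} := by decide
lemma div7 : Nat.divisors 7 = {1, 7} := by decide
lemma div10 : Nat.divisors 10 = {1, 2, 5, 10} := by decide
lemma div13 : Nat.divisors 13 = {1, 13} := by decide

theorem haupt_rt {N : ℕ} (hN : N ∈ ({2, 3, 5, 6, 7, 10, 13} : Set ℕ)) :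
    ∃ κ : ℕ → ℂ, Haupt N (etaQ N (rt N)) (vQ N (rt N)) (gam N) κ := by
  have hs := squarefree_level hN
  refine haupt_etaQ hs ?_ ?_ (rt_cong hN) ?_
  · simp only [Set.mem_insert_iff, Set.mem_singleton_iff] at hN
    rcases hN with rfl | rfl | rfl | rfl | rfl | rfl | rfl <;> decide
  · simp only [Set.mem_insert_iff, Set.mem_singleton_iff] at hN
    rcases hN with rfl | rfl | rfl | rfl | rfl | rfl | rfl <;> decide
  · intro e he he1
    have he' : e ∈ N.divisors := Nat.mem_divisors.2 ⟨he, hs.ne_zero⟩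
    refine ⟨mt N e, ?_, wm N e, wm_mem hN he', ?_⟩
    · simp only [Set.mem_insert_iff, Set.mem_singleton_iff] at hN
      clear he hs
      revert he1
      revert he'
      revert e
      rcases hN with rfl | rfl | rfl | rfl | rfl | rfl | rfl <;> decide
    · rw [mult_of_dvd (mult_rt hN he' he1)]
      simp only [Set.mem_insert_iff, Set.mem_singleton_iff] at hN
      rcases hN with rfl | rfl | rfl | rfl | rfl | rfl | rfl <;>
      simp only [div2, div3, div5, div6, div7, div10, div13, Finset.mem_insert,
        Finset.mem_singleton] at he' <;>
      (try rcases he' with rfl | rfl | rfl | rfl) <;>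
      first
      | exact absurd rfl he1
      | (norm_num [gam, mt, rt, div2, div3, div5, div6, div7, div10, div13])

/-- The constant in the Fricke transformation of `etaQ N (ru N)`. -/
def cu (N : ℕ) : ℂ := if N = 6 then 2 ^ 6 else if N = 10 then 2 ^ 4 else (N : ℂ) ^ (12 / (N - 1))

lemma etaQ_ne_zero {N : ℕ} (r : ℕ → ℤ) {z : ℂ} (hz : 0 < z.im) : etaQ N r z ≠ 0 := by
  refine Finset.prod_ne_zero_iff.2 fun d hd => zpow_ne_zero _ (eta2_ne_zero ?_)
  simpa using mul_pos (Nat.cast_pos.2 (Nat.pos_of_mem_divisors hd)) hz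

set_option maxHeartbeats 2000000 in
lemma etaQ_ru_wm {N : ℕ} (hN : N ∈ ({2, 3, 5, 6, 7, 10, 13} : Set ℕ)) {e : ℕ}
    (he : e ∈ N.divisors) (he1 : e ≠ 1) {z : ℂ} (hz : 0 < z.im) :
    etaQ N (ru N) (mb (wm N e) z) = etaQ N (ru N) z ∨
      etaQ N (ru N) (mb (wm N e) z) = cu N / etaQ N (ru N) z := by
  have hs := squarefree_level hN
  have h0 : ∑ d ∈ N.divisors, ru N d = 0 := by
    simp only [Set.mem_insert_iff, Set.mem_singleton_iff] at hN
    rcases hN with rfl | rfl | rfl | rfl | rfl | rfl | rfl <;> decide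
  rw [etaQ_AL hs.ne_zero (Nat.dvd_of_mem_divisors he) h0 (wm_mem hN he) hz,
    mult_of_dvd (mult_ru hN he he1)]
  simp only [Set.mem_insert_iff, Set.mem_singleton_iff] at hN
  rcases hN with rfl | rfl | rfl | rfl | rfl | rfl | rfl <;>
  simp only [div2, div3, div5, div6, div7, div10, div13, Finset.mem_insert,
    Finset.mem_singleton] at he <;>
  (try rcases he with rfl | rfl | rfl | rfl) <;>
  first
  | exact absurd rfl he1
  | (left; norm_num [etaQ, ru, rt, st, div2, div3, div5, div6, div7, div10, div13]; done)
  | (left; norm_num [etaQ, ru, rt, st, div2, div3, div5, div6, div7, div10, div13]; ring1)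
  | (right
     norm_num [etaQ, ru, rt, st, cu, div2, div3, div5, div6, div7, div10, div13,
        zpow_ofNat, _root_.zpow_neg]
     simp only [div_eq_mul_inv, mul_inv, inv_inv]; ring1)

/-- The constant term in the definition of `jnStar N`. -/
noncomputable def ku (N : ℕ) : ℂ := if N = 6 then 6 else if N = 10 then 4 else 24 / ((N : ℂ) - 1)

lemma jnStar_eq {N : ℕ} (hN : N ∈ ({2, 3, 5, 6, 7, 10, 13} : Set ℕ)) (z : ℂ) :
    jnStar N z = etaQ N (ru N) z + ku N + cu N / etaQ N (ru N) z := by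
  simp only [Set.mem_insert_iff, Set.mem_singleton_iff] at hN
  rcases hN with rfl | rfl | rfl | rfl | rfl | rfl | rfl <;>
    norm_num [jnStar, etaQ, ru, rt, ku, cu, eta2, div2, div3, div5, div6, div7, div10, div13,
      zpow_ofNat, _root_.zpow_neg, div_eq_mul_inv, mul_inv, mul_pow, ← pow_mul] <;> ring1

lemma differentiableOn_etaQ (N : ℕ) (r : ℕ → ℤ) :
    DifferentiableOn ℂ (etaQ N r) upperHalfPlaneSet := by
  unfold etaQ
  refine DifferentiableOn.fun_finsetProd fun d hd => ?_
  have hdpos : (0 : ℝ) < d := by exact_mod_cast Nat.pos_of_mem_divisors hd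
  have him : ∀ z ∈ upperHalfPlaneSet, 0 < ((d : ℂ) * z).im := by
    intro z hz
    simpa using mul_pos hdpos hz
  refine DifferentiableOn.zpow ?_ (Or.inl fun z hz => eta2_ne_zero (him z hz))
  intro z hz
  refine DifferentiableAt.differentiableWithinAt ?_
  exact (differentiableAt_eta2 (him z hz)).comp z (by fun_prop)

lemma differentiableOn_jnStar {N : ℕ} (hN : N ∈ ({2, 3, 5, 6, 7, 10, 13} : Set ℕ)) :
    DifferentiableOn ℂ (jnStar N) upperHalfPlaneSet := by
  have h := differentiableOn_etaQ N (ru N)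
  rw [funext (jnStar_eq hN)]
  exact (h.add_const _).add
    ((differentiableOn_const _).div h fun z hz => etaQ_ne_zero _ hz)

lemma jnStar_AL {N : ℕ} (hN : N ∈ ({2, 3, 5, 6, 7, 10, 13} : Set ℕ)) {e : ℕ} (he : e ∣ N)
    {A : IM} (hA : A ∈ AL N e) {z : ℂ} (hz : 0 < z.im) : jnStar N (mb A z) = jnStar N z := by
  have hs := squarefree_level hN
  have he' : e ∈ N.divisors := Nat.mem_divisors.2 ⟨he, hs.ne_zero⟩
  have hinv : ∀ M ∈ G0 N, ∀ z : ℂ, 0 < z.im → jnStar N (mb M z) = jnStar N z := by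
    intro M hM z hz
    have h0 : ∑ d ∈ N.divisors, ru N d = 0 := by
      simp only [Set.mem_insert_iff, Set.mem_singleton_iff] at hN
      rcases hN with rfl | rfl | rfl | rfl | rfl | rfl | rfl <;> decide
    have hM1 := hM
    rw [← AL_one] at hM1
    have : etaQ N (ru N) (mb M z) = etaQ N (ru N) z := by
      rw [etaQ_AL hs.ne_zero (one_dvd N) h0 hM1 hz, mult,
        zt_zpow_congr (n := 0) (by simpa using ru_cong hN M hM)]
      simp [st_one_right, etaQ]
    rw [jnStar_eq hN, jnStar_eq hN, this]
  by_cases he1 : e = 1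
  · subst he1
    rw [AL_one] at hA
    exact hinv A hA z hz
  have he0 : e ≠ 0 := (Nat.pos_of_mem_divisors he').ne'
  have hB := wm_mem hN he'
  have hBd := AL_det_pos he0 hB
  obtain ⟨C, hC, rfl⟩ := AL_eq_mul he0 he hA hB
  rw [mb_mul _ (den_ne_zero hBd hz), hinv C hC _ (im_mb_pos hBd hz), jnStar_eq hN, jnStar_eq hN]
  have hu := etaQ_ne_zero (N := N) (ru N) hz
  have hu' := etaQ_ne_zero (N := N) (ru N) (im_mb_pos hBd hz)
  rcases etaQ_ru_wm hN he' he1 hz with h | h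
  · rw [h]
  · have hc : cu N ≠ 0 := by
      rintro hc
      rw [hc, zero_div] at h
      exact hu' h
    rw [h]
    field_simp
    ring

end FrickeTrace

namespace FrickeTrace

open Filter Topology
open UpperHalfPlane (upperHalfPlaneSet)

/-- The filter of neighbourhoods of `i∞`. -/
noncomputable def lI : Filter ℂ := comap Complex.im atTop

lemma eventually_lI {p : ℂ → Prop} : (∀ᶠ z in lI, p z) ↔ ∃ Y : ℝ, ∀ z : ℂ, Y ≤ z.im → p z := by
  rw [lI, eventually_comap, eventually_atTop]
  constructor
  · rintro ⟨Y, h⟩; exact ⟨Y, fun z hz => h z.im hz z rfl⟩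
  · rintro ⟨Y, h⟩; exact ⟨Y, fun y hy z hz => h z (hz ▸ hy)⟩

lemma eventually_im_pos : ∀ᶠ z in lI, 0 < z.im :=
  eventually_lI.2 ⟨1, fun _ hz => by linarith⟩

instance : lI.NeBot := by
  rw [lI]
  refine comap_neBot fun s hs => ?_
  obtain ⟨y, hy⟩ := Filter.nonempty_of_mem hs
  exact ⟨⟨0, y⟩, hy⟩

lemma tendsto_qc : Tendsto qc lI (𝓝[≠] 0) := by
  refine tendsto_nhdsWithin_iff.2 ⟨?_, Eventually.of_forall fun z => qc_ne_zero z⟩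
  refine Metric.tendsto_nhds.2 fun ε hε => ?_
  obtain ⟨A, hA⟩ := exists_im_norm_qc_lt hε
  exact eventually_lI.2 ⟨A, fun z hz => by simpa using hA z hz⟩

lemma tendsto_qc_nhds : Tendsto qc lI (𝓝 0) := tendsto_qc.mono_right nhdsWithin_le_nhds

variable {N : ℕ} {t v : ℂ → ℂ} {γ κ : ℕ → ℂ}

lemma Haupt.pos (h : Haupt N t v γ κ) {e : ℕ} (he : e ∣ N) : e ≠ 0 :=
  fun h0 => h.sqf.ne_zero (by rw [h0] at he; exact zero_dvd_iff.1 he)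

lemma Haupt.vcont (h : Haupt N t v γ κ) : ContinuousAt v 0 :=
  (h.vdiff.differentiableAt ball_mem).continuousAt

lemma Haupt.tendsto_cobounded (h : Haupt N t v γ κ) : Tendsto t lI (Bornology.cobounded ℂ) := by
  rw [← tendsto_norm_atTop_iff_cobounded]
  have h1 : Tendsto (fun z => ‖(qc z)⁻¹‖ + -‖v (qc z)‖) lI atTop :=
    (tendsto_norm_atTop_iff_cobounded.2 (tendsto_inv₀_nhdsNE_zero.comp tendsto_qc)).atTop_add
      ((h.vcont.tendsto.comp tendsto_qc_nhds).norm.neg)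
  refine tendsto_atTop_mono' _ (eventually_im_pos.mono fun z hz => ?_) h1
  simp only [h.eq z hz]
  have := norm_sub_le ((qc z)⁻¹ + v (qc z)) (v (qc z))
  rw [add_sub_cancel_right] at this
  linarith

lemma Haupt.tendsto_sub_cobounded (h : Haupt N t v γ κ) (s : ℂ) :
    Tendsto (fun z => t z - s) lI (Bornology.cobounded ℂ) := by
  simp only [sub_eq_add_neg]
  exact (tendsto_add_const_cobounded (-s)).comp h.tendsto_cobounded

lemma Haupt.ne_gamma (h : Haupt N t v γ κ) {e : ℕ} (he : e ∣ N) (he1 : e ≠ 1) {z : ℂ}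
    (hz : 0 < z.im) : t z ≠ γ e := by
  intro h0
  obtain ⟨A, hA⟩ := AL_nonempty h.sqf he
  have := h.al e he he1 A hA z hz
  rw [h0, sub_self, mul_zero] at this
  exact h.kne e he he1 this.symm

lemma Haupt.al_eq (h : Haupt N t v γ κ) {e : ℕ} (he : e ∣ N) (he1 : e ≠ 1) {A : IM}
    (hA : A ∈ AL N e) {z : ℂ} (hz : 0 < z.im) : t (mb A z) = γ e + κ e / (t z - γ e) := by
  have h0 := sub_ne_zero.2 (h.ne_gamma he he1 hz)
  rw [← h.al e he he1 A hA z hz]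
  field_simp
  ring

lemma Haupt.tendsto_gamma (h : Haupt N t v γ κ) {e : ℕ} (he : e ∣ N) (he1 : e ≠ 1) {A : IM}
    (hA : A ∈ AL N e) : Tendsto (fun z => t (mb A z)) lI (𝓝 (γ e)) := by
  have h1 : Tendsto (fun z => γ e + κ e * (t z - γ e)⁻¹) lI (𝓝 (γ e + κ e * 0)) := by
    refine tendsto_const_nhds.add (tendsto_const_nhds.mul ?_)
    refine tendsto_inv₀_cobounded.comp ?_
    exact h.tendsto_sub_cobounded (γ e)
  rw [mul_zero, add_zero] at h1
  exact h1.congr' (eventually_im_pos.mono fun z hz => by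
    simp only [h.al_eq he he1 hA hz, div_eq_mul_inv])

/-- Reduction theory for `Γ₀(N)`. -/
lemma exists_reduced (hN : Squarefree N) {A : ℕ → IM} (hA : ∀ e, e ∣ N → A e ∈ AL N e) {z : ℂ}
    (hz : 0 < z.im) : ∃ e, e ∣ N ∧ ∃ M ∈ G0 N, ∃ w : ℂ, 1 / (2 * N : ℝ) ≤ w.im ∧ 0 ≤ w.re ∧
      w.re ≤ 1 ∧ mb M z = mb (A e) w := by
  obtain ⟨g, hg⟩ := ModularGroup.exists_smul_mem_fd ⟨z, hz⟩
  set σ : ℂ := ((g • (⟨z, hz⟩ : UpperHalfPlane) : UpperHalfPlane) : ℂ) with hσ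
  have hσim : 0 < σ.im := UpperHalfPlane.im_pos _
  have hσ1 : (1 : ℝ) / 2 ≤ σ.im := by
    have := ModularGroup.three_le_four_mul_im_sq_of_mem_fd hg
    change 3 ≤ 4 * σ.im ^ 2 at this
    nlinarith
  set h := g⁻¹ with hh
  have hzσ : z = mb h.1 σ := by
    have := coe_smul_eq_mb h (g • (⟨z, hz⟩ : UpperHalfPlane))
    rw [hh, inv_smul_smul] at this
    exact this
  obtain ⟨e, heN, j, hAL, -⟩ := exists_AL_of_det_one hN h.2
  have he : e ≠ 0 := fun h => hN.ne_zero (by rw [h] at heN; exact zero_dvd_iff.1 heN)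
  have hepos : (0 : ℝ) < e := by exact_mod_cast Nat.pos_of_ne_zero he
  have hec : (e : ℂ) ≠ 0 := by exact_mod_cast he
  set w0 : ℂ := (σ - j) / e with hw
  have hwim : w0.im = σ.im / e := by
    rw [hw, show (e : ℂ) = ((e : ℝ) : ℂ) by simp, div_ofReal_im]; simp
  set w : ℂ := w0 - (⌊w0.re⌋ : ℤ) with hww
  have hwim1 : w.im = σ.im / e := by rw [hww, sub_im, hwim]; simp
  have hwpos : 0 < w.im := by rw [hwim1]; positivity
  have hT : (!![1, ⌊w0.re⌋; 0, 1] : IM) ∈ G0 N := by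
    simp [G0, det_fin_two]
  have hw0 : mb !![1, ⌊w0.re⌋; 0, 1] w = w0 := by
    simp [mb, den, hww]
  have hdet : 0 < (!![(e : ℤ), j; 0, 1] : IM).det := by
    rw [det_fin_two]; simpa using Nat.pos_of_ne_zero he
  have hw0pos : 0 < w0.im := by rw [hwim]; positivity
  have hz' : mb !![(e : ℤ), j; 0, 1] w0 = σ := by
    simp [mb, den, hw]; field_simp; ring
  obtain ⟨C, hC, hCA⟩ := AL_eq_mul he heN (AL_mul_G0 he heN hAL hT) (hA e heN)
  have hAd := AL_det_pos he (hA e heN)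
  have hzC : z = mb C (mb (A e) w) := by
    rw [← mb_mul _ (den_ne_zero hAd hwpos), ← hCA, mb_mul _ (den_ne_zero (G0_det_pos hT) hwpos),
      hw0, mb_mul _ (den_ne_zero hdet hw0pos), hz', ← hzσ]
  refine ⟨e, heN, C.adjugate, G0_adj hC, w, ?_, ?_, ?_, ?_⟩
  · rw [hwim1]
    have : (e : ℝ) ≤ N := by exact_mod_cast Nat.le_of_dvd (Nat.pos_of_ne_zero hN.ne_zero) heN
    have h3 : (0 : ℝ) < N := hepos.trans_le this
    rw [div_le_div_iff₀ (by positivity) hepos]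
    nlinarith
  · rw [hww, sub_re, intCast_re]; linarith [Int.floor_le w0.re]
  · rw [hww, sub_re, intCast_re]; linarith [Int.lt_floor_add_one w0.re]
  · have hp := im_mb_pos hAd hwpos
    rw [hzC, ← mb_mul _ (den_ne_zero (G0_det_pos hC) hp), G0_adj_mul hC, mb_one]

/-- A vertical strip truncated in height. -/
noncomputable def rect (N : ℕ) (Y : ℝ) : Set ℂ := Set.Icc 0 1 ×ℂ Set.Icc (1 / (2 * N : ℝ)) Y

lemma isCompact_rect (N : ℕ) (Y : ℝ) : IsCompact (rect N Y) := isCompact_Icc.reProdIm isCompact_Icc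

lemma im_pos_of_mem_rect (hN : N ≠ 0) {Y : ℝ} {z : ℂ} (hz : z ∈ rect N Y) : 0 < z.im := by
  have h1 := (mem_reProdIm.1 hz).2.1
  have : (0 : ℝ) < N := by exact_mod_cast Nat.pos_of_ne_zero hN
  exact lt_of_lt_of_le (by positivity) h1

lemma Haupt.isCompact (h : Haupt N t v γ κ) {s : ℂ} (hs : ∀ e, e ∣ N → e ≠ 1 → s ≠ γ e) :
    ∃ K : Set ℂ, IsCompact K ∧ K ⊆ upperHalfPlaneSet ∧ ∃ δ > 0, ∀ z : ℂ, 0 < z.im →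
      ‖t z - s‖ < δ → ∃ M ∈ G0 N, mb M z ∈ K := by
  choose! A hA using fun e (he : e ∣ N) => AL_nonempty h.sqf he
  have hfar : ∀ e, e ∣ N → ∃ δ > 0, ∀ᶠ w in lI, δ ≤ ‖t (mb (A e) w) - s‖ := by
    intro e he
    by_cases he1 : e = 1
    · subst he1
      have hA1 := hA 1 he
      rw [AL_one] at hA1
      refine ⟨1, one_pos, ?_⟩
      have h1 := h.tendsto_sub_cobounded s
      filter_upwards [eventually_im_pos, (tendsto_norm_atTop_iff_cobounded.2 h1).eventually_ge_atTop 1]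
        with z hz h2
      rw [h.inv _ hA1 z hz]
      exact h2
    · have h1 := ((h.tendsto_gamma he he1 (hA e he)).sub_const s).norm
      have h2 : 0 < ‖γ e - s‖ := norm_pos_iff.2 (sub_ne_zero.2 (hs e he he1).symm)
      exact ⟨_, half_pos h2, h1.eventually_const_le (half_lt_self h2)⟩
  choose! δ hδ hev using hfar
  have hall : ∀ᶠ w in lI, ∀ e ∈ N.divisors, δ e ≤ ‖t (mb (A e) w) - s‖ :=
    (Finset.eventually_all _).2 fun e he => hev e (Nat.dvd_of_mem_divisors he)
  obtain ⟨Y, hY⟩ := eventually_lI.1 hall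
  have hne : N.divisors.Nonempty := ⟨1, Nat.one_mem_divisors.2 h.sqf.ne_zero⟩
  refine ⟨⋃ e ∈ N.divisors, mb (A e) '' rect N Y, ?_, ?_, N.divisors.inf' hne δ, ?_, ?_⟩
  · refine N.divisors.isCompact_biUnion fun e he => (isCompact_rect N Y).image_of_continuousOn ?_
    have he' := Nat.dvd_of_mem_divisors he
    exact (differentiableOn_mb (AL_det_pos (h.pos he') (hA e he'))).continuousOn.mono
      fun z hz => im_pos_of_mem_rect h.sqf.ne_zero hz
  · intro z hz
    simp only [Set.mem_iUnion] at hz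
    obtain ⟨e, he, w, hw, rfl⟩ := hz
    have he' := Nat.dvd_of_mem_divisors he
    exact im_mb_pos (AL_det_pos (h.pos he') (hA e he')) (im_pos_of_mem_rect h.sqf.ne_zero hw)
  · rw [gt_iff_lt, Finset.lt_inf'_iff]
    exact fun e he => hδ e (Nat.dvd_of_mem_divisors he)
  · intro z hz hzs
    obtain ⟨e, he, M, hM, w, hw1, hw2, hw3, hMz⟩ := exists_reduced h.sqf hA hz
    have hemem : e ∈ N.divisors := Nat.mem_divisors.2 ⟨he, h.sqf.ne_zero⟩
    refine ⟨M, hM, ?_⟩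
    simp only [Set.mem_iUnion]
    refine ⟨e, hemem, w, mem_reProdIm.2 ⟨⟨hw2, hw3⟩, hw1, ?_⟩, hMz.symm⟩
    by_contra hlt
    have h1 := hY w (not_le.1 hlt).le e hemem
    rw [← hMz, h.inv M hM z hz] at h1
    exact absurd (hzs.trans_le (Finset.inf'_le _ hemem)) (not_lt.2 h1)

end FrickeTrace

namespace FrickeTrace

open Filter Topology
open UpperHalfPlane (upperHalfPlaneSet)

lemma finite_int_matrix_bounded (B : ℝ) : {M : IM | ∀ i j, |(M i j : ℝ)| ≤ B}.Finite := by
  have h : (Set.Icc (fun _ _ => -⌈B⌉) (fun _ _ => ⌈B⌉) : Set (Fin 2 → Fin 2 → ℤ)).Finite :=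
    Set.finite_Icc _ _
  refine h.subset fun M hM => ⟨fun i j => ?_, fun i j => ?_⟩
  · have := (abs_le.1 (hM i j)).1
    have h2 : ((-M i j : ℤ) : ℝ) ≤ ⌈B⌉ := by push_cast; linarith [Int.le_ceil B]
    have h3 : -M i j ≤ ⌈B⌉ := by exact_mod_cast h2
    change -⌈B⌉ ≤ M i j
    linarith
  · have := (abs_le.1 (hM i j)).2
    have h2 : ((M i j : ℤ) : ℝ) ≤ ⌈B⌉ := by linarith [Int.le_ceil B]
    exact_mod_cast h2

lemma abs_le_of_norm_linear {a b : ℤ} {z : ℂ} {c R B : ℝ} (hc : 0 < c) (hz : c ≤ z.im)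
    (hR : ‖z‖ ≤ R) (h : ‖(a : ℂ) * z + b‖ ≤ B) :
    |(a : ℝ)| ≤ B / c ∧ |(b : ℝ)| ≤ B + B / c * R := by
  have h1 : |(a : ℝ)| * z.im ≤ B := by
    have := (abs_im_le_norm ((a : ℂ) * z + b)).trans h
    simp only [add_im, mul_im, intCast_re, intCast_im, zero_mul, add_zero] at this
    rwa [abs_mul, abs_of_pos (hc.trans_le hz)] at this
  have h2 : |(a : ℝ)| ≤ B / c := by
    rw [le_div_iff₀ hc]
    exact (mul_le_mul_of_nonneg_left hz (abs_nonneg _)).trans h1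
  refine ⟨h2, ?_⟩
  have h3 : ‖(b : ℂ)‖ ≤ ‖(a : ℂ) * z + b‖ + ‖(a : ℂ) * z‖ := by
    have := norm_sub_le ((a : ℂ) * z + b) ((a : ℂ) * z)
    rwa [add_sub_cancel_left] at this
  rw [norm_mul, norm_intCast, norm_intCast] at h3
  have h4 : |(a : ℝ)| * ‖z‖ ≤ B / c * R :=
    mul_le_mul h2 hR (norm_nonneg _) ((abs_nonneg _).trans h2)
  linarith

/-- Proper discontinuity for integral matrices of a fixed positive determinant. -/
lemma finite_mb_compact (n : ℤ) {K L : Set ℂ} (hK : IsCompact K) (hL : IsCompact L)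
    (hKp : K ⊆ upperHalfPlaneSet) (hLp : L ⊆ upperHalfPlaneSet) :
    {M : IM | M.det = n ∧ 0 < n ∧ ∃ z ∈ K, mb M z ∈ L}.Finite := by
  by_cases hne : K.Nonempty ∧ L.Nonempty
  swap
  · refine Set.finite_empty.subset ?_
    rintro M ⟨-, -, z, hz, hz2⟩
    exact hne ⟨⟨z, hz⟩, ⟨_, hz2⟩⟩
  obtain ⟨zK, hzK, hminK⟩ := hK.exists_isMinOn hne.1 continuous_im.continuousOn
  obtain ⟨zL, hzL, hminL⟩ := hL.exists_isMinOn hne.2 continuous_im.continuousOn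
  obtain ⟨RK, hRK⟩ := hK.exists_bound_of_continuousOn (f := id) continuousOn_id
  obtain ⟨RL, hRL⟩ := hL.exists_bound_of_continuousOn (f := id) continuousOn_id
  have hc1 : 0 < zK.im := hKp hzK
  have hc2 : 0 < zL.im := hLp hzL
  set B : ℝ := Real.sqrt (n * RK / zL.im) with hB
  set B' : ℝ := RL * B with hB'
  refine (finite_int_matrix_bounded (max (max (B / zK.im) (B + B / zK.im * RK))
    (max (B' / zK.im) (B' + B' / zK.im * RK)))).subset ?_
  rintro M ⟨hdet, hn, z, hz, hMz⟩
  have hzp : 0 < z.im := hKp hz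
  have hd := den_ne_zero (hdet ▸ hn) hzp
  have hzR : ‖z‖ ≤ RK := hRK z hz
  have h1 : ‖den M z‖ ≤ B := by
    have h2 : zL.im ≤ (mb M z).im := hminL hMz
    rw [im_mb, hdet, le_div_iff₀ (normSq_pos.2 hd)] at h2
    rw [hB]
    refine Real.le_sqrt_of_sq_le ?_
    rw [le_div_iff₀ hc2, ← normSq_eq_norm_sq]
    have h3 : z.im ≤ RK := (le_abs_self _).trans ((abs_im_le_norm z).trans hzR)
    have h4 : (0 : ℝ) < n := by exact_mod_cast hn
    nlinarith
  have h2 : ‖(M 0 0 : ℂ) * z + M 0 1‖ ≤ B' := by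
    have h3 : (M 0 0 : ℂ) * z + M 0 1 = mb M z * den M z := by
      rw [mb, div_mul_cancel₀ _ hd]
    rw [h3, norm_mul]
    exact mul_le_mul (hRL _ hMz) h1 (norm_nonneg _) ((norm_nonneg _).trans (hRL _ hMz))
  have h3 := abs_le_of_norm_linear hc1 (hminK hz) hzR h1
  have h4 := abs_le_of_norm_linear hc1 (hminK hz) hzR h2
  intro i j
  fin_cases i <;> fin_cases j <;> simp only [Fin.zero_eta, Fin.mk_one, Fin.isValue, le_max_iff]
  · exact Or.inr (Or.inl h4.1)
  · exact Or.inr (Or.inr h4.2)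
  · exact Or.inl (Or.inl h3.1)
  · exact Or.inl (Or.inr h3.2)

/-- `Γ₀(N)`-equivalence of points. -/
def Eqv (N : ℕ) (z w : ℂ) : Prop := ∃ M ∈ G0 N, mb M z = w

lemma Eqv.symm {N : ℕ} {z w : ℂ} (hz : 0 < z.im) : Eqv N z w → Eqv N w z := by
  rintro ⟨M, hM, rfl⟩
  exact ⟨_, G0_adj hM, by
    rw [← mb_mul _ (den_ne_zero (G0_det_pos hM) hz), G0_adj_mul hM, mb_one]⟩

lemma Eqv.trans {N : ℕ} {z w u : ℂ} (hz : 0 < z.im) : Eqv N z w → Eqv N w u → Eqv N z u := by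
  rintro ⟨M, hM, rfl⟩ ⟨L, hL, rfl⟩
  exact ⟨_, G0_mul hL hM, mb_mul _ (den_ne_zero (G0_det_pos hM) hz)⟩

lemma continuousAt_mb {M : IM} (hM : 0 < M.det) {z : ℂ} (hz : 0 < z.im) : ContinuousAt (mb M) z :=
  (hasDerivAt_mb (den_ne_zero hM hz)).continuousAt

lemma exists_compact_nhds {z : ℂ} (hz : 0 < z.im) :
    ∃ K ∈ 𝓝 z, IsCompact K ∧ K ⊆ upperHalfPlaneSet := by
  obtain ⟨K, h1, h2, h3⟩ := local_compact_nhds (UpperHalfPlane.isOpen_upperHalfPlaneSet.mem_nhds hz)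
  exact ⟨K, h1, h3, h2⟩

lemma eventually_mb_eq {n : ℤ} (hn : 0 < n) {z w : ℂ} (hz : 0 < z.im) (hw : 0 < w.im) :
    ∀ᶠ p in 𝓝 z ×ˢ 𝓝 w, ∀ M : IM, M.det = n → mb M p.1 = p.2 → mb M z = w := by
  obtain ⟨K, hK1, hK2, hK3⟩ := exists_compact_nhds hz
  obtain ⟨L, hL1, hL2, hL3⟩ := exists_compact_nhds hw
  have hfin := finite_mb_compact n hK2 hL2 hK3 hL3
  have h1 : ∀ᶠ p in 𝓝 z ×ˢ 𝓝 w, ∀ M ∈ {M : IM | M.det = n ∧ 0 < n ∧ ∃ z ∈ K, mb M z ∈ L},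
      mb M p.1 = p.2 → mb M z = w := by
    refine (eventually_all_finite hfin).2 fun M hM => ?_
    by_cases hMz : mb M z = w
    · exact Eventually.of_forall fun _ _ => hMz
    · have hc : Tendsto (fun p : ℂ × ℂ => mb M p.1 - p.2) (𝓝 z ×ˢ 𝓝 w) (𝓝 (mb M z - w)) :=
        ((continuousAt_mb (hM.1.symm ▸ hn) hz).tendsto.comp tendsto_fst).sub tendsto_snd
      filter_upwards [hc.eventually_ne (sub_ne_zero.2 hMz)] with p hp h0
      exact absurd h0 (sub_ne_zero.1 hp)
  filter_upwards [h1, prod_mem_prod hK1 hL1] with p hp hpm M hM hMp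
  exact hp M ⟨hM, hn, p.1, hpm.1, hMp ▸ hpm.2⟩ hMp

lemma eventually_not_eqv {N : ℕ} {z w : ℂ} (hz : 0 < z.im) (hw : 0 < w.im) (h : ¬ Eqv N z w) :
    ∀ᶠ p in 𝓝 z ×ˢ 𝓝 w, ¬ Eqv N p.1 p.2 := by
  filter_upwards [eventually_mb_eq one_pos hz hw] with p hp
  rintro ⟨M, hM, hMp⟩
  exact h ⟨M, hM, hp M hM.1 hMp⟩

variable {N : ℕ} {t v : ℂ → ℂ} {γ κ : ℕ → ℂ}

lemma Haupt.eqv (h : Haupt N t v γ κ) {z w : ℂ} (hz : 0 < z.im) : Eqv N z w → t w = t z := by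
  rintro ⟨M, hM, rfl⟩; exact h.inv M hM z hz

lemma eqv_of_qc_eq (N : ℕ) {z w : ℂ} (h : qc z = qc w) : Eqv N z w := by
  rw [qc, qc, Complex.exp_eq_exp_iff_exists_int] at h
  obtain ⟨n, hn⟩ := h
  refine ⟨!![1, -n; 0, 1], by simp [G0, det_fin_two], ?_⟩
  have h2 : (2 * Real.pi * I : ℂ) ≠ 0 := Complex.two_pi_I_ne_zero
  have h3 : z = w + n := mul_left_cancel₀ h2 (by rw [hn]; ring)
  simp [mb, den, h3]

lemma Haupt.inj_near_infty (h : Haupt N t v γ κ) : ∃ Y : ℝ, ∀ z w : ℂ, Y ≤ z.im → Y ≤ w.im →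
    t z = t w → Eqv N z w := by
  have hs : HasStrictDerivAt v (deriv v 0) 0 :=
    ((h.vdiff.analyticOnNhd Metric.isOpen_ball) 0 (by simp)).hasStrictDerivAt
  obtain ⟨K, S, hS, hK⟩ := hs.hasStrictFDerivAt.exists_lipschitzOnWith
  obtain ⟨ε, hε, hεS⟩ := Metric.mem_nhds_iff.1 hS
  obtain ⟨Y, hY⟩ := exists_im_norm_qc_lt
    (show 0 < min ε (min 1 (1 / (K + 1 : ℝ))) by positivity)
  refine ⟨max Y 1, fun z w hz hw htt => eqv_of_qc_eq N ?_⟩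
  have hz1 := hY z ((le_max_left _ _).trans hz)
  have hw1 := hY w ((le_max_left _ _).trans hw)
  have hzp : 0 < z.im := lt_of_lt_of_le one_pos ((le_max_right _ _).trans hz)
  have hwp : 0 < w.im := lt_of_lt_of_le one_pos ((le_max_right _ _).trans hw)
  rw [h.eq z hzp, h.eq w hwp] at htt
  set a := qc z
  set b := qc w
  have ha : a ≠ 0 := qc_ne_zero z
  have hb : b ≠ 0 := qc_ne_zero w
  have hmem : ∀ x : ℂ, ‖x‖ < min ε (min 1 (1 / (K + 1 : ℝ))) → x ∈ S := fun x hx =>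
    hεS (by simpa using hx.trans_le (min_le_left _ _))
  have hlip := hK.norm_sub_le (hmem a hz1) (hmem b hw1)
  have h1 : a - b = a * b * (v a - v b) := by
    field_simp at htt
    linear_combination -htt
  by_contra hab
  have hpos : 0 < ‖a - b‖ := norm_pos_iff.2 (sub_ne_zero.2 hab)
  have h2 : ‖a - b‖ ≤ ‖a‖ * ‖b‖ * (K * ‖a - b‖) := by
    calc ‖a - b‖ = ‖a‖ * ‖b‖ * ‖v a - v b‖ := by rw [h1]; simp
      _ ≤ _ := by gcongr
  have h3 : ‖a‖ < 1 := hz1.trans_le ((min_le_right _ _).trans (min_le_left _ _))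
  have h4 : ‖b‖ < 1 / (K + 1) := hw1.trans_le ((min_le_right _ _).trans (min_le_right _ _))
  rw [lt_div_iff₀ (by positivity)] at h4
  have hK0 : (0 : ℝ) ≤ K := K.2
  have h5 : ‖a‖ * ‖b‖ * K < 1 := by
    calc ‖a‖ * ‖b‖ * K ≤ 1 * ‖b‖ * K := by gcongr
      _ ≤ ‖b‖ * (K + 1) := by rw [one_mul]; gcongr; linarith
      _ < 1 := h4
  nlinarith

lemma Haupt.exists_large (h : Haupt N t v γ κ) (Y : ℝ) : ∃ C : ℝ, ∀ z : ℂ, 0 < z.im →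
    C ≤ ‖t z‖ → ∃ w, Eqv N z w ∧ Y ≤ w.im := by
  choose! A hA using fun e (he : e ∣ N) => AL_nonempty h.sqf he
  have hN0 := h.sqf.ne_zero
  have hrect : ∀ e, e ∣ N → ∀ Y, ∃ C : ℝ, ∀ w ∈ rect N Y, ‖t (mb (A e) w)‖ ≤ C := by
    intro e he Y
    refine (isCompact_rect N Y).exists_bound_of_continuousOn ?_
    exact (differentiableOn_comp_mb h.diff (AL_det_pos (h.pos he) (hA e he))).continuousOn.mono
      fun z hz => im_pos_of_mem_rect hN0 hz
  have key : ∀ e, e ∣ N → ∃ C : ℝ, ∀ w : ℂ, 1 / (2 * N : ℝ) ≤ w.im → 0 ≤ w.re → w.re ≤ 1 →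
      C ≤ ‖t (mb (A e) w)‖ → e = 1 ∧ Y ≤ w.im := by
    intro e he
    by_cases he1 : e = 1
    · obtain ⟨C, hC⟩ := hrect e he Y
      refine ⟨C + 1, fun w h1 h2 h3 h4 => ⟨he1, ?_⟩⟩
      by_contra hlt
      have := hC w (mem_reProdIm.2 ⟨⟨h2, h3⟩, h1, (not_le.1 hlt).le⟩)
      linarith
    · obtain ⟨Y', hY'⟩ := eventually_lI.1
        ((h.tendsto_gamma he he1 (hA e he)).norm.eventually_lt_const (lt_add_one ‖γ e‖))
      obtain ⟨C, hC⟩ := hrect e he Y'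
      refine ⟨max (C + 1) (‖γ e‖ + 1), fun w h1 h2 h3 h4 => ?_⟩
      exfalso
      rcases le_total Y' w.im with h5 | h5
      · exact absurd ((le_max_right _ _).trans h4) (not_le.2 (hY' w h5))
      · have := hC w (mem_reProdIm.2 ⟨⟨h2, h3⟩, h1, h5⟩)
        linarith [(le_max_left _ _).trans h4]
  choose! C hC using key
  have hne : N.divisors.Nonempty := ⟨1, Nat.one_mem_divisors.2 hN0⟩
  refine ⟨N.divisors.sup' hne C, fun z hz hzC => ?_⟩
  obtain ⟨e, he, M, hM, w, hw1, hw2, hw3, hMz⟩ := exists_reduced h.sqf hA hz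
  have h1 : C e ≤ ‖t (mb (A e) w)‖ := by
    rw [← hMz, h.inv M hM z hz]
    exact (Finset.le_sup' C (Nat.mem_divisors.2 ⟨he, hN0⟩)).trans hzC
  obtain ⟨rfl, h2⟩ := hC e he w hw1 hw2 hw3 h1
  have hA1 := hA 1 he
  rw [AL_one] at hA1
  have hwp : 0 < w.im := lt_of_lt_of_le (by positivity) hw1
  exact ⟨w, Eqv.trans hz ⟨M, hM, hMz⟩ (Eqv.symm hwp ⟨_, hA1, rfl⟩), h2⟩

lemma Haupt.inj_large (h : Haupt N t v γ κ) : ∃ C : ℝ, ∀ z w : ℂ, 0 < z.im → 0 < w.im →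
    t z = t w → C ≤ ‖t z‖ → Eqv N z w := by
  obtain ⟨Y, hY⟩ := h.inj_near_infty
  obtain ⟨C, hC⟩ := h.exists_large (max Y 1)
  refine ⟨C, fun z w hz hw htt hCz => ?_⟩
  obtain ⟨z', hz', hzY⟩ := hC z hz hCz
  obtain ⟨w', hw', hwY⟩ := hC w hw (htt ▸ hCz)
  have hzp : 0 < z'.im := lt_of_lt_of_le one_pos ((le_max_right _ _).trans hzY)
  have h1 : Eqv N z' w' := hY z' w' ((le_max_left _ _).trans hzY) ((le_max_left _ _).trans hwY)
    (by rw [h.eqv hz hz', h.eqv hw hw', htt])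
  exact hz'.trans hz (h1.trans hzp (hw'.symm hw))

end FrickeTrace

namespace FrickeTrace

open Filter Topology
open UpperHalfPlane (upperHalfPlaneSet isOpen_upperHalfPlaneSet)

lemma isPreconnected_upperHalfPlaneSet : IsPreconnected upperHalfPlaneSet :=
  (convex_halfSpace_im_gt 0).isPreconnected

lemma countable_of_isolated {Z : Set ℂ} (h : ∀ z ∈ Z, ∀ᶠ w in 𝓝[≠] z, w ∉ Z) : Z.Countable := by
  have h1 : ∀ z ∈ Z, {w | w ∈ Z → w = z} ∈ 𝓝[Z] z := by
    intro z hz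
    refine mem_nhdsWithin_of_mem_nhds ?_
    have := eventually_nhdsWithin_iff.1 (h z hz)
    filter_upwards [this] with w hw hwZ
    by_contra hne
    exact hw hne hwZ
  obtain ⟨T, hTZ, hT, hcov⟩ := TopologicalSpace.countable_cover_nhdsWithin h1
  refine hT.mono fun z hz => ?_
  obtain ⟨w, hw, hzw⟩ := Set.mem_iUnion₂.1 (hcov hz)
  rw [show z = w from hzw hz]
  exact hw

lemma bddInf_of_tendsto {F : ℂ → ℂ} {c : ℂ} (h : Tendsto F lI (𝓝 c)) : BddInf F := by
  obtain ⟨Y, hY⟩ := eventually_lI.1 (h.norm.eventually_lt_const (lt_add_one ‖c‖))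
  exact ⟨_, Y, fun z hz => (hY z hz).le⟩

variable {N : ℕ} {t v : ℂ → ℂ} {γ κ : ℕ → ℂ}

lemma Haupt.analyticOnNhd (h : Haupt N t v γ κ) : AnalyticOnNhd ℂ t upperHalfPlaneSet :=
  h.diff.analyticOnNhd isOpen_upperHalfPlaneSet

lemma Haupt.not_const (h : Haupt N t v γ κ) {z : ℂ} (hz : 0 < z.im) (c : ℂ) :
    ¬ ∀ᶠ w in 𝓝 z, t w = c := by
  intro hc
  have h1 := h.analyticOnNhd.eqOn_of_preconnected_of_eventuallyEq (g := fun _ => c)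
    analyticOnNhd_const isPreconnected_upperHalfPlaneSet hz hc
  have h2 := (tendsto_norm_atTop_iff_cobounded.2 h.tendsto_cobounded).eventually_ge_atTop (‖c‖ + 1)
  obtain ⟨w, hw1, hw2⟩ := (h2.and eventually_im_pos).exists
  rw [h1 hw2] at hw1
  linarith

lemma Haupt.nhds_le_map (h : Haupt N t v γ κ) {z : ℂ} (hz : 0 < z.im) :
    𝓝 (t z) ≤ map t (𝓝 z) :=
  (h.analyticOnNhd z hz).eventually_constant_or_nhds_le_map_nhds.resolve_left (h.not_const hz _)

lemma Haupt.countable_crit (h : Haupt N t v γ κ) :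
    {z : ℂ | 0 < z.im ∧ deriv t z = 0}.Countable := by
  refine countable_of_isolated fun z hz => ?_
  have ha : AnalyticAt ℂ (deriv t) z := (h.analyticOnNhd z hz.1).deriv
  rcases ha.eventually_eq_zero_or_eventually_ne_zero with h0 | h0
  · exfalso
    obtain ⟨r, hr, hball⟩ := Metric.mem_nhds_iff.1
      (h0.and (isOpen_upperHalfPlaneSet.mem_nhds hz.1))
    refine h.not_const hz.1 (t z) ?_
    filter_upwards [Metric.ball_mem_nhds z hr] with w hw
    refine (convex_ball z r).is_const_of_fderivWithin_eq_zero (𝕜 := ℂ)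
      (h.diff.mono fun x hx => (hball hx).2) ?_ hw (Metric.mem_ball_self hr)
    intro x hx
    rw [fderivWithin_of_isOpen Metric.isOpen_ball hx]
    ext
    simpa using (hball hx).1
  · filter_upwards [h0] with w hw hwZ
    exact hw hwZ.2

/-- A Hauptmodul separates orbits. -/
theorem Haupt.injective (h : Haupt N t v γ κ) {z w : ℂ} (hz : 0 < z.im) (hw : 0 < w.im)
    (htt : t z = t w) : Eqv N z w := by
  set S : Set ℂ := {s | ∃ z w : ℂ, 0 < z.im ∧ 0 < w.im ∧ t z = s ∧ t w = s ∧ ¬ Eqv N z w} with hS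
  set B : Set ℂ := t '' {z : ℂ | 0 < z.im ∧ deriv t z = 0} ∪ γ '' (N.divisors : Set ℕ) with hB
  have hBc : B.Countable := (h.countable_crit.image t).union
    ((Finset.finite_toSet _).countable.image γ)
  have hBconn : IsPreconnected Bᶜ :=
    (hBc.isPathConnected_compl_of_one_lt_rank (by simp)).isConnected.isPreconnected
  have hBd : Dense Bᶜ := hBc.dense_compl ℂ
  have hSo : IsOpen S := by
    rw [isOpen_iff_mem_nhds]
    rintro s ⟨a, b, ha, hb, rfl, hba, hab⟩
    obtain ⟨U, hU, V, hV, hUV⟩ := mem_prod_iff.1 (eventually_not_eqv ha hb hab)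
    have hUo := isOpen_upperHalfPlaneSet.mem_nhds ha
    have hVo := isOpen_upperHalfPlaneSet.mem_nhds hb
    have h1 : t '' (U ∩ upperHalfPlaneSet) ∈ 𝓝 (t a) :=
      h.nhds_le_map ha (image_mem_map (inter_mem hU hUo))
    have h2 : t '' (V ∩ upperHalfPlaneSet) ∈ 𝓝 (t a) :=
      hba ▸ h.nhds_le_map hb (image_mem_map (inter_mem hV hVo))
    filter_upwards [h1, h2] with s hs1 hs2
    obtain ⟨x, ⟨hx1, hx2⟩, hx3⟩ := hs1
    obtain ⟨y, ⟨hy1, hy2⟩, hy3⟩ := hs2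
    exact ⟨x, y, hx2, hy2, hx3, hy3, hUV (Set.mk_mem_prod hx1 hy1)⟩
  have hcl : closure S ∩ Bᶜ ⊆ S := by
    rintro s ⟨hs, hsB⟩
    have hsγ : ∀ e, e ∣ N → e ≠ 1 → s ≠ γ e := fun e he _ h0 =>
      hsB (Or.inr ⟨e, by simpa using ⟨he, h.sqf.ne_zero⟩, h0.symm⟩)
    obtain ⟨K, hK, hKp, δ, hδ, hKδ⟩ := h.isCompact hsγ
    obtain ⟨u, hu, hus⟩ := mem_closure_iff_seq_limit.1 hs
    have hev : ∀ᶠ n in atTop, ∃ a b : ℂ, a ∈ K ∧ b ∈ K ∧ t a = u n ∧ t b = u n ∧ ¬ Eqv N a b := by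
      filter_upwards [(Metric.tendsto_nhds.1 hus) δ hδ] with n hn
      obtain ⟨a, b, ha, hb, hau, hbu, hab⟩ := hu n
      rw [dist_eq_norm] at hn
      obtain ⟨M, hM, hMa⟩ := hKδ a ha (by rw [hau]; exact hn)
      obtain ⟨L, hL, hLb⟩ := hKδ b hb (by rw [hbu]; exact hn)
      refine ⟨_, _, hMa, hLb, by rw [h.inv M hM a ha, hau], by rw [h.inv L hL b hb, hbu], ?_⟩
      intro h0
      exact hab (Eqv.trans ha ⟨M, hM, rfl⟩ (h0.trans (im_mb_pos (G0_det_pos hM) ha)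
        (Eqv.symm hb ⟨L, hL, rfl⟩)))
    obtain ⟨n0, hn0⟩ := eventually_atTop.1 hev
    choose! a b haK hbK hau hbu hab using hn0
    obtain ⟨⟨x, y⟩, hxy, φ, hφ, hlim⟩ := (hK.prod hK).tendsto_subseq
      (x := fun n => (a (n + n0), b (n + n0)))
      (fun n => ⟨haK _ (Nat.le_add_left _ _), hbK _ (Nat.le_add_left _ _)⟩)
    have hx : 0 < x.im := hKp hxy.1
    have hy : 0 < y.im := hKp hxy.2
    have hax : Tendsto (fun n => a (φ n + n0)) atTop (𝓝 x) :=
      (continuous_fst.tendsto _).comp hlim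
    have hby : Tendsto (fun n => b (φ n + n0)) atTop (𝓝 y) :=
      (continuous_snd.tendsto _).comp hlim
    have hus' : Tendsto (fun n => u (φ n + n0)) atTop (𝓝 s) :=
      hus.comp ((tendsto_add_atTop_nat n0).comp hφ.tendsto_atTop)
    have htx : t x = s := tendsto_nhds_unique
      (((h.analyticOnNhd x hx).continuousAt.tendsto.comp hax).congr
        fun n => hau _ (Nat.le_add_left _ _)) hus'
    have hty : t y = s := tendsto_nhds_unique
      (((h.analyticOnNhd y hy).continuousAt.tendsto.comp hby).congr
        fun n => hbu _ (Nat.le_add_left _ _)) hus'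
    refine ⟨x, y, hx, hy, htx, hty, ?_⟩
    intro hE
    obtain ⟨M, hM, hMy⟩ := hE.symm hx
    have hMb : Tendsto (fun n => mb M (b (φ n + n0))) atTop (𝓝 x) :=
      hMy ▸ (continuousAt_mb (G0_det_pos hM) hy).tendsto.comp hby
    have hdx : deriv t x ≠ 0 := fun h0 => hsB (Or.inl ⟨x, ⟨hx, h0⟩, htx⟩)
    have hsd := (h.analyticOnNhd x hx).hasStrictDerivAt
    have hinj := hsd.hasStrictFDerivAt_equiv hdx
    have hleft := hinj.eventually_left_inverse
    obtain ⟨n, h1, h2⟩ := ((hax.eventually hleft).and (hMb.eventually hleft)).exists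
    have hn : n0 ≤ φ n + n0 := Nat.le_add_left _ _
    rw [hau _ hn] at h1
    rw [h.inv M hM _ (hKp (hbK _ hn)), hbu _ hn] at h2
    exact hab _ hn (Eqv.symm (hKp (hbK _ hn)) ⟨M, hM, h2.symm.trans h1⟩)
  by_contra hE
  have hmem : t z ∈ S := ⟨z, w, hz, hw, rfl, htt.symm, hE⟩
  obtain ⟨s, hsS, hsB⟩ := hBd.inter_open_nonempty S hSo ⟨_, hmem⟩
  have hsub := hBconn.subset_of_closure_inter_subset hSo ⟨s, hsB, hsS⟩ hcl
  obtain ⟨C, hC⟩ := h.inj_large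
  obtain ⟨s', hs'1, hs'2⟩ := hBd.inter_open_nonempty {s : ℂ | C < ‖s‖}
    (isOpen_lt continuous_const continuous_norm) (by
      obtain ⟨x, hx⟩ := NormedSpace.exists_lt_norm ℂ ℂ C
      exact ⟨x, hx⟩)
  obtain ⟨a, b, ha, hb, hta, htb, hab⟩ := hsub hs'2
  exact hab (hC a b ha hb (by rw [hta, htb]) (by rw [hta]; exact le_of_lt hs'1))

end FrickeTrace

namespace FrickeTrace

open Filter Topology
open UpperHalfPlane (upperHalfPlaneSet isOpen_upperHalfPlaneSet)

/-- Local rotation by an `m`-th root of unity around a zero of order `m`. -/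
lemma exists_rotation {m : ℕ} (hm : m ≠ 0) {g : ℂ → ℂ} {z : ℂ} (hg : AnalyticAt ℂ g z)
    (hgz : g z ≠ 0) {ζ : ℂ} (hζ : ζ ^ m = 1) :
    ∃ φ : ℂ → ℂ, HasDerivAt φ ζ z ∧ φ z = z ∧
      ∀ᶠ w in 𝓝 z, (φ w - z) ^ m * g (φ w) = (w - z) ^ m * g w := by
  have hmc : (m : ℂ) ≠ 0 := by exact_mod_cast hm
  obtain ⟨r, hr⟩ := IsAlgClosed.exists_pow_nat_eq (g z) (Nat.pos_of_ne_zero hm)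
  have hr0 : r ≠ 0 := by
    rintro rfl
    rw [zero_pow hm] at hr
    exact hgz hr.symm
  set k : ℂ → ℂ := fun w => r * Complex.exp (Complex.log (g w / g z) / m) with hk
  have hka : AnalyticAt ℂ k z := by
    have h1 : AnalyticAt ℂ (fun w => g w / g z) z := hg.div_const
    have h2 : AnalyticAt ℂ (fun w => Complex.log (g w / g z)) z :=
      h1.clog (by rw [div_self hgz]; exact Complex.one_mem_slitPlane)
    exact analyticAt_const.mul (h2.div_const.cexp)
  have hkz : k z = r := by simp [hk, div_self hgz]
  have hkm : ∀ᶠ w in 𝓝 z, k w ^ m = g w := by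
    filter_upwards [hg.continuousAt.eventually_ne hgz] with w hw
    rw [hk, mul_pow, ← Complex.exp_nat_mul, mul_div_cancel₀ _ hmc,
      Complex.exp_log (div_ne_zero hw hgz), hr, mul_div_cancel₀ _ hgz]
  set h : ℂ → ℂ := fun w => (w - z) * k w with hh
  have hha : AnalyticAt ℂ h z := (analyticAt_id.sub analyticAt_const).mul hka
  have hhz : h z = 0 := by simp [hh]
  have hhd : deriv h z = r := by
    have h1 := ((hasDerivAt_id z).sub_const z).mul hka.differentiableAt.hasDerivAt
    have h2 : HasDerivAt h (1 * k z + (z - z) * deriv k z) z := h1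
    rw [h2.deriv, hkz]
    ring
  have hsd : HasStrictDerivAt h r z := hhd ▸ hha.hasStrictDerivAt
  have hinv := hsd.to_localInverse hr0
  set ψ := hsd.localInverse h r z hr0 with hψ
  have hψz : ψ (h z) = z := (hsd.hasStrictFDerivAt_equiv hr0).localInverse_apply_image
  have hright : ∀ᶠ y in 𝓝 (h z), h (ψ y) = y :=
    (hsd.hasStrictFDerivAt_equiv hr0).eventually_right_inverse
  have hmul : HasDerivAt (fun w => ζ * h w) (ζ * r) z := hsd.hasDerivAt.const_mul ζ
  have hm0 : ζ * h z = h z := by rw [hhz, mul_zero]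
  have hφ : HasDerivAt (fun w => ψ (ζ * h w)) (r⁻¹ * (ζ * r)) z :=
    HasDerivAt.comp z (h₂ := ψ) (by rw [hm0]; exact hinv.hasDerivAt) hmul
  have hφz : ψ (ζ * h z) = z := by rw [hm0, hψz]
  have hφ' : HasDerivAt (fun w => ψ (ζ * h w)) ζ z := by
    convert hφ using 1
    field_simp
  refine ⟨fun w => ψ (ζ * h w), hφ', hφz, ?_⟩
  have hφt : Tendsto (fun w => ψ (ζ * h w)) (𝓝 z) (𝓝 z) := by
    have := hφ'.continuousAt.tendsto
    rwa [hφz] at this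
  have hmt : Tendsto (fun w => ζ * h w) (𝓝 z) (𝓝 (h z)) := by
    have := hmul.continuousAt.tendsto
    rwa [hm0] at this
  filter_upwards [hkm, hφt.eventually hkm, hmt.eventually hright] with w h1 h2 h3
  rw [← h1, ← h2, ← mul_pow, ← mul_pow]
  change h (ψ (ζ * h w)) ^ m = h w ^ m
  rw [h3, mul_pow, hζ, one_mul]

variable {N : ℕ} {t v : ℂ → ℂ} {γ κ : ℕ → ℂ}

/-- The ramification index of `t` at `z`. -/
noncomputable def mo (t : ℂ → ℂ) (z : ℂ) : ℕ := analyticOrderNatAt (fun w => t w - t z) z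

lemma Haupt.order_ne_top (h : Haupt N t v γ κ) {z : ℂ} (hz : 0 < z.im) (c : ℂ) :
    analyticOrderAt (fun w => t w - c) z ≠ ⊤ := by
  intro h0
  refine h.not_const hz c ?_
  filter_upwards [analyticOrderAt_eq_top.1 h0] with w hw
  exact sub_eq_zero.1 hw

lemma Haupt.analyticAt_sub (h : Haupt N t v γ κ) {z : ℂ} (hz : 0 < z.im) (c : ℂ) :
    AnalyticAt ℂ (fun w => t w - c) z := (h.analyticOnNhd z hz).sub analyticAt_const

lemma Haupt.order_eq (h : Haupt N t v γ κ) {z : ℂ} (hz : 0 < z.im) :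
    analyticOrderAt (fun w => t w - t z) z = mo t z :=
  (Nat.cast_analyticOrderNatAt (h.order_ne_top hz _)).symm

lemma Haupt.mo_ne_zero (h : Haupt N t v γ κ) {z : ℂ} (hz : 0 < z.im) : mo t z ≠ 0 := by
  intro h0
  have h1 := h.order_eq hz
  rw [h0, Nat.cast_zero] at h1
  exact (h.analyticAt_sub hz (t z)).analyticOrderAt_eq_zero.1 h1 (sub_self _)

lemma Haupt.factor (h : Haupt N t v γ κ) {z : ℂ} (hz : 0 < z.im) :
    ∃ g : ℂ → ℂ, AnalyticAt ℂ g z ∧ g z ≠ 0 ∧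
      ∀ᶠ w in 𝓝 z, t w - t z = (w - z) ^ mo t z * g w := by
  simpa using ((h.analyticAt_sub hz (t z)).analyticOrderAt_eq_natCast).1 (h.order_eq hz)

/-- Every rotation by a root of unity of order dividing the ramification index is realised by the
derivative of an element of the stabiliser. -/
theorem Haupt.exists_stab (h : Haupt N t v γ κ) {z : ℂ} (hz : 0 < z.im) {ζ : ℂ}
    (hζ : ζ ^ mo t z = 1) : ∃ M ∈ G0 N, mb M z = z ∧ den M z ^ 2 * ζ = 1 := by
  obtain ⟨g, hg, hgz, hfac⟩ := h.factor hz
  obtain ⟨φ, hφ, hφz, hφe⟩ := exists_rotation (h.mo_ne_zero hz) hg hgz hζ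
  have hφt : Tendsto φ (𝓝 z) (𝓝 z) := by
    have := hφ.continuousAt.tendsto
    rwa [hφz] at this
  have him : ∀ᶠ w in 𝓝 z, 0 < w.im := isOpen_upperHalfPlaneSet.mem_nhds hz
  have h1 : ∀ᶠ w in 𝓝 z, ∃ M ∈ {M : IM | M ∈ G0 N ∧ mb M z = z}, mb M w = φ w := by
    filter_upwards [him, hφt.eventually him, hfac, hφt.eventually hfac, hφe,
      (tendsto_id.prodMk hφt).eventually (eventually_mb_eq one_pos hz hz)] with w a1 a2 a3 a4 a5 a6
    obtain ⟨M, hM, hMw⟩ := h.injective a1 a2 (by linear_combination a3 - a4 - a5)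
    exact ⟨M, ⟨hM, a6 M hM.1 hMw⟩, hMw⟩
  have hfin : {M : IM | M ∈ G0 N ∧ mb M z = z}.Finite := by
    refine (finite_mb_compact 1 (isCompact_singleton (x := z)) (isCompact_singleton (x := z))
      (by simpa using hz) (by simpa using hz)).subset ?_
    rintro M ⟨hM, hMz⟩
    exact ⟨hM.1, one_pos, z, rfl, hMz⟩
  obtain ⟨M, hM, hfr⟩ : ∃ M ∈ {M : IM | M ∈ G0 N ∧ mb M z = z}, ∃ᶠ w in 𝓝[≠] z, mb M w = φ w := by
    by_contra! hno
    have h2 : ∀ᶠ w in 𝓝[≠] z, ∀ M ∈ {M : IM | M ∈ G0 N ∧ mb M z = z}, ¬ mb M w = φ w :=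
      (eventually_all_finite hfin).2 fun M hM => hno M hM
    obtain ⟨w, hw1, M, hM, hMw⟩ := (h2.and (h1.filter_mono nhdsWithin_le_nhds)).exists
    exact hw1 M hM hMw
  refine ⟨M, hM.1, hM.2, ?_⟩
  have hden := den_ne_zero (G0_det_pos hM.1) hz
  have hd1 := hasDerivAt_iff_tendsto_slope.1 (hasDerivAt_mb hden)
  have hd2 := hasDerivAt_iff_tendsto_slope.1 hφ
  have hne : (𝓝[≠] z ⊓ 𝓟 {w | mb M w = φ w}).NeBot :=
    frequently_mem_iff_neBot.1 hfr
  have heq := tendsto_nhds_unique_of_eventuallyEq (hd1.mono_left inf_le_left)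
    (hd2.mono_left (inf_le_left (b := 𝓟 {w | mb M w = φ w}))) (by
      filter_upwards [mem_inf_of_right (mem_principal_self _)] with w hw
      rw [slope_def_field, slope_def_field, hM.2, hφz, show mb M w = φ w from hw])
  rw [← heq, hM.1.1]
  push_cast
  field_simp

/-- A Hauptmodul omits only its values at the other cusps. -/
theorem Haupt.surjective (h : Haupt N t v γ κ) {s : ℂ} (hs : ∀ e, e ∣ N → e ≠ 1 → s ≠ γ e) :
    ∃ z : ℂ, 0 < z.im ∧ t z = s := by
  by_contra! hno
  have hne : ∀ z : ℂ, 0 < z.im → t z - s ≠ 0 := fun z hz => sub_ne_zero.2 (hno z hz)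
  obtain ⟨c, hc⟩ := eq_const_of_bddInf_AL h.sqf (F := fun z => (t z - s)⁻¹)
    ((h.diff.sub_const s).inv hne) (fun M hM z hz => by rw [h.inv M hM z hz]) (by
      intro e he
      obtain ⟨A, hA⟩ := AL_nonempty h.sqf he
      by_cases he1 : e = 1
      · subst he1
        refine ⟨1, by rw [AL_one]; exact one_mem_G0 N, bddInf_of_tendsto (c := 0) ?_⟩
        simp only [mb_one]
        exact tendsto_inv₀_cobounded.comp (h.tendsto_sub_cobounded s)
      · refine ⟨A, hA, bddInf_of_tendsto (c := (γ e - s)⁻¹) ?_⟩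
        exact ((h.tendsto_gamma he he1 hA).sub_const s).inv₀ (sub_ne_zero.2 (hs e he he1).symm))
  have hI : (0 : ℝ) < Complex.I.im := by simp
  refine h.not_const hI (c⁻¹ + s) ?_
  filter_upwards [isOpen_upperHalfPlaneSet.mem_nhds hI] with w hw
  rw [← hc w hw]
  simp

end FrickeTrace

namespace FrickeTrace

open Filter Topology
open UpperHalfPlane (upperHalfPlaneSet isOpen_upperHalfPlaneSet)

lemma mb_sub_mb (M : IM) {w z : ℂ} (hw : den M w ≠ 0) (hz : den M z ≠ 0) :
    mb M w - mb M z = (w - z) * (M.det / (den M w * den M z)) := by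
  rw [mb, mb, div_sub_div _ _ hw hz, mul_div_assoc', det_fin_two]
  congr 1
  simp only [den]
  push_cast
  ring

lemma differentiable_den (M : IM) : Differentiable ℂ (den M) :=
  ((differentiable_const _).mul differentiable_id).add_const _

lemma analyticAt_mb {M : IM} (hM : 0 < M.det) {z : ℂ} (hz : 0 < z.im) : AnalyticAt ℂ (mb M) z := by
  rw [Complex.analyticAt_iff_eventually_differentiableAt]
  filter_upwards [isOpen_upperHalfPlaneSet.mem_nhds hz] with w hw
  exact (hasDerivAt_mb (den_ne_zero hM hw)).differentiableAt

/-- A matrix fixing `z` with multiplier `1` is scalar. -/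
lemma eq_scalar_of_den_sq {M : IM} (hM : 0 < M.det) {z : ℂ} (hz : 0 < z.im) (hfix : mb M z = z)
    (hd : den M z ^ 2 = M.det) : ∃ k : ℤ, M = k • 1 := by
  have hden := den_ne_zero hM hz
  have him : (den M z).im = 0 := by
    have h1 := congrArg Complex.im hd
    have h2 := congrArg Complex.re hd
    simp only [sq, Complex.mul_im, Complex.mul_re, Complex.intCast_im, Complex.intCast_re] at h1 h2
    by_contra h0
    have h3 : (den M z).re = 0 := by
      have : (den M z).im * (den M z).re = 0 := by linarith
      exact (mul_eq_zero.1 this).resolve_left h0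
    rw [h3] at h2
    have : (0 : ℝ) < M.det := by exact_mod_cast hM
    nlinarith [mul_self_nonneg (den M z).im]
  have hc : M 1 0 = 0 := by
    have h1 : (den M z).im = M 1 0 * z.im := by simp [den]
    rw [h1] at him
    exact_mod_cast (mul_eq_zero.1 him).resolve_right hz.ne'
  have hdz : den M z = M 1 1 := by simp [den, hc]
  have hdet : M.det = M 0 0 * M 1 1 := by rw [det_fin_two, hc]; ring
  rw [hdz, hdet] at hd
  have h11 : M 1 1 ≠ 0 := by
    rintro h0
    rw [hdz, h0] at hden
    simp at hden
  have h00 : M 0 0 = M 1 1 := by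
    have : M 1 1 * M 1 1 = M 0 0 * M 1 1 := by rw [← sq]; exact_mod_cast hd
    exact (mul_right_cancel₀ h11 this).symm
  have h01 : M 0 1 = 0 := by
    rw [mb, hdz, h00, div_eq_iff (by exact_mod_cast h11)] at hfix
    have : (M 0 1 : ℂ) = 0 := by linear_combination hfix
    exact_mod_cast this
  refine ⟨M 1 1, ?_⟩
  ext i j
  fin_cases i <;> fin_cases j <;> simp [hc, h00, h01]

variable {N : ℕ} {t v : ℂ → ℂ} {γ κ : ℕ → ℂ}

lemma Haupt.diff_factor (h : Haupt N t v γ κ) {M : IM} (hM : 0 < M.det) {z : ℂ} (hz : 0 < z.im)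
    (hfix : mb M z = z) : ∃ G : ℂ → ℂ, AnalyticAt ℂ G z ∧
      (G z = 0 ↔ (M.det / den M z ^ 2 : ℂ) ^ mo t z = 1) ∧
      ∀ᶠ w in 𝓝 z, t w - t (mb M w) = (w - z) ^ mo t z * G w := by
  obtain ⟨g, hg, hgz, hfac⟩ := h.factor hz
  have hden := den_ne_zero hM hz
  refine ⟨fun w => g w - (M.det / (den M w * den M z)) ^ mo t z * g (mb M w), ?_, ?_, ?_⟩
  · have h1 : AnalyticAt ℂ (fun w => (M.det : ℂ) / (den M w * den M z)) z :=
      analyticAt_const.div (((differentiable_den M).analyticAt z).mul analyticAt_const)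
        (mul_ne_zero hden hden)
    exact hg.sub ((h1.pow _).mul (AnalyticAt.comp (by rwa [hfix]) (analyticAt_mb hM hz)))
  · simp only [hfix]
    rw [sub_eq_zero, eq_comm, sq, mul_eq_right₀ hgz]
  · have hM' : Tendsto (mb M) (𝓝 z) (𝓝 z) := by
      simpa [hfix] using (continuousAt_mb hM hz).tendsto
    filter_upwards [hfac, hM'.eventually hfac, isOpen_upperHalfPlaneSet.mem_nhds hz] with w h1 h2 h3
    have h4 := mb_sub_mb M (den_ne_zero hM h3) hden
    rw [hfix] at h4
    rw [h4, mul_pow] at h2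
    linear_combination h1 - h2

lemma Haupt.den_pow_mo (h : Haupt N t v γ κ) {M : IM} (hM : M ∈ G0 N) {z : ℂ} (hz : 0 < z.im)
    (hfix : mb M z = z) : ((den M z ^ 2)⁻¹) ^ mo t z = 1 := by
  obtain ⟨G, hG, hGz, hev⟩ := h.diff_factor (G0_det_pos hM) hz hfix
  have h0 : G z = 0 := by
    have h1 : ∀ᶠ w in 𝓝[≠] z, G w = 0 := by
      filter_upwards [hev.filter_mono nhdsWithin_le_nhds, self_mem_nhdsWithin,
        mem_nhdsWithin_of_mem_nhds (isOpen_upperHalfPlaneSet.mem_nhds hz)] with w h1 h2 h3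
      rw [h.inv M hM w h3, sub_self] at h1
      exact (mul_eq_zero.1 h1.symm).resolve_left (pow_ne_zero _ (sub_ne_zero.2 h2))
    exact tendsto_nhds_unique_of_eventuallyEq
      (hG.continuousAt.tendsto.mono_left nhdsWithin_le_nhds) tendsto_const_nhds h1
  simpa [hM.1] using hGz.1 h0

lemma Haupt.order_sub_mb (h : Haupt N t v γ κ) {M : IM} (hM : 0 < M.det) {z : ℂ} (hz : 0 < z.im)
    (hfix : mb M z = z) (hns : ¬ ∃ k : ℤ, ∃ A ∈ G0 N, M = k • A) :
    analyticOrderAt (fun w => t w - t (mb M w)) z = mo t z := by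
  obtain ⟨G, hG, hGz, hev⟩ := h.diff_factor hM hz hfix
  have han : AnalyticAt ℂ (fun w => t w - t (mb M w)) z :=
    (h.analyticOnNhd z hz).sub
      (AnalyticAt.comp (h.analyticOnNhd _ (im_mb_pos hM hz)) (analyticAt_mb hM hz))
  refine han.analyticOrderAt_eq_natCast.2 ⟨G, hG, ?_, by simpa using hev⟩
  intro h0
  have hden := den_ne_zero hM hz
  have hdet : (M.det : ℂ) ≠ 0 := by exact_mod_cast hM.ne'
  obtain ⟨A, hA, hAz, hAd⟩ := h.exists_stab hz (ζ := (M.det / den M z ^ 2 : ℂ)⁻¹)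
    (by rw [inv_pow, hGz.1 h0, inv_one])
  have hdetB : (A * M).det = M.det := by rw [det_mul, hA.1, one_mul]
  have hBden : den (A * M) z ^ 2 = (A * M).det := by
    rw [hdetB, den_mul _ hden, hfix, mul_pow]
    rw [inv_div, mul_div_assoc', div_eq_one_iff_eq hdet] at hAd
    exact hAd
  obtain ⟨k, hk⟩ := eq_scalar_of_den_sq (hdetB ▸ hM) hz (by rw [mb_mul _ hden, hfix, hAz]) hBden
  refine hns ⟨k, A.adjugate, G0_adj hA, ?_⟩
  rw [← one_mul M, ← G0_adj_mul hA, Matrix.mul_assoc, hk, Matrix.mul_smul, Matrix.mul_one]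

/-- The stabiliser of `z` in `Γ₀(N)` has twice the ramification index as its order. -/
theorem Haupt.ncard_stab (h : Haupt N t v γ κ) {z : ℂ} (hz : 0 < z.im) :
    {M : IM | M ∈ G0 N ∧ mb M z = z}.Finite ∧
      {M : IM | M ∈ G0 N ∧ mb M z = z}.ncard = 2 * mo t z := by
  classical
  have hfin : {M : IM | M ∈ G0 N ∧ mb M z = z}.Finite := by
    refine (finite_mb_compact 1 (isCompact_singleton (x := z)) (isCompact_singleton (x := z))
      (by simpa using hz) (by simpa using hz)).subset ?_
    rintro M ⟨hM, hMz⟩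
    exact ⟨hM.1, one_pos, z, rfl, hMz⟩
  refine ⟨hfin, ?_⟩
  have hm : 0 < mo t z := Nat.pos_of_ne_zero (h.mo_ne_zero hz)
  rw [Set.ncard_eq_toFinset_card _ hfin, Finset.card_eq_sum_card_fiberwise
    (f := fun M => (den M z ^ 2)⁻¹) (t := Polynomial.nthRootsFinset (mo t z) (1 : ℂ)) (by
      intro M hM
      have hM' := hfin.mem_toFinset.1 hM
      exact (Polynomial.mem_nthRootsFinset hm 1).2 (h.den_pow_mo hM'.1 hz hM'.2)),
    Finset.sum_const_nat (m := 2), (Complex.isPrimitiveRoot_exp _ hm.ne').card_nthRootsFinset,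
    mul_comm]
  intro ζ hζ
  obtain ⟨A, hA, hAz, hAd⟩ := h.exists_stab hz ((Polynomial.mem_nthRootsFinset hm 1).1 hζ)
  have hA0 : den A z ≠ 0 := den_ne_zero (G0_det_pos hA) hz
  have hneg : A ≠ -A := by
    intro h0
    have h1 : A.det = 1 := hA.1
    have h2 : A = 0 := by
      ext i j
      have := congrFun (congrFun h0 i) j
      rw [Matrix.neg_apply] at this
      rw [Matrix.zero_apply]
      lia
    rw [h2] at h1
    simp at h1
  rw [show (hfin.toFinset.filter fun M => (den M z ^ 2)⁻¹ = ζ) = {A, -A} from ?_,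
    Finset.card_pair hneg]
  ext M
  simp only [Finset.mem_filter, Set.Finite.mem_toFinset, Finset.mem_insert, Finset.mem_singleton]
  constructor
  · rintro ⟨⟨hM, hMz⟩, hMd⟩
    have hM0 : den M z ≠ 0 := den_ne_zero (G0_det_pos hM) hz
    have hB : M * A.adjugate ∈ G0 N := G0_mul hM (G0_adj hA)
    have hBA : M * A.adjugate * A = M := by
      rw [Matrix.mul_assoc, G0_adj_mul hA, Matrix.mul_one]
    have hBz : mb (M * A.adjugate) z = z := by
      have := mb_mul (M * A.adjugate) hA0
      rw [hBA, hMz, hAz] at this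
      exact this.symm
    have hBd : den (M * A.adjugate) z ^ 2 = (M * A.adjugate).det := by
      have h1 := den_mul (M * A.adjugate) hA0
      rw [hBA, hAz] at h1
      rw [hB.1]
      rw [← hMd, h1] at hAd
      have : den (M * A.adjugate) z ≠ 0 := den_ne_zero (G0_det_pos hB) hz
      field_simp at hAd
      push_cast
      exact hAd.symm
    obtain ⟨k, hk⟩ := eq_scalar_of_den_sq (G0_det_pos hB) hz hBz hBd
    have hdk := hB.1
    rw [hk, det_smul, det_one, Fintype.card_fin, mul_one] at hdk
    rw [← hBA, hk]
    rcases (sq_eq_sq_iff_eq_or_eq_neg.1 (hdk.trans (one_pow 2).symm)) with rfl | rfl <;> simp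
  · rintro (rfl | rfl)
    · exact ⟨⟨hA, hAz⟩, inv_eq_of_mul_eq_one_right hAd⟩
    · refine ⟨⟨?_, by rw [mb_neg, hAz]⟩, ?_⟩
      · refine ⟨by rw [det_neg, hA.1]; simp, ?_⟩
        simpa using hA.2
      · have := den_smul (-1) A z
        simp only [neg_smul, one_smul] at this
        rw [this]
        simpa using inv_eq_of_mul_eq_one_right hAd

lemma Haupt.mo_mb (h : Haupt N t v γ κ) {e : ℕ} (he : e ∣ N) {A : IM} (hA : A ∈ AL N e) {z : ℂ}
    (hz : 0 < z.im) : mo t (mb A z) = mo t z := by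
  have hdet := AL_det_pos (h.pos he) hA
  have hden := den_ne_zero hdet hz
  have hz' := im_mb_pos hdet hz
  have h1 : analyticOrderAt ((fun w => t w - t (mb A z)) ∘ mb A) z = mo t (mb A z) := by
    rw [analyticOrderAt_comp_of_deriv_ne_zero (analyticAt_mb hdet hz), h.order_eq hz']
    rw [(hasDerivAt_mb hden).deriv]
    exact div_ne_zero (by exact_mod_cast hdet.ne') (pow_ne_zero _ hden)
  have him := isOpen_upperHalfPlaneSet.mem_nhds hz
  have h2 : analyticOrderAt ((fun w => t w - t (mb A z)) ∘ mb A) z = mo t z := by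
    by_cases he1 : e = 1
    · subst he1
      rw [AL_one] at hA
      rw [← h.order_eq hz]
      refine analyticOrderAt_congr ?_
      filter_upwards [him] with w hw
      simp only [Function.comp, h.inv A hA w hw, h.inv A hA z hz]
    · have hne := sub_ne_zero.2 (h.ne_gamma he he1 hz)
      have hcong : ((fun w => t w - t (mb A z)) ∘ mb A) =ᶠ[𝓝 z]
          (fun w => t w - t z) * fun w => -(κ e / ((t w - γ e) * (t z - γ e))) := by
        filter_upwards [him] with w hw
        have hnw := sub_ne_zero.2 (h.ne_gamma he he1 hw)
        simp only [Function.comp, Pi.mul_apply, h.al_eq he he1 hA hw, h.al_eq he he1 hA hz]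
        field_simp
        ring
      have hu : AnalyticAt ℂ (fun w => -(κ e / ((t w - γ e) * (t z - γ e)))) z :=
        (analyticAt_const.div ((h.analyticAt_sub hz (γ e)).mul analyticAt_const)
          (mul_ne_zero hne hne)).neg
      rw [analyticOrderAt_congr hcong, analyticOrderAt_mul (h.analyticAt_sub hz _) hu,
        hu.analyticOrderAt_eq_zero.2, add_zero, h.order_eq hz]
      exact neg_ne_zero.2 (div_ne_zero (h.kne e he he1) (mul_ne_zero hne hne))
  exact_mod_cast h1.symm.trans h2

end FrickeTrace

namespace FrickeTrace

open Filter Topology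
open UpperHalfPlane (upperHalfPlaneSet isOpen_upperHalfPlaneSet)

/-- Integral matrices of determinant `n` with lower left entry divisible by `N`. -/
def Dl (N n : ℕ) : Set IM := {M | M.det = n ∧ (N : ℤ) ∣ M 1 0}

lemma Dl_det_pos {N n : ℕ} (hn : n ≠ 0) {M : IM} (hM : M ∈ Dl N n) : 0 < M.det := by
  rw [hM.1]; exact_mod_cast Nat.pos_of_ne_zero hn

lemma G0_mul_Dl {N n : ℕ} {A M : IM} (hA : A ∈ G0 N) (hM : M ∈ Dl N n) : A * M ∈ Dl N n := by
  refine ⟨by rw [det_mul, hA.1, hM.1, one_mul], ?_⟩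
  rw [Matrix.mul_apply, Fin.sum_univ_two]
  exact dvd_add (hA.2.mul_right _) (hM.2.mul_left _)

lemma Dl_mul_G0 {N n : ℕ} {A M : IM} (hA : A ∈ G0 N) (hM : M ∈ Dl N n) : M * A ∈ Dl N n := by
  refine ⟨by rw [det_mul, hA.1, hM.1, mul_one], ?_⟩
  rw [Matrix.mul_apply, Fin.sum_univ_two]
  exact dvd_add (hM.2.mul_right _) (hA.2.mul_left _)

/-- A chosen Atkin–Lehner matrix, the identity for `e = 1`. -/
noncomputable def wl (N e : ℕ) : IM :=
  open Classical in if e = 1 then 1 else if h : ∃ A, A ∈ AL N e then h.choose else 1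

lemma wl_one (N : ℕ) : wl N 1 = 1 := by rw [wl, if_pos rfl]

lemma wl_mem {N e : ℕ} (hN : Squarefree N) (he : e ∣ N) : wl N e ∈ AL N e := by
  rw [wl]
  split_ifs with h1 h2
  · subst h1
    rw [AL_one]
    exact one_mem_G0 N
  · exact h2.choose_spec
  · exact absurd (AL_nonempty hN he) h2

/-- Upper triangular part of a coset representative. -/
def ut (e a d b : ℕ) : IM := !![(e * a : ℤ), b; 0, (e * d : ℤ)]

/-- Representatives of the `Γ₀(N)`-cosets of integral matrices of determinant `e a d`. -/
noncomputable def rep (N e a d b : ℕ) : IM :=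
  !![wl N e 0 0 * a, wl N e 0 0 / e * b + wl N e 0 1 * d;
    wl N e 1 0 * a, wl N e 1 0 / e * b + wl N e 1 1 * d]

lemma smul_rep {N e : ℕ} (hN : Squarefree N) (he : e ∣ N) (a d b : ℕ) :
    (e : ℤ) • rep N e a d b = wl N e * ut e a d b := by
  obtain ⟨-, h1, -, h2⟩ := wl_mem hN he
  have h3 := Int.mul_ediv_cancel' h1
  have h4 := Int.mul_ediv_cancel' ((Int.natCast_dvd_natCast.2 he).trans h2)
  ext i j
  fin_cases i <;> fin_cases j <;> simp [rep, ut, Matrix.mul_apply, Fin.sum_univ_two]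
  · ring
  · linear_combination (b : ℤ) * h3
  · ring
  · linear_combination (b : ℤ) * h4

lemma det_rep {N e : ℕ} (hN : Squarefree N) (he : e ∣ N) (a d b : ℕ) :
    (rep N e a d b).det = (e * (a * d) : ℕ) := by
  have he0 : (e : ℤ) ≠ 0 := by
    have : e ≠ 0 := fun h => hN.ne_zero (by rw [h] at he; exact zero_dvd_iff.1 he)
    exact_mod_cast this
  have h1 := congrArg Matrix.det (smul_rep hN he a d b)
  rw [det_smul, det_mul, (wl_mem hN he).1, Fintype.card_fin, ut, det_fin_two_of] at h1
  refine mul_left_cancel₀ (pow_ne_zero 2 he0) ?_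
  rw [h1]
  push_cast
  ring

lemma rep_mem {N e : ℕ} (hN : Squarefree N) (he : e ∣ N) {n a d : ℕ} (h : e * (a * d) = n) (b : ℕ) :
    rep N e a d b ∈ Dl N n :=
  ⟨by rw [det_rep hN he, h], (wl_mem hN he).2.2.2.mul_right _⟩

lemma mb_rep {N e : ℕ} (hN : Squarefree N) (he : e ∣ N) {a d : ℕ} (ha : a ≠ 0) (hd : d ≠ 0)
    (b : ℕ) {z : ℂ} (hz : 0 < z.im) :
    mb (rep N e a d b) z = mb (wl N e) (mb (ut e a d b) z) := by
  have he0 : e ≠ 0 := fun h => hN.ne_zero (by rw [h] at he; exact zero_dvd_iff.1 he)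
  rw [← mb_smul (n := (e : ℤ)) (by exact_mod_cast he0), smul_rep hN he, mb_mul]
  refine den_ne_zero ?_ hz
  rw [ut, det_fin_two_of]
  have := Nat.pos_of_ne_zero ha
  have := Nat.pos_of_ne_zero hd
  have := Nat.pos_of_ne_zero he0
  simp only [mul_zero, sub_zero]
  positivity

lemma ut_det_pos {e a d : ℕ} (he : e ≠ 0) (ha : a ≠ 0) (hd : d ≠ 0) (b : ℕ) :
    0 < (ut e a d b).det := by
  rw [ut, det_fin_two_of]
  have := Nat.pos_of_ne_zero ha
  have := Nat.pos_of_ne_zero hd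
  have := Nat.pos_of_ne_zero he
  simp only [mul_zero, sub_zero]
  positivity

theorem exists_rep {N n : ℕ} (hN : Squarefree N) (hn : n ≠ 0) {M : IM} (hM : M ∈ Dl N n) :
    ∃ e a d b : ℕ, e ∣ N ∧ e * (a * d) = n ∧ b < e * d ∧ ∃ G ∈ G0 N, M = G * rep N e a d b := by
  obtain ⟨hdet, hNM⟩ := hM
  rw [det_fin_two] at hdet
  have hn' : (0 : ℤ) < n := by exact_mod_cast Nat.pos_of_ne_zero hn
  have hpos : 0 < Int.gcd (M 0 0) (M 1 0) := by
    rw [Int.gcd_pos_iff]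
    by_contra! h0
    rw [h0.1, h0.2] at hdet
    lia
  obtain ⟨A', hA'⟩ := Int.gcd_dvd_left (M 0 0) (M 1 0)
  obtain ⟨C', hC'⟩ := Int.gcd_dvd_right (M 0 0) (M 1 0)
  have hbez := Int.gcd_eq_gcd_ab (M 0 0) (M 1 0)
  set h : ℤ := (Int.gcd (M 0 0) (M 1 0) : ℤ) with hh
  set u := Int.gcdA (M 0 0) (M 1 0)
  set w := Int.gcdB (M 0 0) (M 1 0)
  have hh0 : 0 < h := Int.natCast_pos.2 hpos
  have huw : A' * u + w * C' = 1 := by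
    refine mul_left_cancel₀ hh0.ne' ?_
    linear_combination u * hA'.symm + w * hC'.symm - hbez
  have hg0 : (!![A', -w; C', u] : IM).det = 1 := by rw [det_fin_two_of]; linarith
  obtain ⟨e, heN, j, hW, -⟩ := exists_AL_of_det_one hN hg0
  have he0 : e ≠ 0 := fun h => hN.ne_zero (by rw [h] at heN; exact zero_dvd_iff.1 heN)
  have hcop : IsCoprime (e : ℤ) C' := by
    obtain ⟨h1, -, ⟨k, h2⟩, -⟩ := hW
    simp [Matrix.mul_apply, Fin.sum_univ_two] at h2
    refine ⟨A' * k, w - A' * j, ?_⟩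
    linear_combination huw - A' * h2
  have heh : (e : ℤ) ∣ h := by
    refine hcop.dvd_of_dvd_mul_right ?_
    rw [← hC']
    exact (Int.natCast_dvd_natCast.2 heN).trans hNM
  obtain ⟨a, ha⟩ := heh
  have ha0 : 0 < a := by
    have : (0 : ℤ) < e := by exact_mod_cast Nat.pos_of_ne_zero he0
    rw [ha] at hh0
    exact pos_of_mul_pos_right hh0 this.le
  set D := A' * M 1 1 - C' * M 0 1 with hD
  have hhD : h * D = n := by
    rw [← hdet, hD]
    linear_combination -(M 1 1) * hA' + M 0 1 * hC'
  have hD0 : 0 < D := pos_of_mul_pos_right (hhD ▸ hn') hh0.le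
  lift a to ℕ using ha0.le
  lift D to ℕ using hD0.le with D'
  set b0 : ℤ := u * M 0 1 + w * M 1 1 - j * D' with hb0
  have hed : (0 : ℤ) < e * D' := mul_pos (by exact_mod_cast Nat.pos_of_ne_zero he0) hD0
  have hb1 := Int.emod_nonneg b0 hed.ne'
  have hb2 := Int.emod_lt_of_pos b0 hed
  have hb3 := Int.emod_add_mul_ediv b0 (e * D')
  obtain ⟨b, hb⟩ := Int.eq_ofNat_of_zero_le hb1
  rw [hb] at hb2 hb3
  refine ⟨e, a, D', b, heN, ?_, by exact_mod_cast hb2, ?_⟩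
  · have : (e : ℤ) * (a * D') = n := by rw [← hhD, ha]; ring
    exact_mod_cast this
  set q := b0 / (e * D')
  have hT : (!![1, q; 0, 1] : IM) ∈ G0 N := ⟨by simp, by simp⟩
  obtain ⟨G1, hG1, hG1'⟩ := AL_eq_mul he0 heN (AL_mul_G0 he0 heN (wl_mem hN heN) hT) (wl_mem hN heN)
  obtain ⟨G2, hG2, hG2'⟩ := AL_eq_mul he0 heN hW (wl_mem hN heN)
  refine ⟨G2 * G1, G0_mul hG2 hG1, ?_⟩
  have hez : (e : ℤ) ≠ 0 := by exact_mod_cast he0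
  have key : (e : ℤ) • M = (e : ℤ) • (G2 * G1 * rep N e a D' b) := by
    have h1 : (e : ℤ) • (G2 * G1 * rep N e a D' b) =
        !![A', -w; C', u] * !![(e : ℤ), j; 0, 1] * (!![1, q; 0, 1] * ut e a D' b) := by
      rw [← Matrix.mul_smul, smul_rep hN heN, hG2', Matrix.mul_assoc G2 G1, ← Matrix.mul_assoc G1,
        ← hG1']
      simp only [Matrix.mul_assoc]
    rw [h1]
    ext i k
    fin_cases i <;> fin_cases k <;> simp [ut, Matrix.mul_apply, Fin.sum_univ_two]
    · rw [hA', ha]; ring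
    · linear_combination -A' * e * hb3 - A' * e * hb0 + w * e * hD - e * M 0 1 * huw
    · rw [hC', ha]; ring
    · linear_combination -C' * e * hb3 - C' * e * hb0 - u * e * hD - e * M 1 1 * huw
  exact smul_right_injective IM hez key

theorem rep_unique {N : ℕ} (hN : Squarefree N) {e a d b e' a' d' b' : ℕ} (he : e ∣ N)
    (he' : e' ∣ N) (ha : a ≠ 0) (hd : d ≠ 0) (ha' : a' ≠ 0)
    (hb : b < e * d) (hb' : b' < e' * d') {G : IM} (hG : G ∈ G0 N)
    (h : rep N e' a' d' b' = G * rep N e a d b) : e' = e ∧ a' = a ∧ d' = d ∧ b' = b := by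
  have he0 : e ≠ 0 := fun h => hN.ne_zero (by rw [h] at he; exact zero_dvd_iff.1 he)
  have he0' : e' ≠ 0 := fun h => hN.ne_zero (by rw [h] at he'; exact zero_dvd_iff.1 he')
  have hez : (e : ℤ) ≠ 0 := by exact_mod_cast he0
  have hez' : (e' : ℤ) ≠ 0 := by exact_mod_cast he0'
  obtain ⟨C, hC, hCe⟩ := AL_mul he0' he' he (AL_adj (wl_mem hN he')) (G0_mul_AL he hG (wl_mem hN he))
  have key : (e : ℤ) • ut e' a' d' b' = ((e'.gcd e : ℕ) : ℤ) • (C * ut e a d b) := by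
    refine smul_right_injective IM hez' ?_
    change (e' : ℤ) • (e : ℤ) • ut e' a' d' b' = (e' : ℤ) • ((e'.gcd e : ℕ) : ℤ) • (C * ut e a d b)
    have h1 : (e : ℤ) • (wl N e' * ut e' a' d' b') =
        (e' : ℤ) • (G * (wl N e * ut e a d b)) := by
      rw [← smul_rep hN he', ← smul_rep hN he, h, smul_comm, Matrix.mul_smul]
    have h2 := congrArg ((wl N e').adjugate * ·) h1
    simp only [Matrix.mul_smul, ← Matrix.mul_assoc] at h2
    rw [adjugate_mul, (wl_mem hN he').1, Matrix.mul_assoc (wl N e').adjugate, hCe] at h2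
    simp only [Matrix.smul_mul, Matrix.one_mul] at h2
    rw [smul_comm]
    exact_mod_cast h2
  have hg0 : ((e'.gcd e : ℕ) : ℤ) ≠ 0 := by
    exact_mod_cast (Nat.gcd_pos_of_pos_left _ (Nat.pos_of_ne_zero he0')).ne'
  have haz : (a : ℤ) ≠ 0 := by exact_mod_cast ha
  have hdz : (d : ℤ) ≠ 0 := by exact_mod_cast hd
  have hC10 : C 1 0 = 0 := by
    have := congrFun (congrFun key 1) 0
    simp [ut, Matrix.mul_apply, Fin.sum_univ_two] at this
    tauto
  have hst : st e' e = 1 := by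
    obtain ⟨c1, c2, c3, -⟩ := hC
    have hst0 : st e' e ≠ 0 := fun h0 => by
      have := st_mul_gcd (f := e) he0'
      rw [h0, zero_mul] at this
      exact Nat.lcm_ne_zero he0' he0 this.symm
    rw [det_fin_two, hC10, mul_zero, sub_zero] at c1
    have h1 := mul_dvd_mul c2 c3
    rw [c1] at h1
    have h2 : st e' e * st e' e ∣ st e' e := by exact_mod_cast h1
    have h3 := Nat.le_of_dvd (Nat.pos_of_ne_zero hst0) h2
    nlinarith [Nat.pos_of_ne_zero hst0]
  have hee := st_eq_one he0' hst
  subst hee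
  rw [hst, AL_one] at hC
  rw [Nat.gcd_self] at key
  have key' : ut e' a' d' b' = C * ut e' a d b := smul_right_injective IM hez key
  have k00 := congrFun (congrFun key' 0) 0
  have k01 := congrFun (congrFun key' 0) 1
  have k11 := congrFun (congrFun key' 1) 1
  simp only [ut, Matrix.mul_apply, Fin.sum_univ_two, of_apply, cons_val', cons_val_zero,
    cons_val_one, cons_val_fin_one, mul_zero, add_zero, hC10, zero_mul, zero_add] at k00 k01 k11
  have hdetC := hC.1
  rw [det_fin_two, hC10, mul_zero, sub_zero] at hdetC
  have hC00 : C 0 0 = 1 := by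
    rcases Int.eq_one_or_neg_one_of_mul_eq_one hdetC with h1 | h1
    · exact h1
    · exfalso
      rw [h1] at k00
      have : (0 : ℤ) < e' * a' := by
        have := Nat.pos_of_ne_zero he0'
        have := Nat.pos_of_ne_zero ha'
        positivity
      have : (0 : ℤ) < e' * a := by
        have := Nat.pos_of_ne_zero he0'
        have := Nat.pos_of_ne_zero ha
        positivity
      lia
  have hC11 : C 1 1 = 1 := by rw [hC00, one_mul] at hdetC; exact hdetC
  rw [hC00, one_mul] at k00 k01
  rw [hC11, one_mul] at k11
  have haa : a' = a := by exact_mod_cast mul_left_cancel₀ hez k00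
  have hdd : d' = d := by exact_mod_cast mul_left_cancel₀ hez k11
  refine ⟨rfl, haa, hdd, ?_⟩
  rw [hdd] at hb'
  have hmod : b' ≡ b [MOD e' * d] := by
    rw [← Int.natCast_modEq_iff, Int.modEq_comm, Int.modEq_iff_dvd]
    exact ⟨C 0 1, by push_cast; linarith⟩
  exact hmod.eq_of_lt_of_lt hb' hb

/-- Scalar multiples of elements of `Γ₀(N)`. -/
def Scal (N : ℕ) (M : IM) : Prop := ∃ k : ℤ, ∃ A ∈ G0 N, M = k • A

lemma rep_scalar (N k : ℕ) : rep N 1 k k 0 = (k : ℤ) • 1 := by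
  ext i j
  fin_cases i <;> fin_cases j <;> simp [rep, wl_one]

lemma scal_rep_iff {N : ℕ} (hN : Squarefree N) {e a d b : ℕ} (he : e ∣ N) (ha : a ≠ 0) (hd : d ≠ 0)
    (hb : b < e * d) : Scal N (rep N e a d b) ↔ e = 1 ∧ a = d ∧ b = 0 := by
  constructor
  · rintro ⟨k, A, hA, h⟩
    have he0 : e ≠ 0 := fun h => hN.ne_zero (by rw [h] at he; exact zero_dvd_iff.1 he)
    have hk : k ≠ 0 := by
      rintro rfl
      have := det_rep hN he a d b
      rw [h] at this
      simp [he0, ha, hd] at this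
    have hkn : k.natAbs ≠ 0 := Int.natAbs_ne_zero.2 hk
    have key : ∃ B ∈ G0 N, rep N e a d b = B * rep N 1 k.natAbs k.natAbs 0 := by
      rw [rep_scalar]
      rcases Int.natAbs_eq k with h1 | h1
      · refine ⟨A, hA, ?_⟩
        rw [Matrix.mul_smul, Matrix.mul_one, ← h1, h]
      · refine ⟨-A, ⟨by rw [det_neg, hA.1]; simp, by simpa using hA.2⟩, ?_⟩
        rw [Matrix.mul_smul, Matrix.mul_one, smul_neg, ← neg_smul, ← h1, h]
    obtain ⟨B, hB, hBr⟩ := key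
    obtain ⟨h1, h2, h3, h4⟩ := rep_unique hN (one_dvd N) he hkn hkn ha
      (by simpa using Nat.pos_of_ne_zero hkn) hb hB hBr
    exact ⟨h1, h2.trans h3.symm, h4⟩
  · rintro ⟨rfl, rfl, rfl⟩
    exact ⟨a, 1, one_mem_G0 N, rep_scalar N a⟩

end FrickeTrace

namespace FrickeTrace

open Filter Topology
open UpperHalfPlane (upperHalfPlaneSet isOpen_upperHalfPlaneSet)

/-- Index set of the coset representatives. -/
def ix (N n : ℕ) : Finset (Σ _ : ℕ, Σ _ : ℕ × ℕ, ℕ) :=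
  (N.divisors.filter (· ∣ n)).sigma fun e => (n / e).divisorsAntidiagonal.sigma fun p =>
    Finset.range (e * p.2)

/-- The coset representative with a given index. -/
noncomputable def rp (N : ℕ) (i : Σ _ : ℕ, Σ _ : ℕ × ℕ, ℕ) : IM :=
  rep N i.1 i.2.1.1 i.2.1.2 i.2.2

lemma mem_ix {N n : ℕ} (hN : N ≠ 0) (hn : n ≠ 0) {e a d b : ℕ} :
    (⟨e, (a, d), b⟩ : Σ _ : ℕ, Σ _ : ℕ × ℕ, ℕ) ∈ ix N n ↔ e ∣ N ∧ e * (a * d) = n ∧ b < e * d := by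
  simp only [ix, Finset.mem_sigma, Finset.mem_filter, Nat.mem_divisors, Nat.mem_divisorsAntidiagonal,
    Finset.mem_range]
  constructor
  · rintro ⟨⟨⟨h1, -⟩, h2⟩, ⟨h3, -⟩, h4⟩
    exact ⟨h1, by rw [h3, Nat.mul_div_cancel' h2], h4⟩
  · rintro ⟨h1, h2, h4⟩
    have he : e ∣ n := ⟨_, h2.symm⟩
    have he0 : 0 < e := Nat.pos_of_ne_zero fun h => hN (by rw [h] at h1; exact zero_dvd_iff.1 h1)
    have h3 : n / e = a * d := Nat.div_eq_of_eq_mul_right he0 h2.symm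
    refine ⟨⟨⟨h1, hN⟩, he⟩, ⟨h3.symm, ?_⟩, h4⟩
    exact (Nat.div_pos (Nat.le_of_dvd (Nat.pos_of_ne_zero hn) he) he0).ne'

lemma mem_ix' {N n : ℕ} (hN : N ≠ 0) (hn : n ≠ 0) {i : Σ _ : ℕ, Σ _ : ℕ × ℕ, ℕ} (hi : i ∈ ix N n) :
    i.1 ∣ N ∧ i.1 * (i.2.1.1 * i.2.1.2) = n ∧ i.2.2 < i.1 * i.2.1.2 ∧ i.1 ≠ 0 ∧
      i.2.1.1 ≠ 0 ∧ i.2.1.2 ≠ 0 := by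
  obtain ⟨e, ⟨a, d⟩, b⟩ := i
  obtain ⟨h1, h2, h3⟩ := (mem_ix hN hn).1 hi
  refine ⟨h1, h2, h3, ?_, ?_, ?_⟩ <;> rintro h0 <;> simp only at h0 <;> subst h0 <;> simp at h2 <;>
    exact hn h2.symm

lemma rp_mem {N n : ℕ} (hN : Squarefree N) (hn : n ≠ 0) {i : Σ _ : ℕ, Σ _ : ℕ × ℕ, ℕ}
    (hi : i ∈ ix N n) : rp N i ∈ Dl N n := by
  obtain ⟨h1, h2, -⟩ := mem_ix' hN.ne_zero hn hi
  exact rep_mem hN h1 h2 _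

lemma exists_rp {N n : ℕ} (hN : Squarefree N) (hn : n ≠ 0) {M : IM} (hM : M ∈ Dl N n) :
    ∃ i ∈ ix N n, ∃ G ∈ G0 N, M = G * rp N i := by
  obtain ⟨e, a, d, b, h1, h2, h3, G, hG, h4⟩ := exists_rep hN hn hM
  exact ⟨⟨e, (a, d), b⟩, (mem_ix hN.ne_zero hn).2 ⟨h1, h2, h3⟩, G, hG, h4⟩

lemma rp_inj {N n : ℕ} (hN : Squarefree N) (hn : n ≠ 0) {i j : Σ _ : ℕ, Σ _ : ℕ × ℕ, ℕ}
    (hi : i ∈ ix N n) (hj : j ∈ ix N n) {G : IM} (hG : G ∈ G0 N) (h : rp N i = G * rp N j) :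
    i = j := by
  obtain ⟨i1, -, i3, -, i5, i6⟩ := mem_ix' hN.ne_zero hn hi
  obtain ⟨j1, -, j3, -, j5, j6⟩ := mem_ix' hN.ne_zero hn hj
  obtain ⟨e, ⟨a, d⟩, b⟩ := i
  obtain ⟨e', ⟨a', d'⟩, b'⟩ := j
  obtain ⟨h1, h2, h3, h4⟩ := rep_unique hN j1 i1 j5 j6 i5 j3 i3 hG h
  simp only at h1 h2 h3 h4
  subst h1 h2 h3 h4
  rfl

lemma eqv_coset_symm {N : ℕ} {G A B : IM} (hG : G ∈ G0 N) (h : A = G * B) : B = G.adjugate * A := by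
  rw [h, ← Matrix.mul_assoc, G0_adj_mul hG, Matrix.one_mul]

/-- Reindexing a product over cosets along a map that is injective on cosets. -/
lemma prod_ix_map {N n : ℕ} (hN : Squarefree N) (hn : n ≠ 0) {F : IM → ℂ}
    (hF : ∀ G ∈ G0 N, ∀ M ∈ Dl N n, F (G * M) = F M) {Φ : IM → IM}
    (hΦ : ∀ M ∈ Dl N n, Φ M ∈ Dl N n)
    (hinj : ∀ M ∈ Dl N n, ∀ M' ∈ Dl N n, ∀ G ∈ G0 N, Φ M = G * Φ M' → ∃ G' ∈ G0 N, M = G' * M') :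
    ∏ i ∈ ix N n, F (Φ (rp N i)) = ∏ i ∈ ix N n, F (rp N i) := by
  have h1 : ∀ i, i ∈ ix N n → ∃ j, j ∈ ix N n ∧ ∃ G ∈ G0 N, Φ (rp N i) = G * rp N j := fun i hi =>
    exists_rp hN hn (hΦ _ (rp_mem hN hn hi))
  choose! σ hσ G hG hGσ using h1
  have hin : Set.InjOn σ (ix N n) := by
    intro i hi j hj hij
    have h2 := hGσ i hi
    rw [hij, eqv_coset_symm (hG j hj) (hGσ j hj), ← Matrix.mul_assoc] at h2
    obtain ⟨B, hB, hBr⟩ := hinj _ (rp_mem hN hn hi) _ (rp_mem hN hn hj) _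
      (G0_mul (hG i hi) (G0_adj (hG j hj))) h2
    exact rp_inj hN hn hi hj hB hBr
  refine Finset.prod_nbij σ (fun i hi => hσ i hi) hin
    (Finset.surjOn_of_injOn_of_card_le σ (fun i hi => hσ i hi) hin le_rfl) fun i hi => ?_
  rw [hGσ i hi, hF _ (hG i hi) _ (rp_mem hN hn (hσ i hi))]

lemma Scal.mul_left {N : ℕ} {G M : IM} (hG : G ∈ G0 N) (h : Scal N M) : Scal N (G * M) := by
  obtain ⟨k, A, hA, rfl⟩ := h
  exact ⟨k, G * A, G0_mul hG hA, Matrix.mul_smul ..⟩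

lemma scal_mul_left {N : ℕ} {G M : IM} (hG : G ∈ G0 N) : Scal N (G * M) ↔ Scal N M := by
  refine ⟨fun h => ?_, fun h => h.mul_left hG⟩
  rw [eqv_coset_symm hG (rfl : G * M = G * M)]
  exact h.mul_left (G0_adj hG)

lemma Scal.mul_right {N : ℕ} {G M : IM} (hG : G ∈ G0 N) (h : Scal N M) : Scal N (M * G) := by
  obtain ⟨k, A, hA, rfl⟩ := h
  exact ⟨k, A * G, G0_mul hA hG, Matrix.smul_mul ..⟩

lemma scal_mul_right {N : ℕ} {G M : IM} (hG : G ∈ G0 N) : Scal N (M * G) ↔ Scal N M := by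
  refine ⟨fun h => ?_, fun h => h.mul_right hG⟩
  have := h.mul_right (G0_adj hG)
  rwa [Matrix.mul_assoc, G0_mul_adj hG, Matrix.mul_one] at this

/-- Conjugation by an Atkin–Lehner matrix. -/
lemma exists_conj {N n e : ℕ} (heN : e ∣ N) {w M : IM} (hw : w ∈ AL N e) (hM : M ∈ Dl N n)
    (he : e ≠ 0) : ∃ M' ∈ Dl N n, (e : ℤ) • M' = w.adjugate * M * w := by
  obtain ⟨hd, ⟨x, hx⟩, ⟨u, hu⟩, ⟨y, hy⟩⟩ := hw
  obtain ⟨hMd, ⟨c, hc⟩⟩ := hM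
  obtain ⟨f, rfl⟩ := heN
  push_cast at hy hc
  have hez : (e : ℤ) ≠ 0 := by exact_mod_cast he
  set M' : IM := !![u * (M 0 0 * (e * x) + M 0 1 * (e * f * y)) - w 0 1 * (f * c * (e * x) + M 1 1 * f * y),
    u * (M 0 0 * w 0 1 + M 0 1 * (e * u)) - w 0 1 * (f * c * w 0 1 + M 1 1 * u);
    e * f * (-y * (M 0 0 * x + M 0 1 * (f * y)) + x * (c * (e * x) + M 1 1 * y)),
    -(f * y) * (M 0 0 * w 0 1 + M 0 1 * (e * u)) + x * (e * f * c * w 0 1 + M 1 1 * (e * u))] with hM'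
  have key : (e : ℤ) • M' = w.adjugate * M * w := by
    ext i j
    fin_cases i <;> fin_cases j <;>
      simp [hM', adjugate_fin_two, Matrix.mul_apply, Matrix.vecMul, dotProduct, Fin.sum_univ_two, hx, hu,
        hy, hc] <;> ring
  refine ⟨M', ⟨?_, ?_⟩, key⟩
  · have h1 := congrArg Matrix.det key
    rw [det_smul, det_mul, det_mul, det_adj, hMd, hd, Fintype.card_fin] at h1
    refine mul_left_cancel₀ (pow_ne_zero 2 hez) ?_
    rw [h1]; ring
  · push_cast
    exact ⟨_, rfl⟩

end FrickeTrace

namespace FrickeTrace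

open Filter Topology
open UpperHalfPlane (upperHalfPlaneSet isOpen_upperHalfPlaneSet)

lemma AL_mul_adj {e : ℕ} {N : ℕ} {w : IM} (hw : w ∈ AL N e) : w * w.adjugate = (e : ℤ) • 1 := by
  rw [mul_adjugate, hw.1]

/-- Conjugation by an Atkin–Lehner matrix, as a map on integral matrices of determinant `n`. -/
lemma exists_conj_map (N n : ℕ) {e : ℕ} (heN : e ∣ N) {w : IM} (hw : w ∈ AL N e) (he : e ≠ 0)
    (hn : n ≠ 0) :
    ∃ Φ : IM → IM, (∀ M ∈ Dl N n, Φ M ∈ Dl N n) ∧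
      (∀ M ∈ Dl N n, ∀ M' ∈ Dl N n, ∀ G ∈ G0 N, Φ M = G * Φ M' → ∃ G' ∈ G0 N, M = G' * M') ∧
      (∀ M ∈ Dl N n, (Scal N (Φ M) ↔ Scal N M)) ∧
      (∀ M ∈ Dl N n, ∀ z : ℂ, 0 < z.im → mb M (mb w z) = mb w (mb (Φ M) z)) := by
  have h1 : ∀ M, M ∈ Dl N n → ∃ M', M' ∈ Dl N n ∧ (e : ℤ) • M' = w.adjugate * M * w := fun M hM =>
    exists_conj heN hw hM he
  choose! Φ hΦ hΦe using h1
  have hez : (e : ℤ) ≠ 0 := by exact_mod_cast he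
  have hback : ∀ M ∈ Dl N n, w * Φ M = M * w := by
    intro M hM
    apply smul_right_injective IM hez
    change (e : ℤ) • (w * Φ M) = (e : ℤ) • (M * w)
    rw [← Matrix.mul_smul, hΦe M hM, Matrix.mul_assoc w.adjugate, ← Matrix.mul_assoc w, AL_mul_adj hw,
      Matrix.smul_mul, Matrix.one_mul]
  refine ⟨Φ, hΦ, ?_, ?_, ?_⟩
  · intro M hM M' hM' G hG h
    obtain ⟨C, hC, hCe⟩ := AL_mul he heN heN (AL_mul_G0 he heN hw hG) (AL_adj hw)
    rw [st_self he, AL_one] at hC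
    rw [Nat.gcd_self] at hCe
    refine ⟨C, hC, smul_right_injective IM hez ?_⟩
    change (e : ℤ) • M = (e : ℤ) • (C * M')
    calc (e : ℤ) • M = M * (w * w.adjugate) := by
          rw [AL_mul_adj hw, Matrix.mul_smul, Matrix.mul_one]
      _ = w * (G * Φ M') * w.adjugate := by rw [← Matrix.mul_assoc, ← hback M hM, h]
      _ = (e : ℤ) • (C * M') := by
          apply smul_right_injective IM hez
          change (e : ℤ) • (w * (G * Φ M') * w.adjugate) = (e : ℤ) • ((e : ℤ) • (C * M'))
          rw [← Matrix.smul_mul, ← Matrix.mul_smul, ← Matrix.mul_smul G, hΦe M' hM']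
          calc w * (G * (w.adjugate * M' * w)) * w.adjugate
              = (w * G * w.adjugate) * M' * (w * w.adjugate) := by simp only [Matrix.mul_assoc]
            _ = (e : ℤ) • ((e : ℤ) • (C * M')) := by
              rw [hCe, AL_mul_adj hw, Matrix.mul_smul, Matrix.mul_one, Matrix.smul_mul]
  · intro M hM
    constructor
    · rintro ⟨k, A, hA, hk⟩
      obtain ⟨C, hC, hCe⟩ := AL_mul he heN heN (AL_mul_G0 he heN hw hA) (AL_adj hw)
      rw [st_self he, AL_one] at hC
      rw [Nat.gcd_self] at hCe
      refine ⟨k, C, hC, smul_right_injective IM hez ?_⟩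
      change (e : ℤ) • M = (e : ℤ) • (k • C)
      rw [smul_comm, ← hCe, ← Matrix.smul_mul, ← Matrix.mul_smul, ← hk, hback M hM, Matrix.mul_assoc,
        AL_mul_adj hw, Matrix.mul_smul, Matrix.mul_one]
    · rintro ⟨k, A, hA, hk⟩
      obtain ⟨C, hC, hCe⟩ := AL_mul he heN heN (AL_mul_G0 he heN (AL_adj hw) hA) hw
      rw [st_self he, AL_one] at hC
      rw [Nat.gcd_self] at hCe
      refine ⟨k, C, hC, smul_right_injective IM hez ?_⟩
      change (e : ℤ) • Φ M = (e : ℤ) • (k • C)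
      rw [smul_comm, ← hCe, hΦe M hM, hk, Matrix.mul_smul, Matrix.smul_mul]
  · intro M hM z hz
    have h2 := den_ne_zero (AL_det_pos he hw) hz
    have h3 := den_ne_zero (Dl_det_pos hn (hΦ M hM)) hz
    rw [← mb_mul _ h2, ← mb_mul _ h3, hback M hM]

/-- Factor of the modular equation attached to an integral matrix. -/
noncomputable def fac (N : ℕ) (t : ℂ → ℂ) (τ : ℂ) (M : IM) : ℂ :=
  open scoped Classical in if Scal N M then 1 else t τ - t (mb M τ)

/-- The diagonal restriction of the modular equation of order `n`, scalar factors removed. -/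
noncomputable def heck (N n : ℕ) (t : ℂ → ℂ) (τ : ℂ) : ℂ := ∏ i ∈ ix N n, fac N t τ (rp N i)

/-- The indices of the cosets consisting of multiples of elements of `Γ₀(N)`. -/
noncomputable def six (N n : ℕ) : Finset (Σ _ : ℕ, Σ _ : ℕ × ℕ, ℕ) :=
  open scoped Classical in (ix N n).filter fun i => Scal N (rp N i)

/-- The indices of the remaining cosets. -/
noncomputable def nix (N n : ℕ) : Finset (Σ _ : ℕ, Σ _ : ℕ × ℕ, ℕ) :=
  open scoped Classical in (ix N n).filter fun i => ¬ Scal N (rp N i)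

lemma mem_six {N n : ℕ} {i} : i ∈ six N n ↔ i ∈ ix N n ∧ Scal N (rp N i) := by
  classical simp [six]

lemma mem_nix {N n : ℕ} {i} : i ∈ nix N n ↔ i ∈ ix N n ∧ ¬ Scal N (rp N i) := by
  classical simp [nix]

lemma prod_ite_scal {N n : ℕ} (f : IM → ℂ) [∀ M, Decidable (Scal N M)] :
    ∏ i ∈ ix N n, (if Scal N (rp N i) then 1 else f (rp N i)) = ∏ i ∈ nix N n, f (rp N i) := by
  classical
  rw [nix, Finset.prod_filter]
  refine Finset.prod_congr rfl fun i _ => ?_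
  by_cases h : Scal N (rp N i) <;> simp [h]

lemma heck_eq (N n : ℕ) (t : ℂ → ℂ) (τ : ℂ) :
    heck N n t τ = ∏ i ∈ nix N n, (t τ - t (mb (rp N i) τ)) :=
  open scoped Classical in prod_ite_scal fun M => t τ - t (mb M τ)

lemma prod_nix_map {N n : ℕ} (hN : Squarefree N) (hn : n ≠ 0) {f : IM → ℂ}
    (hf : ∀ G ∈ G0 N, ∀ M ∈ Dl N n, f (G * M) = f M) {Φ : IM → IM}
    (hΦ : ∀ M ∈ Dl N n, Φ M ∈ Dl N n)
    (hinj : ∀ M ∈ Dl N n, ∀ M' ∈ Dl N n, ∀ G ∈ G0 N, Φ M = G * Φ M' → ∃ G' ∈ G0 N, M = G' * M')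
    (hs : ∀ M ∈ Dl N n, (Scal N (Φ M) ↔ Scal N M)) :
    ∏ i ∈ nix N n, f (Φ (rp N i)) = ∏ i ∈ nix N n, f (rp N i) := by
  classical
  have h := prod_ix_map hN hn (F := fun M => if Scal N M then 1 else f M)
    (fun G hG M hM => by simp only [scal_mul_left hG, hf G hG M hM]) hΦ hinj
  rw [prod_ite_scal] at h
  rw [← h, nix, Finset.prod_filter]
  refine Finset.prod_congr rfl fun i hi => ?_
  have := hs _ (rp_mem hN hn hi)
  by_cases h0 : Scal N (rp N i) <;> simp [h0, this]

variable {N : ℕ} {t v : ℂ → ℂ} {γ κ : ℕ → ℂ}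

lemma Haupt.apply_mul (h : Haupt N t v γ κ) {n : ℕ} (hn : n ≠ 0) {G M : IM} (hG : G ∈ G0 N)
    (hM : M ∈ Dl N n) {z : ℂ} (hz : 0 < z.im) : t (mb (G * M) z) = t (mb M z) := by
  have h1 := Dl_det_pos hn hM
  rw [mb_mul _ (den_ne_zero h1 hz), h.inv G hG _ (im_mb_pos h1 hz)]

lemma Haupt.heck_inv (h : Haupt N t v γ κ) {n : ℕ} (hn : n ≠ 0) {A : IM} (hA : A ∈ G0 N) {z : ℂ}
    (hz : 0 < z.im) : heck N n t (mb A z) = heck N n t z := by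
  rw [heck_eq, heck_eq, ← prod_nix_map h.sqf hn (f := fun M => t z - t (mb M z))
    (Φ := fun M => M * A)]
  · refine Finset.prod_congr rfl fun i hi => ?_
    simp only [h.inv A hA z hz, mb_mul _ (den_ne_zero (G0_det_pos hA) hz)]
  · intro G hG M hM
    simp only [h.apply_mul hn hG hM hz]
  · exact fun M hM => Dl_mul_G0 hA hM
  · intro M _ M' _ G hG hh
    refine ⟨G, hG, ?_⟩
    have := congrArg (· * A.adjugate) hh
    simpa only [Matrix.mul_assoc, G0_mul_adj hA, Matrix.mul_one] using this
  · exact fun M _ => scal_mul_right hA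

/-- Behaviour of the modular equation under an Atkin–Lehner involution. -/
lemma Haupt.heck_al (h : Haupt N t v γ κ) {n : ℕ} (hn : n ≠ 0) {e : ℕ} (he : e ∣ N) (he1 : e ≠ 1)
    {w : IM} (hw : w ∈ AL N e) {z : ℂ} (hz : 0 < z.im) :
    heck N n t (mb w z) * ((t z - γ e) ^ (nix N n).card * ∏ i ∈ nix N n, (t (mb (rp N i) z) - γ e)) =
      (-κ e) ^ (nix N n).card * heck N n t z := by
  obtain ⟨Φ, h1, h2, h3, h4⟩ := exists_conj_map N n he hw (h.pos he) hn
  have h0 := sub_ne_zero.2 (h.ne_gamma he he1 hz)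
  have e1 : heck N n t (mb w z) = ∏ i ∈ nix N n, (t (mb w z) - t (mb w (mb (rp N i) z))) := by
    rw [heck_eq, ← prod_nix_map h.sqf hn (f := fun M => t (mb w z) - t (mb w (mb M z))) (Φ := Φ) _ h1 h2
      h3]
    · refine Finset.prod_congr rfl fun i hi => ?_
      rw [h4 _ (rp_mem h.sqf hn (mem_nix.1 hi).1) z hz]
    · intro G hG M hM
      have hM0 := Dl_det_pos hn hM
      have hGM := Dl_det_pos hn (G0_mul_Dl hG hM)
      simp only [h.al_eq he he1 hw (im_mb_pos hM0 hz), h.al_eq he he1 hw (im_mb_pos hGM hz),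
        h.apply_mul hn hG hM hz]
  rw [e1, heck_eq, ← Finset.prod_const, ← Finset.prod_const, ← Finset.prod_mul_distrib,
    ← Finset.prod_mul_distrib, ← Finset.prod_mul_distrib]
  refine Finset.prod_congr rfl fun i hi => ?_
  have hi' := im_mb_pos (Dl_det_pos hn (rp_mem h.sqf hn (mem_nix.1 hi).1)) hz
  have h5 := sub_ne_zero.2 (h.ne_gamma he he1 hi')
  rw [h.al_eq he he1 hw hz, h.al_eq he he1 hw hi']
  field_simp
  ring

lemma Haupt.analyticAt_comp_mb (h : Haupt N t v γ κ) {M : IM} (hM : 0 < M.det) {z : ℂ}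
    (hz : 0 < z.im) : AnalyticAt ℂ (fun w => t (mb M w)) z :=
  AnalyticAt.comp (h.analyticOnNhd _ (im_mb_pos hM hz)) (analyticAt_mb hM hz)

/-- The indices of the cosets with an element fixing `z`. -/
noncomputable def fixIx (N n : ℕ) (z : ℂ) : Finset (Σ _ : ℕ, Σ _ : ℕ × ℕ, ℕ) :=
  open scoped Classical in (ix N n).filter fun i => ∃ G ∈ G0 N, mb (G * rp N i) z = z

lemma mem_fixIx {n : ℕ} {z : ℂ} {i} :
    i ∈ fixIx N n z ↔ i ∈ ix N n ∧ ∃ G ∈ G0 N, mb (G * rp N i) z = z := by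
  classical simp [fixIx]

lemma Haupt.analyticAt_sub_mb (h : Haupt N t v γ κ) {M : IM} (hM : 0 < M.det) {z : ℂ}
    (hz : 0 < z.im) : AnalyticAt ℂ (fun w => t w - t (mb M w)) z :=
  (h.analyticOnNhd z hz).sub (h.analyticAt_comp_mb hM hz)

lemma Haupt.order_fac (h : Haupt N t v γ κ) {n : ℕ} (hn : n ≠ 0) {z : ℂ} (hz : 0 < z.im) {i}
    (hi : i ∈ nix N n) [Decidable (i ∈ fixIx N n z)] :
    analyticOrderAt (fun w => t w - t (mb (rp N i) w)) z =
      ((if i ∈ fixIx N n z then mo t z else 0 : ℕ) : ℕ∞) := by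
  obtain ⟨hi1, hi2⟩ := mem_nix.1 hi
  have hM := rp_mem h.sqf hn hi1
  have hd := Dl_det_pos hn hM
  split_ifs with hf
  · obtain ⟨-, G, hG, hfix⟩ := mem_fixIx.1 hf
    rw [← h.order_sub_mb (Dl_det_pos hn (G0_mul_Dl hG hM)) hz hfix fun hs => hi2 ((scal_mul_left hG).1 hs)]
    apply analyticOrderAt_congr
    filter_upwards [isOpen_upperHalfPlaneSet.mem_nhds hz] with w hw
    rw [h.apply_mul hn hG hM hw]
  · rw [Nat.cast_zero, AnalyticAt.analyticOrderAt_eq_zero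
      (h.analyticAt_sub_mb hd hz), sub_ne_zero]
    intro h0
    obtain ⟨G, hG, hGz⟩ := h.injective (im_mb_pos hd hz) hz h0.symm
    exact hf (mem_fixIx.2 ⟨hi1, G, hG, by rwa [mb_mul _ (den_ne_zero hd hz)]⟩)

lemma analyticAt_finset_prod {ι : Type*} (s : Finset ι) {f : ι → ℂ → ℂ} {z : ℂ}
    (hf : ∀ i ∈ s, AnalyticAt ℂ (f i) z) : AnalyticAt ℂ (fun w => ∏ i ∈ s, f i w) z :=
  Finset.analyticAt_fun_prod s hf

lemma analyticOrderAt_finset_prod {ι : Type*} (s : Finset ι) {f : ι → ℂ → ℂ} {z : ℂ}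
    (hf : ∀ i ∈ s, AnalyticAt ℂ (f i) z) :
    analyticOrderAt (fun w => ∏ i ∈ s, f i w) z = ∑ i ∈ s, analyticOrderAt (f i) z := by
  classical
  induction s using Finset.induction_on with
  | empty =>
    simp only [Finset.prod_empty, Finset.sum_empty]
    exact (analyticAt_const.analyticOrderAt_eq_zero).2 one_ne_zero
  | insert i s hi ih =>
    simp only [Finset.prod_insert hi, Finset.sum_insert hi]
    have h1 := fun j hj => hf j (Finset.mem_insert_of_mem hj)
    rw [← ih h1]
    exact analyticOrderAt_mul (hf i (Finset.mem_insert_self ..)) (analyticAt_finset_prod s h1)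

lemma Haupt.analyticAt_heck (h : Haupt N t v γ κ) {n : ℕ} (hn : n ≠ 0) {z : ℂ} (hz : 0 < z.im) :
    AnalyticAt ℂ (heck N n t) z := by
  rw [funext (heck_eq N n t)]
  exact analyticAt_finset_prod _ fun i hi => h.analyticAt_sub_mb
    (Dl_det_pos hn (rp_mem h.sqf hn (mem_nix.1 hi).1)) hz

lemma Haupt.order_heck (h : Haupt N t v γ κ) {n : ℕ} (hn : n ≠ 0) {z : ℂ} (hz : 0 < z.im) :
    analyticOrderAt (heck N n t) z = ((mo t z * (fixIx N n z \ six N n).card : ℕ) : ℕ∞) := by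
  classical
  rw [funext (heck_eq N n t), analyticOrderAt_finset_prod _ fun i hi => h.analyticAt_sub_mb
    (Dl_det_pos hn (rp_mem h.sqf hn (mem_nix.1 hi).1)) hz,
    Finset.sum_congr rfl fun i hi => h.order_fac hn hz hi, ← Nat.cast_sum, ← Finset.sum_filter,
    Finset.sum_const, smul_eq_mul, mul_comm]
  congr 3
  ext i
  simp only [Finset.mem_filter, mem_nix, Finset.mem_sdiff, mem_six, mem_fixIx]
  tauto

/-- The integral matrices of determinant `n` fixing a point, counted by cosets. -/
lemma Haupt.ncard_fix (h : Haupt N t v γ κ) {n : ℕ} (hn : n ≠ 0) {z : ℂ} (hz : 0 < z.im) :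
    {M : IM | M ∈ Dl N n ∧ mb M z = z}.Finite ∧
      {M : IM | M ∈ Dl N n ∧ mb M z = z}.ncard = 2 * mo t z * (fixIx N n z).card := by
  classical
  have hfin : {M : IM | M ∈ Dl N n ∧ mb M z = z}.Finite := by
    refine (finite_mb_compact n (isCompact_singleton (x := z)) (isCompact_singleton (x := z))
      (by simpa using hz) (by simpa using hz)).subset ?_
    rintro M ⟨hM, hMz⟩
    exact ⟨hM.1, by exact_mod_cast Nat.pos_of_ne_zero hn, z, rfl, by simp [hMz]⟩
  refine ⟨hfin, ?_⟩
  have h1 : ∀ M, M ∈ Dl N n → ∃ i, i ∈ ix N n ∧ ∃ G ∈ G0 N, M = G * rp N i := fun M hM =>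
    exists_rp h.sqf hn hM
  choose! σ hσ hσG using h1
  obtain ⟨hsf, hsc⟩ := h.ncard_stab hz
  rw [Set.ncard_eq_toFinset_card _ hfin, Finset.card_eq_sum_card_fiberwise (f := σ)
    (t := fixIx N n z), Finset.sum_const_nat (m := 2 * mo t z), mul_comm]
  · intro i hi
    obtain ⟨hi1, G₀, hG₀, hfix⟩ := mem_fixIx.1 hi
    rw [← hsc, Set.ncard_eq_toFinset_card _ hsf]
    symm
    have hM₀ := G0_mul_Dl hG₀ (rp_mem h.sqf hn hi1)
    have hden := den_ne_zero (Dl_det_pos hn hM₀) hz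
    refine Finset.card_nbij (fun G => G * (G₀ * rp N i)) ?_ ?_ ?_
    · intro G hG
      simp only [Finset.mem_coe, Set.Finite.mem_toFinset, Set.mem_ofPred_eq, Finset.mem_filter] at hG ⊢
      have hGM := G0_mul_Dl hG.1 hM₀
      refine ⟨⟨hGM, by rw [mb_mul _ hden, hfix, hG.2]⟩, ?_⟩
      obtain ⟨G', hG', hh⟩ := hσG _ hGM
      rw [← Matrix.mul_assoc] at hh
      refine (rp_inj h.sqf hn hi1 (hσ _ hGM) (G0_mul (G0_adj (G0_mul hG.1 hG₀)) hG') ?_).symm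
      rw [Matrix.mul_assoc, ← Matrix.mul_assoc G, ← hh, ← eqv_coset_symm (G0_mul hG.1 hG₀) rfl]
    · intro G _ G' _ hh
      simp only at hh
      have h2 := congrArg (· * (G₀ * rp N i).adjugate) hh
      simp only [Matrix.mul_assoc _ (G₀ * rp N i), mul_adjugate, hM₀.1, Matrix.mul_smul,
        Matrix.mul_one] at h2
      exact smul_right_injective IM (by exact_mod_cast hn : (n : ℤ) ≠ 0) h2
    · intro M hM
      simp only [Finset.coe_filter, Set.Finite.mem_toFinset, Set.mem_ofPred_eq] at hM
      obtain ⟨⟨hM1, hMz⟩, rfl⟩ := hM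
      obtain ⟨G, hG, hh⟩ := hσG M hM1
      have hh2 : M = (G * G₀.adjugate) * (G₀ * rp N (σ M)) := by
        rw [Matrix.mul_assoc, ← eqv_coset_symm hG₀ rfl, ← hh]
      refine ⟨G * G₀.adjugate, ?_, hh2.symm⟩
      simp only [Finset.mem_coe, Set.Finite.mem_toFinset, Set.mem_ofPred_eq]
      refine ⟨G0_mul hG (G0_adj hG₀), ?_⟩
      conv_lhs => rw [← hfix]
      rw [← mb_mul _ hden, ← hh2, hMz]
  · intro M hM
    simp only [Finset.mem_coe, Set.Finite.mem_toFinset, Set.mem_ofPred_eq] at hM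
    obtain ⟨G, hG, hh⟩ := hσG M hM.1
    exact mem_fixIx.2 ⟨hσ M hM.1, G, hG, by rw [← hh, hM.2]⟩

/-- `1` if `n` is a square and `0` otherwise. -/
def sqi (n : ℕ) : ℕ := if IsSquare n then 1 else 0

lemma card_six (hN : Squarefree N) {n : ℕ} (hn : n ≠ 0) : (six N n).card = sqi n := by
  have key : ∀ i, i ∈ six N n ↔ ∃ k, k * k = n ∧ i = ⟨1, (k, k), 0⟩ := by
    intro i
    rw [mem_six]
    constructor
    · rintro ⟨hi, hs⟩
      obtain ⟨h1, h2, h3, h4, h5, h6⟩ := mem_ix' hN.ne_zero hn hi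
      obtain ⟨e, ⟨a, d⟩, b⟩ := i
      obtain ⟨g1, g2, g3⟩ := (scal_rep_iff hN h1 h5 h6 h3).1 hs
      simp only at g1 g2 g3
      subst g1 g2 g3
      exact ⟨a, by simpa using h2, rfl⟩
    · rintro ⟨k, hk, rfl⟩
      have hk0 : k ≠ 0 := by rintro rfl; exact hn (by simpa using hk.symm)
      refine ⟨(mem_ix hN.ne_zero hn).2 ⟨one_dvd _, by simpa using hk, by
        simpa using Nat.pos_of_ne_zero hk0⟩, ?_⟩
      exact (scal_rep_iff hN (one_dvd _) hk0 hk0 (by simpa using Nat.pos_of_ne_zero hk0)).2 ⟨rfl, rfl, rfl⟩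
  rw [sqi]
  split_ifs with hs
  · obtain ⟨k, hk⟩ := hs
    rw [Finset.card_eq_one]
    refine ⟨⟨1, (k, k), 0⟩, ?_⟩
    ext i
    rw [key, Finset.mem_singleton]
    constructor
    · rintro ⟨k', hk', rfl⟩
      have : k' = k := Nat.mul_self_inj.1 (hk'.trans hk)
      rw [this]
    · rintro rfl
      exact ⟨k, hk.symm, rfl⟩
  · rw [Finset.card_eq_zero, Finset.eq_empty_iff_forall_notMem]
    intro i hi
    obtain ⟨k, hk, -⟩ := (key i).1 hi
    exact hs ⟨k, hk.symm⟩

lemma six_subset_fixIx (hN : Squarefree N) {n : ℕ} (hn : n ≠ 0) (z : ℂ) : six N n ⊆ fixIx N n z := by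
  intro i hi
  obtain ⟨hi1, k, A, hA, hk⟩ := mem_six.1 hi
  refine mem_fixIx.2 ⟨hi1, A.adjugate, G0_adj hA, ?_⟩
  have hk0 : k ≠ 0 := by
    rintro rfl
    have := (rp_mem hN hn hi1).1
    rw [hk, zero_smul] at this
    rw [det_zero] at this
    exact hn (by exact_mod_cast this.symm)
  rw [hk, Matrix.mul_smul, G0_adj_mul hA, mb_smul hk0, mb_one]

lemma Haupt.card_fixIx (h : Haupt N t v γ κ) {n : ℕ} (hn : n ≠ 0) (z : ℂ) :
    (fixIx N n z).card = (fixIx N n z \ six N n).card + sqi n := by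
  rw [← card_six h.sqf hn, Finset.card_sdiff_add_card_eq_card (six_subset_fixIx h.sqf hn z)]

end FrickeTrace

namespace FrickeTrace

open Filter Topology
open UpperHalfPlane (upperHalfPlaneSet isOpen_upperHalfPlaneSet)
open Asymptotics

variable {N : ℕ} {t v : ℂ → ℂ} {γ κ : ℕ → ℂ}

lemma qc_add_one (z : ℂ) : qc (z + 1) = qc z := by
  rw [qc, qc, mul_add, Complex.exp_add, mul_one, Complex.exp_two_pi_mul_I, mul_one]

lemma differentiable_qc : Differentiable ℂ qc := by
  unfold qc; fun_prop

/-- A bounded periodic holomorphic function is a constant plus `O(q)`. -/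
lemma exists_limit {F : ℂ → ℂ} (hF : DifferentiableOn ℂ F upperHalfPlaneSet)
    (hper : ∀ z : ℂ, 0 < z.im → F (z + 1) = F z) (hb : BddInf F) :
    ∃ L, (fun z => F z - L) =O[lI] qc := by
  classical
  set f : ℂ → ℂ := fun z => if 0 < z.im then F z else 0 with hf
  have hev : f =ᶠ[lI] F := by
    filter_upwards [eventually_im_pos] with z hz
    simp only [hf, if_pos hz]
  have h1 : Function.Periodic f (1 : ℝ) := by
    intro z
    simp only [hf]
    have : (z + ((1 : ℝ) : ℂ)).im = z.im := by simp
    rw [this]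
    split_ifs with hz
    · simpa using hper z hz
    · rfl
  have h2 : ∀ᶠ z in lI, DifferentiableAt ℂ f z := by
    filter_upwards [eventually_im_pos] with z hz
    have h3 := hF.differentiableAt (isOpen_upperHalfPlaneSet.mem_nhds hz)
    refine h3.congr_of_eventuallyEq ?_
    filter_upwards [isOpen_upperHalfPlaneSet.mem_nhds hz] with w hw
    exact if_pos hw
  have h3 : BoundedAtFilter lI f := by
    obtain ⟨C, A, hC⟩ := hb
    refine (IsBigO.of_bound C ?_ : F =O[lI] (1 : ℂ → ℝ)).congr' hev.symm EventuallyEq.rfl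
    exact eventually_lI.2 ⟨A, fun z hz => by simpa using hC z hz⟩
  have h4 := Function.Periodic.exp_decay_sub_of_bounded_at_inf one_pos h1 h2 h3
  refine ⟨Function.Periodic.cuspFunction 1 f 0, (h4.congr' (hev.mono fun z hz => by simp only [hz]) EventuallyEq.rfl).trans ?_⟩
  refine IsBigO.of_bound 1 (Eventually.of_forall fun z => ?_)
  rw [norm_qc, one_mul, Real.norm_eq_abs, abs_of_pos (Real.exp_pos _)]
  simp

/-- The function has exact order `m` in `q` at `i∞`. -/
def Od (u : ℂ → ℂ) (m : ℤ) : Prop := ∃ C : ℂ, C ≠ 0 ∧ Tendsto (fun z => u z * qc z ^ (-m)) lI (𝓝 C)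

lemma Od.mul {u w : ℂ → ℂ} {m n : ℤ} (hu : Od u m) (hw : Od w n) : Od (fun z => u z * w z) (m + n) := by
  obtain ⟨C, hC, h1⟩ := hu
  obtain ⟨D, hD, h2⟩ := hw
  refine ⟨C * D, mul_ne_zero hC hD, (h1.mul h2).congr fun z => ?_⟩
  rw [neg_add, zpow_add₀ (qc_ne_zero z)]
  ring

lemma Od.inv {u : ℂ → ℂ} {m : ℤ} (hu : Od u m) : Od (fun z => (u z)⁻¹) (-m) := by
  obtain ⟨C, hC, h1⟩ := hu
  refine ⟨C⁻¹, inv_ne_zero hC, (h1.inv₀ hC).congr fun z => ?_⟩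
  rw [mul_inv, ← _root_.zpow_neg]

lemma Od.of_tendsto {u : ℂ → ℂ} {C : ℂ} (hC : C ≠ 0) (h : Tendsto u lI (𝓝 C)) : Od u 0 :=
  ⟨C, hC, h.congr fun z => by simp⟩

lemma Od.const {C : ℂ} (hC : C ≠ 0) : Od (fun _ => C) 0 := Od.of_tendsto hC tendsto_const_nhds

lemma Od.pow {u : ℂ → ℂ} {m : ℤ} (hu : Od u m) (k : ℕ) : Od (fun z => u z ^ k) (k * m) := by
  induction k with
  | zero => simpa using Od.const one_ne_zero
  | succ k ih => simpa only [pow_succ, Nat.cast_succ, add_mul, one_mul] using ih.mul hu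

lemma Od.prod {ι : Type*} (s : Finset ι) {u : ι → ℂ → ℂ} {m : ι → ℤ} (h : ∀ i ∈ s, Od (u i) (m i)) :
    Od (fun z => ∏ i ∈ s, u i z) (∑ i ∈ s, m i) := by
  classical
  induction s using Finset.induction_on with
  | empty => simpa using Od.const one_ne_zero
  | insert i s hi ih =>
    simp only [Finset.prod_insert hi, Finset.sum_insert hi]
    exact (h i (Finset.mem_insert_self ..)).mul (ih fun j hj => h j (Finset.mem_insert_of_mem hj))

lemma Od.congr {u w : ℂ → ℂ} {m : ℤ} (hu : Od u m) (h : ∀ z : ℂ, 0 < z.im → w z = u z) : Od w m := by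
  obtain ⟨C, hC, h1⟩ := hu
  refine ⟨C, hC, h1.congr' ?_⟩
  filter_upwards [eventually_im_pos] with z hz
  rw [h z hz]

lemma tendsto_qc_pow {k : ℕ} (hk : k ≠ 0) : Tendsto (fun z => qc z ^ k) lI (𝓝 0) := by
  simpa [hk] using tendsto_qc_nhds.pow k

lemma eq_zero_of_qc_zpow {C : ℂ} (hC : C ≠ 0) {m : ℤ}
    (h : Tendsto (fun z => qc z ^ m) lI (𝓝 C)) : m = 0 := by
  rcases lt_trichotomy m 0 with hm | hm | hm
  · obtain ⟨k, hk⟩ := Int.eq_ofNat_of_zero_le (by omega : 0 ≤ -m)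
    have h1 := h.inv₀ hC
    have h2 : Tendsto (fun z => (qc z ^ m)⁻¹) lI (𝓝 0) := by
      refine (tendsto_qc_pow (k := k) (by omega)).congr fun z => ?_
      rw [← _root_.zpow_neg, hk, zpow_natCast]
    exact absurd (tendsto_nhds_unique h1 h2) (inv_ne_zero hC)
  · exact hm
  · obtain ⟨k, hk⟩ := Int.eq_ofNat_of_zero_le hm.le
    have h2 : Tendsto (fun z => qc z ^ m) lI (𝓝 0) := by
      refine (tendsto_qc_pow (k := k) (by omega)).congr fun z => ?_
      rw [hk, zpow_natCast]
    exact absurd (tendsto_nhds_unique h h2) hC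

lemma Od.unique {u : ℂ → ℂ} {m n : ℤ} (h : Od u m) (h' : Od u n) : m = n := by
  obtain ⟨C, hC, h1⟩ := h
  obtain ⟨D, hD, h2⟩ := h'
  have h3 : Tendsto (fun z => qc z ^ (m - n)) lI (𝓝 (D / C)) := by
    refine (h2.div h1 hC).congr' ?_
    filter_upwards [h1.eventually_ne hC] with z hz
    have := qc_ne_zero z
    simp only [Pi.div_apply]
    rw [zpow_sub₀ this, _root_.zpow_neg, _root_.zpow_neg]
    have hu : u z ≠ 0 := left_ne_zero_of_mul hz
    field_simp
  have := eq_zero_of_qc_zpow (div_ne_zero hD hC) h3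
  omega

lemma Od.bddInf {u : ℂ → ℂ} {m : ℤ} (h : Od u m) (k : ℕ) (hk : 0 ≤ m + k) :
    BddInf (fun z => u z * qc z ^ k) := by
  obtain ⟨C, hC, h1⟩ := h
  obtain ⟨j, hj⟩ := Int.eq_ofNat_of_zero_le hk
  refine bddInf_of_tendsto (c := C * 0 ^ j) ((h1.mul (tendsto_qc_nhds.pow j)).congr fun z => ?_)
  rw [mul_assoc, ← zpow_natCast (qc z) j, ← hj, ← zpow_add₀ (qc_ne_zero z), ← zpow_natCast]
  congr 2; ring

lemma Haupt.tendsto_mul_qc (h : Haupt N t v γ κ) (s : ℂ) :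
    Tendsto (fun z => (t z - s) * qc z) lI (𝓝 1) := by
  have h1 : Tendsto (fun z => 1 + (v (qc z) - s) * qc z) lI (𝓝 (1 + (v 0 - s) * 0)) :=
    tendsto_const_nhds.add (((h.vcont.tendsto.comp tendsto_qc_nhds).sub_const s).mul tendsto_qc_nhds)
  rw [mul_zero, add_zero] at h1
  refine h1.congr' ?_
  filter_upwards [eventually_im_pos] with z hz
  have := qc_ne_zero z
  rw [h.eq z hz]
  field_simp
  ring

lemma Haupt.od_sub (h : Haupt N t v γ κ) (s : ℂ) : Od (fun z => t z - s) (-1) :=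
  ⟨1, one_ne_zero, (h.tendsto_mul_qc s).congr fun z => by simp⟩

lemma T_mem_G0 (N : ℕ) : (!![1, 1; 0, 1] : IM) ∈ G0 N := by
  simp [G0]

lemma mb_T (z : ℂ) : mb (!![1, 1; 0, 1] : IM) z = z + 1 := by
  simp [mb, den]

/-- An invariant function with a pole of bounded order at `i∞` only is a polynomial in the
Hauptmodul. -/
lemma Haupt.exists_poly_of_bddInf (h : Haupt N t v γ κ) (k : ℕ) : ∀ F : ℂ → ℂ,
    DifferentiableOn ℂ F upperHalfPlaneSet →
    (∀ M ∈ G0 N, ∀ z : ℂ, 0 < z.im → F (mb M z) = F z) →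
    (∀ e, e ∣ N → e ≠ 1 → ∃ A ∈ AL N e, BddInf (fun z => F (mb A z))) →
    BddInf (fun z => F z * qc z ^ k) → ∃ R : Polynomial ℂ, ∀ z : ℂ, 0 < z.im → F z = R.eval (t z) := by
  induction k with
  | zero =>
    intro F hF hinv hA hb
    obtain ⟨c, hc⟩ := eq_const_of_bddInf_AL h.sqf hF hinv fun e he => by
      by_cases he1 : e = 1
      · refine ⟨1, by rw [he1, AL_one]; exact one_mem_G0 N, ?_⟩
        simpa using hb
      · exact hA e he he1
    exact ⟨Polynomial.C c, fun z hz => by rw [hc z hz, Polynomial.eval_C]⟩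
  | succ k ih =>
    intro F hF hinv hA hb
    have hper : ∀ z : ℂ, 0 < z.im → F (z + 1) = F z := fun z hz => by
      rw [← mb_T]; exact hinv _ (T_mem_G0 N) z hz
    have htper : ∀ z : ℂ, 0 < z.im → t (z + 1) = t z := fun z hz => by
      rw [← mb_T]; exact h.inv _ (T_mem_G0 N) z hz
    obtain ⟨L, hL⟩ := exists_limit (hF.mul (differentiable_qc.differentiableOn.pow (k + 1)))
      (fun z hz => by simp only [Pi.mul_apply, Pi.pow_apply, hper z hz, qc_add_one]) hb
    have htL : (fun z => (t z * qc z) ^ (k + 1) - 1) =O[lI] qc := by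
      have h1 : (fun z => t z * qc z - 1) =O[lI] qc := by
        have h2 : (fun z => v (qc z) * qc z) =O[lI] fun z => 1 * qc z :=
          (h.vcont.tendsto.comp tendsto_qc_nhds).isBigO_one ℂ |>.mul (isBigO_refl _ _)
        simp only [one_mul] at h2
        refine h2.congr' ?_ EventuallyEq.rfl
        filter_upwards [eventually_im_pos] with z hz
        have := qc_ne_zero z
        rw [h.eq z hz]
        field_simp
        ring
      have h3 : (fun z => ∑ i ∈ Finset.range (k + 1), (t z * qc z) ^ i) =O[lI] fun _ => (1 : ℂ) := by
        have : Tendsto (fun z => ∑ i ∈ Finset.range (k + 1), (t z * qc z) ^ i) lI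
            (𝓝 (∑ i ∈ Finset.range (k + 1), 1 ^ i)) :=
          tendsto_finsetSum _ fun i _ => by simpa using (h.tendsto_mul_qc 0).pow i
        exact this.isBigO_one ℂ
      have h4 := h3.mul h1
      simp only [one_mul] at h4
      refine h4.congr (fun z => ?_) fun z => rfl
      exact geom_sum_mul _ _
    obtain ⟨R, hR⟩ := ih (fun z => F z - L * t z ^ (k + 1))
      (hF.sub ((h.diff.pow _).const_mul L)) (fun M hM z hz => by rw [hinv M hM z hz, h.inv M hM z hz])
      (fun e he he1 => by
        obtain ⟨A, hA, hbA⟩ := hA e he he1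
        refine ⟨A, hA, ?_⟩
        have := bddInf_of_tendsto (((h.tendsto_gamma he he1 hA).pow (k + 1)).const_mul (-L))
        simpa only [sub_eq_add_neg, neg_mul] using hbA.add this)
      (by
        have h5 : (fun z => (F z - L * t z ^ (k + 1)) * qc z ^ k * qc z) =O[lI] fun z => 1 * qc z := by
          refine (hL.sub (htL.const_mul_left L)).congr (fun z => ?_) fun z => by rw [one_mul]
          simp only [Pi.mul_apply, Pi.pow_apply]
          ring
        obtain ⟨C, hC⟩ := h5.bound
        obtain ⟨Y, hY⟩ := eventually_lI.1 hC
        refine ⟨C, Y, fun z hz => ?_⟩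
        have h6 := hY z hz
        rw [norm_mul, norm_mul (1 : ℂ), norm_one, one_mul] at h6
        exact le_of_mul_le_mul_right h6 (norm_pos_iff.2 (qc_ne_zero z)))
    refine ⟨R + Polynomial.C L * Polynomial.X ^ (k + 1), fun z hz => ?_⟩
    simp only [Polynomial.eval_add, ← hR z hz, Polynomial.eval_mul, Polynomial.eval_C,
      Polynomial.eval_pow, Polynomial.eval_X]
    ring

lemma Haupt.gamma_inj (h : Haupt N t v γ κ) {e f : ℕ} (he : e ∣ N) (he1 : e ≠ 1) (hf : f ∣ N)
    (hf1 : f ≠ 1) (hg : γ e = γ f) : e = f := by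
  by_contra hef
  obtain ⟨A, hA⟩ := AL_nonempty h.sqf he
  obtain ⟨B, hB⟩ := AL_nonempty h.sqf hf
  obtain ⟨C, hC, hCe⟩ := AL_mul (h.pos he) he hf hA hB
  have hst : st e f ∣ N := st_dvd (h.pos he) he hf
  have hst1 : st e f ≠ 1 := fun h1 => hef (st_eq_one (h.pos he) h1)
  have h1 := h.tendsto_gamma hst hst1 hC
  have hgcd : ((e.gcd f : ℕ) : ℤ) ≠ 0 := by
    exact_mod_cast (Nat.gcd_pos_of_pos_left _ (Nat.pos_of_ne_zero (h.pos he))).ne'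
  have h2 : ∀ z : ℂ, 0 < z.im → t (mb C z) - γ e = κ e / κ f * (t z - γ e) := by
    intro z hz
    have hB0 := AL_det_pos (h.pos hf) hB
    have h3 : mb C z = mb A (mb B z) := by
      rw [← mb_mul _ (den_ne_zero hB0 hz), hCe, mb_smul hgcd]
    rw [h3, h.al_eq he he1 hA (im_mb_pos hB0 hz), h.al_eq hf hf1 hB hz, hg, add_sub_cancel_left, add_sub_cancel_left]
    have := h.kne f hf hf1
    have := sub_ne_zero.2 (h.ne_gamma hf hf1 hz)
    field_simp
  have hc : κ e / κ f ≠ 0 := div_ne_zero (h.kne e he he1) (h.kne f hf hf1)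
  have h4 : Tendsto (fun z => t z - γ e) lI (𝓝 ((κ e / κ f)⁻¹ * (γ (st e f) - γ e))) := by
    refine ((h1.sub_const (γ e)).const_mul (κ e / κ f)⁻¹).congr' ?_
    filter_upwards [eventually_im_pos] with z hz
    rw [h2 z hz, inv_mul_cancel_left₀ hc]
  exact not_tendsto_nhds_of_tendsto_atTop
    (tendsto_norm_cobounded_atTop.comp (h.tendsto_sub_cobounded (γ e))) _ h4.norm

end FrickeTrace

namespace FrickeTrace

open Filter Topology
open UpperHalfPlane (upperHalfPlaneSet isOpen_upperHalfPlaneSet)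
open Asymptotics

variable {N : ℕ} {t v : ℂ → ℂ} {γ κ : ℕ → ℂ}

/-- The function is a nonzero constant times `q ^ m * exp (α q + β q ^ 2) * (1 + o (q ^ 2))`. -/
def LE (u : ℂ → ℂ) (m : ℤ) (β : ℂ) : Prop := ∃ C : ℂ, C ≠ 0 ∧ ∃ α : ℂ,
  (fun z => u z * (C * qc z ^ m * exp (α * qc z + β * qc z ^ 2))⁻¹ - 1) =o[lI] fun z => qc z ^ 2

lemma tendsto_lin (α β : ℂ) : Tendsto (fun z => α * qc z + β * qc z ^ 2) lI (𝓝 0) := by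
  simpa using (tendsto_qc_nhds.const_mul α).add ((tendsto_qc_pow two_ne_zero).const_mul β)

lemma tendsto_exp_lin (α β : ℂ) : Tendsto (fun z => exp (α * qc z + β * qc z ^ 2)) lI (𝓝 1) := by
  simpa [Function.comp_def] using (Complex.continuous_exp.tendsto 0).comp (tendsto_lin α β)

lemma tendsto_of_isLittleO {f : ℂ → ℂ} {k : ℕ} (h : (fun z => f z - 1) =o[lI] fun z => qc z ^ k) :
    Tendsto f lI (𝓝 1) := by
  have h1 : (fun z => qc z ^ k) =O[lI] fun _ => (1 : ℂ) := (tendsto_qc_nhds.pow k).isBigO_one ℂ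
  have h2 := (isLittleO_one_iff ℂ).1 (h.trans_isBigO h1)
  simpa using h2.add_const 1

lemma LE.od {u : ℂ → ℂ} {m : ℤ} {β : ℂ} (h : LE u m β) : Od u m := by
  obtain ⟨C, hC, α, h1⟩ := h
  have h2 := (tendsto_of_isLittleO h1).mul ((tendsto_exp_lin α β).const_mul C)
  refine ⟨C, hC, ?_⟩
  rw [one_mul, mul_one] at h2
  refine h2.congr fun z => ?_
  have := qc_ne_zero z
  have := Complex.exp_ne_zero (α * qc z + β * qc z ^ 2)
  rw [_root_.zpow_neg]
  field_simp

lemma LE.congr {u w : ℂ → ℂ} {m : ℤ} {β : ℂ} (h : LE u m β) (h' : ∀ z : ℂ, 0 < z.im → w z = u z) :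
    LE w m β := by
  obtain ⟨C, hC, α, h1⟩ := h
  refine ⟨C, hC, α, h1.congr' ?_ EventuallyEq.rfl⟩
  filter_upwards [eventually_im_pos] with z hz
  rw [h' z hz]

lemma isLittleO_mul_sub_one {f g : ℂ → ℂ} {l : ℂ → ℂ} {L : Filter ℂ} (hf : (fun z => f z - 1) =o[L] l)
    (hg : (fun z => g z - 1) =o[L] l) (hl : l =O[L] fun _ => (1 : ℂ)) :
    (fun z => f z * g z - 1) =o[L] l := by
  have h1 : (fun z => (f z - 1) * (g z - 1)) =o[L] l := by
    have := hf.mul_isBigO (hg.isBigO.trans hl)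
    simpa using this
  refine ((hf.add hg).add h1).congr_left fun z => ?_
  ring

lemma isBigO_qc_pow (k : ℕ) : (fun z => qc z ^ k) =O[lI] fun _ => (1 : ℂ) :=
  (tendsto_qc_nhds.pow k).isBigO_one ℂ

lemma LE.mul {u w : ℂ → ℂ} {m m' : ℤ} {β β' : ℂ} (h : LE u m β) (h' : LE w m' β') :
    LE (fun z => u z * w z) (m + m') (β + β') := by
  obtain ⟨C, hC, α, h1⟩ := h
  obtain ⟨D, hD, α', h2⟩ := h'
  refine ⟨C * D, mul_ne_zero hC hD, α + α', (isLittleO_mul_sub_one h1 h2 (isBigO_qc_pow 2)).congr_left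
    fun z => ?_⟩
  have e1 : exp ((α + α') * qc z + (β + β') * qc z ^ 2) =
      exp (α * qc z + β * qc z ^ 2) * exp (α' * qc z + β' * qc z ^ 2) := by
    rw [← Complex.exp_add]; ring_nf
  rw [e1, zpow_add₀ (qc_ne_zero z)]
  simp only [mul_inv]
  ring

lemma LE.const {C : ℂ} (hC : C ≠ 0) : LE (fun _ => C) 0 0 := by
  refine ⟨C, hC, 0, ?_⟩
  simp [hC]

lemma LE.of_asymp {u : ℂ → ℂ} (h : (fun z => u z - 1) =o[lI] fun z => qc z ^ 2) : LE u 0 0 :=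
  ⟨1, one_ne_zero, 0, by simpa using h⟩

lemma LE.pow {u : ℂ → ℂ} {m : ℤ} {β : ℂ} (h : LE u m β) (k : ℕ) :
    LE (fun z => u z ^ k) (k * m) (k * β) := by
  induction k with
  | zero => simpa using LE.const one_ne_zero
  | succ k ih => simpa only [pow_succ, Nat.cast_succ, add_mul, one_mul] using ih.mul h

lemma LE.prod {ι : Type*} (s : Finset ι) {u : ι → ℂ → ℂ} {m : ι → ℤ} {β : ι → ℂ}
    (h : ∀ i ∈ s, LE (u i) (m i) (β i)) :
    LE (fun z => ∏ i ∈ s, u i z) (∑ i ∈ s, m i) (∑ i ∈ s, β i) := by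
  classical
  induction s using Finset.induction_on with
  | empty => simpa using LE.const one_ne_zero
  | insert i s hi ih =>
    simp only [Finset.prod_insert hi, Finset.sum_insert hi]
    exact (h i (Finset.mem_insert_self ..)).mul (ih fun j hj => h j (Finset.mem_insert_of_mem hj))

lemma exp_expansion (α β : ℂ) :
    (fun z => exp (α * qc z + β * qc z ^ 2) - (1 + α * qc z + (β + α ^ 2 / 2) * qc z ^ 2)) =o[lI]
      fun z => qc z ^ 2 := by
  have hy : (fun z => α * qc z + β * qc z ^ 2) =O[lI] qc := by
    have h1 : (fun z => (α + β * qc z) * qc z) =O[lI] fun z => 1 * qc z :=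
      ((tendsto_const_nhds.add (tendsto_qc_nhds.const_mul β)).isBigO_one ℂ).mul (isBigO_refl _ _)
    simp only [one_mul] at h1
    exact h1.congr_left fun z => by ring
  have h3 : (fun z => qc z ^ 3) =o[lI] fun z => qc z ^ 2 := by
    have : (fun z => qc z * qc z ^ 2) =o[lI] fun z => 1 * qc z ^ 2 :=
      ((isLittleO_one_iff ℂ).2 tendsto_qc_nhds).mul_isBigO (isBigO_refl _ _)
    simp only [one_mul] at this
    exact this.congr_left fun z => by ring
  have h4 : (fun z => exp (α * qc z + β * qc z ^ 2) - ∑ m ∈ Finset.range 3,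
      (α * qc z + β * qc z ^ 2) ^ m / (m.factorial : ℂ)) =o[lI] fun z => qc z ^ 2 := by
    refine IsBigO.trans_isLittleO ?_ h3
    refine IsBigO.trans ?_ (hy.pow 3)
    refine IsBigO.of_bound ((Nat.succ 3 : ℝ) * ((Nat.factorial 3 : ℝ) * 3)⁻¹) ?_
    filter_upwards [(tendsto_lin α β).norm.eventually_lt_const (by simp : ‖(0 : ℂ)‖ < 1)] with z hz
    rw [norm_pow, mul_comm _ (‖_‖ ^ 3)]
    exact_mod_cast Complex.exp_bound hz.le (by norm_num : 0 < 3)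
  have h5 : (fun z => (α * β + β ^ 2 / 2 * qc z) * qc z ^ 3) =o[lI] fun z => 1 * qc z ^ 2 :=
    ((tendsto_const_nhds.add (tendsto_qc_nhds.const_mul _)).isBigO_one ℂ).mul_isLittleO h3
  simp only [one_mul] at h5
  refine (h4.add h5).congr_left fun z => ?_
  simp only [Finset.sum_range_succ, Finset.sum_range_zero, Nat.factorial, Nat.cast_one]
  push_cast
  ring

lemma LE.of_expansion {u : ℂ → ℂ} {C : ℂ} (hC : C ≠ 0) {m : ℤ} {a b : ℂ}
    (h : (fun z => u z * (C * qc z ^ m)⁻¹ - (1 + a * qc z + b * qc z ^ 2)) =o[lI] fun z => qc z ^ 2) :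
    LE u m (b - a ^ 2 / 2) := by
  refine ⟨C, hC, a, ?_⟩
  have h1 := exp_expansion a (b - a ^ 2 / 2)
  have h2 := ((tendsto_exp_lin a (b - a ^ 2 / 2)).inv₀ one_ne_zero).isBigO_one ℂ
  have h3 := h2.mul_isLittleO (h.sub h1)
  simp only [one_mul] at h3
  refine h3.congr_left fun z => ?_
  have := Complex.exp_ne_zero (a * qc z + (b - a ^ 2 / 2) * qc z ^ 2)
  have := qc_ne_zero z
  field_simp
  ring

lemma eq_zero_of_isLittleO {a b : ℂ} (h : (fun z => a * qc z + b * qc z ^ 2) =o[lI] fun z => qc z ^ 2) :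
    a = 0 ∧ b = 0 := by
  have h1 : Tendsto (fun z => (a * qc z + b * qc z ^ 2) / qc z ^ 2) lI (𝓝 0) :=
    h.tendsto_div_nhds_zero
  have ha : a = 0 := by
    have h2 : Tendsto (fun z => (a * qc z + b * qc z ^ 2) / qc z ^ 2 * qc z - b * qc z) lI
        (𝓝 (0 * 0 - b * 0)) := (h1.mul tendsto_qc_nhds).sub (tendsto_qc_nhds.const_mul b)
    simp only [mul_zero, sub_zero] at h2
    refine tendsto_nhds_unique (tendsto_const_nhds.congr fun z => ?_) h2
    have := qc_ne_zero z
    field_simp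
    ring
  subst ha
  refine ⟨rfl, tendsto_nhds_unique (tendsto_const_nhds.congr fun z => ?_) h1⟩
  have := qc_ne_zero z
  field_simp
  ring

lemma isLittleO_inv_sub_one {f : ℂ → ℂ} (h : (fun z => f z - 1) =o[lI] fun z => qc z ^ 2) :
    (fun z => (f z)⁻¹ - 1) =o[lI] fun z => qc z ^ 2 := by
  have h1 := tendsto_of_isLittleO h
  have h2 := ((h1.inv₀ one_ne_zero).isBigO_one ℂ).mul_isLittleO h.neg_left
  simp only [one_mul] at h2
  refine h2.congr' ?_ EventuallyEq.rfl
  filter_upwards [h1.eventually_ne one_ne_zero] with z hz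
  field_simp
  ring

lemma LE.inv {u : ℂ → ℂ} {m : ℤ} {β : ℂ} (h : LE u m β) : LE (fun z => (u z)⁻¹) (-m) (-β) := by
  obtain ⟨C, hC, α, h1⟩ := h
  refine ⟨C⁻¹, inv_ne_zero hC, -α, (isLittleO_inv_sub_one h1).congr_left fun z => ?_⟩
  have e1 : exp (-α * qc z + -β * qc z ^ 2) = (exp (α * qc z + β * qc z ^ 2))⁻¹ := by
    rw [← Complex.exp_neg]; ring_nf
  rw [e1, _root_.zpow_neg]
  simp only [mul_inv, inv_inv]

lemma LE.unique {u : ℂ → ℂ} {m m' : ℤ} {β β' : ℂ} (h : LE u m β) (h' : LE u m' β') :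
    m = m' ∧ β = β' := by
  have hm := h.od.unique h'.od
  refine ⟨hm, ?_⟩
  have hu : ∀ᶠ z in lI, u z * (u z)⁻¹ = 1 := by
    obtain ⟨C, hC, h1⟩ := h.od
    filter_upwards [h1.eventually_ne hC] with z hz
    exact mul_inv_cancel₀ (left_ne_zero_of_mul hz)
  obtain ⟨C, hC, α, h1⟩ := h.mul h'.inv
  rw [← hm, add_neg_cancel] at h1
  simp only [zpow_zero, mul_one] at h1
  have h2 : (fun z => C * exp (α * qc z + (β + -β') * qc z ^ 2) - 1) =o[lI] fun z => qc z ^ 2 := by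
    refine (isLittleO_inv_sub_one h1).congr' ?_ EventuallyEq.rfl
    filter_upwards [hu] with z hz
    rw [hz, one_mul, inv_inv]
  have hC1 : C = 1 := by
    have h3 := tendsto_of_isLittleO h2
    have h4 := (tendsto_exp_lin α (β + -β')).const_mul C
    rw [mul_one] at h4
    exact tendsto_nhds_unique h4 h3
  subst hC1
  have h5 := h2.sub (exp_expansion α (β + -β'))
  obtain ⟨ha, hb⟩ := eq_zero_of_isLittleO (a := α) (b := β + -β' + α ^ 2 / 2)
    (h5.congr_left fun z => by ring)
  subst ha
  linear_combination hb

/-- The polynomial whose values govern the second-order behaviour of `t - s` at `i∞`. -/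
noncomputable def pv (v : ℂ → ℂ) (s : ℂ) : ℂ := (s - v 0) ^ 2 - 2 * deriv v 0

lemma Haupt.le_sub (h : Haupt N t v γ κ) (s : ℂ) : LE (fun z => t z - s) (-1) (-pv v s / 2) := by
  have hb : -pv v s / 2 = deriv v 0 - (v 0 - s) ^ 2 / 2 := by rw [pv]; ring
  rw [hb]
  refine LE.of_expansion (C := 1) one_ne_zero ?_
  have h1 : (fun q => v q - v 0 - deriv v 0 * q) =o[𝓝 0] fun q => q := by
    have := (h.vdiff.differentiableAt ball_mem).hasDerivAt.isLittleO
    simpa [mul_comm] using this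
  have h2 := (h1.comp_tendsto tendsto_qc_nhds).mul_isBigO (isBigO_refl qc lI)
  refine h2.congr' ?_ (Eventually.of_forall fun z => by simp [pow_two])
  filter_upwards [eventually_im_pos] with z hz
  have := qc_ne_zero z
  simp only [Function.comp_apply]
  rw [h.eq z hz, one_mul, _root_.zpow_neg_one, inv_inv]
  field_simp
  ring

end FrickeTrace

namespace FrickeTrace

open Filter Topology
open UpperHalfPlane (upperHalfPlaneSet isOpen_upperHalfPlaneSet)
open Asymptotics Polynomial

variable {N : ℕ} {t v : ℂ → ℂ} {γ κ : ℕ → ℂ}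

lemma Haupt.le_multiset (h : Haupt N t v γ κ) (S : Multiset ℂ) :
    LE (fun z => (S.map fun s => t z - s).prod) (-(Multiset.card S : ℤ)) (-(S.map (pv v)).sum / 2) := by
  induction S using Multiset.induction_on with
  | empty => simpa using LE.const one_ne_zero
  | cons a S ih =>
    simp only [Multiset.map_cons, Multiset.prod_cons, Multiset.card_cons, Multiset.sum_cons]
    have := (h.le_sub a).mul ih
    have e1 : -1 + -(Multiset.card S : ℤ) = -((Multiset.card S + 1 : ℕ) : ℤ) := by push_cast; ring
    have e2 : -pv v a / 2 + -(S.map (pv v)).sum / 2 = -(pv v a + (S.map (pv v)).sum) / 2 := by ring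
    rwa [e1, e2] at this

lemma eval_eq_roots_prod (R : ℂ[X]) (x : ℂ) :
    R.eval x = R.leadingCoeff * (R.roots.map fun s => x - s).prod := by
  conv_lhs => rw [(IsAlgClosed.splits R).eq_prod_roots]
  rw [eval_mul, eval_C, eval_multiset_prod, Multiset.map_map]
  simp

lemma Haupt.le_poly (h : Haupt N t v γ κ) {R : ℂ[X]} (hR : R ≠ 0) :
    LE (fun z => R.eval (t z)) (-(Multiset.card R.roots : ℤ)) (-(R.roots.map (pv v)).sum / 2) := by
  have := (LE.const (leadingCoeff_ne_zero.2 hR)).mul (h.le_multiset R.roots)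
  rw [zero_add, zero_add] at this
  exact this.congr fun z _ => eval_eq_roots_prod R (t z)

lemma exists_factor {R : ℂ[X]} (hR : R ≠ 0) (s : ℂ) : ∃ S : ℂ[X], S.eval s ≠ 0 ∧
    ∀ x, R.eval x = (x - s) ^ R.rootMultiplicity s * S.eval x := by
  obtain ⟨S, h1, h2⟩ := exists_eq_pow_rootMultiplicity_mul_and_not_dvd R hR s
  refine ⟨S, fun h0 => h2 (dvd_iff_isRoot.2 h0), fun x => ?_⟩
  conv_lhs => rw [h1]
  simp

lemma Haupt.order_poly (h : Haupt N t v γ κ) {R : ℂ[X]} (hR : R ≠ 0) {z : ℂ} (hz : 0 < z.im) :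
    analyticOrderAt (fun w => R.eval (t w)) z = ((R.rootMultiplicity (t z) * mo t z : ℕ) : ℕ∞) := by
  obtain ⟨S, hS, hRS⟩ := exists_factor hR (t z)
  have ht := h.analyticOnNhd z hz
  have h1 : AnalyticAt ℂ (fun w => S.eval (t w)) z := by
    exact (S.differentiable.analyticAt _).comp ht
  have h2 : (fun w => R.eval (t w)) =
      (fun w => t w - t z) ^ R.rootMultiplicity (t z) * fun w => S.eval (t w) := by
    funext w
    simp only [Pi.mul_apply, Pi.pow_apply, hRS]
  rw [h2, analyticOrderAt_mul ((h.analyticAt_sub hz _).pow _) h1, analyticOrderAt_pow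
    (h.analyticAt_sub hz _), h.order_eq hz, h1.analyticOrderAt_eq_zero.2 hS]
  simp

lemma Haupt.od_al_sub (h : Haupt N t v γ κ) {e : ℕ} (he : e ∣ N) (he1 : e ≠ 1) {A : IM}
    (hA : A ∈ AL N e) : Od (fun z => t (mb A z) - γ e) 1 := by
  have := (Od.const (h.kne e he he1)).mul (h.od_sub (γ e)).inv
  simp only [zero_add, neg_neg] at this
  refine this.congr fun z hz => ?_
  rw [h.al_eq he he1 hA hz]
  ring

lemma Haupt.od_al_poly (h : Haupt N t v γ κ) {R : ℂ[X]} (hR : R ≠ 0) {e : ℕ} (he : e ∣ N) (he1 : e ≠ 1)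
    {A : IM} (hA : A ∈ AL N e) : Od (fun z => R.eval (t (mb A z))) (R.rootMultiplicity (γ e)) := by
  obtain ⟨S, hS, hRS⟩ := exists_factor hR (γ e)
  have h1 : Od (fun z => S.eval (t (mb A z))) 0 :=
    Od.of_tendsto hS ((S.continuous.tendsto _).comp (h.tendsto_gamma he he1 hA))
  have := ((h.od_al_sub he he1 hA).pow (R.rootMultiplicity (γ e))).mul h1
  rw [mul_one, add_zero] at this
  exact this.congr fun z _ => hRS _

/-- The cusps other than `i∞`. -/
def cus (N : ℕ) : Finset ℕ := N.divisors.erase 1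

lemma Haupt.mem_cus (h : Haupt N t v γ κ) {e : ℕ} : e ∈ cus N ↔ e ∣ N ∧ e ≠ 1 := by
  simp [cus, h.sqf.ne_zero, and_comm]

/-- The product of `t - γ` over the cusps other than `i∞`. -/
noncomputable def cuspProd (N : ℕ) (t : ℂ → ℂ) (γ : ℕ → ℂ) (z : ℂ) : ℂ := ∏ e ∈ cus N, (t z - γ e)

lemma Haupt.od_al_cuspProd (h : Haupt N t v γ κ) {e : ℕ} (he : e ∣ N) (he1 : e ≠ 1) {A : IM}
    (hA : A ∈ AL N e) : Od (fun z => cuspProd N t γ (mb A z)) 1 := by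
  have h1 : ∀ f ∈ cus N, Od (fun z => t (mb A z) - γ f) (if f = e then 1 else 0) := by
    intro f hf
    rw [h.mem_cus] at hf
    split_ifs with hfe
    · rw [hfe]; exact h.od_al_sub he he1 hA
    · refine Od.of_tendsto ?_ ((h.tendsto_gamma he he1 hA).sub_const (γ f))
      exact sub_ne_zero.2 fun hg => hfe (h.gamma_inj he he1 hf.1 hf.2 hg).symm
  have := Od.prod (cus N) h1
  rwa [Finset.sum_ite_eq' (cus N) e, if_pos (h.mem_cus.2 ⟨he, he1⟩)] at this

lemma Haupt.le_cuspProd (h : Haupt N t v γ κ) :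
    LE (cuspProd N t γ) (-((cus N).card : ℤ)) (-(∑ e ∈ cus N, pv v (γ e)) / 2) := by
  have := LE.prod (cus N) fun e _ => h.le_sub (γ e)
  rw [Finset.sum_const, nsmul_eq_mul, ← Finset.sum_div, Finset.sum_neg_distrib, mul_neg, mul_one] at this
  exact this

lemma Haupt.cuspProd_ne_zero (h : Haupt N t v γ κ) {z : ℂ} (hz : 0 < z.im) : cuspProd N t γ z ≠ 0 :=
  Finset.prod_ne_zero_iff.2 fun _ he =>
    sub_ne_zero.2 (h.ne_gamma (h.mem_cus.1 he).1 (h.mem_cus.1 he).2 hz)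

lemma Haupt.diff_cuspProd (h : Haupt N t v γ κ) :
    DifferentiableOn ℂ (cuspProd N t γ) upperHalfPlaneSet := by
  unfold cuspProd
  exact DifferentiableOn.fun_finsetProd fun e _ => h.diff.sub_const _

/-- An invariant function of finite order at the cusps is, up to a power of the cuspidal product, a
polynomial in the Hauptmodul. -/
lemma Haupt.exists_poly (h : Haupt N t v γ κ) {F : ℂ → ℂ} (hF : DifferentiableOn ℂ F upperHalfPlaneSet)
    (hinv : ∀ M ∈ G0 N, ∀ z : ℂ, 0 < z.im → F (mb M z) = F z) {m₁ : ℤ} (hm₁ : Od F m₁) {m : ℕ → ℤ}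
    (hm : ∀ e ∈ cus N, ∃ A ∈ AL N e, Od (fun z => F (mb A z)) (m e)) :
    ∃ (k : ℕ) (R : ℂ[X]), R ≠ 0 ∧ (∀ z : ℂ, 0 < z.im → F z * cuspProd N t γ z ^ k = R.eval (t z)) := by
  set k : ℕ := ∑ e ∈ cus N, (m e).natAbs with hk
  have hke : ∀ e ∈ cus N, 0 ≤ m e + k := by
    intro e he
    have : (m e).natAbs ≤ k := Finset.single_le_sum (f := fun e => (m e).natAbs) (fun _ _ => Nat.zero_le _) he
    omega
  have hod := hm₁.mul (h.le_cuspProd.od.pow k)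
  obtain ⟨R, hR⟩ := h.exists_poly_of_bddInf (m₁ + k * -((cus N).card : ℤ)).natAbs
    (fun z => F z * cuspProd N t γ z ^ k) (hF.mul (h.diff_cuspProd.pow k))
    (fun M hM z hz => by simp only [hinv M hM z hz, cuspProd, h.inv M hM z hz])
    (fun e he he1 => by
      obtain ⟨A, hA, hAo⟩ := hm e (h.mem_cus.2 ⟨he, he1⟩)
      have := (hAo.mul ((h.od_al_cuspProd he he1 hA).pow k)).bddInf 0 (by
        have := hke e (h.mem_cus.2 ⟨he, he1⟩)
        simpa using this)
      exact ⟨A, hA, by simpa using this⟩)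
    (hod.bddInf _ (by omega))
  refine ⟨k, R, ?_, hR⟩
  rintro rfl
  obtain ⟨C, hC, h1⟩ := hod
  obtain ⟨z, hz, hz'⟩ := ((h1.eventually_ne hC).and eventually_im_pos).exists
  apply hz
  simp only [hR z hz', eval_zero, zero_mul]

lemma sum_roots_eq (R : ℂ[X]) {U : Finset ℂ} (hU : ∀ s ∈ R.roots, s ∈ U) (f : ℂ → ℂ) :
    (R.roots.map f).sum = ∑ s ∈ U, (R.rootMultiplicity s : ℂ) * f s := by
  classical
  rw [Finset.sum_multiset_map_count]
  simp only [count_roots, nsmul_eq_mul]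
  refine Finset.sum_subset (fun s hs => hU s (Multiset.mem_toFinset.1 hs)) fun s _ hs => ?_
  rw [Multiset.mem_toFinset, ← Multiset.count_eq_zero, count_roots] at hs
  rw [hs, Nat.cast_zero, zero_mul]

/-- Divisor formula. -/
theorem Haupt.divisor (h : Haupt N t v γ κ) {F : ℂ → ℂ} (hF : DifferentiableOn ℂ F upperHalfPlaneSet)
    (hinv : ∀ M ∈ G0 N, ∀ z : ℂ, 0 < z.im → F (mb M z) = F z) {m₁ : ℤ} {β : ℂ} (hm₁ : LE F m₁ β)
    {m : ℕ → ℤ} (hm : ∀ e ∈ cus N, ∃ A ∈ AL N e, Od (fun z => F (mb A z)) (m e)) {T : Finset ℂ}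
    {pt : ℂ → ℂ} (hpt : ∀ s ∈ T, 0 < (pt s).im ∧ t (pt s) = s)
    (hT : ∀ z : ℂ, 0 < z.im → F z = 0 → t z ∈ T) {ν : ℂ → ℕ}
    (hν : ∀ s ∈ T, analyticOrderAt F (pt s) = ν s) (c : ℂ)
    (hc : c * (cus N).card + c = ∑ e ∈ cus N, pv v (γ e)) :
    ∑ s ∈ T, (ν s : ℂ) / mo t (pt s) * (pv v s - c) =
      -2 * β - ∑ e ∈ cus N, ((m e : ℂ) - m₁) * (pv v (γ e) - c) := by
  classical
  obtain ⟨k, R, hR, hFR⟩ := h.exists_poly hF hinv hm₁.od hm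
  have hRT : ∀ s ∈ R.roots, s ∈ T ∪ (cus N).image γ := by
    intro s hs
    rw [mem_roots hR] at hs
    by_contra hsT
    rw [Finset.mem_union, not_or] at hsT
    obtain ⟨z, hz, rfl⟩ := h.surjective (s := s) fun e he he1 hse =>
      hsT.2 (Finset.mem_image.2 ⟨e, h.mem_cus.2 ⟨he, he1⟩, hse.symm⟩)
    have h1 := hFR z hz
    rw [hs.eq_zero] at h1
    exact hsT.1 (hT z hz ((mul_eq_zero.1 h1).resolve_right (pow_ne_zero _ (h.cuspProd_ne_zero hz))))
  have hdis : Disjoint T ((cus N).image γ) := by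
    rw [Finset.disjoint_left]
    intro s hs hs'
    obtain ⟨e, he, rfl⟩ := Finset.mem_image.1 hs'
    obtain ⟨h1, h2⟩ := hpt _ hs
    exact h.ne_gamma (h.mem_cus.1 he).1 (h.mem_cus.1 he).2 h1 h2
  have hγi : Set.InjOn γ (cus N) := fun e he f hf hef =>
    h.gamma_inj (h.mem_cus.1 he).1 (h.mem_cus.1 he).2 (h.mem_cus.1 hf).1 (h.mem_cus.1 hf).2 hef
  have hμ : ∀ s ∈ T, (R.rootMultiplicity s : ℂ) = ν s / mo t (pt s) := by
    intro s hs
    obtain ⟨h1, h2⟩ := hpt s hs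
    have h3 := h.order_poly hR h1
    have h4 : analyticOrderAt (fun w => R.eval (t w)) (pt s) = ν s := by
      have hB : AnalyticAt ℂ (cuspProd N t γ) (pt s) :=
        h.diff_cuspProd.analyticAt (isOpen_upperHalfPlaneSet.mem_nhds h1)
      rw [← hν s hs, ← analyticOrderAt_congr (f := F * cuspProd N t γ ^ k)]
      · rw [analyticOrderAt_mul (hF.analyticAt (isOpen_upperHalfPlaneSet.mem_nhds h1)) (hB.pow k),
          analyticOrderAt_pow hB, hB.analyticOrderAt_eq_zero.2 (h.cuspProd_ne_zero h1)]
        simp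
      · filter_upwards [isOpen_upperHalfPlaneSet.mem_nhds h1] with w hw
        exact hFR w hw
    rw [h4, h2] at h3
    have h5 : ν s = R.rootMultiplicity s * mo t (pt s) := by exact_mod_cast h3
    have h6 : (mo t (pt s) : ℂ) ≠ 0 := by exact_mod_cast h.mo_ne_zero h1
    rw [h5]
    push_cast
    field_simp
  have hμγ : ∀ e ∈ cus N, (R.rootMultiplicity (γ e) : ℂ) = m e + k := by
    intro e he
    obtain ⟨A, hA, hAo⟩ := hm e he
    obtain ⟨h1, h2⟩ := h.mem_cus.1 he
    have h3 := hAo.mul ((h.od_al_cuspProd h1 h2 hA).pow k)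
    have h4 := (h.od_al_poly hR h1 h2 hA).unique (h3.congr fun z hz =>
      (hFR _ (im_mb_pos (AL_det_pos (h.pos h1) hA) hz)).symm)
    rw [mul_one] at h4
    exact_mod_cast h4
  have hsum : ∀ f : ℂ → ℂ, (R.roots.map f).sum =
      ∑ s ∈ T, (ν s : ℂ) / mo t (pt s) * f s + ∑ e ∈ cus N, ((m e : ℂ) + k) * f (γ e) := by
    intro f
    rw [sum_roots_eq R hRT f, Finset.sum_union hdis, Finset.sum_image hγi]
    congr 1
    · exact Finset.sum_congr rfl fun s hs => by rw [hμ s hs]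
    · exact Finset.sum_congr rfl fun e he => by rw [hμγ e he]
  obtain ⟨hdeg, hβ⟩ := (h.le_poly hR).unique
    ((hm₁.mul (h.le_cuspProd.pow k)).congr fun z hz => (hFR z hz).symm)
  have s1 := hsum fun _ => 1
  have s2 := hsum (pv v)
  simp only [Multiset.map_const', Multiset.sum_replicate, nsmul_eq_mul, mul_one] at s1
  have hdeg' : -(Multiset.card R.roots : ℂ) = m₁ + k * -((cus N).card : ℂ) := by exact_mod_cast hdeg
  simp only [mul_sub, sub_mul, add_mul, Finset.sum_sub_distrib, Finset.sum_add_distrib,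
    ← Finset.sum_mul, ← Finset.mul_sum, Finset.sum_const, nsmul_eq_mul] at s1 s2 ⊢
  linear_combination -s2 + c * s1 - 2 * hβ + c * hdeg' + m₁ * hc

end FrickeTrace

namespace FrickeTrace

open Filter Topology
open UpperHalfPlane (upperHalfPlaneSet isOpen_upperHalfPlaneSet)
open Asymptotics

variable {N : ℕ} {t v : ℂ → ℂ} {γ κ : ℕ → ℂ}

/-- Taylor coefficients at the origin. -/
noncomputable def cf (h : ℂ → ℂ) (n : ℕ) : ℂ := iteratedDeriv n h 0 / n.factorial

lemma cf_zero (h : ℂ → ℂ) : cf h 0 = h 0 := by simp [cf]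

lemma cf_one (h : ℂ → ℂ) : cf h 1 = deriv h 0 := by simp [cf]

lemma isBigO_taylor {h : ℂ → ℂ} (hh : AnalyticAt ℂ h 0) (k : ℕ) :
    (fun y => h y - ∑ j ∈ Finset.range k, cf h j * y ^ j) =O[𝓝 0] fun y => y ^ k := by
  have h1 := (hh.hasFPowerSeriesAt.isBigO_sub_partialSum_pow k).congr (g₂ := fun y => ‖y ^ k‖)
    (f₂ := fun y => h y - ∑ j ∈ Finset.range k, cf h j * y ^ j) (fun y => by
      rw [zero_add, FormalMultilinearSeries.partialSum]
      congr 1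
      refine Finset.sum_congr rfl fun j _ => ?_
      rw [FormalMultilinearSeries.ofScalars_apply_eq, smul_eq_mul, cf]) (fun y => by rw [norm_pow])
  exact h1.of_norm_right

lemma sum_root_pow {D : ℕ} {ζ : ℂ} (hζ : IsPrimitiveRoot ζ D) (k : ℕ) :
    ∑ b ∈ Finset.range D, (ζ ^ b) ^ k = if D ∣ k then (D : ℂ) else 0 := by
  have e1 : ∀ b, (ζ ^ b) ^ k = (ζ ^ k) ^ b := fun b => by rw [← pow_mul, ← pow_mul, mul_comm]
  simp only [e1]
  split_ifs with h
  · simp [(hζ.pow_eq_one_iff_dvd k).2 h]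
  · have h1 : ζ ^ k ≠ 1 := fun h0 => h ((hζ.pow_eq_one_iff_dvd k).1 h0)
    rw [geom_sum_eq h1, ← pow_mul, mul_comm, pow_mul, hζ.pow_eq_one, one_pow, sub_self, zero_div]

lemma isBigO_average {h : ℂ → ℂ} (hh : AnalyticAt ℂ h 0) {D : ℕ} (hD : D ≠ 0) {ζ : ℂ}
    (hζ : IsPrimitiveRoot ζ D) :
    (fun y => ∑ b ∈ Finset.range D, (h (ζ ^ b * y) - h 0) - D * cf h D * y ^ D) =O[𝓝 0]
      fun y => y ^ (D + 1) := by
  have h1 : ∀ b ∈ Finset.range D, (fun y => h (ζ ^ b * y) -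
      ∑ j ∈ Finset.range (D + 1), cf h j * (ζ ^ b * y) ^ j) =O[𝓝 0] fun y => y ^ (D + 1) := by
    intro b _
    have ht : Tendsto (fun y => ζ ^ b * y) (𝓝 0) (𝓝 0) := by
      simpa using (continuous_const_mul (ζ ^ b)).tendsto 0
    refine ((isBigO_taylor hh (D + 1)).comp_tendsto ht).trans ?_
    simp only [Function.comp_def, mul_pow]
    exact isBigO_const_mul_self _ _ _
  refine (IsBigO.sum h1).congr_left fun y => ?_
  rw [Finset.sum_apply, Finset.sum_sub_distrib, Finset.sum_sub_distrib, sub_sub]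
  congr 1
  rw [Finset.sum_comm]
  have e1 : ∀ j, ∑ b ∈ Finset.range D, cf h j * (ζ ^ b * y) ^ j =
      cf h j * y ^ j * if D ∣ j then (D : ℂ) else 0 := by
    intro j
    rw [← sum_root_pow hζ, Finset.mul_sum]
    exact Finset.sum_congr rfl fun b _ => by ring
  simp only [e1]
  rw [Finset.sum_range_succ, Finset.sum_eq_single_of_mem 0 (Finset.mem_range.2 (Nat.pos_of_ne_zero hD))]
  · simp [cf_zero]; ring
  · intro j hj hj0
    rw [if_neg, mul_zero]
    intro hd
    exact hj0 (Nat.eq_zero_of_dvd_of_lt hd (Finset.mem_range.1 hj))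

/-- The values of `q` at the translates `(A z + b) / D`. -/
noncomputable def yq (A D b : ℕ) (z : ℂ) : ℂ := qc ((A * z + b) / D)

lemma yq_ne_zero (A D b : ℕ) (z : ℂ) : yq A D b z ≠ 0 := qc_ne_zero _

lemma yq_pow {A D : ℕ} (hD : D ≠ 0) (z : ℂ) : yq A D 0 z ^ D = qc z ^ A := by
  have : (D : ℂ) ≠ 0 := by exact_mod_cast hD
  rw [yq, qc, qc, ← Complex.exp_nat_mul, ← Complex.exp_nat_mul]
  congr 1
  push_cast
  field_simp
  ring

lemma yq_eq {A D : ℕ} (hD : D ≠ 0) (b : ℕ) (z : ℂ) :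
    yq A D b z = exp (2 * Real.pi * I / D) ^ b * yq A D 0 z := by
  have : (D : ℂ) ≠ 0 := by exact_mod_cast hD
  rw [yq, yq, qc, qc, ← Complex.exp_nat_mul, ← Complex.exp_add]
  congr 1
  push_cast
  field_simp
  ring

lemma im_yq {A D : ℕ} (b : ℕ) (z : ℂ) : ((A * z + b) / D : ℂ).im = A / D * z.im := by
  have : ((A * z + b) / D : ℂ) = ((A / D : ℝ) : ℂ) * z + ((b / D : ℝ) : ℂ) := by
    push_cast; ring
  rw [this, Complex.add_im, Complex.ofReal_im, Complex.im_ofReal_mul, add_zero]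

lemma tendsto_yq_lI {A D : ℕ} (hA : A ≠ 0) (hD : D ≠ 0) (b : ℕ) :
    Tendsto (fun z : ℂ => ((A * z + b) / D : ℂ)) lI lI := by
  refine tendsto_comap_iff.2 ?_
  simp only [Function.comp_def, im_yq]
  have : (0 : ℝ) < A / D := by positivity
  exact (tendsto_comap (f := Complex.im)).const_mul_atTop this

lemma tendsto_yq {A D : ℕ} (hA : A ≠ 0) (hD : D ≠ 0) (b : ℕ) : Tendsto (yq A D b) lI (𝓝 0) :=
  tendsto_qc_nhds.comp (tendsto_yq_lI hA hD b)

lemma isLittleO_average {h : ℂ → ℂ} (hh : AnalyticAt ℂ h 0) {A D : ℕ} (hA : A ≠ 0) (hD : D ≠ 0) :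
    (fun z => ∑ b ∈ Finset.range D, (h (yq A D b z) - h 0) - D * cf h D * qc z ^ A) =o[lI]
      fun z => qc z ^ A := by
  have h1 := (isBigO_average hh hD (Complex.isPrimitiveRoot_exp D hD)).comp_tendsto (tendsto_yq hA hD 0)
  simp only [Function.comp_def, yq_pow hD, ← yq_eq hD, pow_succ] at h1
  refine h1.trans_isLittleO ?_
  have h2 := (isBigO_refl (fun z => qc z ^ A) lI).mul_isLittleO ((isLittleO_one_iff ℂ).2 (tendsto_yq hA hD 0))
  simpa using h2

lemma isLittleO_prod {ι : Type*} (s : Finset ι) {X : ι → ℂ → ℂ} (hX : ∀ i ∈ s, X i =o[lI] qc) :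
    (fun z => ∏ i ∈ s, (1 - X i z) - (1 - ∑ i ∈ s, X i z)) =o[lI] fun z => qc z ^ 2 := by
  classical
  induction s using Finset.induction_on with
  | empty => simp
  | insert i s hi ih =>
    have ih' := ih fun j hj => hX j (Finset.mem_insert_of_mem hj)
    have hS : (fun z => ∑ j ∈ s, X j z) =o[lI] qc :=
      IsLittleO.fun_sum fun j hj => hX j (Finset.mem_insert_of_mem hj)
    have hi' := hX i (Finset.mem_insert_self _ _)
    have h1 : (fun z => X i z * ∑ j ∈ s, X j z) =o[lI] fun z => qc z ^ 2 := by
      simpa only [pow_two] using hi'.mul hS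
    have h2 : (fun z => (1 - X i z)) =O[lI] fun _ => (1 : ℂ) :=
      (isBigO_refl _ _).sub (hi'.isBigO.trans (by simpa using isBigO_qc_pow 1))
    have h3 := h2.mul_isLittleO ih'
    simp only [one_mul] at h3
    refine (h3.add h1).congr_left fun z => ?_
    rw [Finset.prod_insert hi, Finset.sum_insert hi]
    ring

lemma LE.of_prod {ι : Type*} (s : Finset ι) {X : ι → ℂ → ℂ} (hX : ∀ i ∈ s, X i =o[lI] qc) {b : ℂ}
    (hb : (fun z => ∑ i ∈ s, X i z - b * qc z ^ 2) =o[lI] fun z => qc z ^ 2) :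
    LE (fun z => ∏ i ∈ s, (1 - X i z)) 0 (-b) := by
  have h1 := LE.of_expansion (u := fun z => ∏ i ∈ s, (1 - X i z)) (C := 1) one_ne_zero (m := 0) (a := 0)
    (b := -b) (((isLittleO_prod s hX).sub hb).congr_left fun z => by simp; ring)
  simpa using h1

end FrickeTrace

namespace FrickeTrace

open Filter Topology
open UpperHalfPlane (upperHalfPlaneSet isOpen_upperHalfPlaneSet)
open Asymptotics

variable {N : ℕ} {t v : ℂ → ℂ} {γ κ : ℕ → ℂ}

/-- Relative deviation of `t(τ) - t(τ')` from `q⁻¹ - q'⁻¹`. -/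
noncomputable def devn (v : ℂ → ℂ) (x y : ℂ) : ℂ :=
  x * (v y - v 0) + x ^ 2 * (y * ((dslope v 0 x - dslope v 0 y) / (x - y)))

lemma sub_eq_devn (v : ℂ → ℂ) {x y : ℂ} (hx : x ≠ 0) (hy : y ≠ 0) :
    x⁻¹ + v x - (y⁻¹ + v y) = (x⁻¹ - y⁻¹) * (1 - devn v x y) := by
  rcases eq_or_ne x y with rfl | hxy
  · simp
  have h0 : x - y ≠ 0 := sub_ne_zero.2 hxy
  have e1 : v x = v 0 + x * dslope v 0 x := by
    have := sub_smul_dslope v 0 x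
    rw [smul_eq_mul, sub_zero] at this
    rw [this]; ring
  have e2 : v y = v 0 + y * dslope v 0 y := by
    have := sub_smul_dslope v 0 y
    rw [smul_eq_mul, sub_zero] at this
    rw [this]; ring
  rw [devn, e1, e2]
  field_simp
  ring

lemma Haupt.vanal (h : Haupt N t v γ κ) : AnalyticAt ℂ v 0 :=
  h.vdiff.analyticAt ball_mem

lemma Haupt.devn_sub (h : Haupt N t v γ κ) {Y : ℂ → ℂ} (hY : Tendsto Y lI (𝓝 0)) :
    (fun z => devn v (qc z) (Y z) - qc z * (v (Y z) - v 0)) =o[lI] fun z => qc z ^ 2 := by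
  have hw : AnalyticAt ℂ (dslope v 0) 0 := by
    have h1 : DifferentiableOn ℂ (dslope v 0) (Metric.ball 0 1) :=
      (differentiableOn_dslope ball_mem).2 h.vdiff
    exact h1.analyticAt ball_mem
  have h1 := (hw.hasStrictDerivAt.hasStrictFDerivAt.isBigO_sub).comp_tendsto
    (tendsto_qc_nhds.prodMk_nhds hY)
  have h2 : (fun z => (dslope v 0 (qc z) - dslope v 0 (Y z)) / (qc z - Y z)) =O[lI]
      fun _ => (1 : ℂ) := by
    obtain ⟨C, hC, h3⟩ := h1.exists_nonneg
    refine IsBigO.of_bound C ?_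
    filter_upwards [h3.bound] with z hz
    simp only [Function.comp_def] at hz
    rw [norm_div, norm_one, mul_one]
    exact div_le_of_le_mul₀ (norm_nonneg _) hC hz
  have h3 := (isBigO_refl (fun z => qc z ^ 2) lI).mul_isLittleO
    (((isLittleO_one_iff ℂ).2 hY).mul_isBigO h2)
  simp only [mul_one] at h3
  exact h3.congr_left fun z => by rw [devn]; ring

lemma isLittleO_qc_pow {k l : ℕ} (h : k < l) : (fun z => qc z ^ l) =o[lI] fun z => qc z ^ k := by
  obtain ⟨m, rfl⟩ := Nat.exists_eq_add_of_lt h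
  have := (isBigO_refl (fun z => qc z ^ k) lI).mul_isLittleO
    ((isLittleO_one_iff ℂ).2 (tendsto_qc_pow (Nat.succ_ne_zero m)))
  simpa [← pow_add, add_assoc] using this

lemma Haupt.devn_isLittleO (h : Haupt N t v γ κ) {Y : ℂ → ℂ} (hY : Tendsto Y lI (𝓝 0)) :
    (fun z => devn v (qc z) (Y z)) =o[lI] qc := by
  have h1 : (fun z => v (Y z) - v 0) =o[lI] fun _ => (1 : ℂ) := by
    rw [isLittleO_one_iff]
    simpa using (h.vcont.tendsto.comp hY).sub_const (v 0)
  have h2 := (isBigO_refl qc lI).mul_isLittleO h1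
  have h3 := (h.devn_sub hY).trans (isLittleO_qc_pow one_lt_two)
  simp only [mul_one] at h2
  simp only [pow_one] at h3
  exact (h3.add h2).congr_left fun z => by ring

lemma Haupt.sum_devn (h : Haupt N t v γ κ) {a d : ℕ} (ha : a ≠ 0) (hd : d ≠ 0) :
    (fun z => ∑ b ∈ Finset.range d, devn v (qc z) (yq a d b z) -
      (if a = 1 then d * cf v d else 0) * qc z ^ 2) =o[lI] fun z => qc z ^ 2 := by
  have h1 : (fun z => ∑ b ∈ Finset.range d, (devn v (qc z) (yq a d b z) -
      qc z * (v (yq a d b z) - v 0))) =o[lI] fun z => qc z ^ 2 :=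
    IsLittleO.fun_sum fun b _ => h.devn_sub (tendsto_yq ha hd b)
  have h2 := (isBigO_refl qc lI).mul_isLittleO (isLittleO_average h.vanal ha hd)
  have h3 : (fun z => qc z * qc z ^ a) =O[lI] fun z => qc z ^ 2 := by
    obtain ⟨k, rfl⟩ := Nat.exists_eq_succ_of_ne_zero ha
    have := (isBigO_refl (fun z => qc z ^ 2) lI).mul (isBigO_qc_pow k)
    simp only [mul_one] at this
    exact this.congr_left fun z => by rw [Nat.succ_eq_add_one]; ring
  have h4 : (fun z => d * cf v d * (qc z * qc z ^ a) - (if a = 1 then d * cf v d else 0) * qc z ^ 2)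
      =o[lI] fun z => qc z ^ 2 := by
    split_ifs with h0
    · subst h0
      have e : (fun z : ℂ => d * cf v d * (qc z * qc z ^ 1) - d * cf v d * qc z ^ 2) = fun _ => 0 := by
        funext z; ring
      rw [e]
      exact isLittleO_zero _ _
    · have h5 : (fun z => qc z ^ (a + 1)) =o[lI] fun z => qc z ^ 2 := isLittleO_qc_pow (by omega)
      exact (h5.const_mul_left (d * cf v d)).congr_left fun z => by ring
  refine ((h1.add (h2.trans_isBigO h3)).add h4).congr_left fun z => ?_
  rw [Finset.sum_sub_distrib, ← Finset.mul_sum]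
  ring

lemma Haupt.devn_self (h : Haupt N t v γ κ) :
    (fun z => devn v (qc z) (qc z) - cf v 1 * qc z ^ 2) =o[lI] fun z => qc z ^ 2 := by
  have h1 := h.sum_devn one_ne_zero one_ne_zero
  simp only [Finset.range_one, Finset.sum_singleton, if_true, Nat.cast_one, one_mul] at h1
  refine h1.congr_left fun z => ?_
  rw [yq]; simp

/-- The contribution of `1 - q ^ k`. -/
noncomputable def dlt (k : ℕ) : ℂ := if k = 1 then 1 else if k = 2 then 2 else 0

lemma LE.qc_zpow (m : ℤ) : LE (fun z => qc z ^ m) m 0 := by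
  refine ⟨1, one_ne_zero, 0, ?_⟩
  have e : ∀ z, qc z ^ m * (1 * qc z ^ m * exp (0 * qc z + 0 * qc z ^ 2))⁻¹ - 1 = 0 := by
    intro z
    have := zpow_ne_zero m (qc_ne_zero z)
    simp [this]
  simp only [e]
  exact isLittleO_zero _ _

lemma LE.one_sub_qc_pow {k : ℕ} (hk : k ≠ 0) : LE (fun z => 1 - qc z ^ k) 0 (-dlt k / 2) := by
  have key : ∀ a b : ℂ, (fun z => 1 - qc z ^ k - (1 + a * qc z + b * qc z ^ 2)) =o[lI] (fun z => qc z ^ 2) →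
      LE (fun z => 1 - qc z ^ k) 0 (b - a ^ 2 / 2) := fun a b hab =>
    LE.of_expansion (C := 1) one_ne_zero (by simpa using hab)
  rw [dlt]
  split_ifs with h1 h2
  · subst h1
    convert key (-1) 0 ?_ using 1
    · ring
    · exact (isLittleO_zero _ _).congr_left fun z => by ring
  · subst h2
    convert key 0 (-1) ?_ using 1
    · ring
    · exact (isLittleO_zero _ _).congr_left fun z => by ring
  · convert key 0 0 ?_ using 1
    · ring
    · have := (isLittleO_qc_pow (k := 2) (l := k) (by omega)).neg_left
      simpa using this

lemma LE.qc_sub {a d : ℕ} (h : a ≠ d) :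
    LE (fun z => (qc z)⁻¹ ^ d - (qc z)⁻¹ ^ a) (-(max a d : ℕ)) (-dlt (a - d + (d - a)) / 2) := by
  rcases lt_or_gt_of_ne h with h1 | h1
  · obtain ⟨k, rfl⟩ := Nat.exists_eq_add_of_lt h1
    have h2 := (LE.qc_zpow (-((a + k + 1 : ℕ) : ℤ))).mul (LE.one_sub_qc_pow (Nat.succ_ne_zero k))
    rw [add_zero, zero_add] at h2
    rw [max_eq_right h1.le, show a - (a + k + 1) + (a + k + 1 - a) = k.succ by omega]
    refine h2.congr fun z _ => ?_
    have := qc_ne_zero z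
    rw [_root_.zpow_neg, zpow_natCast, inv_pow, inv_pow]
    simp only [Nat.succ_eq_add_one, pow_succ, pow_add]
    field_simp
  · obtain ⟨k, rfl⟩ := Nat.exists_eq_add_of_lt h1
    have h2 := ((LE.const (C := -1) (by norm_num)).mul (LE.qc_zpow (-((d + k + 1 : ℕ) : ℤ)))).mul
      (LE.one_sub_qc_pow (Nat.succ_ne_zero k))
    rw [add_zero, zero_add, zero_add, zero_add] at h2
    rw [max_eq_left h1.le, show d + k + 1 - d + (d - (d + k + 1)) = k.succ by omega]
    refine h2.congr fun z _ => ?_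
    have := qc_ne_zero z
    rw [_root_.zpow_neg, zpow_natCast, inv_pow, inv_pow]
    simp only [Nat.succ_eq_add_one, pow_succ, pow_add]
    field_simp
    ring

/-- Indices `b` of the non-scalar representatives with given `e`, `a`, `d`. -/
def sb (e a d : ℕ) : Finset ℕ := if e = 1 ∧ a = d then (Finset.range (e * d)).erase 0 else Finset.range (e * d)

lemma yq_im_pos {A D : ℕ} (hA : A ≠ 0) (hD : D ≠ 0) (b : ℕ) {z : ℂ} (hz : 0 < z.im) :
    0 < ((A * z + b) / D : ℂ).im := by
  rw [im_yq]; positivity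

lemma Haupt.sub_yq (h : Haupt N t v γ κ) {a d : ℕ} (ha : a ≠ 0) (hd : d ≠ 0) (b : ℕ) {z : ℂ}
    (hz : 0 < z.im) : t z - t ((a * z + b) / d) =
      ((qc z)⁻¹ - (yq a d b z)⁻¹) * (1 - devn v (qc z) (yq a d b z)) := by
  rw [h.eq z hz, h.eq _ (yq_im_pos ha hd b hz), ← sub_eq_devn v (qc_ne_zero z) (yq_ne_zero _ _ _ _), yq]

lemma prod_sub_yq {a d : ℕ} (hd : d ≠ 0) (z : ℂ) :
    ∏ b ∈ Finset.range d, ((qc z)⁻¹ - (yq a d b z)⁻¹) = (qc z)⁻¹ ^ d - (qc z)⁻¹ ^ a := by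
  have h1 := X_pow_sub_C_eq_prod (Complex.isPrimitiveRoot_exp d hd).inv (Nat.pos_of_ne_zero hd)
    (α := (yq a d 0 z)⁻¹) (a := (qc z)⁻¹ ^ a) (by rw [inv_pow, yq_pow hd, inv_pow])
  have h2 := congrArg (Polynomial.eval (qc z)⁻¹) h1
  simp only [Polynomial.eval_sub, Polynomial.eval_pow, Polynomial.eval_X, Polynomial.eval_C,
    Polynomial.eval_prod] at h2
  rw [h2]
  refine Finset.prod_congr rfl fun b _ => ?_
  rw [yq_eq hd b, mul_inv, inv_pow]

/-- Expansion of the block of the modular equation attached to `(1, a, d)`. -/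
lemma Haupt.le_block_one (h : Haupt N t v γ κ) {a d : ℕ} (ha : a ≠ 0) (hd : d ≠ 0) :
    LE (fun z => ∏ b ∈ sb 1 a d, (t z - t ((a * z + b) / d)))
      (-(max a d : ℕ) + if a = d then 1 else 0)
      (-dlt (a - d + (d - a)) / 2 - (if a = 1 then d * cf v d else 0) + if a = d then cf v 1 else 0) := by
  have hX : ∀ b, (fun z => devn v (qc z) (yq a d b z)) =o[lI] qc := fun b =>
    h.devn_isLittleO (tendsto_yq ha hd b)
  by_cases had : a = d
  · subst had
    have hsb : sb 1 a a = (Finset.range a).erase 0 := by simp [sb]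
    have hy : ∀ z, yq a a 0 z = qc z := by
      intro z
      have : (a : ℂ) ≠ 0 := by exact_mod_cast ha
      rw [yq, Nat.cast_zero, add_zero, mul_div_cancel_left₀ _ this]
    have h1 : (fun z => ∑ b ∈ (Finset.range a).erase 0, devn v (qc z) (yq a a b z) -
        ((if a = 1 then a * cf v a else 0) - cf v 1) * qc z ^ 2) =o[lI] fun z => qc z ^ 2 := by
      refine ((h.sum_devn ha ha).sub h.devn_self).congr_left fun z => ?_
      rw [← Finset.add_sum_erase _ _ (Finset.mem_range.2 (Nat.pos_of_ne_zero ha)), hy]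
      ring
    have h2 := LE.of_prod ((Finset.range a).erase 0) (fun b _ => hX b) h1
    set ζ := exp (2 * Real.pi * I / a)
    have hζ : IsPrimitiveRoot ζ a := Complex.isPrimitiveRoot_exp a ha
    have hC : ∏ b ∈ (Finset.range a).erase 0, (1 - (ζ ^ b)⁻¹) ≠ 0 := by
      refine Finset.prod_ne_zero_iff.2 fun b hb => sub_ne_zero.2 fun h0 => ?_
      rw [Finset.mem_erase, Finset.mem_range] at hb
      have h3 : ζ ^ b = 1 := by rw [← inv_inv (ζ ^ b), ← h0, inv_one]
      exact hb.1 (Nat.eq_zero_of_dvd_of_lt ((hζ.pow_eq_one_iff_dvd b).1 h3) hb.2)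
    have h3 := ((LE.const hC).mul (LE.qc_zpow (-((a - 1 : ℕ) : ℤ)))).mul h2
    rw [hsb]
    convert h3.congr (w := fun z => ∏ b ∈ (Finset.range a).erase 0, (t z - t ((a * z + b) / a))) ?_ using 1
    · rw [max_self, if_pos rfl]; omega
    · simp [dlt]; ring
    · intro z hz
      rw [_root_.zpow_neg, zpow_natCast, ← inv_pow]
      have hcard : a - 1 = ((Finset.range a).erase 0).card := by
        rw [Finset.card_erase_of_mem (Finset.mem_range.2 (Nat.pos_of_ne_zero ha)), Finset.card_range]
      rw [hcard, ← Finset.prod_const, ← Finset.prod_mul_distrib, ← Finset.prod_mul_distrib]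
      refine Finset.prod_congr rfl fun b _ => ?_
      rw [h.sub_yq ha ha b hz, yq_eq ha b, hy, mul_inv]
      ring
  · have hsb : sb 1 a d = Finset.range d := by simp [sb, had]
    have h2 := (LE.qc_sub had).mul (LE.of_prod (Finset.range d) (fun b _ => hX b) (h.sum_devn ha hd))
    rw [hsb, if_neg had, if_neg had, add_zero]
    convert h2.congr (w := fun z => ∏ b ∈ Finset.range d, (t z - t ((a * z + b) / d))) ?_ using 1
    · ring
    · ring
    · intro z hz
      rw [← prod_sub_yq hd, ← Finset.prod_mul_distrib]
      exact Finset.prod_congr rfl fun b _ => h.sub_yq ha hd b hz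

end FrickeTrace

namespace FrickeTrace

open Filter Topology
open UpperHalfPlane (upperHalfPlaneSet isOpen_upperHalfPlaneSet)
open Asymptotics

variable {N : ℕ} {t v : ℂ → ℂ} {γ κ : ℕ → ℂ}

lemma mb_ut {e d : ℕ} (a b : ℕ) (z : ℂ) :
    mb (ut e a d b) z = (((e * a : ℕ) : ℂ) * z + b) / ((e * d : ℕ) : ℂ) := by
  simp [mb, den, ut]

lemma mb_rep_one {a d : ℕ} (hN : Squarefree N) (ha : a ≠ 0) (hd : d ≠ 0) (b : ℕ) {z : ℂ} (hz : 0 < z.im) :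
    mb (rep N 1 a d b) z = (a * z + b) / d := by
  rw [mb_rep hN (one_dvd _) ha hd b hz, wl_one, mb_one, mb_ut, one_mul, one_mul]

lemma nix_eq (hN : Squarefree N) {n : ℕ} (hn : n ≠ 0) : nix N n =
    (N.divisors.filter (· ∣ n)).sigma fun e => (n / e).divisorsAntidiagonal.sigma fun p =>
      sb e p.1 p.2 := by
  ext ⟨e, ⟨a, d⟩, b⟩
  have hsub : b ∈ sb e a d ↔ b < e * d ∧ ¬ (e = 1 ∧ a = d ∧ b = 0) := by
    rw [sb]
    split_ifs with h
    · rw [Finset.mem_erase, Finset.mem_range]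
      have := h.1
      have := h.2
      tauto
    · rw [Finset.mem_range]; tauto
  have h1 := (mem_ix hN.ne_zero hn (e := e) (a := a) (d := d) (b := b))
  rw [mem_nix]
  simp only [ix, Finset.mem_sigma] at h1 ⊢
  rw [hsub]
  constructor
  · rintro ⟨⟨h2, h3, h4⟩, h5⟩
    have h6 := mem_ix' hN.ne_zero hn (i := ⟨e, (a, d), b⟩) (by
      simp only [ix, Finset.mem_sigma]; exact ⟨h2, h3, h4⟩)
    refine ⟨h2, h3, Finset.mem_range.1 h4, ?_⟩
    rwa [rp, scal_rep_iff hN h6.1 h6.2.2.2.2.1 h6.2.2.2.2.2 h6.2.2.1] at h5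
  · rintro ⟨h2, h3, h4, h5⟩
    have h6 := mem_ix' hN.ne_zero hn (i := ⟨e, (a, d), b⟩) (by
      simp only [ix, Finset.mem_sigma]; exact ⟨h2, h3, Finset.mem_range.2 h4⟩)
    refine ⟨⟨h2, h3, Finset.mem_range.2 h4⟩, ?_⟩
    rwa [rp, scal_rep_iff hN h6.1 h6.2.2.2.2.1 h6.2.2.2.2.2 h6.2.2.1]

lemma prod_nix (hN : Squarefree N) {n : ℕ} (hn : n ≠ 0) (f : IM → ℂ) :
    ∏ i ∈ nix N n, f (rp N i) = ∏ e ∈ N.divisors.filter (· ∣ n),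
      ∏ p ∈ (n / e).divisorsAntidiagonal, ∏ b ∈ sb e p.1 p.2, f (rep N e p.1 p.2 b) := by
  rw [nix_eq hN hn, Finset.prod_sigma]
  refine Finset.prod_congr rfl fun e _ => ?_
  rw [Finset.prod_sigma]
  rfl

lemma mem_anti {n e : ℕ} {p : ℕ × ℕ} (hp : p ∈ (n / e).divisorsAntidiagonal) : p.1 ≠ 0 ∧ p.2 ≠ 0 := by
  obtain ⟨h1, h2⟩ := Nat.mem_divisorsAntidiagonal.1 hp
  rw [← h1] at h2
  exact ⟨left_ne_zero_of_mul h2, right_ne_zero_of_mul h2⟩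

/-- The function of `q` representing `(t - s)⁻¹` near infinity. -/
noncomputable def hinv (v : ℂ → ℂ) (s q : ℂ) : ℂ := q / (1 + q * (v q - s))

lemma hinv_zero (v : ℂ → ℂ) (s : ℂ) : hinv v s 0 = 0 := by simp [hinv]

lemma Haupt.hinv_anal (h : Haupt N t v γ κ) (s : ℂ) : AnalyticAt ℂ (hinv v s) 0 := by
  unfold hinv
  refine analyticAt_id.div (analyticAt_const.add (analyticAt_id.mul (h.vanal.sub analyticAt_const))) ?_
  simp

lemma Haupt.hinv_qc (h : Haupt N t v γ κ) (s : ℂ) {z : ℂ} (hz : 0 < z.im) :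
    hinv v s (qc z) = (t z - s)⁻¹ := by
  have := qc_ne_zero z
  rw [hinv, h.eq z hz, ← inv_div]
  congr 1
  field_simp
  ring

lemma Haupt.inv_isBigO (h : Haupt N t v γ κ) (s : ℂ) : (fun z => (t z - s)⁻¹) =O[lI] qc := by
  have h1 := ((h.tendsto_mul_qc s).inv₀ one_ne_zero).isBigO_one ℂ
  have h2 := h1.mul (isBigO_refl qc lI)
  simp only [one_mul] at h2
  refine h2.congr_left fun z => ?_
  have := qc_ne_zero z
  rw [mul_inv, mul_assoc, inv_mul_cancel₀ this, mul_one]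

/-- Expansion of the block of the modular equation attached to `(e, a, d)`, `e ≠ 1`. -/
lemma Haupt.le_block (h : Haupt N t v γ κ) {e a d : ℕ} (he : e ∣ N) (he1 : e ≠ 1) (ha : a ≠ 0) (hd : d ≠ 0) :
    LE (fun z => ∏ b ∈ sb e a d, (t z - t (mb (rep N e a d b) z)))
      (-(e * d : ℕ)) ((e * d : ℕ) * (-pv v (γ e) / 2)) := by
  have he0 := h.pos he
  have hA : e * a ≠ 0 := mul_ne_zero he0 ha
  have hD : e * d ≠ 0 := mul_ne_zero he0 hd
  have hsb : sb e a d = Finset.range (e * d) := by simp [sb, he1]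
  set X : ℕ → ℂ → ℂ := fun b z => κ e * ((t z - γ e)⁻¹ * hinv v (γ e) (yq (e * a) (e * d) b z)) with hXd
  have hX : ∀ b, X b =o[lI] qc := by
    intro b
    have h1 : (fun z => hinv v (γ e) (yq (e * a) (e * d) b z)) =o[lI] fun _ => (1 : ℂ) := by
      rw [isLittleO_one_iff]
      simpa [hinv_zero, Function.comp_def] using
        (h.hinv_anal (γ e)).continuousAt.tendsto.comp (tendsto_yq hA hD b)
    have h2 := ((h.inv_isBigO (γ e)).mul_isLittleO h1).const_mul_left (κ e)
    simpa only [mul_one] using h2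
  have hS : (fun z => ∑ b ∈ Finset.range (e * d), X b z - 0 * qc z ^ 2) =o[lI] fun z => qc z ^ 2 := by
    have h1 := isLittleO_average (h.hinv_anal (γ e)) hA hD
    have h2 : (fun z => ∑ b ∈ Finset.range (e * d), (hinv v (γ e) (yq (e * a) (e * d) b z) - hinv v (γ e) 0))
        =O[lI] fun z => qc z ^ (e * a) := by
      refine (h1.isBigO.add (isBigO_const_mul_self ((e * d : ℕ) * cf (hinv v (γ e)) (e * d))
        (fun z => qc z ^ (e * a)) lI)).congr_left fun z => ?_
      ring
    have h3 : (fun z => qc z ^ (e * a)) =o[lI] fun z => qc z ^ 1 := by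
      refine isLittleO_qc_pow ?_
      have : 2 ≤ e := by omega
      have := Nat.pos_of_ne_zero ha
      nlinarith
    have h4 := ((h.inv_isBigO (γ e)).mul_isLittleO (h2.trans_isLittleO h3)).const_mul_left (κ e)
    refine (h4.congr_left fun z => ?_).congr_right fun z => by ring
    simp only [hinv_zero, sub_zero, hXd, Finset.mul_sum, zero_mul]
  have h1 := ((h.le_sub (γ e)).pow (e * d)).mul (LE.of_prod _ (fun b _ => hX b) hS)
  rw [hsb]
  convert h1.congr (w := fun z => ∏ b ∈ Finset.range (e * d), (t z - t (mb (rep N e a d b) z))) ?_ using 1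
  · ring
  · ring
  · intro z hz
    rw [← Finset.card_range (e * d), ← Finset.prod_const, Finset.card_range, ← Finset.prod_mul_distrib]
    refine Finset.prod_congr rfl fun b _ => ?_
    have hu := im_mb_pos (ut_det_pos he0 ha hd b) hz
    rw [mb_rep h.sqf he ha hd b hz, h.al_eq he he1 (wl_mem h.sqf he) hu, ← sub_sub, mul_sub, mul_one]
    congr 1
    simp only [hXd]
    have h2 : hinv v (γ e) (yq (e * a) (e * d) b z) = (t (mb (ut e a d b) z) - γ e)⁻¹ := by
      rw [← h.hinv_qc _ hu, mb_ut, yq]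
    have := sub_ne_zero.2 (h.ne_gamma he he1 hz)
    rw [h2]
    field_simp

/-- Orders at infinity of products over translates. -/
lemma Haupt.od_prod (h : Haupt N t v γ κ) {A D : ℕ} (hA : A ≠ 0) (hD : D ≠ 0) (s : ℂ) :
    Od (fun z => ∏ b ∈ Finset.range D, (t ((A * z + b) / D) - s)) (-A) := by
  set ζ := exp (2 * Real.pi * I / D)
  have hC : ∏ b ∈ Finset.range D, ζ ^ b ≠ 0 :=
    Finset.prod_ne_zero_iff.2 fun b _ => pow_ne_zero _ (Complex.exp_ne_zero _)
  refine ⟨(∏ b ∈ Finset.range D, ζ ^ b)⁻¹, inv_ne_zero hC, ?_⟩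
  have h1 : Tendsto (fun z => ∏ b ∈ Finset.range D, ((t ((A * z + b) / D) - s) * yq A D b z)) lI
      (𝓝 (∏ b ∈ Finset.range D, 1)) :=
    tendsto_finsetProd _ fun b _ => (h.tendsto_mul_qc s).comp (tendsto_yq_lI hA hD b)
  rw [Finset.prod_const_one] at h1
  have h2 := h1.const_mul (∏ b ∈ Finset.range D, ζ ^ b)⁻¹
  rw [mul_one] at h2
  refine h2.congr fun z => ?_
  simp only [Finset.prod_mul_distrib]
  have h3 : ∏ b ∈ Finset.range D, yq A D b z = (∏ b ∈ Finset.range D, ζ ^ b) * qc z ^ A := by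
    rw [← yq_pow hD, Finset.prod_congr rfl fun b _ => yq_eq hD b z, Finset.prod_mul_distrib,
      Finset.prod_const, Finset.card_range]
  rw [h3, neg_neg, zpow_natCast]
  field_simp

end FrickeTrace

namespace FrickeTrace

open Filter Topology
open UpperHalfPlane (upperHalfPlaneSet isOpen_upperHalfPlaneSet)
open Asymptotics

variable {N : ℕ} {t v : ℂ → ℂ} {γ κ : ℕ → ℂ}

/-- `e σ₁(n / e)`, read as zero when `e` does not divide `n`. -/
def sg (n e : ℕ) : ℕ := if e ∣ n then e * ∑ d ∈ (n / e).divisors, d else 0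

lemma sum_anti_fst (n : ℕ) : ∑ p ∈ n.divisorsAntidiagonal, p.1 = ∑ d ∈ n.divisors, d :=
  Nat.sum_divisorsAntidiagonal (fun a _ => a)

lemma sum_anti_snd (n : ℕ) : ∑ p ∈ n.divisorsAntidiagonal, p.2 = ∑ d ∈ n.divisors, d :=
  Nat.sum_divisorsAntidiagonal' (fun _ d => d)

lemma sum_anti_diag {n : ℕ} (hn : n ≠ 0) :
    ∑ p ∈ n.divisorsAntidiagonal, (if p.1 = p.2 then 1 else 0) = sqi n := by
  rw [sqi]
  split_ifs with h
  · obtain ⟨k, rfl⟩ := h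
    rw [Finset.sum_eq_single (k, k)]
    · simp
    · rintro ⟨a, b⟩ hb hne
      rw [Nat.mem_divisorsAntidiagonal] at hb
      rw [if_neg]
      rintro (rfl : a = b)
      have : a = k := Nat.mul_self_inj.1 hb.1
      exact hne (by rw [this])
    · intro h
      exact absurd (Nat.mem_divisorsAntidiagonal.2 ⟨rfl, hn⟩) h
  · refine Finset.sum_eq_zero fun p hp => if_neg fun hpp => h ⟨p.1, ?_⟩
    rw [← (Nat.mem_divisorsAntidiagonal.1 hp).1, ← hpp]

lemma sum_anti_ite {R : Type*} [Semiring R] {n : ℕ} (hn : n ≠ 0) (c : R) :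
    ∑ p ∈ n.divisorsAntidiagonal, (if p.1 = p.2 then c else 0) = sqi n * c := by
  rw [← sum_anti_diag hn, Nat.cast_sum, Finset.sum_mul]
  refine Finset.sum_congr rfl fun p _ => ?_
  split_ifs <;> simp

lemma sum_anti_one {n : ℕ} (hn : n ≠ 0) (f : ℕ → ℂ) :
    ∑ p ∈ n.divisorsAntidiagonal, (if p.1 = 1 then f p.2 else 0) = f n := by
  rw [Nat.sum_divisorsAntidiagonal (fun a d => if a = 1 then f d else 0), Finset.sum_ite_eq']
  simp [hn]

lemma sum_filter_divisors (hN : N ≠ 0) (n : ℕ) {R : Type*} [AddCommMonoid R] (f : ℕ → R) :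
    ∑ e ∈ N.divisors.filter (· ∣ n), f e = f 1 + ∑ e ∈ cus N, if e ∣ n then f e else 0 := by
  rw [Finset.sum_filter, cus, ← Finset.add_sum_erase _ _ (Nat.one_mem_divisors.2 hN), if_pos (one_dvd n)]

lemma mem_filter_divisors (hN : N ≠ 0) {n e : ℕ} : e ∈ N.divisors.filter (· ∣ n) ↔ e ∣ N ∧ e ∣ n := by
  simp [hN]

lemma Haupt.le_heck (h : Haupt N t v γ κ) {n : ℕ} (hn : n ≠ 0) : ∃ m₁ β, LE (heck N n t) m₁ β ∧
    -2 * β = 2 * n * cf v n - 2 * cf v 1 * sqi n +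
      ∑ p ∈ n.divisorsAntidiagonal, dlt (p.1 - p.2 + (p.2 - p.1)) +
      ∑ e ∈ cus N, sg n e * pv v (γ e) := by
  have key : ∀ e ∈ N.divisors.filter (· ∣ n), ∃ m β, LE (fun z => ∏ p ∈ (n / e).divisorsAntidiagonal,
      ∏ b ∈ sb e p.1 p.2, (t z - t (mb (rep N e p.1 p.2 b) z))) m β ∧ -2 * β =
      if e = 1 then 2 * n * cf v n - 2 * cf v 1 * sqi n +
        ∑ p ∈ n.divisorsAntidiagonal, dlt (p.1 - p.2 + (p.2 - p.1)) else sg n e * pv v (γ e) := by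
    intro e he
    rw [mem_filter_divisors h.sqf.ne_zero] at he
    by_cases he1 : e = 1
    · subst he1
      refine ⟨_, _, LE.prod _ fun p hp => (h.le_block_one (mem_anti hp).1 (mem_anti hp).2).congr
        fun z hz => ?_, ?_⟩
      · refine Finset.prod_congr rfl fun b _ => ?_
        rw [mb_rep_one h.sqf (mem_anti hp).1 (mem_anti hp).2 b hz]
      · rw [if_pos rfl, Nat.div_one, Finset.sum_add_distrib, Finset.sum_sub_distrib, sum_anti_ite hn,
          sum_anti_one hn (fun d => d * cf v d), ← Finset.sum_div, Finset.sum_neg_distrib]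
        ring
    · refine ⟨_, _, LE.prod _ fun p hp => h.le_block he.1 he1 (mem_anti hp).1 (mem_anti hp).2, ?_⟩
      rw [if_neg he1, sg, if_pos he.2, ← sum_anti_snd, ← Finset.sum_mul, ← Nat.cast_sum, Finset.mul_sum]
      ring
  choose! m β h1 h2 using key
  refine ⟨_, _, (LE.prod _ h1).congr fun z _ => ?_, ?_⟩
  · rw [heck_eq, prod_nix h.sqf hn fun M => t z - t (mb M z)]
  · rw [Finset.mul_sum, Finset.sum_congr rfl h2, sum_filter_divisors h.sqf.ne_zero, if_pos rfl]
    congr 1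
    refine Finset.sum_congr rfl fun e he => ?_
    rw [if_neg (h.mem_cus.1 he).2]
    split_ifs with h3
    · rfl
    · simp [sg, h3]

lemma card_sb (e a d : ℕ) (hd : d ≠ 0) : (sb e a d).card + (if e = 1 ∧ a = d then 1 else 0) = e * d := by
  rw [sb]
  split_ifs with h
  · rw [Finset.card_erase_of_mem, Finset.card_range, Nat.sub_add_cancel]
    · rw [h.1]; omega
    · rw [Finset.mem_range, h.1]; omega
  · simp

lemma card_nix (hN : Squarefree N) {n : ℕ} (hn : n ≠ 0) :
    (nix N n).card + sqi n = sg n 1 + ∑ e ∈ cus N, sg n e := by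
  have h1 : ∀ e ∈ N.divisors.filter (· ∣ n), (∑ p ∈ (n / e).divisorsAntidiagonal, (sb e p.1 p.2).card) +
      (if e = 1 then sqi n else 0) = sg n e := by
    intro e he
    rw [mem_filter_divisors hN.ne_zero] at he
    rw [sg, if_pos he.2, ← sum_anti_snd, Finset.mul_sum,
      ← Finset.sum_congr rfl fun p hp => card_sb e p.1 p.2 (mem_anti hp).2, Finset.sum_add_distrib]
    congr 1
    split_ifs with h
    · subst h
      rw [Nat.div_one, ← sum_anti_diag hn]
      simp
    · simp [h]
  rw [nix_eq hN hn, Finset.card_sigma]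
  simp only [Finset.card_sigma]
  have h2 := Finset.sum_congr rfl h1
  rw [Finset.sum_add_distrib, Finset.sum_ite_eq', if_pos] at h2
  · rw [h2, sum_filter_divisors hN.ne_zero]
    congr 1
    refine Finset.sum_congr rfl fun e _ => ?_
    split_ifs with h
    · rfl
    · simp [sg, h]
  · exact (mem_filter_divisors hN.ne_zero).2 ⟨one_dvd _, one_dvd _⟩

/-- Orders at infinity of the products entering the transformation of the modular equation. -/
lemma Haupt.od_nix (h : Haupt N t v γ κ) {n : ℕ} (hn : n ≠ 0) {f : ℕ} (hf : f ∣ N) (hf1 : f ≠ 1) :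
    Od (fun z => ∏ i ∈ nix N n, (t (mb (rp N i) z) - γ f)) (-sg n 1 + sqi n + sg n f) := by
  have key : ∀ e ∈ N.divisors.filter (· ∣ n), Od (fun z => ∏ p ∈ (n / e).divisorsAntidiagonal,
      ∏ b ∈ sb e p.1 p.2, (t (mb (rep N e p.1 p.2 b) z) - γ f))
      (if e = 1 then -sg n 1 + sqi n else if e = f then sg n f else 0) := by
    intro e he
    rw [mem_filter_divisors h.sqf.ne_zero] at he
    have he0 := h.pos he.1
    by_cases he1 : e = 1
    · subst he1
      rw [if_pos rfl]
      have : (-sg n 1 + sqi n : ℤ) =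
          ∑ p ∈ (n / 1).divisorsAntidiagonal, (-(p.1 : ℤ) + if p.1 = p.2 then 1 else 0) := by
        rw [Finset.sum_add_distrib, Nat.div_one, sum_anti_ite hn, Finset.sum_neg_distrib, ← Nat.cast_sum,
          sum_anti_fst, sg, if_pos (one_dvd n)]
        simp
      rw [this]
      refine Od.prod _ fun p hp => ?_
      obtain ⟨ha, hd⟩ := mem_anti hp
      have h1 := h.od_prod ha hd (γ f)
      by_cases had : p.1 = p.2
      · rw [if_pos had]
        refine (h1.mul (h.od_sub (γ f)).inv).congr fun z hz => ?_
        have h2 : ((p.1 : ℂ) * z + (0 : ℕ)) / p.2 = z := by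
          have : (p.2 : ℂ) ≠ 0 := by exact_mod_cast hd
          rw [had]
          field_simp
          simp
        rw [← Finset.mul_prod_erase _ _ (Finset.mem_range.2 (Nat.pos_of_ne_zero hd)), h2,
          mul_right_comm, mul_inv_cancel₀ (sub_ne_zero.2 (h.ne_gamma hf hf1 hz)), one_mul, sb,
          if_pos ⟨rfl, had⟩, one_mul]
        exact Finset.prod_congr rfl fun b _ => by rw [mb_rep_one h.sqf ha hd b hz]
      · rw [if_neg had, add_zero]
        refine h1.congr fun z hz => ?_
        rw [sb, if_neg (by tauto), one_mul]
        exact Finset.prod_congr rfl fun b _ => by rw [mb_rep_one h.sqf ha hd b hz]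
    · rw [if_neg he1]
      have hsb : ∀ a d, sb e a d = Finset.range (e * d) := fun a d => by simp [sb, he1]
      by_cases hef : e = f
      · subst hef
        rw [if_pos rfl]
        have : (sg n e : ℤ) = ∑ p ∈ (n / e).divisorsAntidiagonal, ((e * p.1 : ℕ) : ℤ) := by
          rw [← Nat.cast_sum, ← Finset.mul_sum, sum_anti_fst, sg, if_pos he.2]
        rw [this]
        refine Od.prod _ fun p hp => ?_
        obtain ⟨ha, hd⟩ := mem_anti hp
        have h1 := (h.od_prod (mul_ne_zero he0 ha) (mul_ne_zero he0 hd) (γ e)).inv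
        have h2 := (Od.const (pow_ne_zero (e * p.2) (h.kne e he.1 he1))).mul h1
        rw [neg_neg, zero_add] at h2
        refine h2.congr fun z hz => ?_
        rw [hsb, ← Finset.prod_inv_distrib, ← Finset.card_range (e * p.2), ← Finset.prod_const,
          Finset.card_range, ← Finset.prod_mul_distrib]
        refine Finset.prod_congr rfl fun b _ => ?_
        have hu := im_mb_pos (ut_det_pos he0 ha hd b) hz
        rw [mb_rep h.sqf he.1 ha hd b hz, h.al_eq he.1 he1 (wl_mem h.sqf he.1) hu, mb_ut, add_sub_cancel_left,
          div_eq_mul_inv]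
      · rw [if_neg hef]
        have : (0 : ℤ) = ∑ p ∈ (n / e).divisorsAntidiagonal, ∑ b ∈ sb e p.1 p.2, 0 := by simp
        rw [this]
        refine Od.prod _ fun p hp => Od.prod _ fun b _ => ?_
        obtain ⟨ha, hd⟩ := mem_anti hp
        have h1 := ((h.tendsto_gamma he.1 he1 (wl_mem h.sqf he.1)).comp
          (tendsto_yq_lI (mul_ne_zero he0 ha) (mul_ne_zero he0 hd) b)).sub_const (γ f)
        refine (Od.of_tendsto (sub_ne_zero.2 fun hg => hef (h.gamma_inj he.1 he1 hf hf1 hg)) h1).congr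
          fun z hz => ?_
        rw [mb_rep h.sqf he.1 ha hd b hz, mb_ut]
        rfl
  have h1 := Od.prod _ key
  have h2 : ∑ e ∈ N.divisors.filter (· ∣ n), (if e = 1 then -sg n 1 + sqi n else if e = f then sg n f else 0 : ℤ) =
      -sg n 1 + sqi n + sg n f := by
    rw [sum_filter_divisors h.sqf.ne_zero, if_pos rfl]
    congr 1
    rw [Finset.sum_eq_single f]
    · rw [if_neg hf1, if_pos rfl]
      split_ifs with h3
      · rfl
      · simp [sg, h3]
    · intro e he hef
      rw [if_neg (h.mem_cus.1 he).2, if_neg hef, ite_self]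
    · intro h3
      exact absurd (h.mem_cus.2 ⟨hf, hf1⟩) h3
  rw [h2] at h1
  exact h1.congr fun z _ => prod_nix h.sqf hn fun M => t (mb M z) - γ f

lemma Haupt.od_heck (h : Haupt N t v γ κ) {n : ℕ} (hn : n ≠ 0) {m₁ : ℤ} (hm : Od (heck N n t) m₁) {f : ℕ}
    (hf : f ∣ N) (hf1 : f ≠ 1) {A : IM} (hA : A ∈ AL N f) : Od (fun z => heck N n t (mb A z))
      (m₁ + ((nix N n).card + sg n 1 - sqi n - sg n f)) := by
  have h1 := ((h.od_sub (γ f)).pow (nix N n).card).mul (h.od_nix hn hf hf1)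
  have h2 := ((Od.const (pow_ne_zero (nix N n).card (neg_ne_zero.2 (h.kne f hf hf1)))).mul hm).mul h1.inv
  convert h2.congr fun z hz => ?_ using 1
  · ring
  · rw [← h.heck_al hn hf hf1 hA hz, mul_assoc, mul_inv_cancel₀, mul_one]
    refine mul_ne_zero (pow_ne_zero _ (sub_ne_zero.2 (h.ne_gamma hf hf1 hz)))
      (Finset.prod_ne_zero_iff.2 fun i hi => sub_ne_zero.2 (h.ne_gamma hf hf1 ?_))
    exact im_mb_pos (Dl_det_pos hn (rp_mem h.sqf hn (mem_nix.1 hi).1)) hz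

/-- The weighted sum over the zeros of the modular equation of order `n`. -/
lemma Haupt.divisor_heck (h : Haupt N t v γ κ) {n : ℕ} (hn : n ≠ 0) {T : Finset ℂ} {pt : ℂ → ℂ}
    (hpt : ∀ s ∈ T, 0 < (pt s).im ∧ t (pt s) = s)
    (hT : ∀ z : ℂ, 0 < z.im → (fixIx N n z \ six N n).Nonempty → t z ∈ T) (c : ℂ)
    (hc : c * (cus N).card + c = ∑ e ∈ cus N, pv v (γ e)) :
    ∑ s ∈ T, ((fixIx N n (pt s) \ six N n).card : ℂ) * (pv v s - c) =
      2 * n * cf v n + ∑ p ∈ n.divisorsAntidiagonal, dlt (p.1 - p.2 + (p.2 - p.1)) +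
      ∑ e ∈ cus N, sg n e * (2 * (pv v (γ e) - c)) - 2 * c * sg n 1 + sqi n * (2 * c - 2 * cf v 1) := by
  obtain ⟨m₁, β, h1, h2⟩ := h.le_heck hn
  have h3 := h.divisor (F := heck N n t)
    (fun z hz => (h.analyticAt_heck hn hz).differentiableAt.differentiableWithinAt)
    (fun M hM z hz => h.heck_inv hn hM hz) h1
    (fun e he => by
      obtain ⟨A, hA⟩ := AL_nonempty h.sqf (h.mem_cus.1 he).1
      exact ⟨A, hA, h.od_heck hn h1.od (h.mem_cus.1 he).1 (h.mem_cus.1 he).2 hA⟩) hpt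
    (fun z hz hz0 => hT z hz (by
      have h4 := (h.analyticAt_heck hn hz).analyticOrderAt_ne_zero.2 hz0
      rw [h.order_heck hn hz, Nat.cast_ne_zero] at h4
      exact Finset.card_ne_zero.1 (right_ne_zero_of_mul h4))) (fun s hs => h.order_heck hn (hpt s hs).1) c hc
  have h5 : ∀ s ∈ T, ((mo t (pt s) * (fixIx N n (pt s) \ six N n).card : ℕ) : ℂ) / mo t (pt s) *
      (pv v s - c) = ((fixIx N n (pt s) \ six N n).card : ℂ) * (pv v s - c) := by
    intro s hs
    have : (mo t (pt s) : ℂ) ≠ 0 := by exact_mod_cast h.mo_ne_zero (hpt s hs).1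
    push_cast
    field_simp
  rw [Finset.sum_congr rfl h5] at h3
  rw [h3, h2]
  have h6 : ((nix N n).card : ℂ) = sg n 1 + ∑ e ∈ cus N, (sg n e : ℂ) - sqi n := by
    rw [eq_sub_iff_add_eq]
    exact_mod_cast card_nix h.sqf hn
  have h7 : ∑ e ∈ cus N, (pv v (γ e) - c) = c := by
    rw [Finset.sum_sub_distrib, ← hc, Finset.sum_const, nsmul_eq_mul]
    ring
  have h8 : ∀ e ∈ cus N, (((m₁ + ((nix N n).card + sg n 1 - sqi n - sg n e) : ℤ) : ℂ) - m₁) * (pv v (γ e) - c) =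
      ((nix N n).card + sg n 1 - sqi n) * (pv v (γ e) - c) - sg n e * (pv v (γ e) - c) := by
    intro e _
    push_cast
    ring
  rw [Finset.sum_congr rfl h8, Finset.sum_sub_distrib, ← Finset.mul_sum, h7, h6]
  have h9 : ∑ e ∈ cus N, (sg n e : ℂ) * (2 * (pv v (γ e) - c)) =
      ∑ e ∈ cus N, (sg n e : ℂ) * pv v (γ e) + ∑ e ∈ cus N, (sg n e : ℂ) * (pv v (γ e) - c) -
        c * ∑ e ∈ cus N, (sg n e : ℂ) := by
    rw [Finset.mul_sum, ← Finset.sum_add_distrib, ← Finset.sum_sub_distrib]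
    exact Finset.sum_congr rfl fun e _ => by ring
  rw [h9]
  ring

end FrickeTrace

namespace FrickeTrace

open Filter Topology
open UpperHalfPlane (upperHalfPlaneSet isOpen_upperHalfPlaneSet)
open Asymptotics

variable {N : ℕ} {t v : ℂ → ℂ} {γ κ : ℕ → ℂ}

lemma norm_eul_sub_le {q : ℂ} (hq : ‖q‖ ≤ 1 / 2) : ‖eul q - (1 - q) * (1 - q ^ 2)‖ ≤ 16 * ‖q‖ ^ 3 := by
  have h0 := norm_nonneg q
  have h1 := (ModularForm.multipliable_one_sub_pow (q := q) (by linarith)).hasProd.tendsto_prod_nat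
  have h2 := (tendsto_add_atTop_iff_nat 2).2 h1
  refine le_of_tendsto (h2.sub_const ((1 - q) * (1 - q ^ 2))).norm (Eventually.of_forall fun n => ?_)
  have h3 : ∏ i ∈ Finset.range (n + 2), (1 - q ^ (i + 1)) - (1 - q) * (1 - q ^ 2) =
      (1 - q) * (1 - q ^ 2) * (∏ i ∈ Finset.range n, (1 + -q ^ (i + 3)) - 1) := by
    rw [Finset.prod_range_succ', Finset.prod_range_succ']
    simp only [← sub_eq_add_neg, add_assoc]
    norm_num
    ring
  have h4 : ∑ i ∈ Finset.range n, ‖-q ^ (i + 3)‖ ≤ 2 * ‖q‖ ^ 3 := by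
    calc ∑ i ∈ Finset.range n, ‖-q ^ (i + 3)‖ = (∑ i ∈ Finset.range n, ‖q‖ ^ i) * ‖q‖ ^ 3 := by
          rw [Finset.sum_mul]
          exact Finset.sum_congr rfl fun i _ => by rw [norm_neg, norm_pow, pow_add]
      _ ≤ 2 * ‖q‖ ^ 3 := by
          gcongr
          refine (Finset.sum_le_sum fun i _ => pow_le_pow_left₀ h0 hq i).trans ?_
          have := sum_geometric_two_le n
          simpa using this
  have h7 : ‖q‖ ^ 3 ≤ (1 / 2) ^ 3 := pow_le_pow_left₀ h0 hq 3
  have h5 : ‖∏ i ∈ Finset.range n, (1 + -q ^ (i + 3)) - 1‖ ≤ 4 * ‖q‖ ^ 3 := by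
    refine (Finset.norm_prod_one_add_sub_one_le _ _).trans ?_
    have h6 := Real.abs_exp_sub_one_le (x := 2 * ‖q‖ ^ 3) (by
      rw [abs_of_nonneg (by positivity)]; linarith)
    rw [abs_of_nonneg (a := 2 * ‖q‖ ^ 3) (by positivity)] at h6
    linarith [Real.exp_le_exp.2 h4, le_abs_self (Real.exp (2 * ‖q‖ ^ 3) - 1)]
  rw [h3, norm_mul, norm_mul]
  have a1 : ‖1 - q‖ ≤ 2 := (norm_sub_le _ _).trans (by rw [norm_one]; linarith)
  have a2 : ‖1 - q ^ 2‖ ≤ 2 := (norm_sub_le _ _).trans (by rw [norm_one, norm_pow]; nlinarith)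
  calc ‖1 - q‖ * ‖1 - q ^ 2‖ * _ ≤ 2 * 2 * (4 * ‖q‖ ^ 3) := by gcongr
    _ = 16 * ‖q‖ ^ 3 := by ring

lemma eul_expansion : (fun q => eul q - (1 - q - q ^ 2)) =o[𝓝 0] fun q => q ^ 2 := by
  have h1 : (fun q : ℂ => eul q - (1 - q) * (1 - q ^ 2)) =O[𝓝 0] fun q => q ^ 3 := by
    refine IsBigO.of_bound 16 ?_
    filter_upwards [Metric.closedBall_mem_nhds (0 : ℂ) (show (0 : ℝ) < 1 / 2 by norm_num)] with q hq
    rw [norm_pow]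
    exact norm_eul_sub_le (by simpa using hq)
  have h2 : (fun q : ℂ => q ^ 3) =o[𝓝 0] fun q => q ^ 2 := isLittleO_pow_pow (by norm_num)
  refine ((h1.add (isBigO_refl _ _)).trans_isLittleO h2).congr_left fun q => ?_
  ring

lemma LE.eul_qc : LE (fun z => eul (qc z)) 0 (-3 / 2) := by
  have : (-3 / 2 : ℂ) = -1 - (-1) ^ 2 / 2 := by norm_num
  rw [this]
  refine LE.of_expansion (C := 1) one_ne_zero ?_
  refine (eul_expansion.comp_tendsto tendsto_qc_nhds).congr_left fun z => ?_
  simp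
  ring

lemma eta2_pow_twelve (d : ℕ) (z : ℂ) : eta2 (d * z) ^ 12 = qc z ^ d * eul (qc z ^ d) ^ 24 := by
  have h12 : Complex.exp (Real.pi * I * z / 6) ^ 12 = qc z := by
    rw [← Complex.exp_nat_mul, qc]
    congr 1; push_cast; ring
  rw [eta2_eq, mul_pow, ← pow_mul, mul_comm d 12, pow_mul, h12]
  ring

lemma LE.eta2 : LE (fun z => eta2 z ^ 12) 1 (-36) := by
  have h1 := (LE.qc_zpow 1).mul (LE.eul_qc.pow 24)
  norm_num at h1
  refine h1.congr fun z _ => ?_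
  have := eta2_pow_twelve 1 z
  simpa using this

lemma Od.eta2 {d : ℕ} (hd : d ≠ 0) : Od (fun z => eta2 (d * z) ^ 12) d := by
  refine ⟨1, one_ne_zero, ?_⟩
  have h1 : Tendsto (fun z => eul (qc z ^ d) ^ 24) lI (𝓝 (eul (0 ^ d) ^ 24)) := by
    refine Tendsto.pow ?_ 24
    have : ContinuousAt eul (0 ^ d) := by
      rw [zero_pow hd]
      exact (differentiableOn_eul.differentiableAt ball_mem).continuousAt
    exact this.tendsto.comp (tendsto_qc_nhds.pow d)
  rw [zero_pow hd, eul_zero, one_pow] at h1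
  refine h1.congr fun z => ?_
  have := qc_ne_zero z
  simp only [eta2_pow_twelve, _root_.zpow_neg, zpow_natCast]
  field_simp

lemma Haupt.differentiableAt (h : Haupt N t v γ κ) {z : ℂ} (hz : 0 < z.im) : DifferentiableAt ℂ t z :=
  (h.analyticOnNhd z hz).differentiableAt

lemma hasDerivAt_qc (z : ℂ) : HasDerivAt qc (2 * Real.pi * I * qc z) z := by
  have h1 : HasDerivAt (fun z : ℂ => 2 * Real.pi * I * z) (2 * Real.pi * I) z := by
    simpa using (hasDerivAt_id z).const_mul (2 * Real.pi * I)
  exact h1.cexp.congr_deriv (mul_comm _ _)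

lemma Haupt.deriv_eq (h : Haupt N t v γ κ) {z : ℂ} (hz : 0 < z.im) :
    deriv t z = 2 * Real.pi * I * (-(qc z)⁻¹ + qc z * deriv v (qc z)) := by
  have h0 := qc_ne_zero z
  have h1 : HasDerivAt (fun z => (qc z)⁻¹ + v (qc z))
      (-(2 * Real.pi * I * qc z) / qc z ^ 2 + deriv v (qc z) * (2 * Real.pi * I * qc z)) z :=
    ((hasDerivAt_qc z).inv h0).add ((h.vdiff.differentiableAt
      (Metric.isOpen_ball.mem_nhds (qc_mem_ball hz))).hasDerivAt.comp z (hasDerivAt_qc z))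
  have h2 : t =ᶠ[𝓝 z] fun z => (qc z)⁻¹ + v (qc z) := by
    filter_upwards [isOpen_upperHalfPlaneSet.mem_nhds hz] with w hw using h.eq w hw
  rw [h2.deriv_eq, h1.deriv]
  field_simp

lemma Haupt.le_deriv (h : Haupt N t v γ κ) : LE (deriv t) (-1) (-cf v 1) := by
  have h2 : (-cf v 1 : ℂ) = -cf v 1 - 0 ^ 2 / 2 := by norm_num
  rw [h2]
  refine LE.of_expansion (C := -(2 * Real.pi * I)) (neg_ne_zero.2 two_pi_I_ne_zero) ?_
  have h3 : (fun z => deriv v (qc z) - deriv v 0) =o[lI] fun _ => (1 : ℂ) := by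
    rw [isLittleO_one_iff]
    refine tendsto_sub_nhds_zero_iff.2 ?_
    exact (h.vanal.deriv.continuousAt.tendsto.comp tendsto_qc_nhds)
  have h4 := h3.mul_isBigO (isBigO_refl (fun z => qc z ^ 2) lI)
  simp only [one_mul] at h4
  refine h4.neg_left.congr' ?_ EventuallyEq.rfl
  filter_upwards [eventually_im_pos] with z hz
  have := qc_ne_zero z
  have := two_pi_I_ne_zero
  have : (Real.pi : ℂ) ≠ 0 := by exact_mod_cast Real.pi_ne_zero
  rw [h.deriv_eq hz, cf_one, _root_.zpow_neg_one]
  field_simp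
  ring

/-- The modular function `(t')⁶ / Δ`. -/
noncomputable def xi (t : ℂ → ℂ) (z : ℂ) : ℂ := deriv t z ^ 6 / eta2 z ^ 12

lemma Haupt.deriv_inv (h : Haupt N t v γ κ) {M : IM} (hM : M ∈ G0 N) {z : ℂ} (hz : 0 < z.im) :
    deriv t (mb M z) = den M z ^ 2 * deriv t z := by
  have hdet := G0_det_pos hM
  have hden := den_ne_zero hdet hz
  have h1 := (h.differentiableAt (im_mb_pos hdet hz)).hasDerivAt.comp z (hasDerivAt_mb hden)
  have h2 : t =ᶠ[𝓝 z] t ∘ mb M := by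
    filter_upwards [isOpen_upperHalfPlaneSet.mem_nhds hz] with w hw using (h.inv M hM w hw).symm
  rw [h2.deriv_eq, h1.deriv, hM.1]
  simp only [Int.cast_one]
  field_simp

lemma Haupt.deriv_al (h : Haupt N t v γ κ) {e : ℕ} (he : e ∣ N) (he1 : e ≠ 1) {A : IM} (hA : A ∈ AL N e)
    {z : ℂ} (hz : 0 < z.im) :
    deriv t (mb A z) = den A z ^ 2 * (-(κ e) / e * (deriv t z / (t z - γ e) ^ 2)) := by
  have he0 := h.pos he
  have hdet := AL_det_pos he0 hA
  have hden := den_ne_zero hdet hz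
  have h1 := (h.differentiableAt (im_mb_pos hdet hz)).hasDerivAt.comp z (hasDerivAt_mb hden)
  have hne := sub_ne_zero.2 (h.ne_gamma he he1 hz)
  have h2 : t ∘ mb A =ᶠ[𝓝 z] fun z => γ e + κ e / (t z - γ e) := by
    filter_upwards [isOpen_upperHalfPlaneSet.mem_nhds hz] with w hw using h.al_eq he he1 hA hw
  have h3 : HasDerivAt (fun z => γ e + κ e / (t z - γ e)) (κ e * (-deriv t z / (t z - γ e) ^ 2)) z := by
    have := (((h.differentiableAt hz).hasDerivAt.sub_const (γ e)).inv hne).const_mul (κ e)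
    simpa [div_eq_mul_inv] using this.const_add (γ e)
  have h4 := h1.unique (h3.congr_of_eventuallyEq h2)
  rw [hA.1] at h4
  have hec : (e : ℂ) ≠ 0 := by exact_mod_cast he0
  simp only [Int.cast_natCast] at h4
  field_simp at h4 ⊢
  linear_combination h4

lemma eta2_pow_al {e : ℕ} (hN : N ≠ 0) (he : e ∣ N) {A : IM} (hA : A ∈ AL N e) {z : ℂ} (hz : 0 < z.im) :
    eta2 (mb A z) ^ 12 = den A z ^ 12 * eta2 (e * z) ^ 12 := by
  have he0 : e ≠ 0 := fun h => hN (by rw [h] at he; exact zero_dvd_iff.1 he)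
  have h1 := eta2_AL (one_ne_zero) he0 (one_dvd N) he hA hz
  rw [Nat.cast_one, one_mul, st_one_left, Nat.gcd_one_left, Nat.cast_one, div_one] at h1
  have h2 : ∀ k : ℤ, (zt ^ k) ^ 12 = 1 := by
    intro k
    rw [← zpow_natCast, ← _root_.zpow_mul, mul_comm, _root_.zpow_mul, zpow_natCast, zt_pow_twelve,
      _root_.one_zpow]
  rw [h1, mul_pow, mul_pow, h2, one_mul]

lemma Haupt.xi_inv (h : Haupt N t v γ κ) {M : IM} (hM : M ∈ G0 N) {z : ℂ} (hz : 0 < z.im) :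
    xi t (mb M z) = xi t z := by
  have h1 := eta2_pow_al h.sqf.ne_zero (one_dvd N) (by rwa [AL_one]) hz
  have hden := den_ne_zero (G0_det_pos hM) hz
  rw [Nat.cast_one, one_mul] at h1
  rw [xi, xi, h1, h.deriv_inv hM hz, mul_pow, ← pow_mul, mul_div_mul_left _ _ (pow_ne_zero _ hden)]

lemma Haupt.analyticAt_xi (h : Haupt N t v γ κ) {z : ℂ} (hz : 0 < z.im) : AnalyticAt ℂ (xi t) z := by
  have h1 : AnalyticAt ℂ eta2 z := by
    have : DifferentiableOn ℂ eta2 upperHalfPlaneSet := fun w hw =>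
      (differentiableAt_eta2 hw).differentiableWithinAt
    exact this.analyticAt (isOpen_upperHalfPlaneSet.mem_nhds hz)
  exact ((h.analyticOnNhd z hz).deriv.pow 6).div (h1.pow 12) (pow_ne_zero _ (eta2_ne_zero hz))

lemma Haupt.order_xi (h : Haupt N t v γ κ) {z : ℂ} (hz : 0 < z.im) :
    analyticOrderAt (xi t) z = (6 * (mo t z - 1) : ℕ) := by
  have hd := (h.analyticOnNhd z hz).deriv
  have h1 := (h.analyticOnNhd z hz).analyticOrderAt_deriv_add_one
  rw [h.order_eq hz] at h1
  have h2 : analyticOrderAt (deriv t) z = (mo t z - 1 : ℕ) := by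
    obtain ⟨k, hk⟩ := Nat.exists_eq_succ_of_ne_zero (h.mo_ne_zero hz)
    rw [hk] at h1 ⊢
    simp only [Nat.succ_eq_add_one, Nat.cast_add, Nat.cast_one, Nat.add_sub_cancel] at h1 ⊢
    exact (ENat.add_left_injective_of_ne_top ENat.one_ne_top) h1
  have h3 : AnalyticAt ℂ (fun w => (eta2 w ^ 12)⁻¹) z := by
    have : DifferentiableOn ℂ eta2 upperHalfPlaneSet := fun w hw =>
      (differentiableAt_eta2 hw).differentiableWithinAt
    exact ((this.analyticAt (isOpen_upperHalfPlaneSet.mem_nhds hz)).pow 12).inv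
      (pow_ne_zero _ (eta2_ne_zero hz))
  have h4 : xi t = (deriv t) ^ 6 * fun w => (eta2 w ^ 12)⁻¹ := by
    ext w
    simp [xi, div_eq_mul_inv]
  rw [h4, analyticOrderAt_mul (hd.pow 6) h3, analyticOrderAt_pow hd, h2,
    h3.analyticOrderAt_eq_zero.2 (inv_ne_zero (pow_ne_zero _ (eta2_ne_zero hz))), add_zero]
  simp

lemma Haupt.le_xi (h : Haupt N t v γ κ) : LE (xi t) (-7) (36 - 6 * cf v 1) := by
  have h1 := (h.le_deriv.pow 6).mul LE.eta2.inv
  convert h1.congr (w := xi t) fun z _ => ?_ using 1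
  · norm_num
  · push_cast; ring
  · rw [xi, div_eq_mul_inv]

lemma Haupt.od_xi (h : Haupt N t v γ κ) {e : ℕ} (he : e ∣ N) (he1 : e ≠ 1) {A : IM} (hA : A ∈ AL N e) :
    Od (fun z => xi t (mb A z)) (6 - e) := by
  have he0 := h.pos he
  have hec : (e : ℂ) ≠ 0 := by exact_mod_cast he0
  have h1 := ((Od.const (div_ne_zero (neg_ne_zero.2 (h.kne e he he1)) hec)).pow 6).mul
    (((h.le_deriv.od.pow 6).mul ((h.od_sub (γ e)).pow 12).inv).mul (Od.eta2 he0).inv)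
  convert h1.congr (w := fun z => xi t (mb A z)) fun z hz => ?_ using 1
  · push_cast; ring
  · have hden := den_ne_zero (AL_det_pos he0 hA) hz
    have hne := sub_ne_zero.2 (h.ne_gamma he he1 hz)
    have : eta2 (e * z) ≠ 0 := eta2_ne_zero (by
      have := Nat.pos_of_ne_zero he0
      rw [← nsmul_eq_mul, Complex.im_nsmul, nsmul_eq_mul]
      positivity)
    rw [xi, eta2_pow_al h.sqf.ne_zero he hA hz, h.deriv_al he he1 hA hz]
    field_simp

/-- The weighted sum over the zeros of `t'`. -/
lemma Haupt.divisor_xi (h : Haupt N t v γ κ) {T : Finset ℂ} {pt : ℂ → ℂ}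
    (hpt : ∀ s ∈ T, 0 < (pt s).im ∧ t (pt s) = s)
    (hT : ∀ z : ℂ, 0 < z.im → mo t z ≠ 1 → t z ∈ T) (c : ℂ)
    (hc : c * (cus N).card + c = ∑ e ∈ cus N, pv v (γ e)) :
    6 * ∑ s ∈ T, ((mo t (pt s) : ℂ) - 1) / mo t (pt s) * (pv v s - c) =
      12 * cf v 1 - 12 * c - 72 + (∑ e ∈ cus N, e * (pv v (γ e) - c) - c) := by
  have h3 := h.divisor (F := xi t)
    (fun z hz => (h.analyticAt_xi hz).differentiableAt.differentiableWithinAt)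
    (fun M hM z hz => h.xi_inv hM hz) h.le_xi
    (fun e he => by
      obtain ⟨A, hA⟩ := AL_nonempty h.sqf (h.mem_cus.1 he).1
      exact ⟨A, hA, h.od_xi (h.mem_cus.1 he).1 (h.mem_cus.1 he).2 hA⟩) hpt
    (fun z hz hz0 => hT z hz (by
      have h4 := (h.analyticAt_xi hz).analyticOrderAt_ne_zero.2 hz0
      rw [h.order_xi hz, Nat.cast_ne_zero] at h4
      omega)) (fun s hs => h.order_xi (hpt s hs).1) c hc
  have h5 : ∀ s ∈ T, ((6 * (mo t (pt s) - 1) : ℕ) : ℂ) / mo t (pt s) * (pv v s - c) =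
      6 * (((mo t (pt s) : ℂ) - 1) / mo t (pt s) * (pv v s - c)) := by
    intro s hs
    have := Nat.one_le_iff_ne_zero.2 (h.mo_ne_zero (hpt s hs).1)
    push_cast [Nat.cast_sub this]
    ring
  rw [Finset.sum_congr rfl h5, ← Finset.mul_sum] at h3
  rw [h3]
  have h7 : ∑ e ∈ cus N, (pv v (γ e) - c) = c := by
    rw [Finset.sum_sub_distrib, ← hc, Finset.sum_const, nsmul_eq_mul]
    ring
  have h8 : ∀ e ∈ cus N, (((6 - e : ℤ) : ℂ) - (-7 : ℤ)) * (pv v (γ e) - c) =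
      13 * (pv v (γ e) - c) - e * (pv v (γ e) - c) := by
    intro e _
    push_cast
    ring
  rw [Finset.sum_congr rfl h8, Finset.sum_sub_distrib, ← Finset.mul_sum, h7]
  ring

end FrickeTrace

namespace FrickeTrace

open Filter Topology
open UpperHalfPlane (upperHalfPlaneSet isOpen_upperHalfPlaneSet)

variable {N : ℕ} {t v : ℂ → ℂ} {γ κ : ℕ → ℂ}

/-- Positive definite real symmetric `2 × 2` matrices. -/
structure PD (Q : Matrix (Fin 2) (Fin 2) ℝ) : Prop where
  sym : Q 1 0 = Q 0 1
  pos : 0 < Q 0 0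
  det : 0 < Q.det

lemma PD.im_cmPointC {Q : Matrix (Fin 2) (Fin 2) ℝ} (h : PD Q) : 0 < (cmPointC Q).im := by
  have h1 : (cmPointC Q).im = Real.sqrt Q.det / Q 0 0 := by
    rw [cmPointC, Complex.div_ofReal_im]
    simp
  rw [h1]
  exact div_pos (Real.sqrt_pos.2 h.det) h.pos

lemma PD.eq_cmPointC_iff {Q : Matrix (Fin 2) (Fin 2) ℝ} (h : PD Q) {z : ℂ} (hz : 0 < z.im) :
    z = cmPointC Q ↔ (Q 0 0 : ℂ) * z ^ 2 + 2 * (Q 0 1 : ℂ) * z + (Q 1 1 : ℂ) = 0 := by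
  have hp := h.pos
  have hp' : (Q 0 0 : ℂ) ≠ 0 := by exact_mod_cast hp.ne'
  have hdet : Q.det = Q 0 0 * Q 1 1 - Q 0 1 ^ 2 := by rw [Matrix.det_fin_two, h.sym]; ring
  have hs : (Real.sqrt Q.det : ℂ) ^ 2 = (Q 0 0 * Q 1 1 - Q 0 1 ^ 2 : ℂ) := by
    rw [← Complex.ofReal_pow, Real.sq_sqrt h.det.le, hdet]
    push_cast
    rfl
  have key : (Q 0 0 : ℂ) * ((Q 0 0 : ℂ) * z ^ 2 + 2 * (Q 0 1 : ℂ) * z + (Q 1 1 : ℂ)) =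
      (Q 0 0 * z + Q 0 1 - I * Real.sqrt Q.det) * (Q 0 0 * z + Q 0 1 + I * Real.sqrt Q.det) := by
    linear_combination ((Real.sqrt Q.det : ℂ) ^ 2) * I_sq - hs
  have h2 : Q 0 0 * z + Q 0 1 + I * Real.sqrt Q.det ≠ 0 := by
    intro h0
    have := congrArg Complex.im h0
    simp at this
    have h3 := Real.sqrt_nonneg Q.det
    have := mul_pos hp hz
    linarith
  rw [cmPointC, eq_div_iff hp']
  constructor
  · intro h1
    have : (Q 0 0 : ℂ) * ((Q 0 0 : ℂ) * z ^ 2 + 2 * (Q 0 1 : ℂ) * z + (Q 1 1 : ℂ)) = 0 := by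
      rw [key, mul_eq_zero]
      left
      rw [mul_comm, h1]
      push_cast
      ring
    exact (mul_eq_zero.1 this).resolve_left hp'
  · intro h1
    rw [h1, mul_zero] at key
    have := (mul_eq_zero.1 key.symm).resolve_right h2
    push_cast
    linear_combination this

lemma PD.ext {Q Q' : Matrix (Fin 2) (Fin 2) ℝ} (h : PD Q) (h' : PD Q') (hd : Q.det = Q'.det)
    (hc : cmPointC Q = cmPointC Q') : Q = Q' := by
  have hi : ∀ R : Matrix (Fin 2) (Fin 2) ℝ, (cmPointC R).im = Real.sqrt R.det / R 0 0 := fun R => by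
    rw [cmPointC, Complex.div_ofReal_im]
    simp
  have hr : ∀ R : Matrix (Fin 2) (Fin 2) ℝ, (cmPointC R).re = -R 0 1 / R 0 0 := fun R => by
    rw [cmPointC, Complex.div_ofReal_re]
    simp
  have hp := h.pos
  have hp' := h'.pos
  have hs := Real.sqrt_pos.2 h'.det
  have h1 : Q 0 0 = Q' 0 0 := by
    have := hi Q
    rw [hc, hi Q', hd, div_eq_div_iff hp'.ne' hp.ne'] at this
    exact mul_left_cancel₀ hs.ne' this
  have h2 : Q 0 1 = Q' 0 1 := by
    have := hr Q
    rw [hc, hr Q', h1, div_left_inj' hp'.ne'] at this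
    linarith
  have h3 : Q 1 1 = Q' 1 1 := by
    rw [Matrix.det_fin_two, Matrix.det_fin_two, h.sym, h'.sym, h1, h2] at hd
    exact mul_left_cancel₀ hp'.ne' (by linarith)
  ext i j
  fin_cases i <;> fin_cases j <;> simp [h1, h2, h3, h.sym, h'.sym]

lemma PD.act {Q g : Matrix (Fin 2) (Fin 2) ℝ} (h : PD Q) (hg : g.det = 1) : PD (gᵀ * Q * g) := by
  have hdet : Q.det = Q 0 0 * Q 1 1 - Q 0 1 ^ 2 := by rw [Matrix.det_fin_two, h.sym]; ring
  refine ⟨?_, ?_, ?_⟩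
  · simp [Matrix.mul_apply, Fin.sum_univ_two, h.sym]
    ring
  · have h1 : (gᵀ * Q * g) 0 0 * Q 0 0 = (Q 0 0 * g 0 0 + Q 0 1 * g 1 0) ^ 2 + Q.det * g 1 0 ^ 2 := by
      rw [hdet]
      simp [Matrix.mul_apply, Fin.sum_univ_two, h.sym]
      ring
    have h2 : 0 < (gᵀ * Q * g) 0 0 * Q 0 0 := by
      rw [h1]
      by_cases hc : g 1 0 = 0
      · have : g 0 0 ≠ 0 := fun h0 => by
          rw [Matrix.det_fin_two, hc, h0] at hg
          simp at hg
        have hp := h.pos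
        rw [hc]
        have : 0 < (Q 0 0 * g 0 0) ^ 2 := by positivity
        simpa using this
      · have := h.det
        positivity
    exact pos_of_mul_pos_left h2 h.pos.le
  · rw [Matrix.det_mul, Matrix.det_mul, Matrix.det_transpose, hg]
    simpa using h.det

/-- Equivariance of the CM point, for a real matrix proportional to an integral one. -/
lemma PD.cmPointC_act {Q g : Matrix (Fin 2) (Fin 2) ℝ} (h : PD Q) (hg : g.det = 1) {A : IM} {k : ℝ}
    (hA : 0 < A.det) (hgA : g = k • A.map (Int.cast : ℤ → ℝ)) :
    cmPointC Q = mb A (cmPointC (gᵀ * Q * g)) := by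
  have h' := h.act hg
  set z := cmPointC (gᵀ * Q * g) with hz
  have hzi : 0 < z.im := h'.im_cmPointC
  have hden := den_ne_zero hA hzi
  have hk : (k : ℂ) ≠ 0 := by
    intro h0
    have h0' : k = 0 := by exact_mod_cast h0
    rw [hgA, h0'] at hg
    simp at hg
  symm
  rw [h.eq_cmPointC_iff (im_mb_pos hA hzi)]
  have h1 := (h'.eq_cmPointC_iff hzi).1 hz
  have h2 : (k : ℂ) ^ 2 * ((Q 0 0 : ℂ) * (A 0 0 * z + A 0 1) ^ 2 +
      2 * (Q 0 1 : ℂ) * ((A 0 0 * z + A 0 1) * den A z) + (Q 1 1 : ℂ) * den A z ^ 2) = 0 := by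
    rw [← h1, hgA, den]
    simp [Matrix.mul_apply, Fin.sum_univ_two, h.sym]
    ring
  have h3 := (mul_eq_zero.1 h2).resolve_left (pow_ne_zero 2 hk)
  rw [mb]
  field_simp
  linear_combination h3

lemma PD.act_eq_iff {Q Q' g : Matrix (Fin 2) (Fin 2) ℝ} (h : PD Q) (h' : PD Q') (hd : Q.det = Q'.det)
    (hg : g.det = 1) {A : IM} {k : ℝ} (hA : 0 < A.det) (hgA : g = k • A.map (Int.cast : ℤ → ℝ)) :
    Q' = gᵀ * Q * g ↔ cmPointC Q = mb A (cmPointC Q') := by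
  have h1 := h.cmPointC_act hg hA hgA
  refine ⟨fun h2 => by rwa [← h2] at h1, fun h2 => ?_⟩
  refine h'.ext (h.act hg) ?_ ?_
  · rw [Matrix.det_mul, Matrix.det_mul, Matrix.det_transpose, hg]
    simp [hd]
  · have h3 := h1.symm.trans h2
    have hadj : 0 < A.adjugate.det := by rw [det_adj]; exact hA
    have e : ∀ z : ℂ, 0 < z.im → mb A.adjugate (mb A z) = z := fun z hz => mb_adj hA hz
    rw [← e _ (h.act hg).im_cmPointC, ← e _ h'.im_cmPointC, h3]

lemma PD_of_mem {d : ℤ} (hd : 0 < d) {Q : Matrix (Fin 2) (Fin 2) ℝ} (hQ : Q ∈ QdN d N) :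
    PD Q ∧ Q.det = d / 4 := by
  obtain ⟨a, b, c, rfl, ha, hb, -⟩ := hQ
  have h1 : (formMat a b c).det = d / 4 := by
    have : ((b : ℝ) ^ 2 - 4 * a * c) = -d := by exact_mod_cast hb
    simp [formMat]
    linarith
  refine ⟨⟨by simp [formMat], by simpa [formMat] using ha, ?_⟩, h1⟩
  rw [h1]
  have : (0 : ℝ) < d := by exact_mod_cast hd
  positivity

/-- Scaling an integral matrix by `1 / √e`. -/
noncomputable def scl (e : ℕ) (A : IM) : Matrix (Fin 2) (Fin 2) ℝ :=
  (Real.sqrt e)⁻¹ • A.map (Int.cast : ℤ → ℝ)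

lemma det_map_cast (A : IM) : (A.map (Int.cast : ℤ → ℝ)).det = A.det := by
  rw [Matrix.det_fin_two, Matrix.det_fin_two]
  simp

lemma det_scl {e : ℕ} (he : e ≠ 0) {A : IM} (hA : A ∈ AL N e) : (scl e A).det = 1 := by
  have : (0 : ℝ) < e := by exact_mod_cast Nat.pos_of_ne_zero he
  rw [scl, Matrix.det_smul, det_map_cast, hA.1, Fintype.card_fin, inv_pow, Real.sq_sqrt this.le]
  simp [this.ne']

lemma scl_mul {e f : ℕ} (he : e ≠ 0) (A B C : IM) (hC : A * B = (e.gcd f : ℤ) • C) :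
    scl e A * scl f B = scl (st e f) C := by
  have h1 : (A * B).map (Int.cast : ℤ → ℝ) = A.map (Int.cast : ℤ → ℝ) * B.map (Int.cast : ℤ → ℝ) :=
    Matrix.map_mul (f := Int.castRingHom ℝ)
  have h2 : e * f = st e f * (e.gcd f * e.gcd f) := by
    rw [← mul_assoc, st_mul_gcd he, mul_comm (e.lcm f), Nat.gcd_mul_lcm]
  have hg : (0 : ℝ) < (e.gcd f : ℕ) := by
    exact_mod_cast Nat.gcd_pos_of_pos_left _ (Nat.pos_of_ne_zero he)
  have h3 : Real.sqrt e * Real.sqrt f = Real.sqrt (st e f) * (e.gcd f : ℕ) := by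
    rw [← Real.sqrt_mul (by positivity), ← Real.sqrt_sq hg.le, ← Real.sqrt_mul (by positivity)]
    congr 1
    rw [sq]
    exact_mod_cast h2
  have h4 : (A * B).map (Int.cast : ℤ → ℝ) = ((e.gcd f : ℕ) : ℝ) • C.map (Int.cast : ℤ → ℝ) := by
    rw [hC]
    ext i j
    rw [Matrix.map_apply, Matrix.smul_apply, Matrix.smul_apply, Matrix.map_apply, smul_eq_mul,
      smul_eq_mul]
    push_cast
    rfl
  rw [scl, scl, scl, Matrix.smul_mul, Matrix.mul_smul, ← h1, h4, smul_smul, smul_smul, ← mul_inv, h3,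
    mul_inv, mul_assoc, inv_mul_cancel₀ hg.ne', mul_one]

lemma mem_fricke_iff (hN : Squarefree N) {g : SL2R} :
    g ∈ FrickeGroup N ↔ ∃ e, e ∣ N ∧ ∃ A ∈ AL N e, g.1 = scl e A := by
  have hpos : ∀ {e}, e ∣ N → e ≠ 0 := fun he h0 => hN.ne_zero (by rw [h0] at he; exact zero_dvd_iff.1 he)
  constructor
  · intro hg
    induction hg using Subgroup.closure_induction with
    | mem g hg =>
      rcases hg with hg | hg
      · obtain ⟨M, hM, rfl⟩ := hg
        refine ⟨1, one_dvd _, M.1, ?_, ?_⟩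
        · rw [AL_one]
          exact ⟨M.2, (ZMod.intCast_zmod_eq_zero_iff_dvd _ _).1 (CongruenceSubgroup.Gamma0_mem.1 hM)⟩
        · rw [scl]
          ext i j
          simp
      · simp only [Set.mem_iUnion, Set.mem_ofPred_eq, exists_prop] at hg
        obtain ⟨e, ⟨he, -⟩, x, y, z, w, hg⟩ := hg
        have he0 : (0 : ℝ) < e := by exact_mod_cast Nat.pos_of_ne_zero (hpos he)
        have hgs : g.1 = scl e !![x * e, y; z * N, w * e] := by
          rw [hg, scl]
          congr 1
          ext i j
          fin_cases i <;> fin_cases j <;> simp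
        refine ⟨e, he, _, ⟨?_, by simp, by simp, by simp⟩, hgs⟩
        have h1 := g.2
        rw [hgs, scl, Matrix.det_smul, det_map_cast, Fintype.card_fin, inv_pow, Real.sq_sqrt he0.le,
          inv_mul_eq_one₀ he0.ne'] at h1
        exact_mod_cast h1.symm
    | one =>
      refine ⟨1, one_dvd _, 1, by rw [AL_one]; exact one_mem_G0 N, ?_⟩
      rw [scl]
      ext i j
      fin_cases i <;> fin_cases j <;> simp
    | mul g g' _ _ hg hg' =>
      obtain ⟨e, he, A, hA, hgA⟩ := hg
      obtain ⟨f, hf, B, hB, hgB⟩ := hg'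
      obtain ⟨C, hC, hAB⟩ := AL_mul (hpos he) he hf hA hB
      refine ⟨_, st_dvd (hpos he) he hf, C, hC, ?_⟩
      rw [Matrix.SpecialLinearGroup.coe_mul, hgA, hgB, scl_mul (hpos he) A B C hAB]
    | inv g _ hg =>
      obtain ⟨e, he, A, hA, hgA⟩ := hg
      refine ⟨e, he, A.adjugate, AL_adj hA, ?_⟩
      rw [Matrix.SpecialLinearGroup.coe_inv, hgA, scl, scl, Matrix.adjugate_fin_two, Matrix.adjugate_fin_two]
      ext i j
      fin_cases i <;> fin_cases j <;> simp
  · rintro ⟨e, he, A, hA, hgA⟩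
    refine Subgroup.subset_closure (Or.inr ?_)
    simp only [Set.mem_iUnion, Set.mem_ofPred_eq, exists_prop]
    obtain ⟨h1, ⟨x, hx⟩, ⟨w, hw⟩, ⟨z, hz⟩⟩ := hA
    refine ⟨e, ⟨he, ?_⟩, x, A 0 1, z, w, ?_⟩
    · exact Nat.coprime_of_squarefree_mul (by rwa [Nat.mul_div_cancel' he])
    · rw [hgA, scl]
      congr 1
      ext i j
      fin_cases i <;> fin_cases j <;> simp [hx, hw, hz, mul_comm]

end FrickeTrace

namespace FrickeTrace

open Filter Topology
open UpperHalfPlane (upperHalfPlaneSet isOpen_upperHalfPlaneSet)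

variable {N : ℕ} {t v : ℂ → ℂ} {γ κ : ℕ → ℂ}

/-- The action of the Atkin–Lehner involutions on values of a hauptmodul. -/
noncomputable def mu (γ κ : ℕ → ℂ) (e : ℕ) (s : ℂ) : ℂ := if e = 1 then s else γ e + κ e / (s - γ e)

lemma mu_one (s : ℂ) : mu γ κ 1 s = s := if_pos rfl

lemma Haupt.apply_al (h : Haupt N t v γ κ) {e : ℕ} (he : e ∣ N) {A : IM} (hA : A ∈ AL N e) {z : ℂ}
    (hz : 0 < z.im) : t (mb A z) = mu γ κ e (t z) := by
  rw [mu]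
  split_ifs with h1
  · rw [h1, AL_one] at hA
    exact h.inv A hA z hz
  · exact h.al_eq he h1 hA hz

lemma Haupt.mu_mu (h : Haupt N t v γ κ) {e f : ℕ} (he : e ∣ N) (hf : f ∣ N) {z : ℂ} (hz : 0 < z.im) :
    mu γ κ e (mu γ κ f (t z)) = mu γ κ (st e f) (t z) := by
  obtain ⟨A, hA⟩ := AL_nonempty h.sqf he
  obtain ⟨B, hB⟩ := AL_nonempty h.sqf hf
  obtain ⟨C, hC, hAB⟩ := AL_mul (h.pos he) he hf hA hB
  have hBd := AL_det_pos (h.pos hf) hB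
  have hg : (e.gcd f : ℤ) ≠ 0 := by
    exact_mod_cast (Nat.gcd_pos_of_pos_left _ (Nat.pos_of_ne_zero (h.pos he))).ne'
  rw [← h.apply_al hf hB hz, ← h.apply_al he hA (im_mb_pos hBd hz), ← mb_mul _ (den_ne_zero hBd hz), hAB,
    mb_smul hg, h.apply_al (st_dvd (h.pos he) he hf) hC hz]

/-- The action of an Atkin–Lehner matrix preserves the set of forms. -/
lemma form_act {d : ℤ} (hd : 0 < d) {e : ℕ} (he : e ≠ 0) (heN : e ∣ N) {A : IM} (hA : A ∈ AL N e)
    {Q : Matrix (Fin 2) (Fin 2) ℝ} (hQ : Q ∈ QdN d N) : (scl e A)ᵀ * Q * scl e A ∈ QdN d N := by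
  obtain ⟨hPD, hdet⟩ := PD_of_mem hd hQ
  have hact := hPD.act (det_scl he hA)
  have hdet' : ((scl e A)ᵀ * Q * scl e A).det = d / 4 := by
    rw [Matrix.det_mul, Matrix.det_mul, Matrix.det_transpose, det_scl he hA]
    simp [hdet]
  obtain ⟨a, b, c, rfl, ha, hb, ⟨a₁, ha₁⟩⟩ := hQ
  obtain ⟨-, ⟨x, hx⟩, ⟨w, hw⟩, ⟨z, hz⟩⟩ := hA
  obtain ⟨f, hf⟩ := heN
  have he0 : (0 : ℝ) < e := by exact_mod_cast Nat.pos_of_ne_zero he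
  set a' : ℤ := a * e * x ^ 2 + b * x * N * z + c * N * f * z ^ 2
  set b' : ℤ := 2 * a * x * A 0 1 + b * (e * x * w + A 0 1 * f * z) + 2 * c * N * z * w
  set c' : ℤ := f * a₁ * A 0 1 ^ 2 + b * A 0 1 * w + c * e * w ^ 2
  have hs : (Real.sqrt e)⁻¹ * (Real.sqrt e)⁻¹ = (e : ℝ)⁻¹ := by
    rw [← mul_inv, Real.mul_self_sqrt he0.le]
  have hNf : (N : ℝ) = e * f := by exact_mod_cast hf
  have hfm : (scl e A)ᵀ * formMat a b c * scl e A = formMat a' b' c' := by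
    have h1 : (scl e A)ᵀ * formMat a b c * scl e A =
        (e : ℝ)⁻¹ • ((A.map (Int.cast : ℤ → ℝ))ᵀ * formMat a b c * A.map (Int.cast : ℤ → ℝ)) := by
      rw [scl, Matrix.transpose_smul, Matrix.smul_mul, Matrix.smul_mul, Matrix.mul_smul, smul_smul, hs]
    rw [h1]
    ext i j
    fin_cases i <;> fin_cases j <;>
      simp [Matrix.mul_apply, Fin.sum_univ_two, formMat, hx, hw, hz, a', b', c', ha₁, hNf] <;>
      field_simp <;> ring
  rw [hfm] at hact hdet' ⊢
  refine ⟨a', b', c', rfl, ?_, ?_, ?_⟩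
  · have := hact.pos
    simpa [formMat] using this
  · have h2 : ((b' : ℝ) ^ 2 - 4 * a' * c') = -d := by
      simp [formMat] at hdet'
      linarith
    exact_mod_cast h2
  · exact ⟨a₁ * e * x ^ 2 + b * x * z + c * f * z ^ 2, by simp only [a', ha₁]; ring⟩

lemma scl_inj_left {e f : ℕ} (he : e ∣ N) (hf : f ∣ N) (hN : N ≠ 0) {A B : IM} (hA : A ∈ AL N e)
    (hB : B ∈ AL N f) (h : scl e A = scl f B) : e = f := by
  have he0 : e ≠ 0 := ne_zero_of_dvd_ne_zero hN he
  have hf0 : f ≠ 0 := ne_zero_of_dvd_ne_zero hN hf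
  obtain ⟨C, hC, hAB⟩ := AL_mul he0 he hf hA (AL_adj hB)
  obtain ⟨D, hD, hBB⟩ := AL_mul hf0 hf hf hB (AL_adj hB)
  have h1 := scl_mul he0 A B.adjugate C hAB
  have h2 : scl f B * scl f B.adjugate = 1 := by
    have hf1 : (0 : ℝ) < f := by exact_mod_cast Nat.pos_of_ne_zero hf0
    have h3 : B.map (Int.cast : ℤ → ℝ) * B.adjugate.map (Int.cast : ℤ → ℝ) = (f : ℝ) • 1 := by
      have h4 : (B * B.adjugate).map (Int.cast : ℤ → ℝ) = _ := Matrix.map_mul (f := Int.castRingHom ℝ)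
      change _ = B.map (Int.cast : ℤ → ℝ) * B.adjugate.map (Int.cast : ℤ → ℝ) at h4
      rw [← h4, Matrix.mul_adjugate, hB.1]
      ext i j
      rw [Matrix.map_apply, Matrix.smul_apply, Matrix.smul_apply, Matrix.one_apply, Matrix.one_apply]
      split_ifs <;> simp
    rw [scl, scl, Matrix.smul_mul, Matrix.mul_smul, smul_smul, h3, smul_smul, ← mul_inv,
      Real.mul_self_sqrt hf1.le, inv_mul_cancel₀ hf1.ne', one_smul]
  rw [h, h2] at h1
  apply st_eq_one he0
  set k := st e f
  have hk0 : k ≠ 0 := ne_zero_of_dvd_ne_zero hN (st_dvd he0 he hf)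
  have hk : (0 : ℝ) < k := by exact_mod_cast Nat.pos_of_ne_zero hk0
  obtain ⟨-, ⟨x, hx⟩, -⟩ := hC
  have h3 : (1 : ℝ) = (Real.sqrt k)⁻¹ * C 0 0 := by
    have := congrFun (congrFun h1 0) 0
    simpa [scl] using this
  have h4 : (k : ℝ) = (C 0 0 : ℝ) ^ 2 := by
    rw [inv_mul_eq_div, eq_div_iff (Real.sqrt_pos.2 hk).ne', one_mul] at h3
    rw [← h3, Real.sq_sqrt hk.le]
  have h5 : (k : ℤ) * (k * x ^ 2) = k * 1 := by
    have : (k : ℤ) = C 0 0 ^ 2 := by exact_mod_cast h4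
    rw [hx] at this
    linarith
  have h6 := mul_left_cancel₀ (by exact_mod_cast hk0) h5
  have h7 : (k : ℤ) ∣ 1 := ⟨_, h6.symm⟩
  exact Nat.dvd_one.1 (by exact_mod_cast h7)

lemma scl_injective {e : ℕ} (he : e ≠ 0) : Function.Injective (scl e) := by
  intro A B h
  have he0 : (Real.sqrt e)⁻¹ ≠ 0 := by
    have : (0 : ℝ) < e := by exact_mod_cast Nat.pos_of_ne_zero he
    positivity
  have h1 := smul_right_injective (Matrix (Fin 2) (Fin 2) ℝ) he0 h
  ext i j
  have := congrFun (congrFun h1 i) j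
  simpa using this

/-- The Atkin–Lehner indices fixing a value. -/
noncomputable def fixDiv (N : ℕ) (γ κ : ℕ → ℂ) (s : ℂ) : Finset ℕ :=
  open scoped Classical in N.divisors.filter fun e => mu γ κ e s = s

lemma Haupt.card_stab_al (h : Haupt N t v γ κ) {e : ℕ} (he : e ∣ N) {z : ℂ} (hz : 0 < z.im) :
    Finite {A : IM // A ∈ AL N e ∧ mb A z = z} ∧
    Nat.card {A : IM // A ∈ AL N e ∧ mb A z = z} =
      open scoped Classical in if mu γ κ e (t z) = t z then 2 * mo t z else 0 := by
  classical
  by_cases hne : ∃ A₀, A₀ ∈ AL N e ∧ mb A₀ z = z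
  · obtain ⟨A₀, hA₀, hA₀z⟩ := hne
    have hd := AL_det_pos (h.pos he) hA₀
    rw [if_pos (by rw [← h.apply_al he hA₀ hz, hA₀z])]
    have himg : {A : IM | A ∈ AL N e ∧ mb A z = z} = (fun C => C * A₀) '' {M | M ∈ G0 N ∧ mb M z = z} := by
      ext A
      constructor
      · rintro ⟨hA, hAz⟩
        obtain ⟨C, hC, rfl⟩ := AL_eq_mul (h.pos he) he hA hA₀
        refine ⟨C, ⟨hC, ?_⟩, rfl⟩
        rwa [mb_mul _ (den_ne_zero hd hz), hA₀z] at hAz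
      · rintro ⟨C, ⟨hC, hCz⟩, rfl⟩
        exact ⟨G0_mul_AL he hC hA₀, by rw [mb_mul _ (den_ne_zero hd hz), hA₀z, hCz]⟩
    obtain ⟨h1, h2⟩ := h.ncard_stab hz
    have hfin : {A : IM | A ∈ AL N e ∧ mb A z = z}.Finite := by
      rw [himg]
      exact h1.image _
    refine ⟨hfin, ?_⟩
    change Nat.card ↥{A : IM | A ∈ AL N e ∧ mb A z = z} = _
    rw [Nat.card_coe_set_eq, himg, Set.ncard_image_of_injective, h2]
    intro C D hCD
    have h3 : C * A₀ * A₀.adjugate = D * A₀ * A₀.adjugate := by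
      have : C * A₀ = D * A₀ := hCD
      rw [this]
    rw [Matrix.mul_assoc, Matrix.mul_assoc, Matrix.mul_adjugate, Matrix.mul_smul, Matrix.mul_smul,
      Matrix.mul_one, Matrix.mul_one] at h3
    exact smul_right_injective IM hd.ne' h3
  · have hemp : IsEmpty {A : IM // A ∈ AL N e ∧ mb A z = z} := ⟨fun A => hne ⟨A.1, A.2⟩⟩
    refine ⟨inferInstance, ?_⟩
    rw [Nat.card_of_isEmpty, if_neg]
    intro hmu
    obtain ⟨A, hA⟩ := AL_nonempty h.sqf he
    have hd := AL_det_pos (h.pos he) hA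
    rw [← h.apply_al he hA hz] at hmu
    obtain ⟨G, hG, hGz⟩ := h.injective (im_mb_pos hd hz) hz hmu
    exact hne ⟨G * A, G0_mul_AL he hG hA, by rw [mb_mul _ (den_ne_zero hd hz), hGz]⟩

lemma Haupt.stabOrder_eq (h : Haupt N t v γ κ) {d : ℤ} (hd : 0 < d) {Q : Matrix (Fin 2) (Fin 2) ℝ}
    (hQ : Q ∈ QdN d N) : stabOrder (FrickeGroup N) Q =
      mo t (cmPointC Q) * (fixDiv N γ κ (t (cmPointC Q))).card := by
  classical
  obtain ⟨hPD, -⟩ := PD_of_mem hd hQ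
  have hz := hPD.im_cmPointC
  set z := cmPointC Q
  have hdvd : ∀ e : N.divisors, e.1 ∣ N := fun e => Nat.dvd_of_mem_divisors e.2
  have hkey : ∀ e : N.divisors, ∀ A ∈ AL N e, ((scl e A)ᵀ * Q * scl e A = Q ↔ mb A z = z) := by
    intro e A hA
    have h0 := h.pos (hdvd e)
    have := hPD.act_eq_iff hPD rfl (det_scl h0 hA) (AL_det_pos h0 hA) rfl
    rw [eq_comm, this, eq_comm]
  let φ : (Σ e : N.divisors, {A : IM // A ∈ AL N e ∧ mb A z = z}) →
      { g : SL2R // g ∈ FrickeGroup N ∧ (g.1)ᵀ * Q * g.1 = Q } := fun p =>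
    ⟨⟨scl p.1 p.2.1, det_scl (h.pos (hdvd p.1)) p.2.2.1⟩,
      (mem_fricke_iff h.sqf).2 ⟨p.1, hdvd p.1, p.2.1, p.2.2.1, rfl⟩, (hkey p.1 p.2.1 p.2.2.1).2 p.2.2.2⟩
  have hφ : Function.Bijective φ := by
    constructor
    · rintro ⟨e, A⟩ ⟨f, B⟩ hAB
      have h1 : scl e A.1 = scl f B.1 := congrArg (fun g => g.1.1) hAB
      have h2 : e = f := Subtype.ext
        (scl_inj_left (hdvd e) (hdvd f) h.sqf.ne_zero A.2.1 B.2.1 h1)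
      subst h2
      rw [Subtype.ext (scl_injective (h.pos (hdvd e)) h1)]
    · rintro ⟨g, hg, hgQ⟩
      obtain ⟨e, he, A, hA, hgA⟩ := (mem_fricke_iff h.sqf).1 hg
      have he' : e ∈ N.divisors := Nat.mem_divisors.2 ⟨he, h.sqf.ne_zero⟩
      refine ⟨⟨⟨e, he'⟩, A, hA, (hkey ⟨e, he'⟩ A hA).1 (by rw [← hgA]; exact hgQ)⟩, ?_⟩
      exact Subtype.ext (Subtype.ext hgA.symm)
  have hfin : ∀ e : N.divisors, Finite {A : IM // A ∈ AL N e ∧ mb A z = z} := fun e =>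
    (h.card_stab_al (hdvd e) hz).1
  rw [stabOrder, ← Nat.card_congr (Equiv.ofBijective φ hφ), Nat.card_sigma,
    Finset.sum_congr rfl fun e _ => (h.card_stab_al (hdvd e) hz).2,
    Finset.sum_coe_sort N.divisors fun e => if mu γ κ e (t z) = t z then 2 * mo t z else 0,
    Finset.sum_ite, Finset.sum_const_zero, add_zero, Finset.sum_const, smul_eq_mul, fixDiv]
  rw [mul_left_comm, Nat.mul_div_cancel_left _ two_pos, mul_comm]

/-- Summation over an orbit of values. -/
lemma Haupt.sum_orbit (h : Haupt N t v γ κ)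
    (hst : ∀ e ∈ N.divisors, ∀ f ∈ N.divisors, st f (st f e) = e) {z : ℂ} (hz : 0 < z.im) (p : ℂ → ℂ) :
    ∑ e ∈ N.divisors, p (mu γ κ e (t z)) = (fixDiv N γ κ (t z)).card *
      open scoped Classical in ∑ s ∈ N.divisors.image fun e => mu γ κ e (t z), p s := by
  classical
  rw [Finset.sum_comp, Finset.mul_sum]
  refine Finset.sum_congr rfl fun s hs => ?_
  rw [nsmul_eq_mul]
  congr 2
  obtain ⟨f, hf, rfl⟩ := Finset.mem_image.1 hs
  have hdvd : ∀ {e}, e ∈ N.divisors → e ∣ N := fun he => Nat.dvd_of_mem_divisors he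
  have hmem : ∀ {e}, e ∈ N.divisors → st f e ∈ N.divisors := fun he => Nat.mem_divisors.2
    ⟨st_dvd (h.pos (hdvd hf)) (hdvd hf) (hdvd he), h.sqf.ne_zero⟩
  symm
  refine Finset.card_nbij' (fun e => st f e) (fun e => st f e) ?_ ?_ ?_ ?_
  · intro e he
    simp only [fixDiv, Finset.coe_filter, Set.mem_ofPred_eq] at he ⊢
    exact ⟨hmem he.1, by rw [← h.mu_mu (hdvd hf) (hdvd he.1) hz, he.2]⟩
  · intro e he
    simp only [fixDiv, Finset.coe_filter, Set.mem_ofPred_eq] at he ⊢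
    refine ⟨hmem he.1, ?_⟩
    rw [← h.mu_mu (hdvd hf) (hdvd he.1) hz, he.2, h.mu_mu (hdvd hf) (hdvd hf) hz, st_self (h.pos (hdvd hf)),
      mu_one]
  · intro e he
    exact hst e (Finset.mem_of_mem_filter e he) f hf
  · intro e he
    exact hst e (Finset.mem_of_mem_filter e he) f hf

/-- The modular trace as a sum over values of the hauptmodul of `Γ₀(N)`. -/
lemma Haupt.classTrace_eq (h : Haupt N t v γ κ)
    (hst : ∀ e ∈ N.divisors, ∀ f ∈ N.divisors, st f (st f e) = e) {d : ℤ} (hd : 0 < d) {S : Finset ℂ}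
    (hS : ∀ s, s ∈ S ↔ ∃ Q ∈ QdN d N, t (cmPointC Q) = s) {f p : ℂ → ℂ}
    (hf : ∀ z : ℂ, 0 < z.im → f z = ∑ e ∈ N.divisors, p (mu γ κ e (t z))) {pt : ℂ → ℂ}
    (hpt : ∀ s ∈ S, 0 < (pt s).im ∧ t (pt s) = s) :
    classTrace (FrickeGroup N) f (QdN d N) = ∑ s ∈ S, p s / mo t (pt s) := by
  classical
  have hmemdvd : ∀ {e}, e ∈ N.divisors → e ∣ N := fun he => Nat.dvd_of_mem_divisors he
  have hrel : ∀ Q Q' : QdN d N, formRel (FrickeGroup N) (QdN d N) Q Q' ↔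
      ∃ e ∈ N.divisors, t (cmPointC Q.1) = mu γ κ e (t (cmPointC Q'.1)) := by
    intro Q Q'
    obtain ⟨hP, hPd⟩ := PD_of_mem hd Q.2
    obtain ⟨hP', hPd'⟩ := PD_of_mem hd Q'.2
    constructor
    · rintro ⟨g, hg, hQ⟩
      obtain ⟨e, he, A, hA, hgA⟩ := (mem_fricke_iff h.sqf).1 hg
      refine ⟨e, Nat.mem_divisors.2 ⟨he, h.sqf.ne_zero⟩, ?_⟩
      rw [(hP.act_eq_iff hP' (hPd.trans hPd'.symm) g.2 (AL_det_pos (h.pos he) hA) hgA).1 hQ,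
        h.apply_al he hA hP'.im_cmPointC]
    · rintro ⟨e, he, hQ⟩
      have he := hmemdvd he
      obtain ⟨A, hA⟩ := AL_nonempty h.sqf he
      have hAd := AL_det_pos (h.pos he) hA
      rw [← h.apply_al he hA hP'.im_cmPointC] at hQ
      obtain ⟨G, hG, hGz⟩ := h.injective (im_mb_pos hAd hP'.im_cmPointC) hP.im_cmPointC hQ.symm
      have hGA := G0_mul_AL he hG hA
      refine ⟨⟨scl e (G * A), det_scl (h.pos he) hGA⟩,
        (mem_fricke_iff h.sqf).2 ⟨e, he, _, hGA, rfl⟩, ?_⟩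
      refine (hP.act_eq_iff hP' (hPd.trans hPd'.symm) (det_scl (h.pos he) hGA)
        (AL_det_pos (h.pos he) hGA) rfl).2 ?_
      rw [mb_mul _ (den_ne_zero hAd hP'.im_cmPointC), hGz]
  have hequiv : Equivalence (formRel (FrickeGroup N) (QdN d N)) := by
    refine ⟨fun Q => (hrel _ _).2 ⟨1, by simp [h.sqf.ne_zero], by rw [mu_one]⟩, ?_, ?_⟩
    · intro Q Q' hQ
      obtain ⟨e, he, hQ⟩ := (hrel _ _).1 hQ
      refine (hrel _ _).2 ⟨e, he, ?_⟩
      rw [hQ, h.mu_mu (hmemdvd he) (hmemdvd he) (PD_of_mem hd Q'.2).1.im_cmPointC,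
        st_self (h.pos (hmemdvd he)), mu_one]
    · intro Q Q' Q'' hQ hQ'
      obtain ⟨e, he, hQ⟩ := (hrel _ _).1 hQ
      obtain ⟨f, hf, hQ'⟩ := (hrel _ _).1 hQ'
      refine (hrel _ _).2 ⟨st e f, Nat.mem_divisors.2
        ⟨st_dvd (h.pos (hmemdvd he)) (hmemdvd he) (hmemdvd hf), h.sqf.ne_zero⟩, ?_⟩
      rw [hQ, hQ', h.mu_mu (hmemdvd he) (hmemdvd hf) (PD_of_mem hd Q''.2).1.im_cmPointC]
  have hquot : ∀ Q Q' : QdN d N, Quot.mk (formRel (FrickeGroup N) (QdN d N)) Q = Quot.mk _ Q' ↔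
      ∃ e ∈ N.divisors, t (cmPointC Q.1) = mu γ κ e (t (cmPointC Q'.1)) := by
    intro Q Q'
    rw [← hrel]
    exact ⟨fun h1 => hequiv.eqvGen_iff.1 (Quot.eqvGen_exact h1), fun h1 => Quot.sound h1⟩
  have h1N : 1 ∈ N.divisors := by simp [h.sqf.ne_zero]
  choose frm hfrm hfrmt using fun s : S => (hS s.1).1 s.2
  let cls : S → Quot (formRel (FrickeGroup N) (QdN d N)) := fun s => Quot.mk _ ⟨frm s, hfrm s⟩
  have hcls : Function.Surjective cls := by
    intro O
    obtain ⟨Q, rfl⟩ := Quot.exists_rep O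
    refine ⟨⟨t (cmPointC Q.1), (hS _).2 ⟨Q.1, Q.2, rfl⟩⟩, ?_⟩
    exact (hquot _ _).2 ⟨1, h1N, by rw [mu_one]; exact hfrmt _⟩
  have : Finite (Quot (formRel (FrickeGroup N) (QdN d N))) := Finite.of_surjective cls hcls
  have := Fintype.ofFinite (Quot (formRel (FrickeGroup N) (QdN d N)))
  rw [classTrace, finsum_eq_sum_of_fintype, ← Finset.sum_coe_sort S fun s => p s / mo t (pt s),
    ← Finset.sum_fiberwise Finset.univ cls]
  refine Finset.sum_congr rfl fun O _ => ?_
  set Q := Quot.out O with hQ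
  have hOQ : O = Quot.mk _ Q := (Quot.out_eq O).symm
  have hz := (PD_of_mem hd Q.2).1.im_cmPointC
  set z := cmPointC Q.1 with hzd
  have horb : ∀ e ∈ N.divisors, mu γ κ e (t z) ∈ S := by
    intro e he
    have heN := hmemdvd he
    obtain ⟨A, hA⟩ := AL_nonempty h.sqf heN
    have hAd := AL_det_pos (h.pos heN) hA
    have hAd' := AL_det_pos (h.pos heN) (AL_adj hA)
    have hmem := form_act hd (h.pos heN) heN (AL_adj hA) Q.2
    have hcm := (PD_of_mem hd Q.2).1.cmPointC_act (det_scl (h.pos heN) (AL_adj hA)) hAd' rfl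
    change z = mb A.adjugate (cmPointC ((scl e A.adjugate)ᵀ * Q.1 * scl e A.adjugate)) at hcm
    have hval : t (cmPointC ((scl e A.adjugate)ᵀ * Q.1 * scl e A.adjugate)) = mu γ κ e (t z) := by
      rw [← h.apply_al heN hA hz, hcm, mb_mb_adj hAd (PD_of_mem hd hmem).1.im_cmPointC]
    exact (hS (mu γ κ e (t z))).2 ⟨_, hmem, hval⟩
  have hsum : ∑ s : S with cls s = O, p s.1 / mo t (pt s.1) =
      ∑ s ∈ N.divisors.image fun e => mu γ κ e (t z), p s / mo t (pt s) := by
    refine Finset.sum_nbij (fun s => s.1) ?_ ?_ ?_ fun _ _ => rfl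
    · intro s hs
      have h1 := (Finset.mem_filter.1 hs).2
      rw [hOQ] at h1
      obtain ⟨e, he, h2⟩ := (hquot _ _).1 h1
      exact Finset.mem_image.2 ⟨e, he, h2.symm.trans (hfrmt s)⟩
    · intro s _ s' _ hss
      exact Subtype.ext hss
    · intro s hs
      obtain ⟨e, he, rfl⟩ := Finset.mem_image.1 hs
      have hsS := horb e he
      refine ⟨⟨_, hsS⟩, ?_, rfl⟩
      rw [Finset.coe_filter]
      refine ⟨Finset.mem_univ _, ?_⟩
      rw [hOQ]
      exact (hquot _ _).2 ⟨e, he, hfrmt _⟩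
  have hmo : ∀ s ∈ N.divisors.image fun e => mu γ κ e (t z), p s / mo t (pt s) = p s / mo t z := by
    intro s hs
    obtain ⟨e, he, rfl⟩ := Finset.mem_image.1 hs
    have heN := hmemdvd he
    obtain ⟨A, hA⟩ := AL_nonempty h.sqf heN
    have hAd := AL_det_pos (h.pos heN) hA
    obtain ⟨h1, h2⟩ := hpt _ (horb e he)
    rw [← h.apply_al heN hA hz] at h1 h2 ⊢
    obtain ⟨G, hG, hGz⟩ := h.injective (im_mb_pos hAd hz) h1 h2.symm
    rw [← hGz, h.mo_mb (one_dvd N) (AL_one ▸ hG) (im_mb_pos hAd hz), h.mo_mb heN hA hz]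
  have hne : ((fixDiv N γ κ (t z)).card : ℂ) ≠ 0 := by
    have : 1 ∈ fixDiv N γ κ (t z) := Finset.mem_filter.2 ⟨h1N, mu_one _⟩
    exact_mod_cast (Finset.card_pos.2 ⟨1, this⟩).ne'
  rw [hsum, Finset.sum_congr rfl hmo, ← Finset.sum_div, h.stabOrder_eq hd Q.2, hf z hz,
    h.sum_orbit hst hz p]
  push_cast
  rw [mul_comm (mo t z : ℂ), mul_div_mul_left _ _ hne]

end FrickeTrace

namespace FrickeTrace

open Filter Topology
open UpperHalfPlane (upperHalfPlaneSet isOpen_upperHalfPlaneSet)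

variable {N : ℕ} {t v : ℂ → ℂ} {γ κ : ℕ → ℂ}

lemma Haupt.finite_fix (h : Haupt N t v γ κ) {n : ℕ} (hn : n ≠ 0) :
    {s : ℂ | ∃ z : ℂ, 0 < z.im ∧ (fixIx N n z \ six N n).Nonempty ∧ t z = s}.Finite := by
  obtain ⟨m₁, β, h1, -⟩ := h.le_heck hn
  obtain ⟨k, R, hR, hFR⟩ := h.exists_poly (F := heck N n t)
    (fun z hz => (h.analyticAt_heck hn hz).differentiableAt.differentiableWithinAt)
    (fun M hM z hz => h.heck_inv hn hM hz) h1.od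
    (fun e he => by
      obtain ⟨A, hA⟩ := AL_nonempty h.sqf (h.mem_cus.1 he).1
      exact ⟨A, hA, h.od_heck hn h1.od (h.mem_cus.1 he).1 (h.mem_cus.1 he).2 hA⟩)
  refine (R.roots.toFinset.finite_toSet).subset ?_
  rintro s ⟨z, hz, hne, rfl⟩
  have h0 : heck N n t z = 0 := by
    apply (h.analyticAt_heck hn hz).analyticOrderAt_ne_zero.1
    rw [h.order_heck hn hz, Nat.cast_ne_zero]
    exact mul_ne_zero (h.mo_ne_zero hz) (Finset.card_ne_zero.2 hne)
  have := hFR z hz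
  rw [h0, zero_mul] at this
  simp [hR, ← this]

lemma Haupt.finite_mo (h : Haupt N t v γ κ) :
    {s : ℂ | ∃ z : ℂ, 0 < z.im ∧ mo t z ≠ 1 ∧ t z = s}.Finite := by
  obtain ⟨k, R, hR, hFR⟩ := h.exists_poly (F := xi t)
    (fun z hz => (h.analyticAt_xi hz).differentiableAt.differentiableWithinAt)
    (fun M hM z hz => h.xi_inv hM hz) h.le_xi.od
    (fun e he => by
      obtain ⟨A, hA⟩ := AL_nonempty h.sqf (h.mem_cus.1 he).1
      exact ⟨A, hA, h.od_xi (h.mem_cus.1 he).1 (h.mem_cus.1 he).2 hA⟩)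
  refine (R.roots.toFinset.finite_toSet).subset ?_
  rintro s ⟨z, hz, hne, rfl⟩
  have h0 : xi t z = 0 := by
    apply (h.analyticAt_xi hz).analyticOrderAt_ne_zero.1
    rw [h.order_xi hz, Nat.cast_ne_zero]
    have := h.mo_ne_zero hz
    omega
  have := hFR z hz
  rw [h0, zero_mul] at this
  simp [hR, ← this]

lemma mb_eq_self_iff {M : IM} (hM : 0 < M.det) {z : ℂ} (hz : 0 < z.im) :
    mb M z = z ↔ (M 1 0 : ℂ) * z ^ 2 + (M 1 1 - M 0 0) * z - M 0 1 = 0 := by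
  rw [mb, div_eq_iff (den_ne_zero hM hz), den, ← sub_eq_zero, ← neg_eq_zero]
  ring_nf

/-- Matrices of determinant `n` fixing `z` with positive lower left entry. -/
def posFix (N n : ℕ) (z : ℂ) : Set IM := {M | M ∈ Dl N n ∧ mb M z = z ∧ 0 < M 1 0}

lemma ncard_scalar_fix {n : ℕ} (hn : n ≠ 0) {z : ℂ} (hz : 0 < z.im) :
    {M : IM | M ∈ Dl N n ∧ mb M z = z ∧ M 1 0 = 0}.ncard = 2 * sqi n := by
  have hset : ∀ M : IM, (M ∈ Dl N n ∧ mb M z = z ∧ M 1 0 = 0) ↔ ∃ k : ℤ, k * k = n ∧ M = k • 1 := by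
    intro M
    constructor
    · rintro ⟨hM, hf, h0⟩
      rw [mb_eq_self_iff (Dl_det_pos hn hM) hz, h0] at hf
      have him := congrArg Complex.im hf
      have h1 : M 1 1 = M 0 0 := by
        have : ((M 1 1 : ℝ) - M 0 0) * z.im = 0 := by simpa using him
        have := (mul_eq_zero.1 this).resolve_right hz.ne'
        exact_mod_cast sub_eq_zero.1 this
      have h2 : M 0 1 = 0 := by
        rw [h1] at hf
        simpa using hf
      refine ⟨M 0 0, ?_, ?_⟩
      · have := hM.1
        rw [Matrix.det_fin_two, h0, h1] at this
        simpa using this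
      · ext i j
        fin_cases i <;> fin_cases j <;> simp [h0, h1, h2]
    · rintro ⟨k, hk, rfl⟩
      have hk0 : k ≠ 0 := by
        rintro rfl
        simp at hk
        omega
      refine ⟨⟨?_, ?_⟩, ?_, ?_⟩
      · rw [Matrix.det_smul]
        simp [← hk, sq]
      · simp
      · rw [mb_smul hk0, mb_one]
      · simp
  rw [sqi]
  split_ifs with hsq
  · obtain ⟨m, hm⟩ := hsq
    have hm0 : (m : ℤ) ≠ 0 := by
      rintro h0
      have : m = 0 := by exact_mod_cast h0
      simp [this] at hm
      exact hn hm
    have : {M : IM | M ∈ Dl N n ∧ mb M z = z ∧ M 1 0 = 0} = {(m : ℤ) • 1, (-m : ℤ) • 1} := by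
      ext M
      simp only [Set.mem_ofPred_eq, hset, Set.mem_insert_iff, Set.mem_singleton_iff]
      constructor
      · rintro ⟨k, hk, rfl⟩
        have : k * k = (m : ℤ) * m := by rw [hk, hm]; push_cast; rfl
        rcases mul_self_eq_mul_self_iff.1 this with rfl | rfl
        · exact Or.inl rfl
        · exact Or.inr rfl
      · rintro (rfl | rfl)
        · exact ⟨m, by rw [hm]; push_cast; rfl, rfl⟩
        · exact ⟨-m, by rw [hm]; push_cast; ring, rfl⟩
    rw [this, Set.ncard_pair]
    intro heq
    have := congrFun (congrFun heq 0) 0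
    rw [Matrix.smul_apply, Matrix.smul_apply, Matrix.one_apply_eq, smul_eq_mul, smul_eq_mul] at this
    omega
  · have : {M : IM | M ∈ Dl N n ∧ mb M z = z ∧ M 1 0 = 0} = ∅ := by
      ext M
      simp only [Set.mem_ofPred_eq, hset, Set.mem_empty_iff_false, iff_false]
      rintro ⟨k, hk, -⟩
      refine hsq ⟨k.natAbs, ?_⟩
      zify
      rw [abs_mul_abs_self, hk]
    rw [this, Set.ncard_empty]

lemma Haupt.ncard_posFix (h : Haupt N t v γ κ) {n : ℕ} (hn : n ≠ 0) {z : ℂ} (hz : 0 < z.im) :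
    (posFix N n z).Finite ∧ (posFix N n z).ncard + sqi n =
      mo t z * ((fixIx N n z \ six N n).card + sqi n) := by
  obtain ⟨h1, h2⟩ := h.ncard_fix hn hz
  rw [h.card_fixIx hn] at h2
  have hp : (posFix N n z).Finite := h1.subset fun M hM => ⟨hM.1, hM.2.1⟩
  have h0 : {M : IM | M ∈ Dl N n ∧ mb M z = z ∧ M 1 0 = 0}.Finite := h1.subset fun M hM => ⟨hM.1, hM.2.1⟩
  have hneg : ∀ M : IM, M ∈ Dl N n ∧ mb M z = z → -M ∈ Dl N n ∧ mb (-M) z = z := by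
    rintro M ⟨hM, hf⟩
    refine ⟨⟨?_, ?_⟩, by rw [mb_neg, hf]⟩
    · rw [← hM.1, Matrix.det_neg]
      simp
    · simpa using hM.2
  have hu : {M : IM | M ∈ Dl N n ∧ mb M z = z} = posFix N n z ∪ ((fun M => -M) '' posFix N n z ∪
      {M : IM | M ∈ Dl N n ∧ mb M z = z ∧ M 1 0 = 0}) := by
    ext M
    constructor
    · intro hM
      rcases lt_trichotomy (M 1 0) 0 with hl | hl | hl
      · exact Or.inr (Or.inl ⟨-M, ⟨(hneg M hM).1, (hneg M hM).2, by simpa using hl⟩, neg_neg M⟩)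
      · exact Or.inr (Or.inr ⟨hM.1, hM.2, hl⟩)
      · exact Or.inl ⟨hM.1, hM.2, hl⟩
    · rintro (hM | ⟨M', hM', rfl⟩ | hM)
      · exact ⟨hM.1, hM.2.1⟩
      · exact hneg M' ⟨hM'.1, hM'.2.1⟩
      · exact ⟨hM.1, hM.2.1⟩
  have hd1 : Disjoint ((fun M => -M) '' posFix N n z) {M : IM | M ∈ Dl N n ∧ mb M z = z ∧ M 1 0 = 0} := by
    rw [Set.disjoint_left]
    rintro _ ⟨M, hM, rfl⟩ hM'
    have h3 := hM.2.2
    have h4 : (-M) 1 0 = 0 := hM'.2.2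
    rw [Matrix.neg_apply] at h4
    omega
  have hd2 : Disjoint (posFix N n z) ((fun M => -M) '' posFix N n z ∪
      {M : IM | M ∈ Dl N n ∧ mb M z = z ∧ M 1 0 = 0}) := by
    rw [Set.disjoint_left]
    rintro M hM (⟨M', hM', rfl⟩ | hM')
    · have h3 := hM'.2.2
      have h4 : 0 < (-M') 1 0 := hM.2.2
      rw [Matrix.neg_apply] at h4
      omega
    · have h3 := hM.2.2
      have h4 := hM'.2.2
      omega
  refine ⟨hp, ?_⟩
  rw [hu, Set.ncard_union_eq hd2 hp ((hp.image _).union h0), Set.ncard_union_eq hd1 (hp.image _) h0,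
    Set.ncard_image_of_injective _ neg_injective, ncard_scalar_fix hn hz] at h2
  have : 2 * ((posFix N n z).ncard + sqi n) = 2 * (mo t z * ((fixIx N n z \ six N n).card + sqi n)) := by
    linarith
  exact Nat.eq_of_mul_eq_mul_left two_pos this

/-- Forms of discriminant `r² - 4n` with a given root correspond to matrices of trace `r`. -/
lemma exists_form_iff {n : ℕ} (hn : n ≠ 0) {z : ℂ} (hz : 0 < z.im) (r : ℤ) :
    (0 < 4 * (n : ℤ) - r ^ 2 ∧ ∃ Q ∈ QdN (4 * n - r ^ 2) N, cmPointC Q = z) ↔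
      ∃ M ∈ posFix N n z, M 0 0 + M 1 1 = r := by
  constructor
  · rintro ⟨hd, Q, hQ, hQz⟩
    have hPD := (PD_of_mem hd hQ).1
    obtain ⟨a, b, c, rfl, ha, hb, hNa⟩ := hQ
    have hpar : Even (r - b) := by
      have : Even (r ^ 2 - b ^ 2) := ⟨2 * n - 2 * a * c, by linarith⟩
      rw [Int.even_sub, Int.even_pow' two_ne_zero, Int.even_pow' two_ne_zero] at this
      rwa [Int.even_sub]
    obtain ⟨k, hk⟩ := hpar
    have hM : (!![k, -c; a, k + b] : IM) ∈ Dl N n := by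
      refine ⟨?_, by simpa using hNa⟩
      rw [Matrix.det_fin_two_of]
      have : r = b + 2 * k := by linarith
      rw [this] at hb
      linarith
    refine ⟨!![k, -c; a, k + b], ⟨hM, ?_, by simpa using ha⟩, by simp; linarith⟩
    rw [mb_eq_self_iff (Dl_det_pos hn hM) hz]
    have := (hPD.eq_cmPointC_iff hz).1 hQz.symm
    simp [formMat] at this ⊢
    linear_combination this
  · rintro ⟨M, ⟨hM, hf, hpos⟩, rfl⟩
    rw [mb_eq_self_iff (Dl_det_pos hn hM) hz] at hf
    have hdet := hM.1
    rw [Matrix.det_fin_two] at hdet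
    have hd : 0 < 4 * (n : ℤ) - (M 0 0 + M 1 1) ^ 2 := by
      have hre := congrArg Complex.re hf
      have him := congrArg Complex.im hf
      simp [sq] at hre him
      have hp : (0 : ℝ) < M 1 0 := by exact_mod_cast hpos
      have h1 : 2 * (M 1 0 : ℝ) * z.re + (M 1 1 - M 0 0) = 0 := by
        have : (2 * (M 1 0 : ℝ) * z.re + (M 1 1 - M 0 0)) * z.im = 0 := by linarith
        exact (mul_eq_zero.1 this).resolve_right hz.ne'
      have h2 : (0 : ℝ) < 4 * n - (M 0 0 + M 1 1) ^ 2 := by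
        have h3 : (n : ℝ) = M 0 0 * M 1 1 - M 0 1 * M 1 0 := by exact_mod_cast hdet.symm
        have h4 : (4 * n - (M 0 0 + M 1 1) ^ 2 : ℝ) = (2 * M 1 0 * z.im) ^ 2 := by
          rw [h3]
          have h5 : (M 1 1 : ℝ) - M 0 0 = -2 * M 1 0 * z.re := by linarith
          have h6 : (M 0 1 : ℝ) = M 1 0 * (z.re * z.re - z.im * z.im) + (M 1 1 - M 0 0) * z.re := by linarith
          have h7 : (4 * (M 0 0 * M 1 1 - M 0 1 * M 1 0) - (M 0 0 + M 1 1) ^ 2 : ℝ) =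
            -(M 1 1 - M 0 0) ^ 2 - 4 * M 0 1 * M 1 0 := by ring
          rw [h7, h6, h5]
          ring
        rw [h4]
        positivity
      exact_mod_cast h2
    have hQ : formMat (M 1 0) (M 1 1 - M 0 0) (-M 0 1) ∈ QdN (4 * n - (M 0 0 + M 1 1) ^ 2) N :=
      ⟨_, _, _, rfl, hpos, by rw [← hdet]; ring, hM.2⟩
    refine ⟨hd, _, hQ, ?_⟩
    symm
    rw [(PD_of_mem hd hQ).1.eq_cmPointC_iff hz]
    simp [formMat]
    linear_combination hf

lemma trace_injOn {n : ℕ} (hn : n ≠ 0) {z : ℂ} (hz : 0 < z.im) :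
    Set.InjOn (fun M : IM => M 0 0 + M 1 1) (posFix N n z) := by
  rintro M ⟨hM, hf, hp⟩ M' ⟨hM', hf', hp'⟩ htr
  have htr : M 0 0 + M 1 1 = M' 0 0 + M' 1 1 := htr
  rw [mb_eq_self_iff (Dl_det_pos hn hM) hz] at hf
  rw [mb_eq_self_iff (Dl_det_pos hn hM') hz] at hf'
  have key : ∀ M : IM, M ∈ Dl N n → (M 1 0 : ℂ) * z ^ 2 + (M 1 1 - M 0 0) * z - M 0 1 = 0 →
      (M 1 1 : ℝ) - M 0 0 = -(2 * M 1 0 * z.re) ∧ (M 0 1 : ℝ) = -(M 1 0 * (z.re ^ 2 + z.im ^ 2)) ∧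
      (2 * M 1 0 * z.im) ^ 2 = 4 * n - ((M 0 0 + M 1 1 : ℤ) : ℝ) ^ 2 := by
    intro M hM hf
    have hre := congrArg Complex.re hf
    have him := congrArg Complex.im hf
    simp [sq] at hre him
    have h1 : 2 * (M 1 0 : ℝ) * z.re + (M 1 1 - M 0 0) = 0 := by
      have : (2 * (M 1 0 : ℝ) * z.re + (M 1 1 - M 0 0)) * z.im = 0 := by linarith
      exact (mul_eq_zero.1 this).resolve_right hz.ne'
    have h5 : (M 1 1 : ℝ) - M 0 0 = -(2 * M 1 0 * z.re) := by linarith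
    have h6 : (M 0 1 : ℝ) = -(M 1 0 * (z.re ^ 2 + z.im ^ 2)) := by
      rw [h5] at hre
      linarith
    refine ⟨h5, h6, ?_⟩
    have hdet := hM.1
    rw [Matrix.det_fin_two] at hdet
    have h3 : (n : ℝ) = M 0 0 * M 1 1 - M 0 1 * M 1 0 := by exact_mod_cast hdet.symm
    have h7 : (4 * (M 0 0 * M 1 1 - M 0 1 * M 1 0) - ((M 0 0 + M 1 1 : ℤ) : ℝ) ^ 2 : ℝ) =
            -(M 1 1 - M 0 0) ^ 2 - 4 * M 0 1 * M 1 0 := by push_cast; ring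
    rw [h3, h7, h6, h5]
    ring
  obtain ⟨a1, a2, a3⟩ := key M hM hf
  obtain ⟨b1, b2, b3⟩ := key M' hM' hf'
  have hp : (0 : ℝ) < M 1 0 := by exact_mod_cast hp
  have hp' : (0 : ℝ) < M' 1 0 := by exact_mod_cast hp'
  have h1 : (M 1 0 : ℝ) = M' 1 0 := by
    have h2 : (2 * M 1 0 * z.im) ^ 2 = (2 * M' 1 0 * z.im : ℝ) ^ 2 := by rw [a3, b3, htr]
    have h3 := (pow_left_inj₀ (by positivity) (by positivity) two_ne_zero).1 h2
    have h4 := mul_right_cancel₀ hz.ne' h3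
    linarith
  have h2 : (M 0 1 : ℝ) = M' 0 1 := by rw [a2, b2, h1]
  have h3 : (M 1 1 : ℝ) - M 0 0 = M' 1 1 - M' 0 0 := by rw [a1, b1, h1]
  have h1' : M 1 0 = M' 1 0 := by exact_mod_cast h1
  have h2' : M 0 1 = M' 0 1 := by exact_mod_cast h2
  have h3' : M 1 1 - M 0 0 = M' 1 1 - M' 0 0 := by exact_mod_cast h3
  ext i j
  fin_cases i <;> fin_cases j <;> simp [h1', h2'] <;> omega

end FrickeTrace

namespace FrickeTrace

open Filter Topology
open UpperHalfPlane (upperHalfPlaneSet isOpen_upperHalfPlaneSet)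

variable {N : ℕ} {t v : ℂ → ℂ} {γ κ : ℕ → ℂ}

lemma Haupt.exists_form_at (h : Haupt N t v γ κ) {d : ℤ} (hd : 0 < d) {Q : Matrix (Fin 2) (Fin 2) ℝ}
    (hQ : Q ∈ QdN d N) {z : ℂ} (hz : 0 < z.im) (hQz : t (cmPointC Q) = t z) :
    ∃ Q' ∈ QdN d N, cmPointC Q' = z := by
  have hP := (PD_of_mem hd hQ).1
  obtain ⟨G, hG, hGz⟩ := h.injective hP.im_cmPointC hz hQz
  rw [← AL_one] at hG
  have hGa := AL_adj hG
  have hmem := form_act hd one_ne_zero (one_dvd N) hGa hQ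
  have hcm := hP.cmPointC_act (det_scl one_ne_zero hGa) (AL_det_pos one_ne_zero hGa) rfl
  refine ⟨_, hmem, ?_⟩
  rw [← hGz, hcm, mb_mb_adj (AL_det_pos one_ne_zero hG) (PD_of_mem hd hmem).1.im_cmPointC]

/-- The traces of elliptic elements of determinant `n`. -/
noncomputable def ellTr (n : ℕ) : Finset ℤ := (Finset.Icc (-(2 * n : ℤ)) (2 * n)).filter fun r => 0 < 4 * (n : ℤ) - r ^ 2

lemma mem_ellTr {n : ℕ} {r : ℤ} : r ∈ ellTr n ↔ 0 < 4 * (n : ℤ) - r ^ 2 := by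
  rw [ellTr, Finset.mem_filter, Finset.mem_Icc, and_iff_right_iff_imp]
  intro h
  constructor <;> nlinarith

lemma Haupt.trace_sum (h : Haupt N t v γ κ)
    (hst : ∀ e ∈ N.divisors, ∀ f ∈ N.divisors, st f (st f e) = e) {n : ℕ} (hn : n ≠ 0) {f p : ℂ → ℂ}
    (hf : ∀ z : ℂ, 0 < z.im → f z = ∑ e ∈ N.divisors, p (mu γ κ e (t z))) :
    ∃ (T : Finset ℂ) (pt : ℂ → ℂ), (∀ s ∈ T, 0 < (pt s).im ∧ t (pt s) = s) ∧
      (∀ z : ℂ, 0 < z.im → (fixIx N n z \ six N n).Nonempty → t z ∈ T) ∧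
      (∀ z : ℂ, 0 < z.im → mo t z ≠ 1 → t z ∈ T) ∧
      ∑ r ∈ ellTr n, classTrace (FrickeGroup N) f (QdN (4 * n - r ^ 2) N) =
        ∑ s ∈ T, ((fixIx N n (pt s) \ six N n).card : ℂ) * p s +
          sqi n * ∑ s ∈ T, ((mo t (pt s) : ℂ) - 1) / mo t (pt s) * p s := by
  classical
  have hfin := (h.finite_fix hn).union h.finite_mo
  set T := hfin.toFinset with hTdef
  have hT1 : ∀ z : ℂ, 0 < z.im → (fixIx N n z \ six N n).Nonempty → t z ∈ T := fun z hz h1 =>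
    hfin.mem_toFinset.2 (Or.inl ⟨z, hz, h1, rfl⟩)
  have hT2 : ∀ z : ℂ, 0 < z.im → mo t z ≠ 1 → t z ∈ T := fun z hz h1 =>
    hfin.mem_toFinset.2 (Or.inr ⟨z, hz, h1, rfl⟩)
  have hex : ∀ s ∈ T, ∃ z : ℂ, 0 < z.im ∧ t z = s := by
    intro s hs
    rcases hfin.mem_toFinset.1 hs with ⟨z, hz, -, hs⟩ | ⟨z, hz, -, hs⟩ <;> exact ⟨z, hz, hs⟩
  choose! pt hpt using hex
  refine ⟨T, pt, hpt, hT1, hT2, ?_⟩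
  have hS : ∀ r ∈ ellTr n, ∀ s, s ∈ T.filter (fun s => ∃ Q ∈ QdN (4 * n - r ^ 2) N, t (cmPointC Q) = s) ↔
      ∃ Q ∈ QdN (4 * n - r ^ 2) N, t (cmPointC Q) = s := by
    intro r hr s
    rw [Finset.mem_filter, and_iff_right_iff_imp]
    rintro ⟨Q, hQ, rfl⟩
    have hz := (PD_of_mem (mem_ellTr.1 hr) hQ).1.im_cmPointC
    obtain ⟨M, hM, -⟩ := (exists_form_iff hn hz r).1 ⟨mem_ellTr.1 hr, Q, hQ, rfl⟩
    obtain ⟨h1, h2⟩ := h.ncard_posFix hn hz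
    have h3 : 0 < (posFix N n (cmPointC Q)).ncard := (Set.ncard_pos h1).2 ⟨M, hM⟩
    by_cases hcl : (fixIx N n (cmPointC Q) \ six N n).Nonempty
    · exact hT1 _ hz hcl
    · refine hT2 _ hz fun h4 => ?_
      rw [Finset.not_nonempty_iff_eq_empty.1 hcl, h4, Finset.card_empty] at h2
      omega
  have hcount : ∀ s ∈ T, ((ellTr n).filter fun r : ℤ => ∃ Q ∈ QdN (4 * n - r ^ 2) N, t (cmPointC Q) = s).card =
      (posFix N n (pt s)).ncard := by
    intro s hs
    obtain ⟨hz, hts⟩ := hpt s hs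
    have himg : (((ellTr n).filter fun r : ℤ => ∃ Q ∈ QdN (4 * n - r ^ 2) N, t (cmPointC Q) = s : Finset ℤ) :
        Set ℤ) = (fun M : IM => M 0 0 + M 1 1) '' posFix N n (pt s) := by
      ext r
      have h1 := exists_form_iff (N := N) hn hz r
      rw [Finset.coe_filter, Set.mem_ofPred_eq, mem_ellTr]
      constructor
      · rintro ⟨hr, Q, hQ, hQs⟩
        obtain ⟨Q', hQ', hz'⟩ := h.exists_form_at hr hQ hz (hQs.trans hts.symm)
        exact h1.1 ⟨hr, Q', hQ', hz'⟩
      · intro hM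
        obtain ⟨hr, Q, hQ, hQz⟩ := h1.2 hM
        exact ⟨hr, Q, hQ, by rw [hQz, hts]⟩
    rw [← Set.ncard_coe_finset, himg, (trace_injOn hn hz).ncard_image]
  have h1 : ∀ r ∈ ellTr n, classTrace (FrickeGroup N) f (QdN (4 * n - r ^ 2) N) =
      ∑ s ∈ T, if ∃ Q ∈ QdN (4 * n - r ^ 2) N, t (cmPointC Q) = s then p s / mo t (pt s) else 0 := by
    intro r hr
    rw [h.classTrace_eq hst (mem_ellTr.1 hr) (hS r hr) hf fun s hs => hpt s (Finset.mem_of_mem_filter s hs),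
      Finset.sum_filter]
  rw [Finset.sum_congr rfl h1, Finset.sum_comm, Finset.mul_sum, ← Finset.sum_add_distrib]
  refine Finset.sum_congr rfl fun s hs => ?_
  rw [← Finset.sum_filter, Finset.sum_const, hcount s hs, nsmul_eq_mul]
  have hm : (mo t (pt s) : ℂ) ≠ 0 := by exact_mod_cast h.mo_ne_zero (hpt s hs).1
  have h2 : ((posFix N n (pt s)).ncard : ℂ) + sqi n =
      mo t (pt s) * ((fixIx N n (pt s) \ six N n).card + sqi n) := by
    exact_mod_cast (h.ncard_posFix hn (hpt s hs).1).2
  rw [eq_sub_of_add_eq h2]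
  field_simp
  ring

lemma Haupt.trace_formula (h : Haupt N t v γ κ)
    (hst : ∀ e ∈ N.divisors, ∀ f ∈ N.divisors, st f (st f e) = e) {n : ℕ} (hn : n ≠ 0) {f : ℂ → ℂ} {c t₀ : ℂ}
    (hc : c * (cus N).card + c = ∑ e ∈ cus N, pv v (γ e))
    (hf : ∀ z : ℂ, 0 < z.im → f z = ∑ e ∈ N.divisors, (pv v (mu γ κ e (t z)) - c))
    (ht₀ : ∑ e ∈ cus N, e * (pv v (γ e) - c) - c = 72 - 12 * t₀) :
    ∑ r ∈ ellTr n, classTrace (FrickeGroup N) f (QdN (4 * n - r ^ 2) N) =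
      2 * n * cf v n + ∑ p ∈ n.divisorsAntidiagonal, dlt (p.1 - p.2 + (p.2 - p.1)) +
      ∑ e ∈ cus N, sg n e * (2 * (pv v (γ e) - c)) - 2 * c * sg n 1 - 2 * t₀ * sqi n := by
  obtain ⟨T, pt, hpt, hT1, hT2, h1⟩ := h.trace_sum hst hn (p := fun s => pv v s - c) hf
  have h2 := h.divisor_xi hpt hT2 c hc
  rw [h1, h.divisor_heck hn hpt hT1 c hc]
  rw [ht₀] at h2
  linear_combination (sqi n / 6 : ℂ) * h2

end FrickeTrace

namespace FrickeTrace

open Filter Topology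
open UpperHalfPlane (upperHalfPlaneSet isOpen_upperHalfPlaneSet)

variable {N : ℕ} {t v : ℂ → ℂ} {γ κ : ℕ → ℂ}

/-- The value at zero of the modular trace. -/
noncomputable def tZero (N : ℕ) : ℂ := if N = 2 then 5 else if N = 6 ∨ N = 10 then 5 / 2 else 3

/-- An interval containing all traces with a nonzero contribution. -/
noncomputable def allTr (n : ℕ) : Finset ℤ := Finset.Icc (-(2 * n + 2 : ℤ)) (2 * n + 2)

lemma mem_allTr {n : ℕ} {r : ℤ} (h : r ^ 2 ≤ 4 * n + 4) : r ∈ allTr n := by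
  rw [allTr, Finset.mem_Icc]
  constructor <;> nlinarith

lemma card_sq_eq {n : ℕ} (hn : n ≠ 0) {k : ℕ} (hk : 0 < k) (hk2 : k ≤ 2) :
    ((allTr n).filter fun r => r ^ 2 = 4 * (n : ℤ) + k ^ 2).card =
      (n.divisorsAntidiagonal.filter fun p => p.1 - p.2 + (p.2 - p.1) = k).card := by
  symm
  refine Finset.card_nbij (fun p => if p.2 < p.1 then (p.1 + p.2 : ℤ) else -(p.1 + p.2)) ?_ ?_ ?_
  · rintro ⟨a, b⟩ hp
    simp only [Finset.coe_filter, Set.mem_ofPred_eq, Nat.mem_divisorsAntidiagonal] at hp ⊢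
    obtain ⟨⟨hab, -⟩, hd⟩ := hp
    have h1 : ((a : ℤ) - b) ^ 2 = (k : ℤ) ^ 2 := by
      rw [sq_eq_sq_iff_eq_or_eq_neg]
      omega
    have h2 : (if b < a then (a + b : ℤ) else -(a + b)) ^ 2 = 4 * (n : ℤ) + k ^ 2 := by
      rw [← h1, ← hab]
      push_cast
      split_ifs <;> ring
    refine ⟨mem_allTr ?_, h2⟩
    rw [h2]
    have : (k : ℤ) ≤ 2 := by exact_mod_cast hk2
    nlinarith
  · rintro ⟨a, b⟩ hp ⟨a', b'⟩ hp' heq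
    simp only [Finset.coe_filter, Set.mem_ofPred_eq, Nat.mem_divisorsAntidiagonal] at hp hp' heq
    have := hp.2
    have := hp'.2
    ext <;> split_ifs at heq <;> simp only <;> omega
  · intro r hr
    simp only [Finset.coe_filter, Set.mem_ofPred_eq] at hr
    have hr := hr.2
    have key : ∀ r : ℕ, (r : ℤ) ^ 2 = 4 * n + k ^ 2 → ∃ m : ℕ, r = k + 2 * m ∧ m * (m + k) = n ∧ m ≠ 0 := by
      intro r hr
      have hkr : k < r := by
        by_contra hle
        have h1 : (r : ℤ) ≤ k := by exact_mod_cast not_lt.1 hle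
        have h2 : (0 : ℤ) < n := by exact_mod_cast Nat.pos_of_ne_zero hn
        nlinarith
      have hev : Even ((r : ℤ) - k) := by
        have : Even ((r : ℤ) ^ 2 - k ^ 2) := ⟨2 * n, by linarith⟩
        rw [Int.even_sub, Int.even_pow' two_ne_zero, Int.even_pow' two_ne_zero] at this
        rwa [Int.even_sub]
      obtain ⟨m, hm⟩ := hev
      obtain ⟨m, rfl⟩ : ∃ m' : ℕ, m = m' := ⟨m.toNat, by omega⟩
      refine ⟨m, by omega, ?_, by omega⟩
      have : (r : ℤ) = k + 2 * m := by linarith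
      rw [this] at hr
      have h3 : (m : ℤ) * (m + k) = n := by linarith
      exact_mod_cast h3
    obtain ⟨m, h1, h2, h3⟩ := key r.natAbs (by rw [Int.natAbs_sq]; exact hr)
    rcases lt_or_ge 0 r with hpos | hneg
    · refine ⟨(m + k, m), ?_, ?_⟩
      · simp only [Finset.coe_filter, Set.mem_ofPred_eq, Nat.mem_divisorsAntidiagonal]
        exact ⟨⟨by rw [mul_comm]; exact h2, hn⟩, by omega⟩
      · simp only
        rw [if_pos (by omega)]
        push_cast
        omega
    · refine ⟨(m, m + k), ?_, ?_⟩
      · simp only [Finset.coe_filter, Set.mem_ofPred_eq, Nat.mem_divisorsAntidiagonal]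
        exact ⟨⟨h2, hn⟩, by omega⟩
      · simp only
        rw [if_neg (by omega)]
        push_cast
        omega

lemma card_sq_eq_zero {n : ℕ} (hn : n ≠ 0) :
    ((allTr n).filter fun r => r ^ 2 = 4 * (n : ℤ)).card = 2 * sqi n := by
  rw [sqi]
  split_ifs with h
  · obtain ⟨m, hm⟩ := h
    have hm0 : m ≠ 0 := by
      rintro rfl
      exact hn hm
    have : (allTr n).filter (fun r => r ^ 2 = 4 * (n : ℤ)) = {(2 * m : ℤ), (-(2 * m) : ℤ)} := by
      ext r
      rw [Finset.mem_filter, Finset.mem_insert, Finset.mem_singleton, ← sq_eq_sq_iff_eq_or_eq_neg, hm]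
      push_cast
      constructor
      · rintro ⟨-, h1⟩
        rw [h1]
        ring
      · intro h1
        refine ⟨mem_allTr ?_, by rw [h1]; ring⟩
        rw [h1]
        push_cast
        nlinarith
    rw [this, Finset.card_pair]
    omega
  · rw [mul_zero, Finset.card_eq_zero, Finset.filter_eq_empty_iff]
    intro r _ hr
    have hev : Even r := by
      have : Even (r ^ 2) := ⟨2 * n, by linarith⟩
      rwa [Int.even_pow' two_ne_zero] at this
    obtain ⟨m, rfl⟩ := hev
    refine h ⟨m.natAbs, ?_⟩
    zify
    rw [abs_mul_abs_self]
    linarith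

lemma t2Star_eq (P : Polynomial ℂ) (d : ℤ) : t2Star N P d =
    (if 0 < d then classTrace (FrickeGroup N) (fun z => Polynomial.eval (jnStar N z) P) (QdN d N) else 0) +
    (if d = 0 then tZero N else 0) + (if d = -1 then -1 else 0) + (if d = -4 then -2 else 0) := by
  rw [t2Star, tZero]
  rcases lt_trichotomy 0 d with h | h | h
  · simp [h, h.ne', show d ≠ -1 by omega, show d ≠ -4 by omega]
  · subst h
    simp
  · by_cases h1 : d = -1
    · subst h1
      simp
    · by_cases h2 : d = -4
      · subst h2
        simp
      · simp [h.ne, h1, h2, show ¬ 0 < d by omega]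

lemma finsum_t2Star (P : Polynomial ℂ) (n : ℕ) : ∑ᶠ r : ℤ, t2Star N P (4 * n - r ^ 2) =
    ∑ r ∈ allTr n, t2Star N P (4 * n - r ^ 2) := by
  refine finsum_eq_sum_of_support_subset _ fun r hr => ?_
  by_contra hcon
  refine hr ?_
  have h1 : ¬ r ^ 2 ≤ 4 * (n : ℤ) + 4 := fun h => hcon (mem_allTr h)
  change t2Star N P (4 * n - r ^ 2) = 0
  rw [t2Star_eq, if_neg (by omega), if_neg (by omega), if_neg (by omega), if_neg (by omega)]
  simp

lemma finsum_t2Star_zero (P : Polynomial ℂ) : ∑ᶠ r : ℤ, t2Star N P (4 * (0 : ℕ) - r ^ 2) = tZero N - 6 := by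
  rw [finsum_t2Star]
  have : allTr 0 = {-2, -1, 0, 1, 2} := by
    ext r
    simp [allTr]
    omega
  rw [this]
  simp [t2Star_eq]
  ring

lemma finsum_t2Star_neg_one (P : Polynomial ℂ) : ∑ᶠ r : ℤ, t2Star N P (4 * (-1 : ℤ) - r ^ 2) = -2 := by
  rw [finsum_eq_single _ 0]
  · simp [t2Star_eq]
  · intro r hr
    have : 0 < r ^ 2 := by positivity
    rw [t2Star_eq, if_neg (by omega), if_neg (by omega), if_neg (by omega), if_neg (by omega)]
    simp

lemma Haupt.finsum_t2Star_pos (h : Haupt N t v γ κ)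
    (hst : ∀ e ∈ N.divisors, ∀ f ∈ N.divisors, st f (st f e) = e) {P : Polynomial ℂ} {c : ℂ}
    (hc : c * (cus N).card + c = ∑ e ∈ cus N, pv v (γ e))
    (hf : ∀ z : ℂ, 0 < z.im → Polynomial.eval (jnStar N z) P = ∑ e ∈ N.divisors, (pv v (mu γ κ e (t z)) - c))
    (ht₀ : ∑ e ∈ cus N, e * (pv v (γ e) - c) - c = 72 - 12 * tZero N) {n : ℕ} (hn : n ≠ 0) :
    ∑ᶠ r : ℤ, t2Star N P (4 * n - r ^ 2) =
      2 * n * cf v n + ∑ e ∈ cus N, sg n e * (2 * (pv v (γ e) - c)) - 2 * c * sg n 1 := by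
  have h1 : ∑ r ∈ allTr n, (if 0 < 4 * (n : ℤ) - r ^ 2 then classTrace (FrickeGroup N)
      (fun z => Polynomial.eval (jnStar N z) P) (QdN (4 * n - r ^ 2) N) else 0) = ∑ r ∈ ellTr n,
      classTrace (FrickeGroup N) (fun z => Polynomial.eval (jnStar N z) P) (QdN (4 * n - r ^ 2) N) := by
    rw [← Finset.sum_filter]
    refine Finset.sum_congr ?_ fun _ _ => rfl
    ext r
    rw [mem_ellTr, Finset.mem_filter, and_iff_right_iff_imp]
    exact fun hr => mem_allTr (by linarith)
  have h2 : ∑ r ∈ allTr n, (if 4 * (n : ℤ) - r ^ 2 = 0 then tZero N else 0) = 2 * sqi n * tZero N := by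
    rw [← Finset.sum_filter, Finset.sum_const, nsmul_eq_mul]
    have := card_sq_eq_zero hn
    rw [← Finset.filter_congr (p := fun r => 4 * (n : ℤ) - r ^ 2 = 0) (fun r _ => by constructor <;> intro <;> linarith)] at this
    rw [this]
    push_cast
    rfl
  have h3 : ∀ k : ℕ, 0 < k → k ≤ 2 → ∀ x : ℂ, ∑ r ∈ allTr n, (if 4 * (n : ℤ) - r ^ 2 = -k ^ 2 then x else 0) =
      ∑ p ∈ n.divisorsAntidiagonal, if p.1 - p.2 + (p.2 - p.1) = k then x else 0 := by
    intro k hk hk2 x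
    have := card_sq_eq hn hk hk2
    rw [← Finset.sum_filter, ← Finset.sum_filter, Finset.sum_const, Finset.sum_const, ← this]
    congr 2
    exact Finset.filter_congr fun r _ => by constructor <;> intro <;> linarith
  have h4 := h3 1 one_pos one_le_two (-1)
  have h5 := h3 2 two_pos le_rfl (-2)
  have h6 : ∑ p ∈ n.divisorsAntidiagonal, dlt (p.1 - p.2 + (p.2 - p.1)) =
      -(∑ p ∈ n.divisorsAntidiagonal, if p.1 - p.2 + (p.2 - p.1) = 1 then (-1 : ℂ) else 0) -
      ∑ p ∈ n.divisorsAntidiagonal, if p.1 - p.2 + (p.2 - p.1) = 2 then (-2 : ℂ) else 0 := by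
    rw [← Finset.sum_neg_distrib, ← Finset.sum_sub_distrib]
    refine Finset.sum_congr rfl fun p _ => ?_
    rw [dlt]
    split_ifs with h7 h8 <;> first | omega | simp
  norm_num at h4 h5
  rw [finsum_t2Star, Finset.sum_congr rfl fun r _ => t2Star_eq P _, Finset.sum_add_distrib, Finset.sum_add_distrib,
    Finset.sum_add_distrib, h1, h2, h.trace_formula hst hn hc hf ht₀, h6, h4, h5]
  ring

end FrickeTrace

namespace FrickeTrace

open Filter Topology
open UpperHalfPlane (upperHalfPlaneSet isOpen_upperHalfPlaneSet)
variable {N : ℕ} {t v : ℂ → ℂ} {γ κ : ℕ → ℂ}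

lemma tendsto_sub_qc_zpow {f : ℂ → ℂ} {a : ℤ → ℂ} (hf : HasQExp f a (-2)) (h2 : a (-2) = 1) (h1 : a (-1) = 0)
    (h0 : a 0 = 0) : Tendsto (fun z => f z - (qc z)⁻¹ ^ 2) lI (𝓝 0) := by
  have hs : ∀ z : ℂ, 0 < z.im → HasSum (fun m : ℕ => a (m + 1) * qc z ^ (m + 1)) (f z - (qc z)⁻¹ ^ 2) := by
    intro z hz
    have h := (hasSum_nat_add_iff' 3).2 (hf.2 z hz)
    rw [Finset.sum_range_succ, Finset.sum_range_succ, Finset.sum_range_one] at h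
    norm_num [h2, h1, h0] at h
    have h3 : ∀ m : ℕ, -2 + ((m : ℤ) + 3) = m + 1 := fun m => by ring
    simp only [h3] at h
    rw [inv_pow]
    refine h.congr_fun fun m => ?_
    norm_cast
  have hI : 0 < I.im := by simp
  have hbd := (hs I hI).summable.norm
  have hle : ∀ᶠ z in lI, ∀ m : ℕ, ‖a (m + 1) * qc z ^ (m + 1)‖ ≤ ‖a (m + 1) * qc I ^ (m + 1)‖ := by
    filter_upwards [tendsto_qc_nhds.norm.eventually_lt_const (show ‖(0 : ℂ)‖ < ‖qc I‖ by
      rw [norm_zero]; exact norm_pos_iff.2 (qc_ne_zero I))] with z hz m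
    rw [norm_mul, norm_mul, norm_pow, norm_pow]
    gcongr
  have hlim : ∀ m : ℕ, Tendsto (fun z => a (m + 1) * qc z ^ (m + 1)) lI (𝓝 0) := by
    intro m
    simpa using (tendsto_qc_nhds.pow (m + 1)).const_mul (a (m + 1))
  have := tendsto_tsum_of_dominated_convergence hbd hlim hle
  rw [tsum_zero] at this
  refine this.congr' ?_
  filter_upwards [eventually_im_pos] with z hz
  exact (hs z hz).tsum_eq

lemma Haupt.tendsto_pv (h : Haupt N t v γ κ) : Tendsto (fun z => pv v (t z) - (qc z)⁻¹ ^ 2) lI (𝓝 0) := by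
  have h1 : Tendsto (fun q => 2 * dslope v 0 q + (v q - v 0) ^ 2 - 2 * deriv v 0) (𝓝 0) (𝓝 0) := by
    have hd : ContinuousAt (dslope v 0) 0 :=
      continuousAt_dslope_same.2 (h.vdiff.differentiableAt ball_mem)
    have : ContinuousAt (fun q => 2 * dslope v 0 q + (v q - v 0) ^ 2 - 2 * deriv v 0) 0 :=
      ((continuousAt_const.mul hd).add ((h.vcont.sub continuousAt_const).pow 2)).sub continuousAt_const
    simpa using this.tendsto
  refine (h1.comp tendsto_qc_nhds).congr' ?_
  filter_upwards [eventually_im_pos] with z hz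
  have h2 := sub_smul_dslope v 0 (qc z)
  rw [sub_zero, smul_eq_mul] at h2
  simp only [Function.comp_apply]
  have hq := qc_ne_zero z
  rw [pv, h.eq z hz]
  have h3 : dslope v 0 (qc z) = (qc z)⁻¹ * (v (qc z) - v 0) := by
    rw [← h2]
    field_simp
  rw [h3]
  ring

lemma sum_divisors_eq (h : N ≠ 0) (g : ℕ → ℂ) : ∑ e ∈ N.divisors, g e = g 1 + ∑ e ∈ cus N, g e :=
  (Finset.add_sum_erase _ _ (Nat.one_mem_divisors.2 h)).symm

lemma Haupt.sum_mu_al (h : Haupt N t v γ κ) (hst : ∀ e ∈ N.divisors, ∀ f ∈ N.divisors, st f (st f e) = e)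
    (p : ℂ → ℂ) {f : ℕ} (hf : f ∣ N) {A : IM} (hA : A ∈ AL N f) {z : ℂ} (hz : 0 < z.im) :
    ∑ e ∈ N.divisors, p (mu γ κ e (t (mb A z))) = ∑ e ∈ N.divisors, p (mu γ κ e (t z)) := by
  have hN := h.sqf.ne_zero
  have hfm : f ∈ N.divisors := Nat.mem_divisors.2 ⟨hf, hN⟩
  have hm : ∀ e ∈ N.divisors, st f e ∈ N.divisors := fun e he =>
    Nat.mem_divisors.2 ⟨st_dvd (h.pos hf) hf (Nat.dvd_of_mem_divisors he), hN⟩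
  refine Finset.sum_nbij' (st f) (st f) hm hm (fun e he => hst e he f hfm) (fun e he => hst e he f hfm)
    fun e he => ?_
  have he' := Nat.dvd_of_mem_divisors he
  rw [h.apply_al hf hA hz, h.mu_mu he' hf hz, st, st, mul_comm, Nat.gcd_comm]

lemma Haupt.eval_eq (h : Haupt N t v γ κ) (hst : ∀ e ∈ N.divisors, ∀ f ∈ N.divisors, st f (st f e) = e)
    {f : ℂ → ℂ} (hfd : DifferentiableOn ℂ f upperHalfPlaneSet)
    (hfi : ∀ e, e ∣ N → ∀ A ∈ AL N e, ∀ z : ℂ, 0 < z.im → f (mb A z) = f z)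
    (hf : Tendsto (fun z => f z - (qc z)⁻¹ ^ 2) lI (𝓝 0)) {c : ℂ}
    (hc : c * (cus N).card + c = ∑ e ∈ cus N, pv v (γ e)) {z : ℂ} (hz : 0 < z.im) :
    f z = ∑ e ∈ N.divisors, (pv v (mu γ κ e (t z)) - c) := by
  have hN := h.sqf.ne_zero
  set F : ℂ → ℂ := fun z => f z - ∑ e ∈ N.divisors, pv v (mu γ κ e (t z)) with hF
  have hFi : ∀ e, e ∣ N → ∀ A ∈ AL N e, ∀ z : ℂ, 0 < z.im → F (mb A z) = F z := by
    intro e he A hA z hz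
    simp only [hF]
    rw [hfi e he A hA z hz, h.sum_mu_al hst (pv v) he hA hz]
  have hlim : Tendsto F lI (𝓝 (-∑ e ∈ cus N, pv v (γ e))) := by
    have h1 : ∀ e ∈ cus N, Tendsto (fun z => pv v (mu γ κ e (t z))) lI (𝓝 (pv v (γ e))) := by
      intro e he
      obtain ⟨he1, he2⟩ := h.mem_cus.1 he
      obtain ⟨A, hA⟩ := AL_nonempty h.sqf he1
      have h2 : Continuous (pv v) := by unfold pv; fun_prop
      refine ((h2.tendsto _).comp (h.tendsto_gamma he1 he2 hA)).congr' ?_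
      filter_upwards [eventually_im_pos] with z hz
      simp only [Function.comp_apply]
      rw [h.apply_al he1 hA hz]
    have h3 := (hf.sub h.tendsto_pv).sub (tendsto_finsetSum _ h1)
    rw [sub_zero, zero_sub] at h3
    refine h3.congr fun z => ?_
    simp only [hF]
    rw [sum_divisors_eq hN, mu_one]
    ring
  have hFd : DifferentiableOn ℂ F upperHalfPlaneSet := by
    refine hfd.sub (DifferentiableOn.fun_sum fun e he => ?_)
    have h2 : Differentiable ℂ (pv v) := by unfold pv; fun_prop
    refine h2.comp_differentiableOn ?_
    by_cases he1 : e = 1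
    · subst he1
      simpa only [mu_one] using h.diff
    · simp only [mu, if_neg he1]
      refine (differentiableOn_const _).add ((differentiableOn_const _).div
        (h.diff.sub (differentiableOn_const _)) fun z hz => ?_)
      exact sub_ne_zero.2 (h.ne_gamma (Nat.dvd_of_mem_divisors he) he1 hz)
  obtain ⟨k, hk⟩ := eq_const_of_bddInf_AL h.sqf hFd
    (fun M hM z hz => hFi 1 (one_dvd N) M (by rwa [AL_one]) z hz) fun e he => by
      obtain ⟨A, hA⟩ := AL_nonempty h.sqf he
      exact ⟨A, hA, (bddInf_of_tendsto hlim).congr fun z hz => hFi e he A hA z hz⟩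
  have hk2 : k = -∑ e ∈ cus N, pv v (γ e) := by
    refine tendsto_nhds_unique (tendsto_const_nhds.congr' ?_) hlim
    filter_upwards [eventually_im_pos] with z hz
    exact (hk z hz).symm
  have h4 := hk z hz
  simp only [hF] at h4
  rw [Finset.sum_sub_distrib, Finset.sum_const, nsmul_eq_mul]
  have h5 : (N.divisors.card : ℂ) = (cus N).card + 1 := by
    have := Finset.card_erase_add_one (Nat.one_mem_divisors.2 hN)
    rw [cus, ← this]
    push_cast
    rfl
  rw [h5]
  linear_combination h4 + hk2 + hc

end FrickeTrace

namespace FrickeTrace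

open Filter Topology
open UpperHalfPlane (upperHalfPlaneSet isOpen_upperHalfPlaneSet)
open Asymptotics
variable {N : ℕ} {t v : ℂ → ℂ} {γ κ : ℕ → ℂ}

lemma hasDerivAt_eul_zero : HasDerivAt eul (-1) 0 := by
  rw [hasDerivAt_iff_isLittleO]
  have h1 : (fun q : ℂ => q ^ 2) =o[𝓝 0] fun q : ℂ => q := by
    simpa using isLittleO_pow_pow (𝕜 := ℂ) (m := 1) (n := 2) (by norm_num)
  refine ((eul_expansion.trans h1).sub h1).congr (fun q => ?_) fun q => by ring
  rw [eul_zero, smul_eq_mul]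
  ring

lemma vQ_zero (hN : N ≠ 0) (r : ℕ → ℤ) : vQ N r 0 = -2 * r 1 := by
  rw [vQ, dslope_same]
  have h1 : ∀ d ∈ N.divisors, HasDerivAt (fun q : ℂ => (eul (q ^ id d) ^ 2) ^ r d)
      (if d = 1 then -2 * (r 1 : ℂ) else 0) 0 := by
    intro d hd
    have hd0 : d ≠ 0 := (Nat.pos_of_mem_divisors hd).ne'
    have h2 : HasDerivAt (fun q : ℂ => eul (q ^ d)) (-1 * (d * 0 ^ (d - 1))) 0 := by
      refine HasDerivAt.comp (0 : ℂ) (h₂ := eul) ?_ (hasDerivAt_pow d 0)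
      rw [zero_pow hd0]
      exact hasDerivAt_eul_zero
    have h3 := (hasDerivAt_zpow (r d) ((eul ((0 : ℂ) ^ d)) ^ 2) (Or.inl (by rw [zero_pow hd0, eul_zero]; simp))).comp
      (0 : ℂ) (h2.pow 2)
    refine h3.congr_deriv ?_
    rw [zero_pow hd0, eul_zero]
    split_ifs with h
    · subst h
      simp
      ring
    · rw [zero_pow (by omega)]
      simp
  have h4 := HasDerivAt.fun_finsetProd h1
  have h5 : ∀ d ∈ N.divisors, (eul ((0 : ℂ) ^ id d) ^ 2) ^ r d = 1 := by
    intro d hd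
    have hd0 : d ≠ 0 := (Nat.pos_of_mem_divisors hd).ne'
    rw [id, zero_pow hd0, eul_zero]
    simp
  have h6 := h4.deriv
  have h7 : deriv (unitQ N r id) 0 = ∑ d ∈ N.divisors, if d = 1 then -2 * (r 1 : ℂ) else 0 := by
    refine h6.trans (Finset.sum_congr rfl fun d hd => ?_)
    rw [Finset.prod_eq_one fun e he => h5 e (Finset.mem_of_mem_erase he), one_smul]
  rw [h7, Finset.sum_ite_eq' , if_pos (Nat.one_mem_divisors.2 hN)]

lemma LE.eul_qc_pow {d : ℕ} (hd : d ≠ 0) :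
    LE (fun z => eul (qc z ^ d)) 0 (if d = 1 then -3 / 2 else if d = 2 then -1 else 0) := by
  by_cases h1 : d = 1
  · subst h1
    simpa using LE.eul_qc
  have h2 : (fun q => eul q - 1 + q) =o[𝓝 0] fun q : ℂ => q := by
    refine (hasDerivAt_iff_isLittleO.1 hasDerivAt_eul_zero).congr (fun q => ?_) fun q => by ring
    rw [eul_zero, smul_eq_mul]
    ring
  have h3 : Tendsto (fun z => qc z ^ d) lI (𝓝 0) := by
    simpa [zero_pow hd] using tendsto_qc_nhds.pow d
  have h4 := h2.comp_tendsto h3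
  have h5 : (fun q : ℂ => q ^ d) =O[𝓝 0] fun q : ℂ => q ^ 2 := by
    rcases (show 2 ≤ d by omega).eq_or_lt with h | h
    · rw [h]
    · exact (isLittleO_pow_pow h).isBigO
  have h6 := h4.trans_isBigO (h5.comp_tendsto tendsto_qc_nhds)
  rw [if_neg h1]
  split_ifs with h7
  · subst h7
    have : (-1 : ℂ) = -1 - 0 ^ 2 / 2 := by norm_num
    rw [this]
    refine LE.of_expansion (C := 1) one_ne_zero ?_
    refine h6.congr_left fun z => ?_
    simp
    ring
  · refine LE.of_asymp ?_
    have h8 : (fun q : ℂ => q ^ d) =o[𝓝 0] fun q : ℂ => q ^ 2 := isLittleO_pow_pow (by omega)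
    refine (h6.sub (h8.comp_tendsto tendsto_qc_nhds)).congr (fun z => ?_) fun z => rfl
    simp

lemma LE.zpow {u : ℂ → ℂ} {m : ℤ} {β : ℂ} (h : LE u m β) (k : ℤ) :
    LE (fun z => u z ^ k) (k * m) (k * β) := by
  obtain ⟨n, rfl | rfl⟩ := k.eq_nat_or_neg
  · simpa using h.pow n
  · simpa using (h.pow n).inv

lemma pv_vQ_zero (h : Haupt N (etaQ N (rt N)) (vQ N (rt N)) (gam N) κ)
    (h1 : ∑ d ∈ N.divisors, (d : ℤ) * rt N d = 12 * (-1)) :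
    pv (vQ N (rt N)) 0 = ∑ d ∈ N.divisors, (if d = 1 then 6 else if d = 2 then 4 else 0) * (rt N d : ℂ) := by
  have h2 := LE.prod N.divisors fun d hd =>
    ((LE.eul_qc_pow (Nat.pos_of_mem_divisors hd).ne').pow 2).zpow (rt N d)
  have h3 := ((LE.qc_zpow (-1)).mul h2).unique (((h.le_sub 0)).congr fun z hz => ?_)
  · have h4 := h3.2
    rw [zero_add] at h4
    have h5 : pv (vQ N (rt N)) 0 = -2 * (-pv (vQ N (rt N)) 0 / 2) := by ring
    rw [h5, ← h4, Finset.mul_sum]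
    refine Finset.sum_congr rfl fun d _ => ?_
    split_ifs <;> push_cast <;> ring
  · have h6 := prod_eta2_eq (δ := id) h1 z
    simp only [id] at h6
    rw [sub_zero, etaQ, h6]
    rfl

end FrickeTrace

namespace FrickeTrace

open Filter Topology
open UpperHalfPlane (upperHalfPlaneSet isOpen_upperHalfPlaneSet)
variable {N : ℕ} {t v : ℂ → ℂ} {γ κ : ℕ → ℂ}

lemma st_st (hN : N ∈ ({2, 3, 5, 6, 7, 10, 13} : Set ℕ)) :
    ∀ e ∈ N.divisors, ∀ f ∈ N.divisors, st f (st f e) = e := by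
  simp only [Set.mem_insert_iff, Set.mem_singleton_iff] at hN
  rcases hN with rfl | rfl | rfl | rfl | rfl | rfl | rfl <;> decide

lemma pv_vQ (hN : N ∈ ({2, 3, 5, 6, 7, 10, 13} : Set ℕ))
    (h : Haupt N (etaQ N (rt N)) (vQ N (rt N)) (gam N) κ) (s : ℂ) :
    pv (vQ N (rt N)) s = s ^ 2 + 4 * rt N 1 * s +
      ∑ d ∈ N.divisors, (if d = 1 then 6 else if d = 2 then 4 else 0) * (rt N d : ℂ) := by
  rw [← pv_vQ_zero h, pv, pv, vQ_zero h.sqf.ne_zero]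
  · ring
  · simp only [Set.mem_insert_iff, Set.mem_singleton_iff] at hN
    rcases hN with rfl | rfl | rfl | rfl | rfl | rfl | rfl <;> decide

lemma exists_norm (hN : N ∈ ({2, 3, 5, 6, 7, 10, 13} : Set ℕ))
    (h : Haupt N (etaQ N (rt N)) (vQ N (rt N)) (gam N) κ) :
    ∃ c : ℂ, c * (cus N).card + c = ∑ e ∈ cus N, pv (vQ N (rt N)) (gam N e) ∧
      ∑ e ∈ cus N, e * (pv (vQ N (rt N)) (gam N e) - c) - c = 72 - 12 * tZero N := by
  have hp := pv_vQ hN h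
  refine ⟨(∑ e ∈ cus N, pv (vQ N (rt N)) (gam N e)) / ((cus N).card + 1),
    ?_, ?_⟩
  · have := Nat.cast_add_one_ne_zero (R := ℂ) (cus N).card
    field_simp
  simp only [hp]
  clear hp h
  simp only [Set.mem_insert_iff, Set.mem_singleton_iff] at hN
  have c2 : cus 2 = {2} := by decide
  have c3 : cus 3 = {3} := by decide
  have c5 : cus 5 = {5} := by decide
  have c6 : cus 6 = {2, 3, 6} := by decide
  have c7 : cus 7 = {7} := by decide
  have c10 : cus 10 = {2, 5, 10} := by decide
  have c13 : cus 13 = {13} := by decide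
  rcases hN with rfl | rfl | rfl | rfl | rfl | rfl | rfl <;>
    norm_num [c2, c3, c5, c6, c7, c10, c13, div2, div3, div5, div6, div7, div10, div13, rt, gam, tZero,
      Finset.sum_insert]

end FrickeTrace

namespace FrickeTrace

open Filter Topology
open UpperHalfPlane (upperHalfPlaneSet isOpen_upperHalfPlaneSet)
variable {N : ℕ} {t v : ℂ → ℂ} {γ κ : ℕ → ℂ}

/-- The normalized logarithmic derivative of the squared eta function. -/
noncomputable def wE (z : ℂ) : ℂ := (Real.pi * I / 6)⁻¹ * logDeriv eta2 z

lemma pi_I_div_six_ne_zero : (Real.pi * I / 6 : ℂ) ≠ 0 := by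
  simp [Real.pi_ne_zero]

lemma wE_eq (z : UpperHalfPlane) : wE z = EisensteinSeries.E2 z := by
  have h1 : eta2 = fun z => ModularForm.eta z ^ 2 := funext fun z => by rw [eta2, dedekindEta_eq_eta]
  rw [wE, h1, logDeriv_fun_pow (ModularForm.differentiableAt_eta_of_mem_upperHalfPlaneSet z.2),
    ModularForm.logDeriv_eta_eq_E2]
  have := pi_I_div_six_ne_zero
  field_simp
  push_cast
  ring

lemma hasSum_wE {z : ℂ} (hz : 0 < z.im) :
    HasSum (fun n : ℕ => (if n = 0 then 1 else -24 * ∑ d ∈ n.divisors, (d : ℂ)) * qc z ^ n) (wE z) := by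
  have h := EisensteinSeries.hasSum_qExpansion_E2 (z := ⟨z, hz⟩)
  rw [← wE_eq] at h
  refine h.congr_fun fun n => ?_
  rw [smul_eq_mul, qc, ArithmeticFunction.sigma_one_apply]
  push_cast
  rfl

lemma hasSum_wE_mul {z : ℂ} (hz : 0 < z.im) {e : ℕ} (he : e ≠ 0) :
    HasSum (fun n : ℕ => (if n = 0 then (e : ℂ) else -24 * sg n e) * qc z ^ n) (e * wE (e * z)) := by
  have hz' : 0 < ((e : ℂ) * z).im := by
    have : (0 : ℝ) < e := by exact_mod_cast Nat.pos_of_ne_zero he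
    simpa using mul_pos this hz
  have h := (hasSum_wE hz').mul_left (e : ℂ)
  rw [← (mul_right_injective₀ he).hasSum_iff (f := fun n : ℕ => (if n = 0 then (e : ℂ) else -24 * sg n e) * qc z ^ n)]
  · refine h.congr_fun fun n => ?_
    simp only [Function.comp_apply, mul_eq_zero, he, false_or]
    rw [qc_nat_mul, ← pow_mul, sg, if_pos (dvd_mul_right e n), Nat.mul_div_cancel_left _ (Nat.pos_of_ne_zero he)]
    push_cast
    split_ifs <;> ring
  · intro n hn
    have h1 : ¬ e ∣ n := fun ⟨m, hm⟩ => hn ⟨m, hm.symm⟩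
    have h0 : n ≠ 0 := by
      rintro rfl
      exact h1 (dvd_zero e)
    rw [if_neg h0, sg, if_neg h1]
    simp

lemma Haupt.hasSum_deriv (h : Haupt N t v γ κ) {q : ℂ} (hq : q ∈ Metric.ball (0 : ℂ) 1) :
    HasSum (fun n : ℕ => n * cf v n * q ^ n) (q * deriv v q) := by
  have h1 := (Complex.hasSum_taylorSeries_on_ball (h.vdiff.deriv Metric.isOpen_ball) hq).mul_left q
  rw [← hasSum_nat_add_iff' 1]
  simp only [Finset.sum_range_one, Nat.cast_zero, zero_mul, sub_zero]
  refine h1.congr_fun fun n => ?_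
  rw [cf, iteratedDeriv_succ', Nat.factorial_succ, smul_eq_mul, smul_eq_mul, sub_zero]
  have := Nat.cast_add_one_ne_zero (R := ℂ) n
  have := Nat.factorial_ne_zero n
  push_cast
  field_simp
  ring

lemma wE_al {d e : ℕ} (hd : d ≠ 0) (he : e ≠ 0) (hdN : d ∣ N) (heN : e ∣ N) {A : IM} (hA : A ∈ AL N e) {z : ℂ}
    (hz : 0 < z.im) : d * wE (d * mb A z) = den A z ^ 2 / e *
      ((Real.pi * I / 6)⁻¹ * (A 1 0 / den A z) + (st d e : ℕ) * wE ((st d e : ℕ) * z)) := by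
  have hdet := AL_det_pos he hA
  have hst : st d e ≠ 0 := fun h0 => by
    have := st_mul_gcd (e := d) (f := e) hd
    rw [h0, zero_mul] at this
    exact Nat.lcm_ne_zero hd he this.symm
  have him : ∀ {k : ℕ} {w : ℂ}, k ≠ 0 → 0 < w.im → 0 < ((k : ℂ) * w).im := fun {k w} hk hw => by
    have : (0 : ℝ) < k := by exact_mod_cast Nat.pos_of_ne_zero hk
    simpa using mul_pos this hw
  have hden := den_ne_zero hdet hz
  have hmb := im_mb_pos hdet hz
  have hmul : ∀ {k : ℕ} {w : ℂ}, HasDerivAt (fun w : ℂ => (k : ℂ) * w) k w := fun {k w} => by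
    simpa using (hasDerivAt_id w).const_mul (k : ℂ)
  have h1 : HasDerivAt (fun z => eta2 (d * mb A z))
      (deriv eta2 (d * mb A z) * (d * (A.det / den A z ^ 2))) z :=
    HasDerivAt.comp z (h₂ := eta2) (differentiableAt_eta2 (him hd hmb)).hasDerivAt ((hasDerivAt_mb hden).const_mul (d : ℂ))
  have hC : ∃ C : ℂ, C ≠ 0 ∧ ∀ w : ℂ, 0 < w.im → eta2 (d * mb A w) = C * den A w * eta2 ((st d e : ℕ) * w) := by
    have hg : ((d.gcd e : ℕ) : ℂ) ≠ 0 := by exact_mod_cast (Nat.gcd_pos_of_pos_left _ (Nat.pos_of_ne_zero hd)).ne'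
    refine ⟨zt ^ psi (gp A d e) / (d.gcd e : ℕ), ?_, fun w hw => ?_⟩
    · intro h0
      have h2 := eta2_AL hd he hdN heN hA hz
      refine eta2_ne_zero (him hd hmb) (h2.trans ?_)
      rw [div_eq_zero_iff, or_iff_left hg] at h0
      rw [h0, zero_mul, zero_mul]
    · rw [eta2_AL hd he hdN heN hA hw]
      field_simp
  obtain ⟨C, hC0, hC⟩ := hC
  have hdd : HasDerivAt (den A) (A 1 0) z := by
    have := ((hasDerivAt_id z).const_mul (A 1 0 : ℂ)).add_const (A 1 1 : ℂ)
    rw [mul_one] at this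
    exact this
  have h2 : HasDerivAt (fun z => C * den A z * eta2 ((st d e : ℕ) * z))
      (C * A 1 0 * eta2 ((st d e : ℕ) * z) + C * den A z * (deriv eta2 ((st d e : ℕ) * z) * (st d e : ℕ))) z :=
    (hdd.const_mul C).mul (HasDerivAt.comp z (h₂ := eta2) (differentiableAt_eta2 (him hst hz)).hasDerivAt hmul)
  have h3 := h1.unique (h2.congr_of_eventuallyEq (by
    filter_upwards [isOpen_upperHalfPlaneSet.mem_nhds hz] with w hw
    exact hC w hw))
  have hA1 : (A.det : ℂ) = e := by rw [hA.1]; simp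
  have hec : (e : ℂ) ≠ 0 := by exact_mod_cast he
  have hE := eta2_ne_zero (him hst hz)
  rw [hA1] at h3
  have h4 : deriv eta2 (d * mb A z) * d = (C * A 1 0 * eta2 ((st d e : ℕ) * z) +
      C * den A z * (deriv eta2 ((st d e : ℕ) * z) * (st d e : ℕ))) * (den A z ^ 2 / e) := by
    rw [← h3]
    field_simp
  have hpi := pi_I_div_six_ne_zero
  rw [wE, wE, logDeriv_apply, logDeriv_apply]
  have h5 : (d : ℂ) * ((Real.pi * I / 6)⁻¹ * (deriv eta2 (d * mb A z) / eta2 (d * mb A z))) =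
      (Real.pi * I / 6)⁻¹ * (deriv eta2 (d * mb A z) * d / eta2 (d * mb A z)) := by ring
  rw [h5, h4, hC z hz]
  generalize (Real.pi * I / 6 : ℂ)⁻¹ = x
  field_simp

end FrickeTrace

namespace FrickeTrace

open Filter Topology
open UpperHalfPlane (upperHalfPlaneSet isOpen_upperHalfPlaneSet)
variable {N : ℕ} {t v : ℂ → ℂ} {γ κ : ℕ → ℂ}

lemma exists_hasSum_qc {F : ℂ → ℂ} (hF : DifferentiableOn ℂ F upperHalfPlaneSet)
    (hper : ∀ z : ℂ, 0 < z.im → F (z + 1) = F z) (hb : BddInf F) :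
    ∃ cs : ℕ → ℂ, ∀ z : ℂ, 0 < z.im → HasSum (fun n => cs n * qc z ^ n) (F z) := by
  have h1 : Function.Periodic ((fun z : UpperHalfPlane => F z) ∘ UpperHalfPlane.ofComplex) ((1 : ℝ) : ℂ) := by
    intro z
    have him : (z + ((1 : ℝ) : ℂ)).im = z.im := by simp
    simp only [Function.comp_apply]
    rcases lt_or_ge 0 z.im with hz | hz
    · rw [UpperHalfPlane.ofComplex_apply_of_im_pos hz, UpperHalfPlane.ofComplex_apply_of_im_pos (him ▸ hz)]
      simpa using hper z hz
    · rw [UpperHalfPlane.ofComplex_apply_of_im_nonpos hz, UpperHalfPlane.ofComplex_apply_of_im_nonpos (him.symm ▸ hz)]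
  have h2 : DifferentiableOn ℂ ((fun z : UpperHalfPlane => F z) ∘ UpperHalfPlane.ofComplex) upperHalfPlaneSet := by
    refine hF.congr fun z hz => ?_
    simp only [Function.comp_apply]
    rw [UpperHalfPlane.ofComplex_apply_of_im_pos hz]
  have h3 : UpperHalfPlane.IsBoundedAtImInfty (fun z : UpperHalfPlane => F z) := by
    rw [UpperHalfPlane.isBoundedAtImInfty_iff]
    obtain ⟨C, A, hC⟩ := hb
    exact ⟨C, A, fun z hz => hC z hz⟩
  refine ⟨fun n => (UpperHalfPlane.qExpansion 1 (fun z : UpperHalfPlane => F z)).coeff n, fun z hz => ?_⟩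
  refine (UpperHalfPlane.hasSum_qExpansion one_pos h1 (UpperHalfPlane.mdifferentiable_iff.2 h2) h3 ⟨z, hz⟩).congr_fun fun n => ?_
  rw [smul_eq_mul, qc, Function.Periodic.qParam]
  simp

lemma Haupt.exists_hasSum_deriv (h : Haupt N t v γ κ) {e : ℕ} (he : e ∣ N) (he1 : e ≠ 1) :
    ∃ cs : ℕ → ℂ, ∀ z : ℂ, 0 < z.im → HasSum (fun n => cs n * qc z ^ n) (deriv t z / (t z - γ e) ^ 2) := by
  refine exists_hasSum_qc ?_ ?_ ?_
  · exact (h.diff.deriv isOpen_upperHalfPlaneSet).div ((h.diff.sub (differentiableOn_const _)).pow 2)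
      fun z hz => pow_ne_zero _ (sub_ne_zero.2 (h.ne_gamma he he1 hz))
  · intro z hz
    have h1 := h.inv _ (T_mem_G0 N) z hz
    have h2 := h.deriv_inv (T_mem_G0 N) hz
    rw [mb_T] at h1 h2
    rw [h1, h2]
    simp [den]
  · have h1 := h.le_deriv.od.mul ((h.od_sub (γ e)).pow 2).inv
    refine (h1.bddInf 0 (by norm_num)).congr fun z _ => ?_
    rw [div_eq_mul_inv, pow_zero, mul_one]

/-- The weights of the Eisenstein part. -/
noncomputable def yw (v : ℂ → ℂ) (γ : ℕ → ℂ) (c : ℂ) (e : ℕ) : ℂ := if e = 1 then -2 * c else 2 * (pv v (γ e) - c)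

lemma Haupt.sum_yw (h : Haupt N t v γ κ) (c : ℂ) (p : ℕ → ℂ) : ∑ e ∈ N.divisors, p e * yw v γ c e =
    p 1 * (-2 * c) + ∑ e ∈ cus N, p e * (2 * (pv v (γ e) - c)) := by
  rw [sum_divisors_eq h.sqf.ne_zero, yw, if_pos rfl]
  congr 1
  refine Finset.sum_congr rfl fun e he => ?_
  rw [yw, if_neg (h.mem_cus.1 he).2]

lemma Haupt.generating_eq (h : Haupt N t v γ κ)
    (hst : ∀ e ∈ N.divisors, ∀ f ∈ N.divisors, st f (st f e) = e) {P : Polynomial ℂ} {c : ℂ}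
    (hc : c * (cus N).card + c = ∑ e ∈ cus N, pv v (γ e))
    (hf : ∀ z : ℂ, 0 < z.im → Polynomial.eval (jnStar N z) P = ∑ e ∈ N.divisors, (pv v (mu γ κ e (t z)) - c))
    (ht₀ : ∑ e ∈ cus N, e * (pv v (γ e) - c) - c = 72 - 12 * tZero N) {z w : ℂ} (hz : 0 < z.im)
    (hw : HasSum (fun n : ℕ => (∑ᶠ r : ℤ, t2Star N P (4 * ((n : ℤ) - 1) - r ^ 2)) * qc z ^ ((n : ℤ) - 1)) w) :
    w = deriv t z / (Real.pi * I) - 1 / 24 * ∑ e ∈ N.divisors, e * wE (e * z) * yw v γ c e := by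
  have h1 := (hasSum_nat_add_iff' 1).2 hw
  rw [Finset.sum_range_one, Nat.cast_zero, zero_sub, finsum_t2Star_neg_one] at h1
  have h2 := ((h.hasSum_deriv (qc_mem_ball hz)).mul_left 2).add ((hasSum_sum (s := N.divisors) fun e he =>
    (hasSum_wE_mul hz (Nat.pos_of_mem_divisors he).ne').mul_right (yw v γ c e)).mul_left (-1 / 24))
  have h3 := (h1.congr_fun fun n => ?_).unique h2
  · rw [_root_.zpow_neg_one] at h3
    rw [h.deriv_eq hz]
    have hpi : (Real.pi * I : ℂ) ≠ 0 := by simp [Real.pi_ne_zero]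
    have h4 : 2 * Real.pi * I * (-(qc z)⁻¹ + qc z * deriv v (qc z)) / (Real.pi * I) =
        2 * (-(qc z)⁻¹ + qc z * deriv v (qc z)) := by
      field_simp
    rw [h4]
    linear_combination h3
  · have h5 : ∀ e : ℕ, (if n = 0 then (e : ℂ) else -24 * sg n e) * qc z ^ n * yw v γ c e =
        qc z ^ n * ((if n = 0 then (e : ℂ) else -24 * sg n e) * yw v γ c e) := fun e => by ring
    simp only [h5]
    rw [← Finset.mul_sum, h.sum_yw c]
    have h6 : (((n + 1 : ℕ) : ℤ) - 1) = n := by push_cast; ring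
    rw [h6, zpow_natCast]
    by_cases hn : n = 0
    · subst hn
      rw [finsum_t2Star_zero]
      simp only [if_true, Nat.cast_one]
      have h7 : ∑ e ∈ cus N, (e : ℂ) * (2 * (pv v (γ e) - c)) = 2 * ∑ e ∈ cus N, e * (pv v (γ e) - c) := by
        rw [Finset.mul_sum]
        exact Finset.sum_congr rfl fun e _ => by ring
      rw [h7]
      simp
      linear_combination (-1 / 12 : ℂ) * ht₀
    · rw [h.finsum_t2Star_pos hst hc hf ht₀ hn]
      simp only [if_neg hn]
      have h7 : ∑ e ∈ cus N, -24 * (sg n e : ℂ) * (2 * (pv v (γ e) - c)) =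
          -24 * ∑ e ∈ cus N, sg n e * (2 * (pv v (γ e) - c)) := by
        rw [Finset.mul_sum]
        exact Finset.sum_congr rfl fun e _ => by ring
      rw [h7]
      ring

end FrickeTrace

namespace FrickeTrace

open Filter Topology
open UpperHalfPlane (upperHalfPlaneSet isOpen_upperHalfPlaneSet)
variable {N : ℕ} {t v : ℂ → ℂ} {γ κ : ℕ → ℂ}

lemma Haupt.sum_yw_eq_zero (h : Haupt N t v γ κ) {c : ℂ}
    (hc : c * (cus N).card + c = ∑ e ∈ cus N, pv v (γ e)) : ∑ e ∈ N.divisors, yw v γ c e = 0 := by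
  have h1 := h.sum_yw c fun _ => 1
  simp only [one_mul] at h1
  rw [h1, ← Finset.mul_sum, Finset.sum_sub_distrib, ← hc, Finset.sum_const, nsmul_eq_mul]
  ring

lemma Haupt.slash_al (h : Haupt N t v γ κ) {c : ℂ} (hc : c * (cus N).card + c = ∑ e ∈ cus N, pv v (γ e))
    {e : ℕ} (he : e ∣ N) (he1 : e ≠ 1) {A : IM} (hA : A ∈ AL N e) {z : ℂ} (hz : 0 < z.im) :
    den A z ^ (-2 : ℤ) * (deriv t (mb A z) / (Real.pi * I) -
      1 / 24 * ∑ f ∈ N.divisors, f * wE (f * mb A z) * yw v γ c f) =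
    (-(κ e) / e / (Real.pi * I)) * (deriv t z / (t z - γ e) ^ 2) +
      (-1 / (24 * e)) * ∑ f ∈ N.divisors, (st f e : ℕ) * wE ((st f e : ℕ) * z) * yw v γ c f := by
  have he0 := h.pos he
  have hden := den_ne_zero (AL_det_pos he0 hA) hz
  have h1 : ∑ f ∈ N.divisors, f * wE (f * mb A z) * yw v γ c f = den A z ^ 2 / e *
      ∑ f ∈ N.divisors, (st f e : ℕ) * wE ((st f e : ℕ) * z) * yw v γ c f := by
    have h2 : ∀ f ∈ N.divisors, f * wE (f * mb A z) * yw v γ c f =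
        den A z ^ 2 / e * ((Real.pi * I / 6)⁻¹ * (A 1 0 / den A z)) * yw v γ c f +
        den A z ^ 2 / e * ((st f e : ℕ) * wE ((st f e : ℕ) * z) * yw v γ c f) := by
      intro f hf
      rw [wE_al (Nat.pos_of_mem_divisors hf).ne' he0 (Nat.dvd_of_mem_divisors hf) he hA hz]
      ring
    rw [Finset.sum_congr rfl h2, Finset.sum_add_distrib, ← Finset.mul_sum, ← Finset.mul_sum,
      h.sum_yw_eq_zero hc, mul_zero, zero_add]
  have hec : (e : ℂ) ≠ 0 := by exact_mod_cast he0
  have h3 : den A z ^ (-2 : ℤ) = (den A z ^ 2)⁻¹ := by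
    rw [_root_.zpow_neg]
    rfl
  have hpi : (Real.pi * I : ℂ) ≠ 0 := by simp [Real.pi_ne_zero]
  rw [h1, h.deriv_al he he1 hA hz, h3]
  generalize deriv t z / (t z - γ e) ^ 2 = x
  generalize ∑ f ∈ N.divisors, (st f e : ℕ) * wE ((st f e : ℕ) * z) * yw v γ c f = y
  have h4 : den A z ^ 2 ≠ 0 := pow_ne_zero _ hden
  generalize den A z ^ 2 = d at h4 ⊢
  generalize (Real.pi * I : ℂ) = p at hpi ⊢
  field_simp
  ring

lemma Haupt.exists_hasSum_slash (h : Haupt N t v γ κ) {c : ℂ}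
    (hc : c * (cus N).card + c = ∑ e ∈ cus N, pv v (γ e)) {G : ℂ → ℂ}
    (hG : ∀ z : ℂ, 0 < z.im → G z = deriv t z / (Real.pi * I) -
      1 / 24 * ∑ e ∈ N.divisors, e * wE (e * z) * yw v γ c e)
    {e : ℕ} (he : e ∣ N) (he1 : e ≠ 1) {A : IM} (hA : A ∈ AL N e) :
    ∃ cs : ℕ → ℂ, ∀ z : ℂ, 0 < z.im →
      HasSum (fun n => cs n * qc z ^ n) (den A z ^ (-2 : ℤ) * G (mb A z)) := by
  obtain ⟨cs, hcs⟩ := h.exists_hasSum_deriv he he1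
  have he0 := h.pos he
  refine ⟨fun n => (-(κ e) / e / (Real.pi * I)) * cs n + (-1 / (24 * e)) *
    ∑ f ∈ N.divisors, (if n = 0 then ((st f e : ℕ) : ℂ) else -24 * sg n (st f e)) * yw v γ c f, fun z hz => ?_⟩
  rw [hG _ (im_mb_pos (AL_det_pos he0 hA) hz), h.slash_al hc he he1 hA hz]
  have hst : ∀ f ∈ N.divisors, st f e ≠ 0 := fun f hf h0 => by
    have hf0 : f ≠ 0 := (Nat.pos_of_mem_divisors hf).ne'
    have := st_mul_gcd (e := f) (f := e) hf0
    rw [h0, zero_mul] at this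
    exact Nat.lcm_ne_zero hf0 he0 this.symm
  refine (((hcs z hz).mul_left _).add ((hasSum_sum (s := N.divisors) fun f hf =>
    (hasSum_wE_mul hz (hst f hf)).mul_right (yw v γ c f)).mul_left _)).congr_fun fun n => ?_
  have h5 : ∀ f : ℕ, (if n = 0 then ((st f e : ℕ) : ℂ) else -24 * sg n (st f e)) * qc z ^ n * yw v γ c f =
      (if n = 0 then ((st f e : ℕ) : ℂ) else -24 * sg n (st f e)) * yw v γ c f * qc z ^ n := fun f => by ring
  simp only [h5]
  rw [← Finset.sum_mul]
  ring

end FrickeTrace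

/-- **Proposition 4.4.** For `N ∈ {2,3,5,6,7,10,13}`, the weakly holomorphic modular form
`G₂^{(N*)}` of weight `2` on `Γ₀(N)` is holomorphic at every cusp other than `i∞`
(i.e. at every cusp `a/c` with `N ∤ c`); its only pole is the simple pole at `i∞`,
with coefficient `Σ_r t₂^{(N*)}(-4 - r²) = -2` in front of `q⁻¹`. -/
theorem trace_generating_function_pole_only_at_infinity (N : ℕ)
    (hN : N ∈ ({2, 3, 5, 6, 7, 10, 13} : Set ℕ))
    (P : Polynomial ℂ) (e : ℤ → ℂ)
    (hP : HasQExp (fun z => Polynomial.eval (jnStar N z) P) e (-2))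
    (he2 : e (-2) = 1) (he1 : e (-1) = 0) (he0 : e 0 = 0)
    (G : ℂ → ℂ)
    (hG : ∀ τ : ℂ, 0 < τ.im →
      HasSum (fun n : ℕ =>
          (∑ᶠ r : ℤ, t2Star N P (4 * ((n : ℤ) - 1) - r ^ 2)) * qc τ ^ ((n : ℤ) - 1))
        (G τ)) :
    (∑ᶠ r : ℤ, t2Star N P (4 * (-1 : ℤ) - r ^ 2)) = -2 ∧
      (∀ a b c d : ℤ, a * d - b * c = 1 → ¬ (N : ℤ) ∣ c →
        ∃ (M : ℕ) (cs : ℕ → ℂ), 0 < M ∧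
          ∀ τ : ℂ, 0 < τ.im →
            HasSum (fun j : ℕ => cs j * Complex.exp (2 * Real.pi * Complex.I * τ / M) ^ j)
              (((c : ℂ) * τ + d) ^ (-(2 : ℤ)) *
                G (((a : ℂ) * τ + b) / ((c : ℂ) * τ + d)))) := by
  obtain ⟨κ, h⟩ := FrickeTrace.haupt_rt hN
  obtain ⟨k, hk, hk0⟩ := FrickeTrace.exists_norm hN h
  have hst := FrickeTrace.st_st hN
  refine ⟨FrickeTrace.finsum_t2Star_neg_one P, fun a b c d hdet hc => ?_⟩
  have hf : ∀ z : ℂ, 0 < z.im → _ := fun z hz => h.eval_eq hst (f := fun z => Polynomial.eval (jnStar N z) P)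
    (P.differentiable.comp_differentiableOn (FrickeTrace.differentiableOn_jnStar hN))
    (fun e he A hA z hz => by simp only [FrickeTrace.jnStar_AL hN he hA hz])
    (FrickeTrace.tendsto_sub_qc_zpow hP he2 he1 he0) hk hz
  obtain ⟨m, hm, j, hA, hm1⟩ := FrickeTrace.exists_AL_of_det_one h.sqf (g := !![a, b; c, d])
    (by rw [Matrix.det_fin_two_of]; exact hdet)
  have hm1' : m ≠ 1 := fun hm' => hc (by simpa using hm1.2 hm')
  have hm0 := h.pos hm
  have hmc : (m : ℂ) ≠ 0 := by exact_mod_cast hm0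
  have hmpos : (0 : ℝ) < m := by exact_mod_cast Nat.pos_of_ne_zero hm0
  obtain ⟨cs, hcs⟩ := h.exists_hasSum_slash hk
    (fun z hz => h.generating_eq hst hk hf hk0 hz (hG z hz)) hm hm1' hA
  refine ⟨m, fun n => cs n * qc (-j / m) ^ n, Nat.pos_of_ne_zero hm0, fun τ hτ => ?_⟩
  have him : 0 < ((τ - j) / m).im := by
    rw [Complex.div_natCast_im]
    exact div_pos (by simpa using hτ) hmpos
  have hden : FrickeTrace.den (!![a, b; c, d] * !![(m : ℤ), j; 0, 1]) ((τ - j) / m) = c * τ + d := by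
    simp [FrickeTrace.den]
    field_simp
    ring
  have hmb : FrickeTrace.mb (!![a, b; c, d] * !![(m : ℤ), j; 0, 1]) ((τ - j) / m) =
      (a * τ + b) / (c * τ + d) := by
    rw [FrickeTrace.mb, hden]
    congr 1
    simp
    field_simp
    ring
  have := hcs _ him
  rw [hden, hmb] at this
  refine this.congr_fun fun n => ?_
  rw [mul_assoc, ← mul_pow, qc, qc, ← Complex.exp_add]
  congr 3
  ring
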